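/- Let m ≥ 2, 0 < a < b and 1 < p < (m+3)/(m−1). Then there exists a family (u_λ)_{λ>0} of classical solutions of problem (1.3) on the annulus A ⊂ ℝ^{2m} such that each u_λ is positive in A and O(m)×O(m)-invariant, and, with Γ := {(y₁,0) ∈ ℝ^m × ℝ^m : |y₁| = a} (an (m−1)-dimensional sphere contained in the inner boundary {|x| = a}), the family concentrates on Γ as λ → +∞: for every δ > 0, sup{ u_λ(x) : x ∈ Ā, dist(x, Γ) ≥ δ } → 0 as λ → +∞, and every point x_λ at which u_λ attains its maximum over Ā satisfies dist(x_λ, Γ) → 0 as λ → +∞. -/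

import Mathlib

noncomputable section
open Real MeasureTheory Filter

/-- Euclidean norm on `ℝ^m × ℝ^m = ℝ^{2m}`. -/
def pnorm {m : ℕ} (x : EuclideanSpace ℝ (Fin m) × EuclideanSpace ℝ (Fin m)) : ℝ :=
  Real.sqrt (‖x.1‖ ^ 2 + ‖x.2‖ ^ 2)

/-- The Euclidean Laplacian of a function on `ℝ^m × ℝ^m = ℝ^{2m}`. -/
def lapP {m : ℕ} (f : EuclideanSpace ℝ (Fin m) × EuclideanSpace ℝ (Fin m) → ℝ)
    (x : EuclideanSpace ℝ (Fin m) × EuclideanSpace ℝ (Fin m)) : ℝ :=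
  (∑ i : Fin m,
    fderiv ℝ (fun y => fderiv ℝ f y ((EuclideanSpace.single i (1 : ℝ)), 0)) x
      ((EuclideanSpace.single i (1 : ℝ)), 0)) +
  ∑ i : Fin m,
    fderiv ℝ (fun y => fderiv ℝ f y (0, (EuclideanSpace.single i (1 : ℝ)))) x
      (0, (EuclideanSpace.single i (1 : ℝ)))

/-- The annulus `A = {a < |x| < b}` in `ℝ^{2m} = ℝ^m × ℝ^m`. -/
def Ann (m : ℕ) (a b : ℝ) : Set (EuclideanSpace ℝ (Fin m) × EuclideanSpace ℝ (Fin m)) :=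
  {x | a < pnorm x ∧ pnorm x < b}

/-- Euclidean distance on `ℝ^{2m} = ℝ^m × ℝ^m`. -/
def pdist {m : ℕ} (x w : EuclideanSpace ℝ (Fin m) × EuclideanSpace ℝ (Fin m)) : ℝ :=
  Real.sqrt (‖x.1 - w.1‖ ^ 2 + ‖x.2 - w.2‖ ^ 2)

/-- Euclidean distance from a point of `ℝ^{2m}` to a set. -/
def pdistSet {m : ℕ} (x : EuclideanSpace ℝ (Fin m) × EuclideanSpace ℝ (Fin m))
    (S : Set (EuclideanSpace ℝ (Fin m) × EuclideanSpace ℝ (Fin m))) : ℝ :=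
  sInf {d : ℝ | ∃ w ∈ S, d = pdist x w}

set_option linter.unusedSectionVars false
set_option linter.unusedVariables false

namespace Conc
open Topology Set Module

section basics
variable {F : Type} [NormedAddCommGroup F] [InnerProductSpace ℝ F] [FiniteDimensional ℝ F]

/-- directional derivative along the standard orthonormal basis -/
def pd (i : Fin (finrank ℝ F)) (f : F → ℝ) (x : F) : ℝ :=
  fderiv ℝ f x (stdOrthonormalBasis ℝ F i)

/-- Laplacian -/
def lap (f : F → ℝ) (x : F) : ℝ := ∑ i, pd i (pd i f) x

/-- gradient dot product -/
def gdot (f g : F → ℝ) (x : F) : ℝ := ∑ i, pd i f x * pd i g x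

lemma pd_congr {f g : F → ℝ} {x : F} (h : f =ᶠ[𝓝 x] g) (i) : pd i f x = pd i g x := by
  unfold pd; rw [h.fderiv_eq]

lemma pd_congr' {f g : F → ℝ} {x : F} (h : f =ᶠ[𝓝 x] g) (i) : pd i f =ᶠ[𝓝 x] pd i g := by
  filter_upwards [h.eventuallyEq_nhds] with y hy using pd_congr hy i

lemma lap_congr {f g : F → ℝ} {x : F} (h : f =ᶠ[𝓝 x] g) : lap f x = lap g x := by
  unfold lap
  exact Finset.sum_congr rfl fun i _ => pd_congr (pd_congr' h i) i

lemma gdot_congr {f g f' g' : F → ℝ} {x : F} (h : f =ᶠ[𝓝 x] f') (h' : g =ᶠ[𝓝 x] g') :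
    gdot f g x = gdot f' g' x := by
  unfold gdot
  exact Finset.sum_congr rfl fun i _ => by rw [pd_congr h, pd_congr h']

lemma gdot_comm (f g : F → ℝ) (x : F) : gdot f g x = gdot g f x := by
  unfold gdot; exact Finset.sum_congr rfl fun i _ => mul_comm _ _

lemma gdot_self_nonneg (f : F → ℝ) (x : F) : 0 ≤ gdot f f x :=
  Finset.sum_nonneg fun i _ => mul_self_nonneg _

lemma pd_add {f g : F → ℝ} {x : F} (hf : DifferentiableAt ℝ f x) (hg : DifferentiableAt ℝ g x) (i) :
    pd i (fun y => f y + g y) x = pd i f x + pd i g x := by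
  unfold pd; rw [fderiv_fun_add hf hg]; rfl

lemma pd_sub {f g : F → ℝ} {x : F} (hf : DifferentiableAt ℝ f x) (hg : DifferentiableAt ℝ g x) (i) :
    pd i (fun y => f y - g y) x = pd i f x - pd i g x := by
  unfold pd; rw [fderiv_fun_sub hf hg]; rfl

lemma pd_mul {f g : F → ℝ} {x : F} (hf : DifferentiableAt ℝ f x) (hg : DifferentiableAt ℝ g x) (i) :
    pd i (fun y => f y * g y) x = f x * pd i g x + g x * pd i f x := by
  unfold pd; rw [fderiv_fun_mul hf hg]; simp

lemma pd_const_mul {f : F → ℝ} {x : F} (c : ℝ) (hf : DifferentiableAt ℝ f x) (i) :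
    pd i (fun y => c * f y) x = c * pd i f x := by
  unfold pd; rw [fderiv_const_mul hf]; simp

lemma pd_comp {f : F → ℝ} {x : F} {φ : ℝ → ℝ} {φ' : ℝ} (hφ : HasDerivAt φ φ' (f x))
    (hf : DifferentiableAt ℝ f x) (i) :
    pd i (fun y => φ (f y)) x = φ' * pd i f x := by
  unfold pd
  have := (hφ.comp_hasFDerivAt x hf.hasFDerivAt).fderiv
  simp only [Function.comp_def] at this
  rw [this]; simp

lemma contDiffAt_pd {f : F → ℝ} {x : F} {n : ℕ} (h : ContDiffAt ℝ (n + 1 : ℕ) f x) (i) :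
    ContDiffAt ℝ n (pd i f) x := by
  unfold pd
  exact (h.fderiv_right (m := n) (by norm_cast)).clm_apply contDiffAt_const

lemma differentiableAt_pd {f : F → ℝ} {x : F} (h : ContDiffAt ℝ 2 f x) (i) :
    DifferentiableAt ℝ (pd i f) x :=
  (contDiffAt_pd (n := 1) h i).differentiableAt (by norm_num)

lemma continuousAt_pd {f : F → ℝ} {x : F} (h : ContDiffAt ℝ 1 f x) (i) :
    ContinuousAt (pd i f) x :=
  (contDiffAt_pd (n := 0) h i).continuousAt

lemma C2_ev {f : F → ℝ} {x : F} (h : ContDiffAt ℝ 2 f x) : ∀ᶠ y in 𝓝 x, ContDiffAt ℝ 2 f y :=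
  h.eventually (by simp)

lemma C1_ev {f : F → ℝ} {x : F} (h : ContDiffAt ℝ 1 f x) : ∀ᶠ y in 𝓝 x, ContDiffAt ℝ 1 f y :=
  h.eventually (by simp)

lemma lap_continuousAt {f : F → ℝ} {x : F} (h : ContDiffAt ℝ 2 f x) : ContinuousAt (lap f) x := by
  unfold lap
  exact tendsto_finsetSum _ fun i _ => continuousAt_pd (contDiffAt_pd (n := 1) h i) i

lemma gdot_continuousAt {f g : F → ℝ} {x : F} (h : ContDiffAt ℝ 1 f x) (hg : ContDiffAt ℝ 1 g x) :
    ContinuousAt (gdot f g) x := by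
  unfold gdot
  exact tendsto_finsetSum _ fun i _ => (continuousAt_pd h i).mul (continuousAt_pd hg i)

lemma lap_add {f g : F → ℝ} {x : F} (hf : ContDiffAt ℝ 2 f x) (hg : ContDiffAt ℝ 2 g x) :
    lap (fun y => f y + g y) x = lap f x + lap g x := by
  unfold lap
  rw [← Finset.sum_add_distrib]
  refine Finset.sum_congr rfl fun i _ => ?_
  rw [← pd_add (differentiableAt_pd hf i) (differentiableAt_pd hg i)]
  apply pd_congr
  filter_upwards [C2_ev hf, C2_ev hg] with y hy hy'
  exact pd_add (hy.differentiableAt (by norm_num)) (hy'.differentiableAt (by norm_num)) i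

lemma lap_const_mul {f : F → ℝ} {x : F} (c : ℝ) (hf : ContDiffAt ℝ 2 f x) :
    lap (fun y => c * f y) x = c * lap f x := by
  unfold lap
  rw [Finset.mul_sum]
  refine Finset.sum_congr rfl fun i _ => ?_
  rw [← pd_const_mul c (differentiableAt_pd hf i)]
  apply pd_congr
  filter_upwards [C2_ev hf] with y hy
  exact pd_const_mul c (hy.differentiableAt (by norm_num)) i

lemma lap_sub {f g : F → ℝ} {x : F} (hf : ContDiffAt ℝ 2 f x) (hg : ContDiffAt ℝ 2 g x) :
    lap (fun y => f y - g y) x = lap f x - lap g x := by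
  have h1 : (fun y => f y - g y) = (fun y => f y + (-1) * g y) := by ext; ring
  rw [h1, lap_add hf (contDiffAt_const.mul hg), lap_const_mul _ hg]; ring

/-- derivative of the squared distance -/
lemma pd_sq (y0 : F) (x : F) (i) :
    pd i (fun x => ‖x - y0‖ ^ 2) x = 2 * inner ℝ (x - y0) (stdOrthonormalBasis ℝ F i) := by
  unfold pd
  have h : HasFDerivAt (fun x : F => ‖x - y0‖ ^ 2) (2 • (innerSL ℝ (x - y0))) x := by
    simpa using ((hasFDerivAt_id x).sub_const y0).norm_sq
  rw [h.fderiv]; simp [inner_sub_left]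

lemma contDiff_sq (y0 : F) {n} : ContDiff ℝ n (fun x : F => ‖x - y0‖ ^ 2) :=
  (contDiff_id.sub contDiff_const).norm_sq ℝ

lemma sum_inner_sq (x : F) : ∑ i, inner ℝ x (stdOrthonormalBasis ℝ F i) ^ 2 = ‖x‖ ^ 2 := by
  have := (stdOrthonormalBasis ℝ F).sum_sq_norm_inner_left x
  simpa using this

lemma pd_radial (y0 : F) {φ : ℝ → ℝ} {φ' : ℝ} {x : F} (h : HasDerivAt φ φ' (‖x - y0‖ ^ 2)) (i) :
    pd i (fun x => φ (‖x - y0‖ ^ 2)) x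
      = φ' * (2 * inner ℝ (x - y0) (stdOrthonormalBasis ℝ F i)) := by
  rw [pd_comp (f := fun x => ‖x - y0‖ ^ 2) h ((contDiff_sq y0 (n := 1)).differentiable (by norm_num) x),
    pd_sq]

lemma lap_radial (y0 : F) {φ φ' : ℝ → ℝ} {φ'' : ℝ} {x : F}
    (h : ∀ᶠ q in 𝓝 (‖x - y0‖ ^ 2), HasDerivAt φ (φ' q) q)
    (h2 : HasDerivAt φ' φ'' (‖x - y0‖ ^ 2)) :
    lap (fun x => φ (‖x - y0‖ ^ 2)) x
      = 4 * φ'' * ‖x - y0‖ ^ 2 + 2 * finrank ℝ F * φ' (‖x - y0‖ ^ 2) := by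
  have hc : Tendsto (fun x : F => ‖x - y0‖ ^ 2) (𝓝 x) (𝓝 (‖x - y0‖ ^ 2)) :=
    (contDiff_sq y0 (n := 1)).continuous.continuousAt
  have key : ∀ i, pd i (pd i (fun x => φ (‖x - y0‖ ^ 2))) x =
      4 * φ'' * inner ℝ (x - y0) (stdOrthonormalBasis ℝ F i) ^ 2 + 2 * φ' (‖x - y0‖ ^ 2) := by
    intro i
    have e1 : pd i (fun x => φ (‖x - y0‖ ^ 2)) =ᶠ[𝓝 x]
        fun x => φ' (‖x - y0‖ ^ 2) * (2 * inner ℝ (x - y0) (stdOrthonormalBasis ℝ F i)) := by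
      filter_upwards [hc.eventually h] with y hy using pd_radial y0 hy i
    have hd : HasFDerivAt (fun x : F => 2 * inner ℝ (x - y0) (stdOrthonormalBasis ℝ F i))
        ((2 : ℝ) • (innerSL ℝ (stdOrthonormalBasis ℝ F i))) x := by
      have : HasFDerivAt (fun x : F => inner ℝ (x - y0) (stdOrthonormalBasis ℝ F i))
        (innerSL ℝ (stdOrthonormalBasis ℝ F i)) x := by
        have := (innerSL ℝ (stdOrthonormalBasis ℝ F i)).hasFDerivAt.comp x
          ((hasFDerivAt_id x).sub_const y0)
        refine (this.congr_of_eventuallyEq (Eventually.of_forall fun z => ?_))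
        simp [real_inner_comm]
      exact this.const_mul 2
    rw [pd_congr e1, pd_mul (f := fun x => φ' (‖x - y0‖ ^ 2)) _ hd.differentiableAt, pd_radial y0 h2]
    · have : pd i (fun x : F => 2 * inner ℝ (x - y0) (stdOrthonormalBasis ℝ F i)) x = 2 := by
        unfold pd; rw [hd.fderiv]; simp
      rw [this]; ring
    · exact (h2.comp_hasFDerivAt x
        ((contDiff_sq y0 (n := 1)).differentiable (by norm_num) x).hasFDerivAt).differentiableAt
  unfold lap
  simp_rw [key]
  rw [Finset.sum_add_distrib, ← Finset.mul_sum, sum_inner_sq]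
  simp; ring

/-- second derivative test -/
lemma pd_pd_nonpos_of_localMax {f : F → ℝ} {x : F} (hf : ContDiffAt ℝ 2 f x) (h : IsLocalMax f x)
    (i) : pd i (pd i f) x ≤ 0 := by
  by_contra hcon
  push Not at hcon
  set w := stdOrthonormalBasis ℝ F i
  have hL : ∀ t : ℝ, HasDerivAt (fun t : ℝ => x + t • w) w t := fun t => by
    have := ((hasDerivAt_id' t).smul_const w).const_add x
    rwa [one_smul] at this
  have hcont : Tendsto (fun t : ℝ => x + t • w) (𝓝 0) (𝓝 x) := by
    have := (hL 0).continuousAt.tendsto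
    simpa using this
  set γ : ℝ → ℝ := fun t => f (x + t • w)
  have hd : ∀ᶠ t in 𝓝 (0 : ℝ), HasDerivAt γ (pd i f (x + t • w)) t := by
    filter_upwards [hcont.eventually (C2_ev hf)] with t ht
    exact (ht.differentiableAt (by norm_num)).hasFDerivAt.comp_hasDerivAt t (hL t)
  have hd' : deriv γ =ᶠ[𝓝 0] fun t => pd i f (x + t • w) := by
    filter_upwards [hd] with t ht using ht.deriv
  have hdd : HasDerivAt (fun t : ℝ => pd i f (x + t • w)) (pd i (pd i f) x) 0 := by
    have h1 : DifferentiableAt ℝ (pd i f) (x + (0 : ℝ) • w) := by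
      simpa using differentiableAt_pd hf i
    have := h1.hasFDerivAt.comp_hasDerivAt (0 : ℝ) (hL 0)
    simp only [zero_smul, add_zero] at this
    exact this
  have hmax : IsLocalMax γ 0 := by
    have : ∀ᶠ t in 𝓝 (0 : ℝ), f (x + t • w) ≤ f x := hcont.eventually h
    filter_upwards [this] with t ht
    simpa [γ] using ht
  have h0 : deriv γ 0 = 0 := hmax.deriv_eq_zero
  have hmin : IsLocalMin γ 0 := by
    apply isLocalMin_of_deriv_deriv_pos _ h0 hd.self_of_nhds.continuousAt
    rw [hd'.deriv_eq, hdd.deriv]; exact hcon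
  have hconst : γ =ᶠ[𝓝 0] fun _ => γ 0 := by
    filter_upwards [hmax, hmin] with t h1 h2 using le_antisymm h1 h2
  have : deriv (deriv γ) 0 = 0 := by
    have h3 : deriv γ =ᶠ[𝓝 0] fun _ => 0 := by
      filter_upwards [hconst.eventuallyEq_nhds] with t ht
      rw [ht.deriv_eq]; simp
    rw [h3.deriv_eq]; simp
  rw [hd'.deriv_eq, hdd.deriv] at this
  linarith

lemma lap_nonpos_of_localMax {f : F → ℝ} {x : F} (hf : ContDiffAt ℝ 2 f x) (h : IsLocalMax f x) :
    lap f x ≤ 0 :=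
  Finset.sum_nonpos fun i _ => pd_pd_nonpos_of_localMax hf h i

/-- weak maximum principle -/
lemma wmp {U K : Set F} (hU : IsOpen U) (hK : IsCompact K) (hUK : U ⊆ K) {w : F → ℝ}
    (hc : ContinuousOn w K) (h2 : ∀ x ∈ U, 0 < w x → ContDiffAt ℝ 2 w x) (hb : ∀ x ∈ K, x ∉ U → w x ≤ 0)
    (hl : ∀ x ∈ U, 0 < w x → 0 < lap w x) : ∀ x ∈ K, w x ≤ 0 := by
  intro x hx
  obtain ⟨x0, hx0, hmax⟩ := hK.exists_isMaxOn ⟨x, hx⟩ hc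
  refine (hmax hx).trans ?_
  by_contra hcon
  push Not at hcon
  have hxU : x0 ∈ U := by
    by_contra h
    exact absurd (hb x0 hx0 h) (not_le.2 hcon)
  have hloc : IsLocalMax w x0 := by
    filter_upwards [hU.mem_nhds hxU] with y hy using hmax (hUK hy)
  linarith [hl x0 hxU hcon, lap_nonpos_of_localMax (h2 x0 hxU hcon) hloc]

end basics
end Conc

namespace Conc
open Topology Set Module Metric

section homog
variable {F : Type} [NormedAddCommGroup F] [InnerProductSpace ℝ F] [FiniteDimensional ℝ F]
variable {G : Type} [NormedAddCommGroup G] [NormedSpace ℝ G]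

/-- kernels smooth off the origin and homogeneous of degree `d` -/
structure Hom (k : F → G) (d : ℝ) : Prop where
  smooth : ∀ z, z ≠ 0 → ContDiffAt ℝ (⊤ : ℕ∞) k z
  hom : ∀ t : ℝ, 0 < t → ∀ z, k (t • z) = t ^ d • k z

lemma Hom.bound {k : F → G} {d : ℝ} (h : Hom k d) :
    ∃ C, 0 < C ∧ ∀ z, z ≠ 0 → ‖k z‖ ≤ C * ‖z‖ ^ d := by
  have hc : ContinuousOn k (sphere 0 1) := fun z hz =>
    (h.smooth z (by rintro rfl; simp at hz)).continuousAt.continuousWithinAt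
  obtain ⟨C, hC⟩ := (isCompact_sphere (0 : F) 1).exists_bound_of_continuousOn hc
  refine ⟨max C 1, by positivity, fun z hz => ?_⟩
  have hz' : 0 < ‖z‖ := norm_pos_iff.2 hz
  have h1 := hC (‖z‖⁻¹ • z) (by simp [norm_smul, hz'.ne'])
  have h2 : z = ‖z‖ • (‖z‖⁻¹ • z) := by rw [smul_smul, mul_inv_cancel₀ hz'.ne', one_smul]
  rw [h2, h.hom _ hz', norm_smul, ← h2, Real.norm_of_nonneg (by positivity), mul_comm]
  gcongr
  exact h1.trans (le_max_left _ _)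

lemma Hom.fderiv {k : F → G} {d : ℝ} (h : Hom k d) : Hom (fderiv ℝ k) (d - 1) where
  smooth z hz := (h.smooth z hz).fderiv_right (m := (⊤ : ℕ∞)) (by simp)
  hom t ht z := by
    have e : (fun z => k (t • z)) = fun z => t ^ d • k z := funext (h.hom t ht)
    have h1 := fderiv_comp_smul (𝕜 := ℝ) (f := k) (x := z) t
    have e2 : _root_.fderiv ℝ (fun z => t ^ d • k z) z = t ^ d • _root_.fderiv ℝ k z := by
      have := congrFun (fderiv_const_smul_field (𝕜 := ℝ) (f := k) (t ^ d)) z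
      exact this
    rw [e, e2] at h1
    rw [rpow_sub_one ht.ne', div_eq_inv_mul, mul_smul, h1, smul_smul, inv_mul_cancel₀ ht.ne', one_smul]

variable [MeasurableSpace F] [BorelSpace F]

lemma aesm_of_contOn {k : F → G} (hk : ∀ z, z ≠ 0 → ContinuousAt k z) (hN : 1 ≤ finrank ℝ F) :
    AEStronglyMeasurable k volume := by
  have : Nontrivial F := Module.nontrivial_of_finrank_pos (R := ℝ) (by omega)
  have h : AEStronglyMeasurable k (volume.restrict ({0}ᶜ : Set F)) := by
    have := FiniteDimensional.proper_real F
    have : SecondCountableTopology F := by infer_instance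
    refine ContinuousOn.aestronglyMeasurable (fun z hz => (hk z hz).continuousWithinAt)
      (measurableSet_singleton _).compl
  rwa [restrict_compl_singleton] at h

lemma Hom.aesm {k : F → G} {d : ℝ} (h : Hom k d) (hN : 1 ≤ finrank ℝ F) :
    AEStronglyMeasurable k volume := aesm_of_contOn (fun z hz => (h.smooth z hz).continuousAt) hN

lemma aesm_sub {k : F → G} (h : AEStronglyMeasurable k volume) (x : F) :
    AEStronglyMeasurable (fun y => k (x - y)) volume :=
  h.comp_measurePreserving (volume.measurePreserving_sub_left x)

lemma ball_int {α : ℝ} (hα : α < finrank ℝ F) (hN : 1 ≤ finrank ℝ F) (r : ℝ) :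
    IntegrableOn (fun z : F => ‖z‖ ^ (-α)) (ball 0 r) := by
  refine integrableOn_ball_of_norm_le_rpow (C := 1) hN hα ?_ ?_
  · refine ae_of_all _ fun x => ?_
    rw [one_mul, Real.norm_of_nonneg (by positivity)]
  · exact aesm_of_contOn (fun z hz => (continuous_norm.continuousAt).rpow_const
      (Or.inl (norm_ne_zero_iff.2 hz))) hN

/-- a dominating function at infinity -/
def domf (α β : ℝ) (y : F) : ℝ :=
  (ball (0 : F) 1).indicator (fun y => ‖y‖ ^ (-β)) y + 2 ^ β * (1 + ‖y‖) ^ (-(α + β))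

lemma domf_int {α β : ℝ} (hN : 1 ≤ finrank ℝ F) (hβ : β < finrank ℝ F) (hαβ : finrank ℝ F < α + β) :
    Integrable (domf (F := F) α β) := by
  unfold domf
  refine Integrable.add ?_ ?_
  · exact (ball_int hβ hN 1).integrable_indicator measurableSet_ball
  · exact (integrable_one_add_norm hαβ).const_mul _

lemma domf_le {α β : ℝ} (hα : 0 ≤ α) (hβ : 0 ≤ β) (y : F) (hy : y ≠ 0):
    (1 + ‖y‖) ^ (-α) * ‖y‖ ^ (-β) ≤ domf α β y := by
  unfold domf
  have hy' : 0 < ‖y‖ := norm_pos_iff.2 hy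
  by_cases h : y ∈ ball (0 : F) 1
  · rw [indicator_of_mem h]
    have h1 : (1 + ‖y‖) ^ (-α) ≤ 1 := rpow_le_one_of_one_le_of_nonpos (by linarith) (by linarith)
    have : (1 + ‖y‖) ^ (-α) * ‖y‖ ^ (-β) ≤ 1 * ‖y‖ ^ (-β) := by gcongr
    have : 0 ≤ 2 ^ β * (1 + ‖y‖) ^ (-(α + β)) := by positivity
    linarith
  · rw [indicator_of_notMem h, zero_add]
    have h1 : 1 ≤ ‖y‖ := by simpa using h
    rw [neg_add, rpow_add (by linarith)]
    have : ‖y‖ ^ (-β) ≤ 2 ^ β * (1 + ‖y‖) ^ (-β) := by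
      have : ((1 + ‖y‖) / 2) ^ β ≤ ‖y‖ ^ β := by gcongr; linarith
      rw [div_rpow (by linarith) (by norm_num)] at this
      rw [rpow_neg hy'.le, rpow_neg (by linarith)]
      rw [← div_eq_mul_inv, inv_eq_one_div, div_le_div_iff₀ (by positivity) (by positivity)]
      rw [div_le_iff₀ (by positivity)] at this
      linarith
    calc _ ≤ (1 + ‖y‖) ^ (-α) * (2 ^ β * (1 + ‖y‖) ^ (-β)) := by gcongr
      _ = _ := by ring

/-- away from the pole -/
lemma away_le {α r R : ℝ} (hα : 0 ≤ α) (hr : 0 < r) (hR : 0 ≤ R) {x y : F} (hx : ‖x‖ ≤ R)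
    (hxy : r ≤ ‖x - y‖) : ‖x - y‖ ^ (-α) ≤ ((1 + R) / r + 1) ^ α * (1 + ‖y‖) ^ (-α) := by
  have h0 : 0 < ‖x - y‖ := hr.trans_le hxy
  have h1 : 1 + ‖y‖ ≤ ((1 + R) / r + 1) * ‖x - y‖ := by
    have : ‖y‖ ≤ ‖x‖ + ‖x - y‖ := by
      have := norm_sub_le x (x - y); simpa using this
    have h2 : 1 + R ≤ (1 + R) / r * ‖x - y‖ := by
      rw [div_mul_eq_mul_div, le_div_iff₀ hr]; gcongr
    linarith
  have h2 : (1 + ‖y‖) ^ α ≤ ((1 + R) / r + 1) ^ α * ‖x - y‖ ^ α := by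
    rw [← mul_rpow (by positivity) h0.le]
    gcongr
  rw [rpow_neg h0.le, rpow_neg (by positivity), ← div_eq_mul_inv, inv_eq_one_div,
    div_le_div_iff₀ (by positivity) (by positivity)]
  linarith

/-- uniform bound for weakly singular integrals -/
lemma weight_bound {α β r0 R0 : ℝ} (hN : 1 ≤ finrank ℝ F) (hα : 0 ≤ α) (hβ : 0 ≤ β)
    (hα' : α < finrank ℝ F) (hβ' : β < finrank ℝ F) (hαβ : finrank ℝ F < α + β)
    (hr0 : 0 < r0) :
    ∃ B, 0 < B ∧ ∀ x : F, r0 ≤ ‖x‖ → ‖x‖ ≤ R0 →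
      Integrable (fun y => ‖x - y‖ ^ (-α) * ‖y‖ ^ (-β)) ∧
      ∫ y, ‖x - y‖ ^ (-α) * ‖y‖ ^ (-β) ≤ B := by
  set r := r0 / 2 with hr
  set A1 := r ^ (-β)
  set A2 := ((1 + |R0|) / r + 1) ^ α
  set s : F → ℝ := (ball (0 : F) r).indicator (fun z => ‖z‖ ^ (-α)) with hs
  have hsi : Integrable s := (ball_int hα' hN r).integrable_indicator measurableSet_ball
  have : Nontrivial F := Module.nontrivial_of_finrank_pos (R := ℝ) (by omega)
  have hs0 : 0 ≤ ∫ z, s z := integral_nonneg fun z => indicator_nonneg (fun _ _ => by positivity) _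
  have hd0 : 0 ≤ ∫ z : F, domf α β z := integral_nonneg fun z => by
    unfold domf
    exact add_nonneg (indicator_nonneg (fun _ _ => by positivity) _) (by positivity)
  refine ⟨A1 * (∫ z, s z) + A2 * (∫ z : F, domf α β z) + 1, by positivity, fun x hx1 hx2 => ?_⟩
  have hle : ∀ᵐ y : F, ‖x - y‖ ^ (-α) * ‖y‖ ^ (-β) ≤ A1 * s (x - y) + A2 * domf α β y := by
    have h0 : ∀ᵐ y : F, y ≠ 0 := by
      simp [ae_iff]
    filter_upwards [h0] with y hy
    have hdn : 0 ≤ domf α β y := (by positivity : (0:ℝ) ≤ (1 + ‖y‖) ^ (-α) * ‖y‖ ^ (-β)).trans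
      (domf_le hα hβ y hy)
    by_cases h : x - y ∈ ball (0 : F) r
    · rw [hs, indicator_of_mem h]
      have h1 : r ≤ ‖y‖ := by
        have h3 : ‖x - y‖ < r := by simpa using h
        have := norm_sub_norm_le x (x - y)
        simp only [sub_sub_cancel] at this
        linarith
      have h2 : ‖y‖ ^ (-β) ≤ A1 := rpow_le_rpow_of_nonpos (by positivity) h1 (by linarith)
      have : ‖x - y‖ ^ (-α) * ‖y‖ ^ (-β) ≤ ‖x - y‖ ^ (-α) * A1 := by gcongr
      have : 0 ≤ A2 * domf α β y := by positivity
      linarith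
    · rw [hs, indicator_of_notMem h]
      have h1 : r ≤ ‖x - y‖ := by simpa using h
      have := away_le hα (by positivity : 0 < r) (abs_nonneg R0) (hx2.trans (le_abs_self _)) h1
      calc _ ≤ A2 * (1 + ‖y‖) ^ (-α) * ‖y‖ ^ (-β) := by gcongr
        _ = A2 * ((1 + ‖y‖) ^ (-α) * ‖y‖ ^ (-β)) := by ring
        _ ≤ A2 * domf α β y := by gcongr; exact domf_le hα hβ y hy
        _ = _ := by ring
  have hitg0 : Integrable (fun y => A1 * s (x - y) + A2 * domf α β y) :=
    ((hsi.comp_sub_left x).const_mul _).add ((domf_int hN hβ' hαβ).const_mul _)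
  have hm : AEStronglyMeasurable (fun y : F => ‖x - y‖ ^ (-α) * ‖y‖ ^ (-β)) volume := by
    have hk : ∀ γ : ℝ, AEStronglyMeasurable (fun y : F => ‖y‖ ^ (-γ)) volume := fun γ =>
      aesm_of_contOn (fun z hz => (continuous_norm.continuousAt).rpow_const
        (Or.inl (norm_ne_zero_iff.2 hz))) hN
    exact (aesm_sub (hk α) x).mul (hk β)
  have hi : Integrable (fun y => ‖x - y‖ ^ (-α) * ‖y‖ ^ (-β)) := by
    refine hitg0.mono' hm ?_
    filter_upwards [hle] with y hy
    rwa [Real.norm_of_nonneg (by positivity)]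
  refine ⟨hi, (integral_mono_ae hi hitg0 hle).trans ?_⟩
  rw [integral_add ((hsi.comp_sub_left x).const_mul _) ((domf_int hN hβ' hαβ).const_mul _),
    integral_const_mul, integral_const_mul, integral_sub_left_eq_self]
  linarith

/-- differentiation under the integral sign, far from the pole -/
lemma far_deriv {k : F → G} {d α β r : ℝ} (hk : Hom k d) (hd : d ≤ -α) (hN : 1 ≤ finrank ℝ F)
    (hα : 0 ≤ α) (hβ : 0 ≤ β) (hβ' : β < finrank ℝ F) (hαβ : finrank ℝ F < α + β)
    {f : F → ℝ} (hfm : AEStronglyMeasurable f volume) {C : ℝ} (hf : ∀ y, y ≠ 0 → |f y| ≤ C * ‖y‖ ^ (-β))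
    {x0 : F} (hr : 0 < r) (hf0 : ∀ y ∈ ball x0 (2 * r), f y = 0) {x : F} (hx : x ∈ ball x0 r) :
    Integrable (fun y => f y • k (x - y)) ∧ 
    HasFDerivAt (fun x => ∫ y, f y • k (x - y)) (∫ y, f y • fderiv ℝ k (x - y)) x := by
  have : Nontrivial F := Module.nontrivial_of_finrank_pos (R := ℝ) (by omega)
  have hC : 0 ≤ C := by
    obtain ⟨y, hy⟩ := exists_ne (0 : F)
    have h1 := (abs_nonneg _).trans (hf y hy)
    have : 0 < ‖y‖ ^ (-β) := rpow_pos_of_pos (norm_pos_iff.2 hy) _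
    exact nonneg_of_mul_nonneg_left h1 this
  have sep : ∀ x ∈ ball x0 r, ∀ y, f y ≠ 0 → r ≤ ‖x - y‖ := by
    intro x hx y hy
    by_contra hcon
    push Not at hcon
    apply hy; apply hf0
    rw [mem_ball, dist_eq_norm] at hx ⊢
    calc ‖y - x0‖ = ‖(x - x0) - (x - y)‖ := by congr 1; abel
      _ ≤ ‖x - x0‖ + ‖x - y‖ := norm_sub_le _ _
      _ < 2 * r := by linarith
  have gen : ∀ {G' : Type} [NormedAddCommGroup G'] [NormedSpace ℝ G'] {k : F → G'} {d : ℝ},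
      Hom k d → d ≤ -α →
      ∃ A, 0 ≤ A ∧ ∀ x ∈ ball x0 r, ∀ y, y ≠ 0 → ‖f y • k (x - y)‖ ≤ A * domf α β y := by
    intro G' _ _ k d hk hd
    obtain ⟨Ck, hCk, hb⟩ := hk.bound
    refine ⟨C * Ck * r ^ (d + α) * ((1 + (‖x0‖ + r)) / r + 1) ^ α, by positivity, fun x hx y hy => ?_⟩
    by_cases hfy : f y = 0
    · have hdn : 0 ≤ domf α β y := (by positivity : (0:ℝ) ≤ (1 + ‖y‖) ^ (-α) * ‖y‖ ^ (-β)).trans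
        (domf_le hα hβ y hy)
      rw [hfy, zero_smul, norm_zero]; positivity
    · have h1 := sep x hx y hfy
      have h0 : 0 < ‖x - y‖ := hr.trans_le h1
      have hxn : ‖x‖ ≤ ‖x0‖ + r := by
        rw [mem_ball, dist_eq_norm] at hx
        have := norm_sub_norm_le x x0
        linarith
      have h2 := away_le hα hr (by positivity) hxn h1
      have h3 : ‖x - y‖ ^ d ≤ r ^ (d + α) * ‖x - y‖ ^ (-α) := by
        have : ‖x - y‖ ^ d = ‖x - y‖ ^ (d + α) * ‖x - y‖ ^ (-α) := by
          rw [← rpow_add h0]; congr 1; ring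
        rw [this]
        gcongr ?_ * _
        exact rpow_le_rpow_of_nonpos hr h1 (by linarith)
      rw [norm_smul, Real.norm_eq_abs]
      calc |f y| * ‖k (x - y)‖ ≤ (C * ‖y‖ ^ (-β)) * (Ck * ‖x - y‖ ^ d) := by
            gcongr
            · exact hf y hy
            · exact hb _ (norm_pos_iff.1 h0)
        _ ≤ (C * ‖y‖ ^ (-β)) * (Ck * (r ^ (d + α) *
              (((1 + (‖x0‖ + r)) / r + 1) ^ α * (1 + ‖y‖) ^ (-α)))) := by
            gcongr
            exact h3.trans (by gcongr)
        _ = C * Ck * r ^ (d + α) * ((1 + (‖x0‖ + r)) / r + 1) ^ α *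
              ((1 + ‖y‖) ^ (-α) * ‖y‖ ^ (-β)) := by ring
        _ ≤ _ := by gcongr; exact domf_le hα hβ y hy
  have h0 : ∀ᵐ y : F, y ≠ 0 := by
      simp [ae_iff]
  have hdi := domf_int (F := F) hN hβ' hαβ
  have hmeas : ∀ x, AEStronglyMeasurable (fun y => f y • k (x - y)) volume := fun x =>
    hfm.smul (aesm_sub (hk.aesm hN) x)
  have hI : Integrable (fun y => f y • k (x - y)) := by
    obtain ⟨A, hA, hb⟩ := gen hk hd
    refine (hdi.const_mul A).mono' (hmeas x) ?_
    filter_upwards [h0] with y hy using hb x hx y hy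
  refine ⟨hI, ?_⟩
  obtain ⟨A, hA, hb⟩ := gen hk.fderiv (by linarith : d - 1 ≤ -α)
  refine hasFDerivAt_integral_of_dominated_of_fderiv_le (s := ball x0 r)
    (F' := fun x y => f y • fderiv ℝ k (x - y)) (isOpen_ball.mem_nhds hx)
    (Eventually.of_forall hmeas) hI (hfm.smul (aesm_sub (hk.fderiv.aesm hN) x)) 
    (bound := fun y => A * domf α β y) ?_ (hdi.const_mul A) ?_
  · filter_upwards [h0] with y hy x hx using hb x hx y hy
  · refine ae_of_all _ fun y x hx => ?_
    by_cases hfy : f y = 0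
    · simp only [hfy, zero_smul]; exact hasFDerivAt_const _ _
    · have h1 := sep x hx y hfy
      have hne : x - y ≠ 0 := norm_pos_iff.1 (hr.trans_le h1)
      have h2 : HasFDerivAt k (fderiv ℝ k (x - y)) (x - y) :=
        ((hk.smooth _ hne).differentiableAt (by simp)).hasFDerivAt
      have := (h2.comp x ((hasFDerivAt_id x).sub_const y)).const_smul (f y)
      rw [ContinuousLinearMap.comp_id] at this
      exact this

end homog
end Conc

namespace Conc
open Topology Set Module Metric

section newton
variable {F : Type} [NormedAddCommGroup F] [InnerProductSpace ℝ F] [FiniteDimensional ℝ F]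

/-- regularised Newtonian kernel -/
def ker (ε : ℝ) (z : F) : ℝ := (‖z‖ ^ 2 + ε) ^ (1 - (finrank ℝ F : ℝ) / 2)

/-- its gradient -/
def dker (ε : ℝ) (z : F) : F →L[ℝ] ℝ :=
  (2 * (1 - (finrank ℝ F : ℝ) / 2) * (‖z‖ ^ 2 + ε) ^ (- (finrank ℝ F : ℝ) / 2)) • innerSL ℝ z

lemma ker_hom : Hom (ker (F := F) 0) (2 - finrank ℝ F) where
  smooth z hz := by
    unfold ker
    refine ContDiffAt.rpow_const_of_ne ?_ ?_
    · exact ((contDiff_id.norm_sq ℝ).add contDiff_const).contDiffAt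
    · have : 0 < ‖z‖ := norm_pos_iff.2 hz
      positivity
  hom t ht z := by
    unfold ker
    rw [norm_smul, Real.norm_of_nonneg ht.le, add_zero, add_zero, mul_pow, mul_rpow (by positivity) (by positivity),
      ← rpow_natCast t 2, ← rpow_mul ht.le, smul_eq_mul]
    congr 2
    push_cast; ring

lemma ker_nonneg (z : F) : 0 ≤ ker 0 z := by unfold ker; positivity

lemma ker_zero_eq {z : F} : ker 0 z = ‖z‖ ^ (2 - (finrank ℝ F : ℝ)) := by
  unfold ker
  rw [add_zero, ← rpow_natCast ‖z‖ 2, ← rpow_mul (norm_nonneg _)]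
  congr 1; push_cast; ring

lemma ker_hasFDerivAt {ε : ℝ} {z : F} (h : 0 < ‖z‖ ^ 2 + ε) : HasFDerivAt (ker ε) (dker ε z) z := by
  have h1 : HasFDerivAt (fun z : F => ‖z‖ ^ 2 + ε) (2 • innerSL ℝ z) z := by
    have := ((hasFDerivAt_id z).norm_sq).add_const ε
    simpa using this
  have h2 := h1.rpow_const (p := 1 - (finrank ℝ F : ℝ) / 2) (Or.inl h.ne')
  refine h2.congr_fderiv ?_
  unfold dker
  ext v
  simp
  rw [neg_div]
  ring

lemma ker_le (hN : 3 ≤ finrank ℝ F) {ε : ℝ} (hε : 0 ≤ ε) {z : F} (hz : z ≠ 0) :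
    ‖ker ε z‖ ≤ 1 * ‖z‖ ^ (-((finrank ℝ F : ℝ) - 2)) := by
  have h0 : 0 < ‖z‖ := norm_pos_iff.2 hz
  have hN' : (3 : ℝ) ≤ finrank ℝ F := by exact_mod_cast hN
  rw [show -((finrank ℝ F : ℝ) - 2) = 2 - (finrank ℝ F : ℝ) by ring, ← ker_zero_eq, one_mul]
  unfold ker
  rw [Real.norm_of_nonneg (by positivity)]
  exact rpow_le_rpow_of_nonpos (by positivity) (by linarith) (by linarith)

lemma dker_le (hN : 3 ≤ finrank ℝ F) {ε : ℝ} (hε : 0 ≤ ε) {z : F} (hz : z ≠ 0) :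
    ‖dker ε z‖ ≤ finrank ℝ F * ‖z‖ ^ (-((finrank ℝ F : ℝ) - 1)) := by
  have h0 : 0 < ‖z‖ := norm_pos_iff.2 hz
  have hN' : (3 : ℝ) ≤ finrank ℝ F := by exact_mod_cast hN
  unfold dker
  rw [norm_smul, innerSL_apply_norm, norm_mul, Real.norm_of_nonneg (by positivity : 0 ≤ (‖z‖ ^ 2 + ε) ^ (- (finrank ℝ F : ℝ) / 2))]
  have h1 : (‖z‖ ^ 2 + ε) ^ (- (finrank ℝ F : ℝ) / 2) ≤ ‖z‖ ^ (-(finrank ℝ F : ℝ)) := by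
    calc _ ≤ (‖z‖ ^ 2) ^ (- (finrank ℝ F : ℝ) / 2) :=
          rpow_le_rpow_of_nonpos (by positivity) (by linarith) (by linarith)
      _ = _ := by
          rw [← rpow_natCast ‖z‖ 2, ← rpow_mul (norm_nonneg _)]
          congr 1; push_cast; ring
  have h2 : ‖(2 * (1 - (finrank ℝ F : ℝ) / 2))‖ ≤ finrank ℝ F := by
    rw [Real.norm_eq_abs, abs_le]; constructor <;> linarith
  have h3 : ‖z‖ ^ (-((finrank ℝ F : ℝ) - 1)) = ‖z‖ ^ (-(finrank ℝ F : ℝ)) * ‖z‖ := by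
    rw [← rpow_add_one h0.ne']; congr 1; ring
  rw [h3, ← mul_assoc]
  gcongr

lemma ker_lap {ε : ℝ} (x : F) (h : 0 < ‖x‖ ^ 2 + ε) :
    lap (ker ε) x = - (finrank ℝ F * (finrank ℝ F - 2) * ε *
      (‖x‖ ^ 2 + ε) ^ (-((finrank ℝ F : ℝ) + 2) / 2)) := by
  have e : ker (F := F) ε = fun x => (fun q : ℝ => (q + ε) ^ (1 - (finrank ℝ F : ℝ) / 2)) (‖x - 0‖ ^ 2) := by
    ext x; simp [ker]
  set b := (1 - (finrank ℝ F : ℝ) / 2) with hb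
  rw [e, lap_radial (0 : F) (φ := fun q : ℝ => (q + ε) ^ b) (x := x) (φ' := fun q => b * (q + ε) ^ (b - 1))
    (φ'' := b * ((b - 1) * (‖x‖ ^ 2 + ε) ^ (b - 1 - 1)))]
  · simp only [sub_zero]
    have h1 : (‖x‖ ^ 2 + ε) ^ (b - 1) = (‖x‖ ^ 2 + ε) ^ (b - 1 - 1) * (‖x‖ ^ 2 + ε) := by
      rw [← rpow_add_one h.ne']; congr 1; ring
    have h2 : -((finrank ℝ F : ℝ) + 2) / 2 = b - 1 - 1 := by rw [hb]; ring
    rw [h1, h2]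
    generalize (‖x‖ ^ 2 + ε) ^ (b - 1 - 1) = P
    rw [hb]; ring
  · simp only [sub_zero]
    have : ∀ᶠ q in 𝓝 (‖x‖ ^ 2), 0 < q + ε :=
      (continuous_id.add continuous_const).continuousAt.eventually (lt_mem_nhds h)
    filter_upwards [this] with q hq
    have := ((hasDerivAt_id q).add_const ε).rpow_const (p := b) (Or.inl hq.ne')
    simpa using this
  · simp only [sub_zero]
    have := (((hasDerivAt_id (‖x‖ ^ 2)).add_const ε).rpow_const (p := b - 1) (Or.inl h.ne')).const_mul b
    simpa using this

lemma ker_smooth {ε : ℝ} (hε : 0 < ε) {n : ℕ∞} : ContDiff ℝ n (ker (F := F) ε) := by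
  unfold ker
  refine ContDiff.rpow_const_of_ne ?_ ?_
  · exact ((contDiff_id.norm_sq ℝ).add contDiff_const)
  · intro z; positivity

variable {G : Type} [NormedAddCommGroup G] [NormedSpace ℝ G]
variable [MeasurableSpace F] [BorelSpace F]

lemma near_int {k : F → G} {α C : ℝ} (hN : 1 ≤ finrank ℝ F) (hα' : α < finrank ℝ F)
    (hkm : AEStronglyMeasurable k volume) (hk : ∀ z, z ≠ 0 → ‖k z‖ ≤ C * ‖z‖ ^ (-α))
    {f : F → ℝ} (hf : Continuous f) (hfc : HasCompactSupport f) (x : F) :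
    Integrable (fun y => f y • k (x - y)) := by
  have : Nontrivial F := Module.nontrivial_of_finrank_pos (R := ℝ) (by omega)
  have h0 : ∀ᵐ y : F, y ≠ 0 := by simp [ae_iff]
  have hl : LocallyIntegrable k volume := locallyIntegrable_of_norm_le_rpow (C := C) hN hα'
    (by filter_upwards [h0] with y hy using hk y hy) hkm
  have h := (hfc.convolutionExists_right (ContinuousLinearMap.lsmul ℝ ℝ).flip hl hf) x
  have h2 := h.integrable_swap
  exact h2

lemma near_cont {k : F → G} {α C : ℝ} (hN : 1 ≤ finrank ℝ F) (hα' : α < finrank ℝ F)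
    (hkm : AEStronglyMeasurable k volume) (hk : ∀ z, z ≠ 0 → ‖k z‖ ≤ C * ‖z‖ ^ (-α))
    {f : F → ℝ} (hf : Continuous f) (hfc : HasCompactSupport f) :
    Continuous (fun x => ∫ y, f y • k (x - y)) := by
  have : Nontrivial F := Module.nontrivial_of_finrank_pos (R := ℝ) (by omega)
  have h0 : ∀ᵐ y : F, y ≠ 0 := by simp [ae_iff]
  have hl : LocallyIntegrable k volume := locallyIntegrable_of_norm_le_rpow (C := C) hN hα'
    (by filter_upwards [h0] with y hy using hk y hy) hkm
  have h := (hfc.continuous_convolution_right (ContinuousLinearMap.lsmul ℝ ℝ).flip hl hf)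
  refine h.congr fun x => ?_
  rw [convolution_eq_swap]; rfl

lemma near_unif {k : F → G} {kn : ℕ → F → G} {α C : ℝ} (hN : 1 ≤ finrank ℝ F) (hα' : α < finrank ℝ F)
    (hkm : ∀ n, AEStronglyMeasurable (kn n) volume) (hkm' : AEStronglyMeasurable k volume)
    (hk : ∀ n z, z ≠ 0 → ‖kn n z‖ ≤ C * ‖z‖ ^ (-α))
    (hlim : ∀ z, z ≠ 0 → Tendsto (fun n => kn n z) atTop (𝓝 (k z)))
    {f : F → ℝ} (hf : Continuous f) (hfc : HasCompactSupport f) (x0 : F) :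
    TendstoUniformlyOn (fun n x => ∫ y, f y • kn n (x - y)) (fun x => ∫ y, f y • k (x - y)) atTop
      (ball x0 1) := by
  have : Nontrivial F := Module.nontrivial_of_finrank_pos (R := ℝ) (by omega)
  have h0 : ∀ᵐ y : F, y ≠ 0 := by simp [ae_iff]
  have hk' : ∀ z, z ≠ 0 → ‖k z‖ ≤ C * ‖z‖ ^ (-α) := fun z hz =>
    le_of_tendsto (hlim z hz).norm (Eventually.of_forall fun n => hk n z hz)
  obtain ⟨B, hB⟩ := hfc.exists_bound_of_continuous hf
  obtain ⟨R1, hR1, hR1'⟩ := hfc.isBounded.exists_pos_norm_lt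
  set R := R1 + ‖x0‖ + 1
  have hB0 : 0 ≤ B := (norm_nonneg _).trans (hB 0)
  have hbi : Integrable ((ball (0 : F) R).indicator fun z => 2 * C * ‖z‖ ^ (-α)) :=
    IntegrableOn.integrable_indicator ((ball_int hα' hN R).const_mul (2 * C)) measurableSet_ball
  set d : ℕ → F → ℝ := fun n => (ball (0 : F) R).indicator fun z => ‖kn n z - k z‖ with hd
  have hdm : ∀ n, AEStronglyMeasurable (d n) volume := fun n =>
    (((hkm n).sub hkm').norm).indicator measurableSet_ball
  have hdb : ∀ n, ∀ᵐ z : F, ‖d n z‖ ≤ (ball (0 : F) R).indicator (fun z => 2 * C * ‖z‖ ^ (-α)) z := by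
    intro n
    filter_upwards [h0] with z hz
    simp only [hd]
    by_cases h : z ∈ ball (0 : F) R
    · rw [indicator_of_mem h, indicator_of_mem h, norm_norm]
      have := norm_sub_le (kn n z) (k z)
      linarith [hk n z hz, hk' z hz]
    · rw [indicator_of_notMem h, indicator_of_notMem h]; simp
  have hdi : ∀ n, Integrable (d n) := fun n => hbi.mono' (hdm n) (hdb n)
  have hlim0 : Tendsto (fun n => B * ∫ z, d n z) atTop (𝓝 0) := by
    have h1 : Tendsto (fun n => ∫ z, d n z) atTop (𝓝 (∫ z : F, (0 : ℝ))) := by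
      refine tendsto_integral_of_dominated_convergence _ hdm hbi hdb ?_
      filter_upwards [h0] with z hz
      simp only [hd]
      by_cases h : z ∈ ball (0 : F) R
      · simp only [indicator_of_mem h]
        have := ((hlim z hz).sub_const (k z)).norm
        simpa using this
      · simp only [indicator_of_notMem h]; exact tendsto_const_nhds
    have := h1.const_mul B
    simpa using this
  rw [Metric.tendstoUniformlyOn_iff]
  intro ε hε
  filter_upwards [hlim0.eventually (gt_mem_nhds hε)] with n hn x hx
  refine lt_of_le_of_lt ?_ hn
  rw [dist_comm, dist_eq_norm, ← integral_sub (near_int hN hα' (hkm n) (hk n) hf hfc x)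
    (near_int hN hα' hkm' hk' hf hfc x), ← integral_sub_left_eq_self (d n) volume x, ← integral_const_mul]
  refine norm_integral_le_of_norm_le (((hdi n).comp_sub_left x).const_mul B) (ae_of_all _ fun y => ?_)
  rw [← smul_sub, norm_smul]
  by_cases hy : f y = 0
  · rw [hy, norm_zero, zero_mul]
    exact mul_nonneg hB0 (indicator_nonneg (fun _ _ => norm_nonneg _) _)
  · have : x - y ∈ ball (0 : F) R := by
      have h1 := hR1' y (subset_tsupport _ hy)
      rw [mem_ball, dist_eq_norm] at hx
      rw [mem_ball_zero_iff]
      have := norm_sub_le x y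
      have := norm_sub_norm_le x x0
      simp only [R]; linarith
    simp only [hd]
    rw [indicator_of_mem this]
    gcongr
    exact hB y

/-- vanishing regularisation parameters -/
def eps (n : ℕ) : ℝ := (1 / ((n : ℝ) + 1)) ^ 2

lemma eps_pos (n : ℕ) : 0 < eps n := by unfold eps; positivity

lemma eps_lim : Tendsto eps atTop (𝓝 0) := by
  unfold eps
  have := (tendsto_one_div_add_atTop_nhds_zero_nat (𝕜 := ℝ)).pow 2
  simpa using this

lemma ker_lim {z : F} (hz : z ≠ 0) : Tendsto (fun n => ker (eps n) z) atTop (𝓝 (ker 0 z)) := by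
  unfold ker
  have h0 : 0 < ‖z‖ := norm_pos_iff.2 hz
  exact (tendsto_const_nhds.add eps_lim).rpow_const (Or.inl (by positivity))

lemma fderiv_ker {z : F} (hz : z ≠ 0) : fderiv ℝ (ker 0) z = dker 0 z :=
  (ker_hasFDerivAt (by have := norm_pos_iff.2 hz; positivity)).fderiv

lemma dker_lim {z : F} (hz : z ≠ 0) :
    Tendsto (fun n => dker (eps n) z) atTop (𝓝 (fderiv ℝ (ker 0) z)) := by
  rw [fderiv_ker hz]
  unfold dker
  have h0 : 0 < ‖z‖ := norm_pos_iff.2 hz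
  refine Tendsto.smul_const ?_ _
  exact ((tendsto_const_nhds.add eps_lim).rpow_const (Or.inl (by positivity))).const_mul _

lemma dker_cont {ε : ℝ} (hε : 0 < ε) : Continuous (dker (F := F) ε) := by
  unfold dker
  have h1 : Continuous fun z : F => 2 * (1 - (finrank ℝ F : ℝ) / 2) *
      (‖z‖ ^ 2 + ε) ^ (- (finrank ℝ F : ℝ) / 2) :=
    continuous_const.mul (Continuous.rpow_const (by fun_prop) fun z => Or.inl (by positivity))
  exact h1.smul (innerSL ℝ (E := F)).continuous

lemma near_C1 (hN : 3 ≤ finrank ℝ F) {f : F → ℝ} (hf : Continuous f) (hfc : HasCompactSupport f)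
    (x : F) : HasFDerivAt (fun x => ∫ y, f y • ker 0 (x - y)) (∫ y, f y • fderiv ℝ (ker 0) (x - y)) x := by
  have hN' : (3 : ℝ) ≤ finrank ℝ F := by exact_mod_cast hN
  have hN1 : 1 ≤ finrank ℝ F := by omega
  have hkm : ∀ n, AEStronglyMeasurable (ker (F := F) (eps n)) volume := fun n =>
    (ker_smooth (n := 0) (eps_pos n)).continuous.aestronglyMeasurable
  have hdkm : ∀ n, AEStronglyMeasurable (dker (F := F) (eps n)) volume := fun n =>
    (dker_cont (eps_pos n)).aestronglyMeasurable
  have u1 := near_unif hN1 (by linarith) hdkm ((ker_hom (F := F)).fderiv.aesm hN1)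
    (fun n z hz => dker_le hN (eps_pos n).le hz) (fun z hz => dker_lim hz) hf hfc x
  have u0 := fun x => near_unif hN1 (by linarith) hkm ((ker_hom (F := F)).aesm hN1)
    (fun n z hz => ker_le hN (eps_pos n).le hz) (fun z hz => ker_lim hz) hf hfc x
  refine hasFDerivAt_of_tendstoUniformlyOn isOpen_ball u1 (f := fun n x => ∫ y, f y • ker (eps n) (x - y))
    ?_ (fun y hy => (u0 y).tendsto_at (mem_ball_self one_pos)) (mem_ball_self one_pos)
  intro n x hx
  have hfi : Integrable f := hf.integrable_of_hasCompactSupport hfc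
  set A := 2 * ‖(1 - (finrank ℝ F : ℝ) / 2)‖ * (eps n) ^ (-(finrank ℝ F : ℝ) / 2)
  have hloc : ∃ A, ∀ y ∈ tsupport f, ∀ w ∈ ball x 1, ‖dker (eps n) (w - y)‖ ≤ A := by
    have hK : IsCompact ((closedBall x 1) ×ˢ (tsupport f)) := (isCompact_closedBall x 1).prod hfc
    have hc : Continuous (fun q : F × F => dker (eps n) (q.1 - q.2)) :=
      (dker_cont (eps_pos n)).comp (continuous_fst.sub continuous_snd)
    obtain ⟨A, hA⟩ := hK.exists_bound_of_continuousOn hc.continuousOn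
    exact ⟨A, fun y hy w hw => hA (w, y) ⟨ball_subset_closedBall hw, hy⟩⟩
  obtain ⟨A, hA⟩ := hloc
  refine hasFDerivAt_integral_of_dominated_of_fderiv_le (s := ball x 1)
    (F' := fun x y => f y • dker (eps n) (x - y)) (ball_mem_nhds x one_pos)
    (Eventually.of_forall fun w => hf.aestronglyMeasurable.smul (aesm_sub (hkm n) w))
    (near_int hN1 (by linarith) (hkm n) (fun z hz => ker_le hN (eps_pos n).le hz) hf hfc x)
    (hf.aestronglyMeasurable.smul (aesm_sub (hdkm n) x)) (bound := fun y => ‖f y‖ * A) ?_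
    (hfi.norm.mul_const A) ?_
  · refine ae_of_all _ fun y w hw => ?_
    rw [norm_smul]
    by_cases hy : f y = 0
    · simp [hy]
    · gcongr
      exact hA y (subset_tsupport _ hy) w hw
  · refine ae_of_all _ fun y w hw => ?_
    have h2 : HasFDerivAt (ker (eps n)) (dker (eps n) (w - y)) (w - y) :=
      ker_hasFDerivAt (by have := eps_pos n; positivity)
    have := (h2.comp w ((hasFDerivAt_id w).sub_const y)).const_smul (f y)
    rw [ContinuousLinearMap.comp_id] at this
    exact this

lemma ker_meas_bound (hN : 3 ≤ finrank ℝ F) : AEStronglyMeasurable (fderiv ℝ (ker (F := F) 0)) volume ∧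
    ∀ z : F, z ≠ 0 → ‖fderiv ℝ (ker 0) z‖ ≤ finrank ℝ F * ‖z‖ ^ (-((finrank ℝ F : ℝ) - 1)) := by
  refine ⟨(ker_hom (F := F)).fderiv.aesm (by omega), fun z hz => ?_⟩
  rw [fderiv_ker hz]; exact dker_le hN le_rfl hz

lemma near_contDiff1 (hN : 3 ≤ finrank ℝ F) {f : F → ℝ} (hf : Continuous f) (hfc : HasCompactSupport f) :
    ContDiff ℝ 1 (fun x => ∫ y, f y • ker 0 (x - y)) := by
  rw [contDiff_one_iff_fderiv]
  refine ⟨fun x => (near_C1 hN hf hfc x).differentiableAt, ?_⟩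
  have : fderiv ℝ (fun x => ∫ y, f y • ker 0 (x - y)) = fun x => ∫ y, f y • fderiv ℝ (ker 0) (x - y) :=
    funext fun x => (near_C1 hN hf hfc x).fderiv
  rw [this]
  exact near_cont (by omega) (by linarith) (ker_meas_bound hN).1 (ker_meas_bound hN).2 hf hfc

lemma near_dir (hN : 3 ≤ finrank ℝ F) {f : F → ℝ} (hf : ContDiff ℝ 1 f) (hfc : HasCompactSupport f)
    (v x : F) : fderiv ℝ (fun x => ∫ y, f y • ker 0 (x - y)) x v = ∫ y, (fderiv ℝ f y v) • ker 0 (x - y) := by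
  have : Nontrivial F := Module.nontrivial_of_finrank_pos (R := ℝ) (by omega)
  have h0 : ∀ᵐ y : F, y ≠ 0 := by simp [ae_iff]
  have hl : LocallyIntegrable (ker (F := F) 0) volume := locallyIntegrable_of_norm_le_rpow (C := 1)
    (α := (finrank ℝ F : ℝ) - 2) (by omega) (by linarith)
    (by filter_upwards [h0] with y hy using ker_le hN le_rfl hy) (ker_hom.aesm (by omega))
  have h := hfc.hasFDerivAt_convolution_right (ContinuousLinearMap.lsmul ℝ ℝ).flip hl hf x
  have e : (fun x => ∫ y, f y • ker 0 (x - y)) =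
      convolution (ker (F := F) 0) f (ContinuousLinearMap.lsmul ℝ ℝ).flip volume := by
    ext x; rw [convolution_eq_swap]; rfl
  rw [e, h.fderiv, convolution_precompR_apply _ hl (hfc.fderiv (𝕜 := ℝ)) (hf.continuous_fderiv (by norm_num))]
  rw [convolution_eq_swap]; rfl

lemma near_contDiff2 (hN : 3 ≤ finrank ℝ F) {f : F → ℝ} (hf : ContDiff ℝ 1 f) (hfc : HasCompactSupport f) :
    ContDiff ℝ 2 (fun x => ∫ y, f y • ker 0 (x - y)) := by
  have : (2 : WithTop ℕ∞) = 1 + 1 := by norm_num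
  rw [this, contDiff_succ_iff_fderiv_apply]
  refine ⟨fun x => (near_C1 hN hf.continuous hfc x).differentiableAt, by simp, fun v => ?_⟩
  have : (fun x => fderiv ℝ (fun x => ∫ y, f y • ker 0 (x - y)) x v) =
      fun x => ∫ y, (fderiv ℝ f y v) • ker 0 (x - y) := funext fun x => near_dir hN hf hfc v x
  rw [this]
  exact near_contDiff1 hN ((hf.continuous_fderiv (by norm_num)).clm_apply continuous_const)
    ((hfc.fderiv_apply (𝕜 := ℝ) v))

end newton
end Conc

namespace Conc
open Topology Set Module Metric

section newton2
variable {F : Type} [NormedAddCommGroup F] [InnerProductSpace ℝ F] [FiniteDimensional ℝ F]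
variable [MeasurableSpace F] [BorelSpace F]

/-- normalisation constant of the Newtonian kernel -/
def cN (F : Type) [NormedAddCommGroup F] [InnerProductSpace ℝ F] [FiniteDimensional ℝ F]
    [MeasurableSpace F] [BorelSpace F] : ℝ :=
  ∫ w : F, finrank ℝ F * ((finrank ℝ F : ℝ) - 2) * (1 + ‖w‖ ^ 2) ^ (-((finrank ℝ F : ℝ) + 2) / 2)

lemma prof_int : Integrable (fun w : F => (1 + ‖w‖ ^ 2) ^ (-((finrank ℝ F : ℝ) + 2) / 2)) :=
  integrable_rpow_neg_one_add_norm_sq (by linarith)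

lemma cN_pos (hN : 3 ≤ finrank ℝ F) : 0 < cN F := by
  have hN' : (3 : ℝ) ≤ finrank ℝ F := by exact_mod_cast hN
  have h : ∀ w : F, 0 < finrank ℝ F * ((finrank ℝ F : ℝ) - 2) *
      (1 + ‖w‖ ^ 2) ^ (-((finrank ℝ F : ℝ) + 2) / 2) := fun w =>
    mul_pos (mul_pos (by linarith) (by linarith)) (by positivity)
  unfold cN
  rw [integral_pos_iff_support_of_nonneg (fun w => (h w).le) (prof_int.const_mul _)]
  rw [Function.support_eq_univ (fun w => (h w).ne')]
  exact isOpen_univ.measure_pos volume univ_nonempty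

lemma near_pp (hN : 3 ≤ finrank ℝ F) {f : F → ℝ} (hf : ContDiff ℝ 1 f) (hfc : HasCompactSupport f)
    (x : F) (i) (n : ℕ) :
    (∫ y, (pd i f y) • dker (eps n) (x - y)) (stdOrthonormalBasis ℝ F i) =
      ∫ y, f y * pd i (pd i (ker (eps n))) (x - y) := by
  have hN' : (3 : ℝ) ≤ finrank ℝ F := by exact_mod_cast hN
  set b := stdOrthonormalBasis ℝ F i
  have hpc : Continuous (pd i f) := (hf.continuous_fderiv (by norm_num)).clm_apply continuous_const
  have hps : HasCompactSupport (pd i f) := hfc.fderiv_apply (𝕜 := ℝ) b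
  have hsm : ContDiff ℝ 2 (ker (F := F) (eps n)) := ker_smooth (n := 2) (eps_pos n)
  rw [ContinuousLinearMap.integral_apply (near_int (by omega) (by linarith)
    (dker_cont (eps_pos n)).aestronglyMeasurable (fun z hz => dker_le hN (eps_pos n).le hz) hpc hps x)]
  have e1 : ∀ z : F, dker (eps n) z b = pd i (ker (eps n)) z := fun z => by
    unfold pd; rw [(ker_hasFDerivAt (by have := eps_pos n; positivity)).fderiv]
  set g : F → ℝ := fun y => pd i (ker (eps n)) (x - y) with hg
  have hk1 : ContDiff ℝ 1 (pd i (ker (F := F) (eps n))) := by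
    rw [contDiff_iff_contDiffAt]; exact fun z => contDiffAt_pd (n := 1) hsm.contDiffAt i
  have hk2 : Continuous (pd i (pd i (ker (F := F) (eps n)))) :=
    (hk1.continuous_fderiv (by norm_num)).clm_apply continuous_const
  have hgd : ∀ y, HasFDerivAt g (-(fderiv ℝ (pd i (ker (eps n))) (x - y))) y := by
    intro y
    have h1 := ((hk1.differentiable (by norm_num)) (x - y)).hasFDerivAt.comp y
      ((hasFDerivAt_id y).const_sub x)
    refine h1.congr_fderiv ?_
    ext v; simp
  have hgd' : ∀ y, fderiv ℝ g y b = - pd i (pd i (ker (eps n))) (x - y) := fun y => by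
    rw [(hgd y).fderiv]; rfl
  have hgc : Continuous g := hk1.continuous.comp (continuous_const.sub continuous_id)
  have hg2c : Continuous fun y => - pd i (pd i (ker (eps n))) (x - y) :=
    (hk2.comp (continuous_const.sub continuous_id)).neg
  have key := integral_mul_fderiv_eq_neg_fderiv_mul_of_integrable (μ := volume) (f := f) (g := g) (v := b)
    ((hpc.mul hgc).integrable_of_hasCompactSupport hps.mul_right)
    (by simp_rw [hgd']; exact (hf.continuous.mul hg2c).integrable_of_hasCompactSupport hfc.mul_right)
    ((hf.continuous.mul hgc).integrable_of_hasCompactSupport hfc.mul_right)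
    (fun y _ => hf.differentiable (by norm_num) y) (fun y _ => (hgd y).differentiableAt)
  simp_rw [hgd'] at key
  have e2 : ∀ y, ((pd i f y) • dker (eps n) (x - y)) b = fderiv ℝ f y b * g y := fun y => by
    simp only [_root_.smul_apply, smul_eq_mul, e1]; rfl
  simp_rw [e2]
  simp only [mul_neg, integral_neg, neg_inj] at key
  exact key.symm

lemma near_lap_lim (hN : 3 ≤ finrank ℝ F) {f : F → ℝ} (hf : Continuous f) (hfc : HasCompactSupport f)
    (x : F) : Tendsto (fun n => ∫ y, f y * lap (ker (eps n)) (x - y)) atTop (𝓝 (- (cN F * f x))) := by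
  have e : ∀ n, ∫ y, f y * lap (ker (eps n)) (x - y) =
      ∫ w, f (x - (1 / ((n : ℝ) + 1)) • w) * (-(finrank ℝ F * ((finrank ℝ F : ℝ) - 2) *
        (1 + ‖w‖ ^ 2) ^ (-((finrank ℝ F : ℝ) + 2) / 2))) := by
    intro n
    set t := 1 / ((n : ℝ) + 1) with ht
    have ht0 : 0 < t := by positivity
    have he : eps n = t ^ 2 := rfl
    rw [← integral_sub_left_eq_self (fun y => f y * lap (ker (eps n)) (x - y)) volume x]
    simp only [sub_sub_cancel]
    have h2 : ∫ z, f (x - z) * lap (ker (eps n)) z =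
        t ^ finrank ℝ F • ∫ z, f (x - t • z) * lap (ker (eps n)) (t • z) := by
      rw [Measure.integral_comp_smul (volume : Measure F) (fun z => f (x - z) * lap (ker (eps n)) z) t,
        abs_of_pos (by positivity), smul_smul, mul_inv_cancel₀ (by positivity), one_smul]
    rw [h2, smul_eq_mul, ← integral_const_mul]
    congr 1
    ext w
    rw [ker_lap _ (by rw [he]; positivity), he, norm_smul, Real.norm_of_nonneg ht0.le]
    have h3 : (t * ‖w‖) ^ 2 + t ^ 2 = t ^ 2 * (1 + ‖w‖ ^ 2) := by ring
    rw [h3, mul_rpow (by positivity) (by positivity)]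
    have h4 : t ^ finrank ℝ F * (t ^ 2 * (t ^ 2) ^ (-((finrank ℝ F : ℝ) + 2) / 2)) = 1 := by
      rw [← rpow_natCast t 2, ← rpow_mul ht0.le, ← rpow_natCast t (finrank ℝ F), ← rpow_add ht0,
        ← rpow_add ht0]
      convert rpow_zero t using 2
      push_cast; ring
    generalize (1 + ‖w‖ ^ 2) ^ (-((finrank ℝ F : ℝ) + 2) / 2) = Q
    calc _ = f (x - t • w) * (-(finrank ℝ F * ((finrank ℝ F : ℝ) - 2) * Q)) *
        (t ^ finrank ℝ F * (t ^ 2 * (t ^ 2) ^ (-((finrank ℝ F : ℝ) + 2) / 2))) := by ring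
      _ = _ := by rw [h4, mul_one]
  simp_rw [e]
  have e0 : -(cN F * f x) = ∫ w : F, f x * (-(finrank ℝ F * ((finrank ℝ F : ℝ) - 2) *
        (1 + ‖w‖ ^ 2) ^ (-((finrank ℝ F : ℝ) + 2) / 2))) := by
    rw [integral_const_mul, integral_neg]; unfold cN; ring
  rw [e0]
  obtain ⟨B, hB⟩ := hfc.exists_bound_of_continuous hf
  have hpc := (prof_int (F := F)).const_mul (finrank ℝ F * ((finrank ℝ F : ℝ) - 2))
  refine tendsto_integral_of_dominated_convergence (fun w => B * ‖(-(finrank ℝ F * ((finrank ℝ F : ℝ) - 2) *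
        (1 + ‖w‖ ^ 2) ^ (-((finrank ℝ F : ℝ) + 2) / 2)))‖) ?_ (hpc.neg.norm.const_mul B) ?_ ?_
  · intro n
    exact ((hf.comp (continuous_const.sub (continuous_const_smul _))).aestronglyMeasurable).mul
      hpc.neg.aestronglyMeasurable
  · intro n
    refine ae_of_all _ fun w => ?_
    rw [norm_mul]; gcongr; exact hB _
  · refine ae_of_all _ fun w => ?_
    refine Tendsto.mul_const _ ?_
    have h1 : Tendsto (fun n : ℕ => x - (1 / ((n : ℝ) + 1)) • w) atTop (𝓝 (x - (0 : ℝ) • w)) :=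
      tendsto_const_nhds.sub ((tendsto_one_div_add_atTop_nhds_zero_nat (𝕜 := ℝ)).smul_const w)
    rw [zero_smul, sub_zero] at h1
    exact (hf.tendsto x).comp h1

lemma near_lap (hN : 3 ≤ finrank ℝ F) {f : F → ℝ} (hf : ContDiff ℝ 1 f) (hfc : HasCompactSupport f)
    (x : F) : lap (fun x => ∫ y, f y • ker 0 (x - y)) x = - (cN F * f x) := by
  have hN' : (3 : ℝ) ≤ finrank ℝ F := by exact_mod_cast hN
  refine tendsto_nhds_unique ?_ (near_lap_lim hN hf.continuous hfc x)
  have h1 : ∀ n, ∫ y, f y * lap (ker (eps n)) (x - y) =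
      ∑ i, (∫ y, (pd i f y) • dker (eps n) (x - y)) (stdOrthonormalBasis ℝ F i) := by
    intro n
    simp_rw [near_pp hN hf hfc x]
    rw [← integral_finsetSum]
    · congr 1; ext y; unfold lap; rw [Finset.mul_sum]
    · intro i _
      have hk2 : Continuous (pd i (pd i (ker (F := F) (eps n)))) := by
        have hsm : ContDiff ℝ 2 (ker (F := F) (eps n)) := ker_smooth (n := 2) (eps_pos n)
        have hk1 : ContDiff ℝ 1 (pd i (ker (F := F) (eps n))) := by
          rw [contDiff_iff_contDiffAt]; exact fun z => contDiffAt_pd (n := 1) hsm.contDiffAt i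
        exact (hk1.continuous_fderiv (by norm_num)).clm_apply continuous_const
      exact (hf.continuous.mul (hk2.comp (continuous_const.sub continuous_id))).integrable_of_hasCompactSupport
        hfc.mul_right
  simp_rw [h1]
  unfold lap
  refine tendsto_finsetSum _ fun i _ => ?_
  have hpc : Continuous (pd i f) := (hf.continuous_fderiv (by norm_num)).clm_apply continuous_const
  have hps : HasCompactSupport (pd i f) := hfc.fderiv_apply (𝕜 := ℝ) _
  have e1 : pd i (fun x => ∫ y, f y • ker 0 (x - y)) = fun x => ∫ y, pd i f y • ker 0 (x - y) :=
    funext fun x => near_dir hN hf hfc _ x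
  rw [e1]
  have e2 : pd i (fun x => ∫ y, pd i f y • ker 0 (x - y)) x =
      (∫ y, pd i f y • fderiv ℝ (ker 0) (x - y)) (stdOrthonormalBasis ℝ F i) := by
    rw [← (near_C1 hN hpc hps x).fderiv]; rfl
  rw [e2]
  have u1 := near_unif (by omega) (by linarith) (fun n => (dker_cont (F := F) (eps_pos n)).aestronglyMeasurable)
    ((ker_hom (F := F)).fderiv.aesm (by omega))
    (fun n z hz => dker_le hN (eps_pos n).le hz) (fun z hz => dker_lim hz) hpc hps x
  have := u1.tendsto_at (mem_ball_self one_pos)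
  exact ((ContinuousLinearMap.apply ℝ ℝ (stdOrthonormalBasis ℝ F i)).continuous.tendsto _).comp this

end newton2
end Conc

namespace Conc
open Topology Set Module Metric

section pot
variable {F : Type} [NormedAddCommGroup F] [InnerProductSpace ℝ F] [FiniteDimensional ℝ F]
variable [MeasurableSpace F] [BorelSpace F]

/-- admissible densities -/
structure Dens (f : F → ℝ) (C : ℝ) : Prop where
  cont : ∀ y, y ≠ 0 → ContinuousAt f y
  bd : ∀ y, y ≠ 0 → |f y| ≤ C * ‖y‖ ^ (-((finrank ℝ F : ℝ) / 2 + 1))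

/-- Newtonian potential -/
def Pot (f : F → ℝ) (x : F) : ℝ := ∫ y, f y • ker 0 (x - y)

lemma Hom_pd {k : F → ℝ} {d : ℝ} (h : Hom k d) (i) : Hom (pd i k) (d - 1) where
  smooth z hz := (h.fderiv.smooth z hz).clm_apply contDiffAt_const
  hom t ht z := by
    show fderiv ℝ k (t • z) _ = _
    rw [h.fderiv.hom t ht z]; rfl

/-- far hypotheses -/
lemma far_pd {k : F → ℝ} {d : ℝ} (hk : Hom k d) (hd : d ≤ 2 - finrank ℝ F) (hN : 3 ≤ finrank ℝ F)
    {f : F → ℝ} (hfm : AEStronglyMeasurable f volume) {C : ℝ}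
    (hf : ∀ y, y ≠ 0 → |f y| ≤ C * ‖y‖ ^ (-((finrank ℝ F : ℝ) / 2 + 1)))
    {x0 : F} {r : ℝ} (hr : 0 < r) (hf0 : ∀ y ∈ ball x0 (2 * r), f y = 0) {x : F} (hx : x ∈ ball x0 r) :
    Integrable (fun y => f y • k (x - y)) ∧
    (∀ i, pd i (fun x => ∫ y, f y • k (x - y)) x = ∫ y, f y • pd i k (x - y)) ∧
    ContDiffAt ℝ 2 (fun x => ∫ y, f y • k (x - y)) x ∧
    HasFDerivAt (fun x => ∫ y, f y • k (x - y)) (∫ y, f y • fderiv ℝ k (x - y)) x ∧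
    Integrable (fun y => f y • fderiv ℝ k (x - y)) := by
  have hN' : (3 : ℝ) ≤ finrank ℝ F := by exact_mod_cast hN
  have fd : ∀ {G : Type} [NormedAddCommGroup G] [NormedSpace ℝ G] {k : F → G} {d : ℝ},
      Hom k d → d ≤ 2 - finrank ℝ F → ∀ x ∈ ball x0 r,
      Integrable (fun y => f y • k (x - y)) ∧
      HasFDerivAt (fun x => ∫ y, f y • k (x - y)) (∫ y, f y • fderiv ℝ k (x - y)) x := by
    intro G _ _ k d hk hd x hx
    exact far_deriv (α := (finrank ℝ F : ℝ) - 2) hk (by linarith) (by omega) (by linarith)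
      (by linarith) (by linarith) (by linarith) hfm hf hr hf0 hx
  have h1 := fd hk hd x hx
  have h2 := fd hk.fderiv (by linarith) x hx
  refine ⟨h1.1, fun i => ?_, ?_, h1.2, h2.1⟩
  · unfold pd
    rw [h1.2.fderiv, ContinuousLinearMap.integral_apply h2.1]
    rfl
  · have hnb : ball x0 r ∈ 𝓝 x := isOpen_ball.mem_nhds hx
    rw [show (2 : WithTop ℕ∞) = ((1 : ℕ) : WithTop ℕ∞) + 1 by norm_num]
    rw [contDiffAt_succ_iff_hasFDerivAt]
    refine ⟨_, ⟨_, hnb, fun z hz => (fd hk hd z hz).2⟩, ?_⟩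
    rw [show ((1 : ℕ) : WithTop ℕ∞) = ((0 : ℕ) : WithTop ℕ∞) + 1 by norm_num]
    rw [contDiffAt_succ_iff_hasFDerivAt]
    refine ⟨_, ⟨_, hnb, fun z hz => (fd hk.fderiv (by linarith) z hz).2⟩, ?_⟩
    rw [Nat.cast_zero]
    rw [contDiffAt_zero]
    refine ⟨_, hnb, fun z hz => ?_⟩
    exact (fd hk.fderiv.fderiv (by linarith) z hz).2.continuousAt.continuousWithinAt

lemma far_lap (hN : 3 ≤ finrank ℝ F)
    {f : F → ℝ} (hfm : AEStronglyMeasurable f volume) {C : ℝ}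
    (hf : ∀ y, y ≠ 0 → |f y| ≤ C * ‖y‖ ^ (-((finrank ℝ F : ℝ) / 2 + 1)))
    {x0 : F} {r : ℝ} (hr : 0 < r) (hf0 : ∀ y ∈ ball x0 (2 * r), f y = 0) {x : F} (hx : x ∈ ball x0 r) :
    lap (Pot f) x = 0 := by
  have hN' : (3 : ℝ) ≤ finrank ℝ F := by exact_mod_cast hN
  have h1 : ∀ z ∈ ball x0 r, ∀ i, pd i (Pot f) z = ∫ y, f y • pd i (ker 0) (z - y) := fun z hz i =>
    (far_pd ker_hom le_rfl hN hfm hf hr hf0 hz).2.1 i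
  have h2 : ∀ i, pd i (pd i (Pot f)) x = ∫ y, f y • pd i (pd i (ker 0)) (x - y) := by
    intro i
    have e : pd i (Pot f) =ᶠ[𝓝 x] fun x => ∫ y, f y • pd i (ker 0) (x - y) := by
      filter_upwards [isOpen_ball.mem_nhds hx] with z hz using h1 z hz i
    rw [pd_congr e]
    exact (far_pd (Hom_pd ker_hom i) (by linarith) hN hfm hf hr hf0 hx).2.1 i
  unfold lap
  simp_rw [h2]
  rw [← integral_finsetSum]
  · refine integral_eq_zero_of_ae (ae_of_all _ fun y => ?_)
    show ∑ i, f y • pd i (pd i (ker 0)) (x - y) = 0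
    by_cases hy : f y = 0
    · simp [hy]
    · rw [← Finset.smul_sum]
      have hxy : x - y ≠ 0 := by
        intro h0
        rw [sub_eq_zero] at h0
        apply hy; apply hf0; rw [← h0]
        exact ball_subset_ball (by linarith) hx
      have := ker_lap (ε := 0) (x - y) (by have := norm_pos_iff.2 hxy; positivity)
      unfold lap at this
      rw [this]; simp
  · intro i _
    exact (far_pd (Hom_pd (Hom_pd ker_hom i) i) (by linarith) hN hfm hf hr hf0 hx).1

lemma Dens.aesm {f : F → ℝ} {C : ℝ} (h : Dens f C) (hN : 3 ≤ finrank ℝ F) :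
    AEStronglyMeasurable f volume := aesm_of_contOn h.cont (by omega)

/-- splitting -/
lemma pot_split (hN : 3 ≤ finrank ℝ F) {f : F → ℝ} {C : ℝ} (hf : Dens f C) {x0 : F} {r : ℝ} (hr : 0 < r)
    (hr3 : 3 * r < ‖x0‖) : ∃ f1 f2 : F → ℝ, (∀ y, f y = f1 y + f2 y) ∧ Continuous f1 ∧ HasCompactSupport f1 ∧
      ((∀ y ∈ ball x0 (4 * r), ContDiffAt ℝ 1 f y) → ContDiff ℝ 1 f1) ∧
      (∀ y ∈ ball x0 (2 * r), f2 y = 0) ∧ AEStronglyMeasurable f2 volume ∧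
      (∀ y, y ≠ 0 → |f2 y| ≤ C * ‖y‖ ^ (-((finrank ℝ F : ℝ) / 2 + 1))) := by
  let χ : ContDiffBump x0 := ⟨2 * r, 3 * r, by linarith, by linarith⟩
  have hz : ∀ y, y ∉ closedBall x0 (3 * r) → (fun y => χ y * f y) =ᶠ[𝓝 y] fun _ => 0 := by
    intro y hy
    filter_upwards [isClosed_closedBall.isOpen_compl.mem_nhds hy] with w hw
    have : χ w = 0 := by
      apply χ.zero_of_le_dist
      simp only [mem_compl_iff, mem_closedBall, not_le] at hw
      exact hw.le
    simp [this]
  have hne : ∀ y ∈ closedBall x0 (3 * r), y ≠ 0 := by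
    rintro y hy rfl
    rw [mem_closedBall, dist_eq_norm, zero_sub, norm_neg] at hy; linarith
  have hc : Continuous fun y => χ y * f y := by
    rw [continuous_iff_continuousAt]
    intro y
    by_cases hy : y ∈ closedBall x0 (3 * r)
    · exact χ.continuous.continuousAt.mul (hf.cont y (hne y hy))
    · exact (continuousAt_const).congr (hz y hy).symm
  refine ⟨fun y => χ y * f y, fun y => (1 - χ y) * f y, fun y => by ring, hc,
    χ.hasCompactSupport.mul_right, ?_, ?_, ?_, ?_⟩
  · intro h
    rw [contDiff_iff_contDiffAt]
    intro y
    by_cases hy : y ∈ closedBall x0 (3 * r)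
    · exact χ.contDiffAt.mul (h y (closedBall_subset_ball (by linarith) hy))
    · exact contDiffAt_const.congr_of_eventuallyEq (hz y hy)
  · intro y hy
    have : χ y = 1 := χ.one_of_mem_closedBall (ball_subset_closedBall hy)
    simp [this]
  · exact (aestronglyMeasurable_const.sub χ.continuous.aestronglyMeasurable).mul (hf.aesm hN)
  · intro y hy
    rw [abs_mul]
    refine le_trans ?_ (hf.bd y hy)
    have h1 : |1 - χ y| ≤ 1 := by
      rw [abs_le]; constructor <;> linarith [χ.nonneg (x := y), χ.le_one (x := y)]
    nlinarith [abs_nonneg (f y)]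

lemma pot_main (hN : 3 ≤ finrank ℝ F) {f : F → ℝ} {C : ℝ} (hf : Dens f C) {x : F} (hx : x ≠ 0) :
    Integrable (fun y => f y • ker 0 (x - y)) ∧
    ContDiffAt ℝ 1 (Pot f) x ∧ fderiv ℝ (Pot f) x = ∫ y, f y • fderiv ℝ (ker 0) (x - y) ∧
    ((∀ᶠ y in 𝓝 x, ContDiffAt ℝ 1 f y) → ContDiffAt ℝ 2 (Pot f) x ∧ lap (Pot f) x = - (cN F * f x)) := by
  have hN' : (3 : ℝ) ≤ finrank ℝ F := by exact_mod_cast hN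
  have hx' : 0 < ‖x‖ := norm_pos_iff.2 hx
  have gen : ∀ r, 0 < r → 3 * r < ‖x‖ → ∃ f1 f2 : F → ℝ, Pot f =ᶠ[𝓝 x] (Pot f1 + Pot f2) ∧
      Integrable (fun y => f y • ker 0 (x - y)) ∧
      (∫ y, f y • fderiv ℝ (ker 0) (x - y) = (∫ y, f1 y • fderiv ℝ (ker 0) (x - y)) +
        ∫ y, f2 y • fderiv ℝ (ker 0) (x - y)) ∧
      Continuous f1 ∧ HasCompactSupport f1 ∧
      ((∀ y ∈ ball x (4 * r), ContDiffAt ℝ 1 f y) → ContDiff ℝ 1 f1) ∧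
      f1 x = f x ∧ ContDiffAt ℝ 2 (Pot f2) x ∧ lap (Pot f2) x = 0 ∧
      HasFDerivAt (Pot f2) (∫ y, f2 y • fderiv ℝ (ker 0) (x - y)) x := by
    intro r hr hr3
    obtain ⟨f1, f2, h12, c1, s1, d1, z2, m2, b2⟩ := pot_split hN hf hr hr3
    have I1 : ∀ z, Integrable (fun y => f1 y • ker 0 (z - y)) := fun z =>
      near_int (C := 1) (by omega) (α := (finrank ℝ F : ℝ) - 2) (by linarith) (ker_hom.aesm (by omega))
        (fun w hw => ker_le hN le_rfl hw) c1 s1 z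
    have I1' := near_int (by omega) (by linarith) (ker_meas_bound hN).1 (ker_meas_bound hN).2 c1 s1 x
    have fp : ∀ z ∈ ball x r, _ := fun z hz => far_pd ker_hom le_rfl hN m2 b2 hr z2 hz
    have hs := mem_ball_self hr (x := x)
    refine ⟨f1, f2, ?_, ?_, ?_, c1, s1, d1, ?_, (fp x hs).2.2.1, far_lap hN m2 b2 hr z2 hs, (fp x hs).2.2.2.1⟩
    · filter_upwards [ball_mem_nhds x hr] with z hz
      simp only [Pot, Pi.add_apply]
      rw [← integral_add (I1 z) (fp z hz).1]
      simp_rw [h12, add_smul]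
    · simp_rw [h12, add_smul]; exact (I1 x).add (fp x hs).1
    · rw [← integral_add I1' (fp x hs).2.2.2.2]
      simp_rw [h12, add_smul]
    · rw [h12, z2 x (mem_ball_self (by linarith)), add_zero]
  obtain ⟨f1, f2, e, I, e', c1, s1, -, -, c2, -, hd⟩ := gen (‖x‖ / 4) (by positivity) (by linarith)
  refine ⟨I, ?_, ?_, fun h => ?_⟩
  · refine ContDiffAt.congr_of_eventuallyEq ?_ e
    exact (near_contDiff1 hN c1 s1).contDiffAt.add (c2.of_le (by norm_num))
  · rw [e.fderiv_eq, e']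
    exact ((near_C1 hN c1 s1 x).add hd).fderiv
  · obtain ⟨ρ, hρ, hb⟩ := Metric.eventually_nhds_iff_ball.1 h
    obtain ⟨f1, f2, e, I, e', c1, s1, d1, ex, c2, l2, hd⟩ := gen (min (ρ / 4) (‖x‖ / 4)) (by positivity)
      (by have := min_le_right (ρ / 4) (‖x‖ / 4); linarith)
    have d1' := d1 fun y hy => hb y (ball_subset_ball
      (by have := min_le_left (ρ / 4) (‖x‖ / 4); linarith) hy)
    have cd1 : ContDiffAt ℝ 2 (Pot f1) x := (near_contDiff2 hN d1' s1).contDiffAt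
    refine ⟨(cd1.add c2).congr_of_eventuallyEq e, ?_⟩
    rw [lap_congr e, show (Pot f1 + Pot f2) = fun z => Pot f1 z + Pot f2 z from rfl, lap_add cd1 c2, l2, ← ex]
    rw [add_zero]
    exact near_lap hN d1' s1 x

/-- uniform bounds for potentials on annuli -/
lemma pot_bounds (hN : 3 ≤ finrank ℝ F) {r0 R0 : ℝ} (hr0 : 0 < r0) :
    ∃ B, 0 < B ∧ ∀ (f : F → ℝ) (C : ℝ), 0 ≤ C → Dens f C → ∀ x : F, r0 ≤ ‖x‖ → ‖x‖ ≤ R0 →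
      |Pot f x| ≤ B * C ∧ ‖fderiv ℝ (Pot f) x‖ ≤ B * C := by
  have hN' : (3 : ℝ) ≤ finrank ℝ F := by exact_mod_cast hN
  have : Nontrivial F := Module.nontrivial_of_finrank_pos (R := ℝ) (by omega)
  have h0 : ∀ᵐ y : F, y ≠ 0 := by simp [ae_iff]
  obtain ⟨B1, hB1, h1⟩ := weight_bound (F := F) (α := (finrank ℝ F : ℝ) - 2) (β := (finrank ℝ F : ℝ) / 2 + 1) (R0 := R0)
    (by omega) (by linarith) (by linarith) (by linarith) (by linarith) (by linarith) hr0
  obtain ⟨B2, hB2, h2⟩ := weight_bound (F := F) (α := (finrank ℝ F : ℝ) - 1) (β := (finrank ℝ F : ℝ) / 2 + 1) (R0 := R0)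
    (by omega) (by linarith) (by linarith) (by linarith) (by linarith) (by linarith) hr0
  have gen : ∀ {G : Type} [NormedAddCommGroup G] [NormedSpace ℝ G] (k : F → G) (A α B C : ℝ) (f : F → ℝ) (x : F),
      0 ≤ A → 0 ≤ C → Dens f C → (∀ z, z ≠ 0 → ‖k z‖ ≤ A * ‖z‖ ^ (-α)) →
      Integrable (fun y => ‖x - y‖ ^ (-α) * ‖y‖ ^ (-((finrank ℝ F : ℝ) / 2 + 1))) →
      ∫ y, ‖x - y‖ ^ (-α) * ‖y‖ ^ (-((finrank ℝ F : ℝ) / 2 + 1)) ≤ B → 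
      ‖∫ y, f y • k (x - y)‖ ≤ A * B * C := by
    intro G _ _ k A α B C f x hA hC hf hk hi hB
    have hx0 : ∀ᵐ y : F, y ≠ x := by simp [ae_iff]
    calc _ ≤ ∫ y, (A * C) * (‖x - y‖ ^ (-α) * ‖y‖ ^ (-((finrank ℝ F : ℝ) / 2 + 1))) := by
          refine norm_integral_le_of_norm_le (hi.const_mul _) ?_
          filter_upwards [h0, hx0] with y hy hyx
          rw [norm_smul, Real.norm_eq_abs]
          calc _ ≤ (C * ‖y‖ ^ (-((finrank ℝ F : ℝ) / 2 + 1))) * (A * ‖x - y‖ ^ (-α)) := by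
                gcongr
                · exact hf.bd y hy
                · exact hk _ (sub_ne_zero.2 (Ne.symm hyx))
            _ = _ := by ring
      _ = (A * C) * _ := integral_const_mul _ _
      _ ≤ (A * C) * B := by gcongr
      _ = _ := by ring
  refine ⟨B1 + finrank ℝ F * B2, by positivity, fun f C hC hf x hx1 hx2 => ?_⟩
  have hxn : x ≠ 0 := norm_pos_iff.1 (hr0.trans_le hx1)
  constructor
  · have := gen (ker 0) 1 _ B1 C f x zero_le_one hC hf (fun z hz => ker_le hN le_rfl hz) (h1 x hx1 hx2).1 (h1 x hx1 hx2).2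
    rw [Real.norm_eq_abs] at this
    refine this.trans ?_
    have : 0 ≤ finrank ℝ F * B2 * C := by positivity
    nlinarith
  · rw [(pot_main hN hf hxn).2.2.1]
    refine (gen _ _ _ B2 C f x (by positivity) hC hf (ker_meas_bound hN).2 (h2 x hx1 hx2).1 (h2 x hx1 hx2).2).trans ?_
    have : 0 ≤ B1 * C := by positivity
    nlinarith

end pot
end Conc

namespace Conc
open Topology Set Module Metric

section ext
variable {F : Type} [NormedAddCommGroup F] [InnerProductSpace ℝ F] [FiniteDimensional ℝ F]
variable [MeasurableSpace F] [BorelSpace F]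

open EuclideanGeometry

lemma inv_int (hN : 3 ≤ finrank ℝ F) {R : ℝ} (hR : 0 < R) (g : F → ℝ) :
    ∫ y, g y = ∫ y, (R / ‖y‖) ^ (2 * finrank ℝ F) * g (inversion 0 R y) := by
  have : Nontrivial F := Module.nontrivial_of_finrank_pos (R := ℝ) (by omega)
  have him : inversion (0 : F) R '' ({0}ᶜ) = {0}ᶜ := by
    rw [Set.image_compl_eq (inversion_bijective 0 hR.ne'), Set.image_singleton, inversion_self]
  have h := integral_image_eq_integral_abs_det_fderiv_smul (volume : Measure F) (s := {0}ᶜ)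
    (f := inversion (0 : F) R)
    (f' := fun x => ((R / dist x 0) ^ 2 • ((ℝ ∙ (x - 0))ᗮ.reflection : F →L[ℝ] F)))
    (measurableSet_singleton _).compl
    (fun x hx => (hasFDerivAt_inversion (by simpa using hx)).hasFDerivWithinAt)
    (inversion_injective 0 hR.ne').injOn g
  rw [him, restrict_compl_singleton] at h
  rw [h]
  congr 1
  ext y
  rw [smul_eq_mul]
  congr 1
  have : ((R / dist y 0) ^ 2 • ((ℝ ∙ (y - 0))ᗮ.reflection : F →L[ℝ] F)).det =
      ((R / ‖y‖) ^ 2) ^ finrank ℝ F * LinearMap.det ((ℝ ∙ (y - 0))ᗮ.reflection.toLinearMap) := by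
    unfold ContinuousLinearMap.det
    rw [dist_zero_right, ContinuousLinearMap.toLinearMap_smul, LinearMap.det_smul]
    rfl
  rw [this, Submodule.det_reflection, abs_mul, abs_pow, abs_pow (-1 : ℝ), abs_neg, abs_one, one_pow, mul_one,
    abs_of_nonneg (by positivity), pow_mul]

lemma inv_norm {R : ℝ} {y : F} (hy : y ≠ 0) : ‖inversion (0 : F) R y‖ = R ^ 2 / ‖y‖ := by
  have := dist_inversion_center (0 : F) y R
  simpa using this

lemma inv_eq {R : ℝ} {y : F} : inversion (0 : F) R y = (R / ‖y‖) ^ 2 • y := by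
  simp [inversion]

lemma inv_sub {R : ℝ} (hR : 0 < R) {x y : F} (hx : ‖x‖ = R) (hy : y ≠ 0) :
    ‖x - inversion (0 : F) R y‖ = R / ‖y‖ * ‖x - y‖ := by
  have hx0 : x ≠ 0 := by rintro rfl; simp at hx; linarith
  have h1 : inversion (0 : F) R x = x := by rw [inv_eq, hx, div_self hR.ne']; simp
  have h2 := dist_inversion_inversion hx0 hy R
  rw [h1, dist_eq_norm, dist_zero_right, dist_zero_right, hx, dist_eq_norm] at h2
  rw [h2]; field_simp

/-- odd densities have potentials vanishing on the sphere -/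
lemma pot_zero (hN : 3 ≤ finrank ℝ F) {R : ℝ} (hR : 0 < R) {f : F → ℝ}
    (hf : ∀ y, y ≠ 0 → f (inversion 0 R y) = - ((‖y‖ / R) ^ (finrank ℝ F + 2) * f y)) {x : F} (hx : ‖x‖ = R) :
    Pot f x = 0 := by
  have hN' : (3 : ℝ) ≤ finrank ℝ F := by exact_mod_cast hN
  have : Nontrivial F := Module.nontrivial_of_finrank_pos (R := ℝ) (by omega)
  have h0 : ∀ᵐ y : F, y ≠ 0 := by simp [ae_iff]
  have h : Pot f x = - Pot f x := by
    conv_lhs => unfold Pot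
    rw [inv_int hN hR]
    unfold Pot
    rw [← integral_neg]
    refine integral_congr_ae ?_
    filter_upwards [h0] with y hy
    have hy' : 0 < ‖y‖ := norm_pos_iff.2 hy
    rw [hf y hy, ker_zero_eq, ker_zero_eq, inv_sub hR hx hy, mul_rpow (by positivity) (by positivity)]
    have e : (R / ‖y‖) ^ (2 * finrank ℝ F) * ((‖y‖ / R) ^ (finrank ℝ F + 2) * (R / ‖y‖) ^ (2 - (finrank ℝ F : ℝ))) = 1 := by
      have h1 : ‖y‖ / R = (R / ‖y‖)⁻¹ := by rw [inv_div]
      rw [h1]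
      have ht : 0 < R / ‖y‖ := by positivity
      generalize R / ‖y‖ = t at ht
      rw [← rpow_natCast, inv_pow, ← rpow_natCast t (_ + 2), ← rpow_neg ht.le, ← rpow_add ht, ← rpow_add ht]
      convert rpow_zero t using 2
      push_cast; ring
    simp only [smul_eq_mul]
    calc _ = -(f y * ‖x - y‖ ^ (2 - (finrank ℝ F : ℝ))) * ((R / ‖y‖) ^ (2 * finrank ℝ F) *
        ((‖y‖ / R) ^ (finrank ℝ F + 2) * (R / ‖y‖) ^ (2 - (finrank ℝ F : ℝ)))) := by ring
      _ = _ := by rw [e, mul_one]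
  linarith

/-- the annulus -/
def DD (F : Type) [NormedAddCommGroup F] (al be : ℝ) : Set F := {z | al < ‖z‖ ∧ ‖z‖ < be}

lemma DD_open (al be : ℝ) : IsOpen (DD F al be) :=
  (isOpen_lt continuous_const continuous_norm).inter (isOpen_lt continuous_norm continuous_const)

/-- angular log coordinate -/
def sg (al be : ℝ) (y : F) : ℝ := π * (log (‖y‖ / al) / log (be / al))

/-- folded radius -/
def rh (al be : ℝ) (y : F) : ℝ := al * exp (arccos (cos (sg al be y)) / π * log (be / al))

/-- folding map -/
def pr (al be : ℝ) (y : F) : F := (rh al be y / ‖y‖) • y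

/-- odd Kelvin extension -/
def Fx (al be : ℝ) (f : F → ℝ) (y : F) : ℝ :=
  ‖y‖ ^ (-((finrank ℝ F : ℝ) / 2 + 1)) *
    (SignType.sign (sin (sg al be y)) * (‖pr al be y‖ ^ ((finrank ℝ F : ℝ) / 2 + 1) * f (pr al be y)))

variable {al be : ℝ}

lemma log_pos' (hal : 0 < al) (hab : al < be) : 0 < log (be / al) :=
  log_pos ((one_lt_div hal).2 hab)

lemma rh_bd (hal : 0 < al) (hab : al < be) (y : F) : al ≤ rh al be y ∧ rh al be y ≤ be := by
  have hL := log_pos' hal hab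
  have h1 : 0 ≤ arccos (cos (sg al be y)) / π := div_nonneg (arccos_nonneg _) pi_pos.le
  have h2 : arccos (cos (sg al be y)) / π ≤ 1 := (div_le_one pi_pos).2 (arccos_le_pi _)
  unfold rh
  constructor
  · have : 1 ≤ exp (arccos (cos (sg al be y)) / π * log (be / al)) := one_le_exp (by positivity)
    nlinarith
  · have : exp (arccos (cos (sg al be y)) / π * log (be / al)) ≤ exp (log (be / al)) := by
      apply exp_le_exp.2; nlinarith
    rw [exp_log (by have := hal.trans hab; positivity)] at this
    calc _ ≤ al * (be / al) := by gcongr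
      _ = be := by field_simp

lemma pr_norm (hal : 0 < al) (hab : al < be) {y : F} (hy : y ≠ 0) : ‖pr al be y‖ = rh al be y := by
  have hy' : 0 < ‖y‖ := norm_pos_iff.2 hy
  have := (rh_bd hal hab y).1
  unfold pr
  rw [norm_smul, norm_div, norm_norm, Real.norm_of_nonneg (by linarith)]
  field_simp

lemma pr_cont (hal : 0 < al) (hab : al < be) {y : F} (hy : y ≠ 0) : ContinuousAt (pr al be) y ∧
    ContinuousAt (sg (F := F) al be) y := by
  have hy' : 0 < ‖y‖ := norm_pos_iff.2 hy
  have h1 : ContinuousAt (sg (F := F) al be) y := by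
    unfold sg
    exact continuousAt_const.mul ((ContinuousAt.log (continuousAt_id.norm.div_const _) (by show ‖y‖ / al ≠ 0; positivity)).div_const _)
  refine ⟨?_, h1⟩
  unfold pr rh
  refine ContinuousAt.smul (ContinuousAt.div ?_ continuousAt_id.norm hy'.ne') continuousAt_id
  refine continuousAt_const.mul (ContinuousAt.rexp ?_)
  refine ContinuousAt.mul (ContinuousAt.div_const ?_ _) continuousAt_const
  exact continuous_arccos.continuousAt.comp (continuous_cos.continuousAt.comp h1)

lemma pr_id (hal : 0 < al) (hab : al < be) {y : F} (hy : y ∈ DD F al be) : pr al be y = y ∧ 0 < sin (sg al be y) := by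
  have hL := log_pos' hal hab
  have hy' : 0 < ‖y‖ := hal.trans hy.1
  have h1 : 0 < log (‖y‖ / al) := log_pos ((one_lt_div hal).2 hy.1)
  have h2 : log (‖y‖ / al) < log (be / al) := log_lt_log (by positivity) (by have := hy.2; gcongr)
  have h3 : 0 < sg al be y := by unfold sg; have := pi_pos; positivity
  have h4 : sg al be y < π := by
    unfold sg
    have := (div_lt_one hL).2 h2
    nlinarith [pi_pos]
  refine ⟨?_, sin_pos_of_pos_of_lt_pi h3 h4⟩
  have : rh al be y = ‖y‖ := by
    unfold rh
    rw [arccos_cos h3.le h4.le]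
    have : sg al be y / π * log (be / al) = log (‖y‖ / al) := by
      unfold sg; have := pi_pos.ne'; field_simp
    rw [this, exp_log (by positivity)]; field_simp
  unfold pr
  rw [this, div_self hy'.ne', one_smul]

lemma Fx_id (hal : 0 < al) (hab : al < be) (f : F → ℝ) {y : F} (hy : y ∈ DD F al be) : Fx al be f y = f y := by
  have hy' : 0 < ‖y‖ := hal.trans hy.1
  unfold Fx
  rw [(pr_id hal hab hy).1, sign_pos (pr_id hal hab hy).2, ← mul_assoc, ← mul_assoc, rpow_neg hy'.le]
  have : ‖y‖ ^ ((finrank ℝ F : ℝ) / 2 + 1) ≠ 0 := (rpow_pos_of_pos hy' _).ne'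
  simp only [SignType.coe_one, mul_one]
  rw [inv_mul_cancel₀ this, one_mul]

/-- `f` vanishes at folded points where the sine vanishes -/
lemma fold_zero (hal : 0 < al) (hab : al < be) {f : F → ℝ} (hf0 : ∀ z, z ∉ DD F al be → f z = 0) {y : F} (hy : y ≠ 0)
    (h : sin (sg al be y) = 0) : f (pr al be y) = 0 := by
  apply hf0
  intro hD
  have hn := pr_norm hal hab hy
  have hL := log_pos' hal hab
  have hc := sin_sq_add_cos_sq (sg al be y)
  rw [h] at hc
  have hc2 : cos (sg al be y) = 1 ∨ cos (sg al be y) = -1 := by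
    rw [← sq_eq_one_iff]; linarith
  rcases hc2 with hc2 | hc2
  · have : rh al be y = al := by unfold rh; rw [hc2]; simp
    have := hD.1; linarith
  · have : rh al be y = be := by
      unfold rh; rw [hc2, arccos_neg_one, div_self pi_pos.ne', one_mul, exp_log (by have := hal.trans hab; positivity)]
      field_simp
    have := hD.2; linarith

lemma Fx_dens (hal : 0 < al) (hab : al < be) {f : F → ℝ} (hf : Continuous f)
    (hf0 : ∀ z, z ∉ DD F al be → f z = 0) {M : ℝ} (hM : ∀ z, |f z| ≤ M) :
    Dens (Fx al be f) (be ^ ((finrank ℝ F : ℝ) / 2 + 1) * M) where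
  cont y hy := by
    have hy' : 0 < ‖y‖ := norm_pos_iff.2 hy
    have hp := pr_cont hal hab hy
    unfold Fx
    refine ContinuousAt.mul (continuousAt_id.norm.rpow_const (Or.inl hy'.ne')) ?_
    have hH : ContinuousAt (fun y => ‖pr al be y‖ ^ ((finrank ℝ F : ℝ) / 2 + 1) * f (pr al be y)) y :=
      (hp.1.norm.rpow_const (Or.inr (by positivity))).mul (hf.continuousAt.comp hp.1)
    by_cases hs : sin (sg al be y) = 0
    · have hz := fold_zero hal hab hf0 hy hs
      have hH0 : Tendsto (fun y => ‖pr al be y‖ ^ ((finrank ℝ F : ℝ) / 2 + 1) * f (pr al be y)) (𝓝 y) (𝓝 0) := by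
        have := hH.tendsto; simpa [hz] using this
      show Tendsto _ _ _
      simp only [hz, mul_zero]
      refine squeeze_zero_norm (fun z => ?_) (tendsto_norm_zero.comp hH0)
      rw [norm_mul]
      have : ‖((SignType.sign (sin (sg al be z)) : SignType) : ℝ)‖ ≤ 1 := by
        rcases SignType.sign (sin (sg al be z)) with _ | _ | _ <;> simp
      simp only [Function.comp]
      exact mul_le_of_le_one_left (norm_nonneg _) this
    · refine ContinuousAt.mul ?_ hH
      have hsc : ContinuousAt (fun y : F => sin (sg al be y)) y := continuous_sin.continuousAt.comp hp.2
      rcases lt_or_gt_of_ne hs with h | h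
      · refine (continuousAt_const (y := (-1 : ℝ))).congr ?_
        filter_upwards [hsc.eventually (gt_mem_nhds h)] with z hz
        rw [sign_neg hz]; simp
      · refine (continuousAt_const (y := (1 : ℝ))).congr ?_
        filter_upwards [hsc.eventually (lt_mem_nhds h)] with z hz
        rw [sign_pos hz]; simp
  bd y hy := by
    have hb := rh_bd hal hab y
    unfold Fx
    rw [abs_mul, abs_mul, abs_mul, abs_of_nonneg (by positivity), mul_comm,
      abs_of_nonneg (by positivity : 0 ≤ ‖pr al be y‖ ^ ((finrank ℝ F : ℝ) / 2 + 1)), pr_norm hal hab hy]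
    have : |((SignType.sign (sin (sg al be y)) : SignType) : ℝ)| ≤ 1 := by
      rcases SignType.sign (sin (sg al be y)) with _ | _ | _ <;> simp
    have h0 : 0 ≤ rh al be y := by linarith
    refine mul_le_mul_of_nonneg_right ?_ (by positivity)
    refine (mul_le_of_le_one_left (by positivity) this).trans ?_
    have hbe := hal.trans hab
    gcongr
    · exact hb.2
    · exact hM _

lemma Fx_inv (hal : 0 < al) (hab : al < be) (f : F → ℝ) {R : ℝ} (hR : R = al ∨ R = be) {y : F} (hy : y ≠ 0) :
    Fx al be f (inversion 0 R y) = - ((‖y‖ / R) ^ (finrank ℝ F + 2) * Fx al be f y) := by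
  have hL := log_pos' hal hab
  have hbe := hal.trans hab
  have hR0 : 0 < R := by rcases hR with rfl | rfl <;> assumption
  have hy' : 0 < ‖y‖ := norm_pos_iff.2 hy
  have hn := inv_norm (R := R) hy
  have hsc : cos (sg al be (inversion 0 R y)) = cos (sg al be y) ∧
      sin (sg al be (inversion 0 R y)) = - sin (sg al be y) := by
    rcases hR with rfl | rfl
    · have : sg R be (inversion 0 R y) = - sg R be y := by
        unfold sg
        rw [hn, show R ^ 2 / ‖y‖ / R = (‖y‖ / R)⁻¹ by field_simp, log_inv]; ring
      rw [this]; exact ⟨cos_neg _, sin_neg _⟩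
    · have : sg al R (inversion 0 R y) = 2 * π - sg al R y := by
        unfold sg
        rw [hn, show R ^ 2 / ‖y‖ / al = (R / al) ^ 2 / (‖y‖ / al) by field_simp, log_div (by positivity) (by positivity),
          log_pow]
        push_cast; field_simp
      rw [this]; exact ⟨cos_two_pi_sub _, sin_two_pi_sub _⟩
  have hrh : rh al be (inversion 0 R y) = rh al be y := by unfold rh; rw [hsc.1]
  have hpr : pr al be (inversion 0 R y) = pr al be y := by
    unfold pr
    rw [hrh, hn, inv_eq, smul_smul]
    congr 1
    field_simp
  unfold Fx
  rw [hpr, hsc.2, Left.sign_neg, hn]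
  have e : (R ^ 2 / ‖y‖) ^ (-((finrank ℝ F : ℝ) / 2 + 1)) = (‖y‖ / R) ^ (finrank ℝ F + 2) * ‖y‖ ^ (-((finrank ℝ F : ℝ) / 2 + 1)) := by
    have e1 : R ^ 2 / ‖y‖ = ((‖y‖ / R) ^ 2)⁻¹ * ‖y‖ := by field_simp
    rw [e1, mul_rpow (by positivity) (by positivity)]
    congr 1
    rw [rpow_neg (by positivity), ← inv_rpow (by positivity), inv_inv, ← rpow_natCast _ 2, ← rpow_mul (by positivity),
      ← rpow_natCast]
    congr 1; push_cast; ring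
  rw [e]
  push_cast
  ring

/-- linear isometries -/
lemma Fx_iso (A : F ≃ₗᵢ[ℝ] F) {f : F → ℝ} (hf : ∀ z, f (A z) = f z) (y : F) : Fx al be f (A y) = Fx al be f y := by
  have h1 : sg al be (A y) = sg al be y := by unfold sg; rw [A.norm_map]
  have h2 : pr al be (A y) = A (pr al be y) := by unfold pr rh; rw [h1, A.norm_map, map_smul]
  unfold Fx
  rw [h1, h2, A.norm_map, A.norm_map, hf]

lemma Pot_iso (A : F ≃ₗᵢ[ℝ] F) {f : F → ℝ} (hf : ∀ z, f (A z) = f z) (x : F) : Pot f (A x) = Pot f x := by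
  unfold Pot
  rw [← A.measurePreserving.integral_comp A.toHomeomorph.measurableEmbedding]
  congr 1; ext y
  rw [hf, ← map_sub]
  unfold ker
  rw [A.norm_map]

end ext
end Conc

namespace Conc
open Topology Set Module Metric

section green
variable {F : Type} [NormedAddCommGroup F] [InnerProductSpace ℝ F] [FiniteDimensional ℝ F]
variable [MeasurableSpace F] [BorelSpace F]
variable {al be : ℝ}

/-- potential -/
def VV (z : F) : ℝ := 1 / (2 * ‖z‖)

/-- the function class -/
structure Cls (e : F) (al be : ℝ) (h : F → ℝ) : Prop where
  cont : Continuous h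
  zero : ∀ z, z ∉ DD F al be → h z = 0
  sym : ∀ A : F ≃ₗᵢ[ℝ] F, A e = e → ∀ z, h (A z) = h z

variable {e : F}

lemma Cls.add {h g : F → ℝ} (hh : Cls e al be h) (hg : Cls e al be g) : Cls e al be (fun z => h z + g z) :=
  ⟨hh.cont.add hg.cont, fun z hz => by simp [hh.zero z hz, hg.zero z hz], fun A hA z => by
    rw [hh.sym A hA, hg.sym A hA]⟩

lemma Cls.comp {h : F → ℝ} (hh : Cls e al be h) {g : ℝ → ℝ} (hg : Continuous g) (h0 : g 0 = 0) :
    Cls e al be (fun z => g (h z)) :=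
  ⟨hg.comp hh.cont, fun z hz => by simp [hh.zero z hz, h0], fun A hA z => by rw [hh.sym A hA]⟩

lemma Cls.smul {h : F → ℝ} (hh : Cls e al be h) (c : ℝ) : Cls e al be (fun z => c * h z) :=
  hh.comp (g := fun t => c * t) (by fun_prop) (by simp)

lemma cD_compact : IsCompact {z : F | al ≤ ‖z‖ ∧ ‖z‖ ≤ be} := by
  refine (isCompact_closedBall (0 : F) be).of_isClosed_subset
    ((isClosed_le continuous_const continuous_norm).inter (isClosed_le continuous_norm continuous_const)) ?_
  intro z hz; simpa using hz.2

lemma DD_sub : DD F al be ⊆ {z : F | al ≤ ‖z‖ ∧ ‖z‖ ≤ be} := fun z hz => ⟨hz.1.le, hz.2.le⟩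

lemma Cls.bdd {h : F → ℝ} (hh : Cls e al be h) : ∃ M, 0 ≤ M ∧ ∀ z, |h z| ≤ M := by
  obtain ⟨M, hM⟩ := (cD_compact (F := F) (al := al) (be := be)).exists_bound_of_continuousOn hh.cont.continuousOn
  refine ⟨max M 0, le_max_right _ _, fun z => ?_⟩
  by_cases hz : z ∈ DD F al be
  · exact (hM z (DD_sub hz)).trans (le_max_left _ _)
  · rw [hh.zero z hz]; simp

lemma VV_pos {z : F} (hz : z ≠ 0) : 0 < VV z := by
  have := norm_pos_iff.2 hz; unfold VV; positivity

lemma VV_nonneg (z : F) : 0 ≤ VV z := by unfold VV; positivity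

lemma VV_smooth {z : F} (hz : z ≠ 0) {n : ℕ∞} : ContDiffAt ℝ n (VV (F := F)) z := by
  unfold VV
  exact contDiffAt_const.div (contDiffAt_const.mul (contDiffAt_norm ℝ hz)) (by have := norm_pos_iff.2 hz; positivity)

lemma DD_ne (hal : 0 < al) {z : F} (hz : z ∈ DD F al be) : z ≠ 0 := norm_pos_iff.1 (hal.trans hz.1)

lemma VV_cont (hal : 0 < al) {h : F → ℝ} (hc : Continuous h) (h0 : ∀ z, z ∉ DD F al be → h z = 0) :
    Continuous fun z => VV z * h z := by
  rw [continuous_iff_continuousAt]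
  intro z
  by_cases hz : z = 0
  · subst hz
    refine (continuousAt_const (y := (0 : ℝ))).congr ?_
    filter_upwards [ball_mem_nhds (0 : F) hal] with w hw
    rw [h0 w, mul_zero]
    intro hD
    have : ‖w‖ < al := by simpa using hw
    linarith [hD.1]
  · exact (VV_smooth (n := 0) hz).continuousAt.mul hc.continuousAt

lemma VV_le (hal : 0 < al) {h : F → ℝ} (h0 : ∀ z, z ∉ DD F al be → h z = 0) {M : ℝ} (hM : ∀ z, |h z| ≤ M) (z : F) :
    |VV z * h z| ≤ 1 / (2 * al) * M := by
  have hM0 : 0 ≤ M := (abs_nonneg _).trans (hM 0)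
  by_cases hz : z ∈ DD F al be
  · have := hz.1
    rw [abs_mul, abs_of_nonneg (VV_nonneg z)]
    unfold VV
    gcongr
    exact hM z
  · rw [h0 z hz]; simp; positivity

/-- Green potential on the whole space -/
def GP (al be : ℝ) (h : F → ℝ) (x : F) : ℝ := (cN F)⁻¹ * Pot (Fx al be (fun z => VV z * h z)) x

/-- Green operator -/
def TT (al be : ℝ) (h : F → ℝ) : F → ℝ := (DD F al be).indicator (GP al be h)

lemma Cls.dens (hal : 0 < al) (hab : al < be) {h : F → ℝ} (hh : Cls e al be h) {M : ℝ} (hM : ∀ z, |h z| ≤ M) :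
    Dens (Fx al be (fun z => VV z * h z)) (be ^ ((finrank ℝ F : ℝ) / 2 + 1) * (1 / (2 * al) * M)) :=
  Fx_dens hal hab (VV_cont hal hh.cont hh.zero) (fun z hz => by simp [hh.zero z hz]) (VV_le hal hh.zero hM)

lemma GP_C1 (hN : 3 ≤ finrank ℝ F) (hal : 0 < al) (hab : al < be) {h : F → ℝ} (hh : Cls e al be h) {x : F} (hx : x ≠ 0) :
    ContDiffAt ℝ 1 (GP al be h) x := by
  obtain ⟨M, hM0, hM⟩ := hh.bdd
  exact contDiffAt_const.mul (pot_main hN (hh.dens hal hab hM) hx).2.1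

lemma GP_C2 (hN : 3 ≤ finrank ℝ F) (hal : 0 < al) (hab : al < be) {h : F → ℝ} (hh : Cls e al be h)
    (h1 : ∀ x ∈ DD F al be, ContDiffAt ℝ 1 h x) {x : F} (hx : x ∈ DD F al be) :
    ContDiffAt ℝ 2 (GP al be h) x ∧ lap (GP al be h) x = - (VV x * h x) := by
  obtain ⟨M, hM0, hM⟩ := hh.bdd
  have hx0 := DD_ne hal hx
  have hev : ∀ᶠ y in 𝓝 x, ContDiffAt ℝ 1 (Fx al be (fun z => VV z * h z)) y := by
    filter_upwards [(DD_open al be).mem_nhds hx] with y hy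
    have : (fun z => VV z * h z) =ᶠ[𝓝 y] Fx al be (fun z => VV z * h z) := by
      filter_upwards [(DD_open al be).mem_nhds hy] with w hw
      rw [Fx_id hal hab _ hw]
    exact ((VV_smooth (n := 1) (DD_ne hal hy)).mul (h1 y hy)).congr_of_eventuallyEq this.symm
  have := (pot_main hN (hh.dens hal hab hM) hx0).2.2.2 hev
  refine ⟨contDiffAt_const.mul this.1, ?_⟩
  unfold GP
  rw [lap_const_mul _ this.1, this.2, Fx_id hal hab _ hx]
  have := (cN_pos (F := F) hN).ne'
  field_simp

lemma GP_zero (hN : 3 ≤ finrank ℝ F) (hal : 0 < al) (hab : al < be) (h : F → ℝ) {x : F} (hx : ‖x‖ = al ∨ ‖x‖ = be) :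
    GP al be h x = 0 := by
  unfold GP
  rw [pot_zero hN (R := ‖x‖) (by rcases hx with hx | hx <;> rw [hx] <;> linarith) (fun y hy => Fx_inv hal hab _ hx hy) rfl,
    mul_zero]

lemma TT_eq (hN : 3 ≤ finrank ℝ F) (hal : 0 < al) (hab : al < be) (h : F → ℝ) {x : F} (hx : al ≤ ‖x‖ ∧ ‖x‖ ≤ be) :
    TT al be h x = GP al be h x := by
  unfold TT
  by_cases hD : x ∈ DD F al be
  · rw [indicator_of_mem hD]
  · rw [indicator_of_notMem hD, GP_zero hN hal hab]
    rcases hx.1.eq_or_lt with h | h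
    · exact Or.inl h.symm
    · rcases hx.2.eq_or_lt with h' | h'
      · exact Or.inr h'
      · exact absurd ⟨h, h'⟩ hD

lemma TT_ev (h : F → ℝ) {x : F} (hx : x ∈ DD F al be) : TT al be h =ᶠ[𝓝 x] GP al be h := by
  filter_upwards [(DD_open al be).mem_nhds hx] with y hy
  unfold TT; rw [indicator_of_mem hy]

lemma clD : closure (DD F al be) ⊆ {z : F | al ≤ ‖z‖ ∧ ‖z‖ ≤ be} :=
  closure_minimal DD_sub cD_compact.isClosed

lemma TT_cls (hN : 3 ≤ finrank ℝ F) (hal : 0 < al) (hab : al < be) {h : F → ℝ} (hh : Cls e al be h) :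
    Cls e al be (TT al be h) where
  cont := by
    have : ContinuousOn (GP al be h) (closure (DD F al be)) := fun x hx => by
      have hx' := clD hx
      exact (GP_C1 hN hal hab hh (norm_pos_iff.1 (hal.trans_le hx'.1))).continuousAt.continuousWithinAt
    refine continuous_indicator (fun x hx => ?_) this
    have h1 := clD (frontier_subset_closure hx)
    have h2 : x ∉ DD F al be := fun hD => by
      rw [(DD_open al be).frontier_eq] at hx; exact hx.2 hD
    rw [← TT_eq hN hal hab h h1]; unfold TT; rw [indicator_of_notMem h2]
  zero z hz := indicator_of_notMem hz _
  sym A hA z := by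
    unfold TT
    have hD : A z ∈ DD F al be ↔ z ∈ DD F al be := by unfold DD; simp
    by_cases hz : z ∈ DD F al be
    · rw [indicator_of_mem hz, indicator_of_mem (hD.2 hz)]
      unfold GP
      rw [Pot_iso A]
      exact fun y => Fx_iso A (fun w => by unfold VV; rw [A.norm_map, hh.sym A hA]) y
    · rw [indicator_of_notMem hz, indicator_of_notMem (fun h => hz (hD.1 h))]

lemma GP_add (hN : 3 ≤ finrank ℝ F) (hal : 0 < al) (hab : al < be) {h g : F → ℝ} (hh : Cls e al be h)
    (hg : Cls e al be g) {x : F} (hx : x ≠ 0) :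
    GP al be (fun z => h z + g z) x = GP al be h x + GP al be g x := by
  obtain ⟨M, hM0, hM⟩ := hh.bdd
  obtain ⟨M', hM0', hM'⟩ := hg.bdd
  unfold GP
  rw [← mul_add]
  congr 1
  unfold Pot
  rw [← integral_add (pot_main hN (hh.dens hal hab hM) hx).1 (pot_main hN (hg.dens hal hab hM') hx).1]
  congr 1; ext y
  unfold Fx
  simp only [smul_eq_mul]; ring

lemma GP_smul (c : ℝ) (h : F → ℝ) (x : F) :
    GP al be (fun z => c * h z) x = c * GP al be h x := by
  unfold GP Pot
  rw [mul_left_comm]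
  congr 1
  rw [← integral_const_mul]
  congr 1; ext y
  unfold Fx
  simp only [smul_eq_mul]; ring

lemma TT_add (hN : 3 ≤ finrank ℝ F) (hal : 0 < al) (hab : al < be) {h g : F → ℝ} (hh : Cls e al be h)
    (hg : Cls e al be g) (x : F) :
    TT al be (fun z => h z + g z) x = TT al be h x + TT al be g x := by
  unfold TT
  by_cases hD : x ∈ DD F al be
  · simp only [indicator_of_mem hD]; exact GP_add hN hal hab hh hg (DD_ne hal hD)
  · simp only [indicator_of_notMem hD]; simp

lemma TT_smul (c : ℝ) (h : F → ℝ) (x : F) :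
    TT al be (fun z => c * h z) x = c * TT al be h x := by
  unfold TT
  by_cases hD : x ∈ DD F al be
  · simp only [indicator_of_mem hD]; exact GP_smul c h x
  · simp only [indicator_of_notMem hD]; simp

lemma GP_bd (hN : 3 ≤ finrank ℝ F) (hal : 0 < al) (hab : al < be) (e : F) : ∃ C, 0 < C ∧ ∀ (h : F → ℝ), Cls e al be h →
    ∀ M, (∀ z, |h z| ≤ M) → ∀ x : F, al / 2 ≤ ‖x‖ → ‖x‖ ≤ be + al →
      |GP al be h x| ≤ C * M ∧ ‖fderiv ℝ (GP al be h) x‖ ≤ C * M := by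
  obtain ⟨B, hB, hb⟩ := pot_bounds (F := F) hN (r0 := al / 2) (R0 := be + al) (by positivity)
  have hc := cN_pos (F := F) hN
  have hbe := hal.trans hab
  refine ⟨(cN F)⁻¹ * B * (be ^ ((finrank ℝ F : ℝ) / 2 + 1) * (1 / (2 * al))), by positivity,
    fun h hh M hM x hx1 hx2 => ?_⟩
  have hM0 : 0 ≤ M := (abs_nonneg _).trans (hM 0)
  have hd := hh.dens hal hab hM
  have := hb _ _ (by positivity) hd x hx1 hx2
  have hx0 : x ≠ 0 := norm_pos_iff.1 (by linarith)
  constructor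
  · unfold GP
    rw [abs_mul, abs_of_pos (inv_pos.2 hc)]
    calc _ ≤ (cN F)⁻¹ * (B * (be ^ ((finrank ℝ F : ℝ) / 2 + 1) * (1 / (2 * al) * M))) := by gcongr; exact this.1
      _ = _ := by ring
  · have e1 : fderiv ℝ (GP al be h) x = (cN F)⁻¹ • fderiv ℝ (Pot (Fx al be fun z => VV z * h z)) x := by
      unfold GP
      exact fderiv_const_mul ((pot_main hN hd hx0).2.1.differentiableAt (by norm_num)) _
    rw [e1, norm_smul, Real.norm_of_nonneg (inv_pos.2 hc).le]
    calc _ ≤ (cN F)⁻¹ * (B * (be ^ ((finrank ℝ F : ℝ) / 2 + 1) * (1 / (2 * al) * M))) := by gcongr; exact this.2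
      _ = _ := by ring

/-- local Lipschitz bound for potentials -/
lemma GP_lip (hN : 3 ≤ finrank ℝ F) (hal : 0 < al) (hab : al < be) (e : F) : ∃ C, 0 < C ∧ ∀ (h : F → ℝ), Cls e al be h →
    ∀ M, (∀ z, |h z| ≤ M) → ∀ x0 : F, al ≤ ‖x0‖ → ‖x0‖ ≤ be → ∀ x ∈ ball x0 (al / 2),
      |GP al be h x - GP al be h x0| ≤ C * M * ‖x - x0‖ := by
  obtain ⟨C, hC, hb⟩ := GP_bd hN hal hab e
  refine ⟨C, hC, fun h hh M hM x0 h1 h2 x hx => ?_⟩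
  have hr : ∀ z ∈ ball x0 (al / 2), al / 2 ≤ ‖z‖ ∧ ‖z‖ ≤ be + al := by
    intro z hz
    rw [mem_ball, dist_eq_norm] at hz
    have := norm_sub_norm_le x0 z
    have := norm_sub_norm_le z x0
    rw [norm_sub_rev] at this
    rw [norm_sub_rev z] at hz
    constructor <;> linarith
  have := (convex_ball x0 (al / 2)).norm_image_sub_le_of_norm_fderiv_le (𝕜 := ℝ) (f := GP al be h) (C := C * M)
    (fun z hz => (GP_C1 hN hal hab hh (norm_pos_iff.1 (by linarith [(hr z hz).1]))).differentiableAt (by norm_num))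
    (fun z hz => (hb h hh M hM z (hr z hz).1 (hr z hz).2).2) (mem_ball_self (by positivity)) hx
  exact this

end green
end Conc

namespace Conc
open Topology Set Module Metric BoundedContinuousFunction

section fred
variable {F : Type} [NormedAddCommGroup F] [InnerProductSpace ℝ F] [FiniteDimensional ℝ F]
variable [MeasurableSpace F] [BorelSpace F]
variable {al be : ℝ}

/-- Banach space of the class -/
def EE (e : F) (al be : ℝ) : @Submodule ℝ (F →ᵇ ℝ) _
    ((inferInstance : NormedAddCommGroup (F →ᵇ ℝ)).toAddCommGroup.toAddCommMonoid)
    ((inferInstance : NormedSpace ℝ (F →ᵇ ℝ)).toModule) where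
  carrier := {h | Cls e al be (h : F → ℝ)}
  add_mem' {a b} ha hb := Cls.add ha hb
  zero_mem' := ⟨continuous_const, fun _ _ => rfl, fun _ _ _ => rfl⟩
  smul_mem' c {h} hh := Cls.smul hh c

variable {e : F}

lemma EE_closed : IsClosed (EE e al be : Set (F →ᵇ ℝ)) := by
  have : (EE e al be : Set (F →ᵇ ℝ)) = {h : F →ᵇ ℝ | ∀ z, z ∉ DD F al be → h z = 0} ∩
      {h : F →ᵇ ℝ | ∀ A : F ≃ₗᵢ[ℝ] F, A e = e → ∀ z, h (A z) = h z} := by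
    ext h
    exact ⟨fun hh => ⟨hh.zero, hh.sym⟩, fun hh => ⟨h.continuous, hh.1, hh.2⟩⟩
  rw [this]
  refine IsClosed.inter ?_ ?_
  · simp only [ofPred_forall]
    exact isClosed_iInter fun z => isClosed_iInter fun _ => isClosed_eq (continuous_eval_const z) continuous_const
  · simp only [ofPred_forall]
    exact isClosed_iInter fun A => isClosed_iInter fun _ => isClosed_iInter fun z =>
      isClosed_eq (continuous_eval_const _) (continuous_eval_const _)

instance : CompleteSpace (EE e al be) := EE_closed.completeSpace_coe

/-- package -/
def mkE {h : F → ℝ} (hh : Cls e al be h) : EE e al be :=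
  ⟨BoundedContinuousFunction.ofNormedAddCommGroup h hh.cont (Classical.choose hh.bdd)
    (Classical.choose_spec hh.bdd).2, hh⟩

@[simp] lemma mkE_apply {h : F → ℝ} (hh : Cls e al be h) (z : F) : (mkE hh : F →ᵇ ℝ) z = h z := rfl

lemma E_le (h : EE e al be) (z : F) : |(h : F →ᵇ ℝ) z| ≤ ‖h‖ := (h : F →ᵇ ℝ).norm_coe_le_norm z

lemma E_norm_le {h : EE e al be} {M : ℝ} (hM0 : 0 ≤ M) (hM : ∀ z, |(h : F →ᵇ ℝ) z| ≤ M) : ‖h‖ ≤ M :=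
  (BoundedContinuousFunction.norm_le hM0).2 hM

/-- linear operator -/
def TL (hN : 3 ≤ finrank ℝ F) (hal : 0 < al) (hab : al < be) : EE e al be →ₗ[ℝ] EE e al be where
  toFun h := mkE (TT_cls hN hal hab h.2)
  map_add' a b := by
    ext z
    exact TT_add hN hal hab a.2 b.2 z
  map_smul' c a := by
    ext z
    exact TT_smul c _ z

lemma TL_apply (hN : 3 ≤ finrank ℝ F) (hal : 0 < al) (hab : al < be) (h : EE e al be) (z : F) :
    (TL hN hal hab h : F →ᵇ ℝ) z = TT al be (h : F →ᵇ ℝ) z := rfl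

lemma TT_bd (hN : 3 ≤ finrank ℝ F) (hal : 0 < al) (hab : al < be) (e : F) : ∃ C, 0 < C ∧ ∀ (h : F → ℝ), Cls e al be h →
    ∀ M, (∀ z, |h z| ≤ M) → ∀ x : F, |TT al be h x| ≤ C * M := by
  obtain ⟨C, hC, hb⟩ := GP_bd hN hal hab e
  refine ⟨C, hC, fun h hh M hM x => ?_⟩
  have hM0 : 0 ≤ M := (abs_nonneg _).trans (hM 0)
  by_cases hD : x ∈ DD F al be
  · rw [TT_eq hN hal hab h (DD_sub hD)]
    exact (hb h hh M hM x (by linarith [hD.1]) (by linarith [hD.2])).1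
  · unfold TT; rw [indicator_of_notMem hD]; simp; positivity

lemma TL_bd (hN : 3 ≤ finrank ℝ F) (hal : 0 < al) (hab : al < be) :
    ∃ C, ∀ h : EE e al be, ‖TL hN hal hab h‖ ≤ C * ‖h‖ := by
  obtain ⟨C, hC, hb⟩ := TT_bd hN hal hab e
  exact ⟨C, fun h => E_norm_le (by positivity) fun z => hb _ h.2 _ (E_le h) z⟩

/-- continuous operator -/
def TC (hN : 3 ≤ finrank ℝ F) (hal : 0 < al) (hab : al < be) : EE e al be →L[ℝ] EE e al be :=
  LinearMap.mkContinuous (E := EE e al be) (F := EE e al be) (TL hN hal hab) _ (Classical.choose_spec (TL_bd (e := e) hN hal hab))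

lemma TC_apply (hN : 3 ≤ finrank ℝ F) (hal : 0 < al) (hab : al < be) (h : EE e al be) (z : F) :
    (TC hN hal hab h : F →ᵇ ℝ) z = TT al be (h : F →ᵇ ℝ) z := rfl

/-- equicontinuity estimate -/
lemma TT_equi (hN : 3 ≤ finrank ℝ F) (hal : 0 < al) (hab : al < be) (e : F) (x0 : F) (M : ℝ) :
    ∃ r C, 0 < r ∧ 0 < C ∧ ∀ (h : F → ℝ), Cls e al be h → (∀ z, |h z| ≤ M) → ∀ x ∈ ball x0 r,
      |TT al be h x - TT al be h x0| ≤ C * M * ‖x - x0‖ := by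
  obtain ⟨C, hC, hb⟩ := GP_lip hN hal hab e
  by_cases hc : al ≤ ‖x0‖ ∧ ‖x0‖ ≤ be
  · by_cases hD : x0 ∈ DD F al be
    · obtain ⟨r, hr, hrD⟩ := Metric.isOpen_iff.1 (DD_open al be) x0 hD
      refine ⟨min r (al / 2), C, by positivity, hC, fun h hh hM x hx => ?_⟩
      rw [TT_eq hN hal hab h hc, TT_eq hN hal hab h (DD_sub (hrD (ball_subset_ball (min_le_left _ _) hx)))]
      exact hb h hh M hM x0 hc.1 hc.2 x (ball_subset_ball (min_le_right _ _) hx)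
    · refine ⟨al / 2, C, by positivity, hC, fun h hh hM x hx => ?_⟩
      have hM0 : 0 ≤ M := (abs_nonneg _).trans (hM 0)
      have h0 : TT al be h x0 = 0 := by unfold TT; rw [indicator_of_notMem hD]
      by_cases hx' : x ∈ DD F al be
      · rw [TT_eq hN hal hab h hc, TT_eq hN hal hab h (DD_sub hx')]
        exact hb h hh M hM x0 hc.1 hc.2 x hx
      · have h1 : TT al be h x = 0 := by unfold TT; rw [indicator_of_notMem hx']
        rw [h0, h1]; simp; positivity
  · have hop : IsOpen {z : F | al ≤ ‖z‖ ∧ ‖z‖ ≤ be}ᶜ := cD_compact.isClosed.isOpen_compl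
    obtain ⟨r, hr, hrD⟩ := Metric.isOpen_iff.1 hop x0 hc
    refine ⟨r, C, hr, hC, fun h hh hM x hx => ?_⟩
    have hM0 : 0 ≤ M := (abs_nonneg _).trans (hM 0)
    have hz : ∀ z, z ∈ ball x0 r → TT al be h z = 0 := fun z hz => by
      unfold TT; rw [indicator_of_notMem (fun hD => hrD hz (DD_sub hD))]
    rw [hz x hx, hz x0 (mem_ball_self hr)]; simp; positivity

/-- restriction to a compact ball -/
def rs (e : F) (al be : ℝ) (h : EE e al be) : (closedBall (0 : F) be) →ᵇ ℝ :=
  (h : F →ᵇ ℝ).compContinuous ⟨Subtype.val, continuous_subtype_val⟩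

lemma rs_iso (hbe : 0 < be) : Isometry (rs e al be) := by
  refine Isometry.of_dist_eq fun a b => ?_
  apply le_antisymm
  · refine (BoundedContinuousFunction.dist_le dist_nonneg).2 fun z => ?_
    exact (a : F →ᵇ ℝ).dist_coe_le_dist (g := (b : F →ᵇ ℝ)) z
  · refine (BoundedContinuousFunction.dist_le (f := (a : F →ᵇ ℝ)) (g := (b : F →ᵇ ℝ)) dist_nonneg).2 fun z => ?_
    by_cases hz : z ∈ DD F al be
    · have hz' : z ∈ closedBall (0 : F) be := by simpa using hz.2.le
      exact (rs e al be a).dist_coe_le_dist (g := rs e al be b) ⟨z, hz'⟩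
    · rw [a.2.zero z hz, b.2.zero z hz]; simp

lemma TC_compact (hN : 3 ≤ finrank ℝ F) (hal : 0 < al) (hab : al < be) (e : F) :
    IsCompactOperator (TC (e := e) hN hal hab) := by
  have hbe := hal.trans hab
  have key := isCompactOperator_iff_isCompact_closure_image_closedBall (𝕜₁ := ℝ) (𝕜₂ := ℝ) (M₁ := EE e al be) (M₂ := EE e al be)
    ((TC (e := e) hN hal hab : EE e al be →L[ℝ] EE e al be) : EE e al be →ₗ[ℝ] EE e al be) one_pos
  refine key.2 ?_
  set S : Set (EE e al be) := _ '' closedBall (0 : EE e al be) 1 with hS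
  have : CompactSpace (closedBall (0 : F) be) := isCompact_iff_compactSpace.1 (isCompact_closedBall _ _)
  obtain ⟨C, hC, hb⟩ := TT_bd hN hal hab e
  have hcomp : IsCompact (closure (rs e al be '' S)) := by
    refine BoundedContinuousFunction.arzela_ascoli (Icc (-C) C) isCompact_Icc _ ?_ ?_
    · rintro f x ⟨g, ⟨h, hh, rfl⟩, rfl⟩
      have h1 : ∀ z, |(h : F →ᵇ ℝ) z| ≤ 1 := fun z => (E_le h z).trans (by rw [← dist_zero_right]; exact hh)
      have := hb _ h.2 1 h1 x
      rw [mul_one, abs_le] at this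
      exact this
    · intro x0
      rw [Metric.equicontinuousAt_iff]
      intro ε hε
      obtain ⟨r, C', hr, hC', hq⟩ := TT_equi hN hal hab e (x0 : F) 1
      refine ⟨min r (ε / C'), by positivity, fun x hx => ?_⟩
      rintro ⟨_, ⟨g, ⟨h, hh, rfl⟩, rfl⟩⟩
      have h1 : ∀ z, |(h : F →ᵇ ℝ) z| ≤ 1 := fun z => (E_le h z).trans (by rw [← dist_zero_right]; exact hh)
      have hx' : dist (x : F) x0 < min r (ε / C') := hx
      have h2 := hq _ h.2 h1 x (hx'.trans_le (min_le_left _ _))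
      rw [dist_comm, Real.dist_eq]
      refine h2.trans_lt ?_
      rw [mul_one, ← dist_eq_norm]
      calc C' * dist (x : F) x0 < C' * (ε / C') := by
            gcongr; exact hx'.trans_le (min_le_right _ _)
        _ = ε := by field_simp
  have htb : TotallyBounded S := by
    have h1 : TotallyBounded (rs e al be '' S) := hcomp.totallyBounded.subset subset_closure
    have h2 := totallyBounded_preimage (rs_iso (e := e) (al := al) hbe).isUniformInducing h1
    exact h2.subset (subset_preimage_image _ _)
  exact htb.closure.isCompact_of_isClosed isClosed_closure

/-- interface of the linear theory -/
structure LinTh (e : F) (al be lam : ℝ) (R : (F → ℝ) → F → ℝ) : Prop where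
  cls : ∀ h, Cls e al be h → Cls e al be (R h)
  c1 : ∀ h, Cls e al be h → ∃ U : F → ℝ, (∀ x, x ≠ 0 → ContDiffAt ℝ 1 U x) ∧
    ∀ x : F, al ≤ ‖x‖ ∧ ‖x‖ ≤ be → R h x = U x
  c2 : ∀ h, Cls e al be h → (∀ x ∈ DD F al be, ContDiffAt ℝ 1 h x) → ∀ x ∈ DD F al be,
    ContDiffAt ℝ 2 (R h) x ∧ -lap (R h) x + lam * (VV x * R h x) = VV x * h x
  lip : ∃ C, 0 ≤ C ∧ ∀ h g, Cls e al be h → Cls e al be g → ∀ M, (∀ z, |h z - g z| ≤ M) → ∀ z, |R h z - R g z| ≤ C * M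
  cpt : ∀ (h : ℕ → F → ℝ) (M : ℝ), (∀ n, Cls e al be (h n)) → (∀ n z, |h n z| ≤ M) →
    ∃ φ : ℕ → ℕ, StrictMono φ ∧ ∃ w, Cls e al be w ∧ ∀ ε > 0, ∀ᶠ n in atTop, ∀ z, |R (h (φ n)) z - w z| ≤ ε

lemma cmp_D (hal : 0 < al) {w : F → ℝ} (hw : Continuous w) (h0 : ∀ z, z ∉ DD F al be → w z ≤ 0)
    (h2 : ∀ x ∈ DD F al be, 0 < w x → ContDiffAt ℝ 2 w x ∧ 0 < lap w x) (x : F) : w x ≤ 0 := by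
  by_cases hx : x ∈ DD F al be
  · exact wmp (DD_open al be) cD_compact DD_sub hw.continuousOn (fun x hx h => (h2 x hx h).1)
      (fun x _ hx => h0 x hx) (fun x hx h => (h2 x hx h).2) x (DD_sub hx)
  · exact h0 x hx

lemma TT_C1 (hN : 3 ≤ finrank ℝ F) (hal : 0 < al) (hab : al < be) {h : F → ℝ} (hh : Cls e al be h) {x : F} (hx : x ∈ DD F al be) :
    ContDiffAt ℝ 1 (TT al be h) x :=
  (GP_C1 hN hal hab hh (DD_ne hal hx)).congr_of_eventuallyEq (TT_ev h hx)

lemma TT_C2 (hN : 3 ≤ finrank ℝ F) (hal : 0 < al) (hab : al < be) {h : F → ℝ} (hh : Cls e al be h)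
    (h1 : ∀ x ∈ DD F al be, ContDiffAt ℝ 1 h x) {x : F} (hx : x ∈ DD F al be) :
    ContDiffAt ℝ 2 (TT al be h) x ∧ lap (TT al be h) x = - (VV x * h x) := by
  have := GP_C2 hN hal hab hh h1 hx
  exact ⟨this.1.congr_of_eventuallyEq (TT_ev h hx), by rw [lap_congr (TT_ev h hx), this.2]⟩

lemma no_eig (hN : 3 ≤ finrank ℝ F) (hal : 0 < al) (hab : al < be) {lam : ℝ} (hlam : 0 < lam) {h : F → ℝ}
    (hh : Cls e al be h) (heq : ∀ z, h z = - lam * TT al be h z) (x : F) : h x ≤ 0 := by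
  have e1 : h = fun z => -lam * TT al be h z := funext heq
  have c1 : ∀ x ∈ DD F al be, ContDiffAt ℝ 1 h x := fun x hx => by
    rw [e1]; exact contDiffAt_const.mul (TT_C1 hN hal hab hh hx)
  refine cmp_D hal hh.cont (fun z hz => (hh.zero z hz).le) (fun x hx hpos => ?_) x
  have := TT_C2 hN hal hab hh c1 hx
  have hV := VV_pos (DD_ne hal hx)
  constructor
  · rw [e1]; exact contDiffAt_const.mul this.1
  · have : lap h x = lam * (VV x * h x) := by
      conv_lhs => rw [e1]
      rw [lap_const_mul _ this.1, this.2]; ring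
    rw [this]; positivity

theorem linTh_exists (hN : 3 ≤ finrank ℝ F) (hal : 0 < al) (hab : al < be) {lam : ℝ} (hlam : 0 < lam) :
    ∃ R, LinTh e al be lam R := by
  classical
  set T := TC (e := e) hN hal hab with hT
  have hTa : ∀ (h : EE e al be) (z : F), (T h : F →ᵇ ℝ) z = TT al be (h : F →ᵇ ℝ) z := fun h z => rfl
  have hTc : IsCompactOperator T := TC_compact hN hal hab e
  have hmu : (-(1 / lam)) ≠ 0 := by
    have : 0 < 1 / lam := by positivity
    linarith
  have hres : -(1 / lam) ∈ resolventSet ℝ T := by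
    refine (hTc.hasEigenvalue_or_mem_resolventSet hmu).resolve_left fun hev => ?_
    obtain ⟨h, hh⟩ := hev.exists_hasEigenvector
    have h1 := hh.apply_eq_smul
    have h2 : ∀ z, (h : F →ᵇ ℝ) z = - lam * TT al be (h : F →ᵇ ℝ) z := by
      intro z
      have := congrArg (fun g : EE e al be => (g : F →ᵇ ℝ) z) h1
      have h3 : TT al be (h : F →ᵇ ℝ) z = -(1 / lam) * (h : F →ᵇ ℝ) z := this
      rw [h3]; field_simp
    have h3 : ∀ z, ((-h : EE e al be) : F →ᵇ ℝ) z = - lam * TT al be ((-h : EE e al be) : F →ᵇ ℝ) z := by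
      intro z
      have := congrArg (fun g : EE e al be => (g : F →ᵇ ℝ) z) (map_neg T h)
      have h4 : TT al be ((-h : EE e al be) : F →ᵇ ℝ) z = - TT al be (h : F →ᵇ ℝ) z := this
      rw [h4]
      have := h2 z
      show - (h : F →ᵇ ℝ) z = _
      linarith
    apply hh.2
    ext z
    apply le_antisymm
    · exact no_eig hN hal hab hlam h.2 h2 z
    · have := no_eig hN hal hab hlam (-h : EE e al be).2 h3 z
      have h5 : - (h : F →ᵇ ℝ) z ≤ 0 := this
      show 0 ≤ (h : F →ᵇ ℝ) z
      linarith
  rw [spectrum.mem_resolventSet_iff] at hres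
  obtain ⟨u, hu⟩ := hres
  -- S = (1 + lam T)^{-1}
  set S : EE e al be →L[ℝ] EE e al be := (-(1 / lam)) • (↑u⁻¹ : EE e al be →L[ℝ] EE e al be) with hS
  have hSeq : ∀ h : EE e al be, S h + lam • T (S h) = h := by
    intro h
    have h1 : (u : EE e al be →L[ℝ] EE e al be) ((↑u⁻¹ : EE e al be →L[ℝ] EE e al be) h) = h := by
      have := congrArg (fun L : EE e al be →L[ℝ] EE e al be => L h) u.mul_inv
      exact this
    rw [hu] at h1
    set g := (↑u⁻¹ : EE e al be →L[ℝ] EE e al be) h with hg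
    have h2 : -(1 / lam) • g - T g = h := by
      have : (algebraMap ℝ (EE e al be →L[ℝ] EE e al be) (-(1 / lam)) - T) g = -(1 / lam) • g - T g := rfl
      rw [← this]; exact h1
    have h3 : S h = -(1 / lam) • g := rfl
    rw [h3, map_smul, smul_smul, ← h2]
    have : lam * -(1 / lam) = -1 := by field_simp
    rw [this]; module
  set R : (F → ℝ) → F → ℝ := fun h => if hh : Cls e al be h then ((T (S (mkE hh)) : EE e al be) : F →ᵇ ℝ) else 0 with hR
  have hRe : ∀ h (hh : Cls e al be h), R h = ((T (S (mkE hh)) : EE e al be) : F →ᵇ ℝ) := fun h hh => by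
    rw [hR]; simp only [dif_pos hh]
  have hRT : ∀ h (hh : Cls e al be h), R h = TT al be ((S (mkE hh) : EE e al be) : F →ᵇ ℝ) := fun h hh => by
    rw [hRe h hh]; rfl
  have hcls : ∀ h, Cls e al be h → Cls e al be (R h) := fun h hh => by
    rw [hRe h hh]; exact (T (S (mkE hh))).2
  refine ⟨R, hcls, fun h hh => ?_, fun h hh h1 x hx => ?_, ?_, ?_⟩
  · refine ⟨GP al be ((S (mkE hh) : EE e al be) : F →ᵇ ℝ), fun x hx => GP_C1 hN hal hab (S (mkE hh)).2 hx, fun x hx => ?_⟩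
    rw [hRT h hh, TT_eq hN hal hab _ hx]
  · have hs : (((S (mkE hh) : EE e al be) : F →ᵇ ℝ) : F → ℝ) = fun z => h z - lam * R h z := by
      ext z
      have := congrArg (fun g : EE e al be => (g : F →ᵇ ℝ) z) (hSeq (mkE hh))
      have h4 : ((S (mkE hh) : EE e al be) : F →ᵇ ℝ) z + lam * ((T (S (mkE hh)) : EE e al be) : F →ᵇ ℝ) z = h z := this
      rw [hRe h hh]; linarith
    have hC1 : ∀ x ∈ DD F al be, ContDiffAt ℝ 1 (((S (mkE hh) : EE e al be) : F →ᵇ ℝ) : F → ℝ) x := by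
      intro x hx
      rw [hs, hRT h hh]
      exact (h1 x hx).sub (contDiffAt_const.mul (TT_C1 hN hal hab (S (mkE hh)).2 hx))
    have := TT_C2 hN hal hab (S (mkE hh)).2 hC1 hx
    rw [← hRT h hh] at this
    refine ⟨this.1, ?_⟩
    rw [this.2, hs]; ring
  · refine ⟨‖T‖ * ‖S‖, by positivity, fun h g hh hg M hM z => ?_⟩
    have hM0 : 0 ≤ M := (abs_nonneg _).trans (hM 0)
    rw [hRe h hh, hRe g hg]
    have h1 : ‖mkE hh - mkE hg‖ ≤ M := E_norm_le hM0 hM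
    have h2 : T (S (mkE hh)) - T (S (mkE hg)) = T (S (mkE hh - mkE hg)) := by simp
    have h3 := E_le (T (S (mkE hh)) - T (S (mkE hg))) z
    refine h3.trans ?_
    rw [h2]
    calc _ ≤ ‖T‖ * ‖S (mkE hh - mkE hg)‖ := T.le_opNorm _
      _ ≤ ‖T‖ * (‖S‖ * ‖mkE hh - mkE hg‖) := by gcongr; exact S.le_opNorm _
      _ ≤ ‖T‖ * (‖S‖ * M) := by gcongr
      _ = _ := by ring
  · intro h M hh hM
    have hM0 : 0 ≤ M := (abs_nonneg _).trans (hM 0 0)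
    obtain ⟨K, hK, hKs⟩ := IsCompactOperator.image_subset_compact_of_bounded
      (f := (T : EE e al be →ₗ[ℝ] EE e al be)) hTc (isBounded_closedBall (x := (0 : EE e al be)) (r := ‖S‖ * M))
    have hmem : ∀ n, T (S (mkE (hh n))) ∈ K := fun n => hKs ⟨S (mkE (hh n)), by
      rw [mem_closedBall, dist_zero_right]
      exact (S.le_opNorm _).trans (by gcongr; exact E_norm_le hM0 (hM n)), rfl⟩
    obtain ⟨w, -, φ, hφ, hlim⟩ := hK.tendsto_subseq hmem
    refine ⟨φ, hφ, (w : F →ᵇ ℝ), w.2, fun ε hε => ?_⟩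
    filter_upwards [hlim.eventually (ball_mem_nhds w hε)] with n hn z
    rw [hRe _ (hh (φ n))]
    have := E_le (T (S (mkE (hh (φ n)))) - w) z
    refine this.trans ?_
    rw [← dist_eq_norm]
    exact (le_of_lt hn)

lemma LinTh.nonneg {lam : ℝ} {R : (F → ℝ) → F → ℝ} (L : LinTh e al be lam R) (hal : 0 < al) (hlam : 0 < lam) {h : F → ℝ}
    (hh : Cls e al be h) (h1 : ∀ x ∈ DD F al be, ContDiffAt ℝ 1 h x) (h0 : ∀ z, 0 ≤ h z) (x : F) : 0 ≤ R h x := by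
  have := cmp_D (be := be) hal (w := fun z => (-1) * R h z) ((L.cls h hh).smul (-1)).cont
    (fun z hz => by simp [(L.cls h hh).zero z hz]) (fun x hx hpos => ?_) x
  · linarith
  · have c := L.c2 h hh h1 x hx
    refine ⟨contDiffAt_const.mul c.1, ?_⟩
    rw [lap_const_mul _ c.1]
    have hV := VV_pos (DD_ne hal hx)
    have : 0 ≤ VV x * h x := mul_nonneg hV.le (h0 x)
    have h2 : lam * (VV x * R h x) < 0 := by
      have : R h x < 0 := by linarith
      exact mul_neg_of_pos_of_neg hlam (mul_neg_of_pos_of_neg hV this)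
    linarith

end fred
end Conc

namespace Conc
open Topology Set Module Metric

section ibp
variable {F : Type} [NormedAddCommGroup F] [InnerProductSpace ℝ F] [FiniteDimensional ℝ F]
variable [MeasurableSpace F] [BorelSpace F]
variable {al be : ℝ}

lemma int_pd_zero {f : F → ℝ} (hf : ContDiff ℝ 1 f) (hc : HasCompactSupport f) (i) :
    ∫ x, pd i f x = 0 := by
  have hi : Integrable (fun x => fderiv ℝ f x (stdOrthonormalBasis ℝ F i)) := by
    refine Continuous.integrable_of_hasCompactSupport ?_ ?_
    · exact (hf.continuous_fderiv (by norm_num)).clm_apply continuous_const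
    · exact (hc.fderiv (𝕜 := ℝ)).comp_left (g := fun L : F →L[ℝ] ℝ => L (stdOrthonormalBasis ℝ F i)) (by simp)
  have := integral_mul_fderiv_eq_neg_fderiv_mul_of_integrable (μ := (volume : Measure F)) (𝕜 := ℝ) (f := f) (g := fun _ => (1 : ℝ))
    (v := stdOrthonormalBasis ℝ F i) (by simpa using hi) (by simp)
    (by simpa using hf.continuous.integrable_of_hasCompactSupport hc) (fun x _ => hf.differentiable (by norm_num) x) (fun x _ => by fun_prop)
  simp at this
  exact this

lemma ibp_i {O : Set F} {f ψ : F → ℝ} (hf : ∀ x ∈ O, ContDiffAt ℝ 1 f x) (hψ : ContDiff ℝ 1 ψ)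
    (hc : HasCompactSupport ψ) (hs : tsupport ψ ⊆ O) (i) :
    Integrable (fun x => f x * pd i ψ x) ∧ Integrable (fun x => ψ x * pd i f x) ∧
    ∫ x, f x * pd i ψ x = - ∫ x, ψ x * pd i f x := by
  have hev : ∀ x, x ∉ tsupport ψ → ψ =ᶠ[𝓝 x] fun _ => 0 := fun x hx =>
    notMem_tsupport_iff_eventuallyEq.1 hx
  have hev2 : ∀ x, x ∉ tsupport ψ → pd i ψ =ᶠ[𝓝 x] fun _ => 0 := fun x hx => by
    refine (pd_congr' (hev x hx) i).trans (Eventually.of_forall fun y => ?_)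
    simp [pd]
  have hC : ContDiff ℝ 1 (fun x => f x * ψ x) := by
    rw [contDiff_iff_contDiffAt]
    intro x
    by_cases hx : x ∈ tsupport ψ
    · exact (hf x (hs hx)).mul hψ.contDiffAt
    · refine (contDiffAt_const (c := (0 : ℝ))).congr_of_eventuallyEq ?_
      filter_upwards [hev x hx] with y hy; simp [hy]
  have hcs : HasCompactSupport (fun x => f x * ψ x) := hc.mul_left
  have i1 : Integrable (fun x => f x * pd i ψ x) := by
    refine Continuous.integrable_of_hasCompactSupport ?_ ?_
    · rw [continuous_iff_continuousAt]
      intro x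
      by_cases hx : x ∈ tsupport ψ
      · exact (hf x (hs hx)).continuousAt.mul (continuousAt_pd hψ.contDiffAt i)
      · refine (continuousAt_const (y := (0 : ℝ))).congr ?_
        filter_upwards [hev2 x hx] with y hy; simp [hy]
    · refine HasCompactSupport.intro hc.isCompact fun x hx => ?_
      rw [(hev2 x hx).self_of_nhds, mul_zero]
  have i2 : Integrable (fun x => ψ x * pd i f x) := by
    refine Continuous.integrable_of_hasCompactSupport ?_ hc.mul_right
    rw [continuous_iff_continuousAt]
    intro x
    by_cases hx : x ∈ tsupport ψ
    · exact hψ.continuous.continuousAt.mul (continuousAt_pd (hf x (hs hx)) i)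
    · refine (continuousAt_const (y := (0 : ℝ))).congr ?_
      filter_upwards [hev x hx] with y hy; simp [hy]
  refine ⟨i1, i2, ?_⟩
  have h0 := int_pd_zero hC hcs i
  have he : ∀ x, pd i (fun x => f x * ψ x) x = f x * pd i ψ x + ψ x * pd i f x := by
    intro x
    by_cases hx : x ∈ tsupport ψ
    · exact pd_mul ((hf x (hs hx)).differentiableAt (by norm_num)) (hψ.differentiable (by norm_num) x) i
    · have h1 : (fun x => f x * ψ x) =ᶠ[𝓝 x] fun _ => 0 := by
        filter_upwards [hev x hx] with y hy; simp [hy]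
      rw [pd_congr h1, (hev2 x hx).self_of_nhds, (hev x hx).self_of_nhds]; simp [pd]
  simp only [he] at h0
  rw [integral_add i1 i2] at h0
  linarith

lemma ibp_cpt {O : Set F} {W ψ : F → ℝ} (hW : ∀ x ∈ O, ContDiffAt ℝ 2 W x) (hψ : ContDiff ℝ 1 ψ)
    (hc : HasCompactSupport ψ) (hs : tsupport ψ ⊆ O) :
    ∫ x, gdot W ψ x = ∫ x, -lap W x * ψ x := by
  have h := fun i => ibp_i (f := pd i W) (fun x hx => contDiffAt_pd (n := 1) (hW x hx) i) hψ hc hs i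
  have e2 : (fun x => -lap W x * ψ x) = fun x => ∑ i, -(ψ x * pd i (pd i W) x) := by
    ext x; unfold lap; rw [Finset.sum_neg_distrib, ← Finset.mul_sum]; ring
  rw [e2]
  unfold gdot
  rw [integral_finsetSum _ fun i _ => (h i).1, integral_finsetSum (f := fun i x => -(ψ x * pd i (pd i W) x)) _ fun i _ => (h i).2.1.neg]
  refine Finset.sum_congr rfl fun i _ => ?_
  rw [(h i).2.2, integral_neg]

/-- profile -/
def th0 (t : ℝ) : ℝ := ∫ s in (0 : ℝ)..t, Real.smoothTransition (s - 1)

lemma sT_cont : Continuous fun s : ℝ => Real.smoothTransition (s - 1) :=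
  Real.smoothTransition.continuous.comp (by fun_prop)

lemma th0_deriv (t : ℝ) : HasDerivAt th0 (Real.smoothTransition (t - 1)) t :=
  sT_cont.deriv_integral _ 0 t ▸ (intervalIntegral.differentiable_integral_of_continuous sT_cont).differentiableAt.hasDerivAt

/-- truncation -/
def th (ε t : ℝ) : ℝ := ε * th0 (t / ε)
/-- derivative of the truncation -/
def thd (ε t : ℝ) : ℝ := Real.smoothTransition (t / ε - 1)

variable {ε : ℝ}

lemma th_deriv (hε : 0 < ε) (t : ℝ) : HasDerivAt (th ε) (thd ε t) t := by
  have h1 : HasDerivAt (fun t => t / ε) (1 / ε) t := (hasDerivAt_id' t).div_const ε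
  have := ((th0_deriv (t / ε)).comp t h1).const_mul ε
  have h2 : ε * (Real.smoothTransition (t / ε - 1) * (1 / ε)) = thd ε t := by unfold thd; field_simp
  rw [h2] at this
  exact this

lemma thd_nonneg (t : ℝ) : 0 ≤ thd ε t := Real.smoothTransition.nonneg _
lemma thd_le (t : ℝ) : thd ε t ≤ 1 := Real.smoothTransition.le_one _
lemma thd_smooth {n : ℕ∞} : ContDiff ℝ n (thd ε) := by
  unfold thd; exact Real.smoothTransition.contDiff.comp (by fun_prop)
lemma thd_mono (hε : 0 < ε) : Monotone (thd ε) := fun a b hab =>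
  Real.smoothTransition.monotone (by gcongr)
lemma thd_one (hε : 0 < ε) {t : ℝ} (ht : 2 * ε ≤ t) : thd ε t = 1 :=
  Real.smoothTransition.one_of_one_le (by rw [le_sub_iff_add_le, le_div_iff₀ hε]; linarith)
lemma thd_zero (hε : 0 < ε) {t : ℝ} (ht : t ≤ ε) : thd ε t = 0 :=
  Real.smoothTransition.zero_of_nonpos (by rw [sub_nonpos, div_le_iff₀ hε]; linarith)

lemma th_zero (hε : 0 < ε) {t : ℝ} (ht : t ≤ ε) : th ε t = 0 := by
  have h1 : t / ε ≤ 1 := by rw [div_le_iff₀ hε]; linarith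
  unfold th th0
  rw [intervalIntegral.integral_congr (g := fun _ => (0 : ℝ)), intervalIntegral.integral_zero, mul_zero]
  intro s hs
  refine Real.smoothTransition.zero_of_nonpos ?_
  have := hs.2
  have : s ≤ 1 := this.trans (max_le (by norm_num) h1)
  linarith

lemma th_smooth (hε : 0 < ε) : ContDiff ℝ 2 (th ε) := by
  have hd : deriv (th ε) = thd ε := funext fun t => (th_deriv hε t).deriv
  have : ContDiff ℝ (1 + 1) (th ε) := by
    rw [contDiff_succ_iff_deriv]
    refine ⟨fun t => (th_deriv hε t).differentiableAt, by simp, ?_⟩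
    rw [hd]; exact thd_smooth (n := 1)
  exact this

lemma th_mono (hε : 0 < ε) : Monotone (th ε) :=
  monotone_of_deriv_nonneg (fun t => (th_deriv hε t).differentiableAt) fun t => by
    rw [(th_deriv hε t).deriv]; exact thd_nonneg t

lemma th_nonneg (hε : 0 < ε) (t : ℝ) : 0 ≤ th ε t := by
  rcases le_total t ε with h | h
  · rw [th_zero hε h]
  · have := th_mono hε h; rwa [th_zero hε le_rfl] at this

lemma th_le (hε : 0 < ε) {t : ℝ} (ht : 0 ≤ t) : th ε t ≤ t := by
  have hm : Monotone fun t => t - th ε t := monotone_of_deriv_nonneg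
    (fun t => differentiableAt_id.sub (th_deriv hε t).differentiableAt) fun t => by
      have : HasDerivAt (fun t => t - th ε t) (1 - thd ε t) t := (hasDerivAt_id' t).sub (th_deriv hε t)
      rw [this.deriv]; linarith [thd_le (ε := ε) t]
  have := hm ht
  simp only [th_zero hε hε.le] at this
  linarith

lemma th_ge (hε : 0 < ε) (t : ℝ) : t - 2 * ε ≤ th ε t := by
  rcases le_total t (2 * ε) with h | h
  · linarith [th_nonneg hε t]
  · have hm : MonotoneOn (fun t => th ε t - t) (Ici (2 * ε)) := by
      refine monotoneOn_of_deriv_nonneg (convex_Ici _) ?_ ?_ ?_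
      · exact ((th_smooth hε).continuous.sub continuous_id).continuousOn
      · exact fun t _ => ((th_deriv hε t).differentiableAt.sub differentiableAt_id).differentiableWithinAt
      · intro t ht
        rw [interior_Ici] at ht
        have : HasDerivAt (fun t => th ε t - t) (thd ε t - 1) t := (th_deriv hε t).sub (hasDerivAt_id' t)
        rw [this.deriv, thd_one hε (le_of_lt ht)]; simp
    have := hm (by simp : 2 * ε ∈ Ici (2 * ε)) h h
    simp only at this
    linarith [th_nonneg hε (2 * ε)]

lemma th_tsupp (hε : 0 < ε) {v : F → ℝ} (hv : Continuous v) : tsupport (fun x => th ε (v x)) ⊆ {x | ε ≤ v x} := by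
  refine closure_minimal ?_ (isClosed_le continuous_const hv)
  intro x hx
  by_contra h
  exact hx (th_zero hε (le_of_lt (not_le.1 h)))

lemma lev_sub (hε : 0 < ε) {v : F → ℝ} (h0 : ∀ z, z ∉ DD F al be → v z = 0) : {x | ε ≤ v x} ⊆ DD F al be := by
  intro x hx
  by_contra h
  have : ε ≤ v x := hx
  rw [h0 x h] at this; linarith

lemma th_cs (hε : 0 < ε) {v : F → ℝ} (hv : Continuous v) (h0 : ∀ z, z ∉ DD F al be → v z = 0) :
    HasCompactSupport (fun x => th ε (v x)) :=
  (cD_compact (F := F) (al := al) (be := be)).of_isClosed_subset (isClosed_tsupport _)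
    ((th_tsupp hε hv).trans ((lev_sub hε h0).trans DD_sub))

lemma th_contDiff (hε : 0 < ε) {v : F → ℝ} (hv : Continuous v) (h0 : ∀ z, z ∉ DD F al be → v z = 0) {n : ℕ} (hn : n ≤ 2)
    (h2 : ∀ x ∈ DD F al be, ContDiffAt ℝ n v x) : ContDiff ℝ n (fun x => th ε (v x)) := by
  rw [contDiff_iff_contDiffAt]
  intro x
  by_cases hx : x ∈ DD F al be
  · exact (((th_smooth hε).of_le (by exact_mod_cast hn)).contDiffAt).comp x (h2 x hx)
  · refine (contDiffAt_const (c := (0 : ℝ))).congr_of_eventuallyEq ?_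
    have : x ∉ tsupport (fun x => th ε (v x)) := fun h => hx (lev_sub hε h0 (th_tsupp hε hv h))
    exact notMem_tsupport_iff_eventuallyEq.1 this

lemma intg_D {f : F → ℝ} (hc : ContinuousOn f (DD F al be)) (hb : ∃ C, ∀ x ∈ DD F al be, |f x| ≤ C) :
    IntegrableOn f (DD F al be) := by
  obtain ⟨C, hC⟩ := hb
  have hm : MeasurableSet (DD F al be) := (DD_open al be).measurableSet
  have : IsFiniteMeasure (volume.restrict (DD F al be)) := ⟨by
    rw [Measure.restrict_apply_univ]
    exact ((measure_mono DD_sub).trans_lt (cD_compact (F := F) (al := al) (be := be)).measure_lt_top)⟩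
  refine Integrable.of_bound (hc.aestronglyMeasurable hm) C ?_
  · exact (ae_restrict_iff' hm).2 (Eventually.of_forall hC)

lemma gdot_abs_le (f g : F → ℝ) (x : F) : |gdot f g x| ≤ gdot f f x + gdot g g x := by
  unfold gdot
  rw [← Finset.sum_add_distrib]
  refine (Finset.abs_sum_le_sum_abs _ _).trans (Finset.sum_le_sum fun i _ => ?_)
  rw [abs_mul]
  nlinarith [sq_abs (pd i f x), sq_abs (pd i g x), sq_nonneg (|pd i f x| - |pd i g x|), sq_nonneg (|pd i f x|), sq_nonneg (|pd i g x|)]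

/-- integration by parts up to the boundary -/
lemma ibp0 {W φ : F → ℝ} (hW : ∀ x ∈ DD F al be, ContDiffAt ℝ 2 W x)
    (hWg : ∃ C, ∀ x ∈ DD F al be, gdot W W x ≤ C) (hWl : ∃ C, ∀ x ∈ DD F al be, |lap W x| ≤ C)
    (hφ : Continuous φ) (hφ0 : ∀ z, z ∉ DD F al be → φ z = 0) (hφn : ∀ z, 0 ≤ φ z)
    (hφ1 : ∀ x ∈ DD F al be, ContDiffAt ℝ 1 φ x) (hφg : ∃ C, ∀ x ∈ DD F al be, gdot φ φ x ≤ C) :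
    ∫ x in DD F al be, gdot W φ x = ∫ x in DD F al be, -lap W x * φ x := by
  have hm : MeasurableSet (DD F al be) := (DD_open al be).measurableSet
  obtain ⟨C1, hC1⟩ := hWg
  obtain ⟨C2, hC2⟩ := hWl
  obtain ⟨C3, hC3⟩ := hφg
  obtain ⟨C4, hC4⟩ := (cD_compact (F := F) (al := al) (be := be)).exists_bound_of_continuousOn hφ.continuousOn
  have ig : IntegrableOn (gdot W φ) (DD F al be) := intg_D
    (fun x hx => (gdot_continuousAt ((hW x hx).of_le (by norm_num)) (hφ1 x hx)).continuousWithinAt)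
    ⟨C1 + C3, fun x hx => (gdot_abs_le _ _ _).trans (add_le_add (hC1 x hx) (hC3 x hx))⟩
  have il : IntegrableOn (fun x => -lap W x * φ x) (DD F al be) := intg_D
    (fun x hx => ((lap_continuousAt (hW x hx)).neg.mul hφ.continuousAt).continuousWithinAt)
    ⟨C2 * C4, fun x hx => by
      rw [abs_mul, abs_neg]
      exact mul_le_mul (hC2 x hx) (hC4 x (DD_sub hx)) (abs_nonneg _) ((abs_nonneg _).trans (hC2 x hx))⟩
  set εs : ℕ → ℝ := fun n => 1 / ((n : ℝ) + 1) with hεs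
  have hε : ∀ n, 0 < εs n := fun n => by rw [hεs]; positivity
  have hlim : Tendsto εs atTop (𝓝 0) := tendsto_one_div_add_atTop_nhds_zero_nat
  have heq : ∀ n, ∫ x in DD F al be, thd (εs n) (φ x) * gdot W φ x = ∫ x in DD F al be, -lap W x * th (εs n) (φ x) := by
    intro n
    have h := ibp_cpt (W := W) (ψ := fun x => th (εs n) (φ x)) hW (th_contDiff (n := 1) (hε n) hφ hφ0 (by norm_num) hφ1)
      (th_cs (hε n) hφ hφ0) ((th_tsupp (hε n) hφ).trans (lev_sub (hε n) hφ0))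
    rw [← setIntegral_eq_integral_of_forall_compl_eq_zero (s := DD F al be),
      ← setIntegral_eq_integral_of_forall_compl_eq_zero (s := DD F al be) (f := fun x => -lap W x * th (εs n) (φ x))] at h
    · rw [← h]
      refine setIntegral_congr_fun hm fun x hx => ?_
      unfold gdot
      rw [Finset.mul_sum]
      refine Finset.sum_congr rfl fun i _ => ?_
      rw [pd_comp (th_deriv (hε n) _) ((hφ1 x hx).differentiableAt (by norm_num))]; ring
    · intro x hx
      rw [hφ0 x hx, th_zero (hε n) (hε n).le, mul_zero]
    · intro x hx
      have : x ∉ tsupport (fun x => th (εs n) (φ x)) := fun h => hx (lev_sub (hε n) hφ0 (th_tsupp (hε n) hφ h))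
      have h1 := notMem_tsupport_iff_eventuallyEq.1 this
      unfold gdot
      refine Finset.sum_eq_zero fun i _ => ?_
      rw [pd_congr h1]; simp [pd]
  have t1 : Tendsto (fun n => ∫ x in DD F al be, thd (εs n) (φ x) * gdot W φ x) atTop (𝓝 (∫ x in DD F al be, gdot W φ x)) := by
    refine tendsto_integral_of_dominated_convergence (fun x => |gdot W φ x|) ?_ ig.abs ?_ ?_
    · intro n
      exact ((thd_smooth (n := 0)).continuous.comp hφ).aestronglyMeasurable.mul ig.aestronglyMeasurable
    · intro n
      refine Eventually.of_forall fun x => ?_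
      rw [Real.norm_eq_abs, abs_mul, abs_of_nonneg (thd_nonneg _)]
      exact mul_le_of_le_one_left (abs_nonneg _) (thd_le _)
    · refine (ae_restrict_iff' hm).2 (Eventually.of_forall fun x hx => ?_)
      rcases (hφn x).eq_or_lt with h | h
      · have hmin : IsLocalMin φ x := Eventually.of_forall fun y => by rw [← h]; exact hφn y
        have : gdot W φ x = 0 := by
          unfold gdot
          refine Finset.sum_eq_zero fun i _ => ?_
          unfold pd; rw [hmin.fderiv_eq_zero]; simp
        simp [this]
      · refine tendsto_const_nhds.congr' ?_
        filter_upwards [hlim.eventually (gt_mem_nhds (show (0 : ℝ) < φ x / 2 by positivity))] with n hn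
        rw [thd_one (hε n) (by linarith), one_mul]
  have t2 : Tendsto (fun n => ∫ x in DD F al be, -lap W x * th (εs n) (φ x)) atTop (𝓝 (∫ x in DD F al be, -lap W x * φ x)) := by
    refine tendsto_integral_of_dominated_convergence (fun x => |-lap W x * φ x|) ?_ il.abs ?_ ?_
    · intro n
      have : ContinuousOn (fun x => -lap W x * th (εs n) (φ x)) (DD F al be) := fun x hx =>
        ((lap_continuousAt (hW x hx)).neg.mul ((th_smooth (hε n)).continuous.comp hφ).continuousAt).continuousWithinAt
      exact this.aestronglyMeasurable hm
    · intro n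
      refine Eventually.of_forall fun x => ?_
      rw [Real.norm_eq_abs, abs_mul, abs_mul, abs_of_nonneg (th_nonneg (hε n) _), abs_of_nonneg (hφn x)]
      gcongr
      exact th_le (hε n) (hφn x)
    · refine Eventually.of_forall fun x => ?_
      refine Tendsto.const_mul _ ?_
      refine tendsto_of_tendsto_of_tendsto_of_le_of_le (g := fun n => φ x - 2 * εs n) (h := fun _ => φ x) ?_ tendsto_const_nhds
        (fun n => th_ge (hε n) _) (fun n => th_le (hε n) (hφn x))
      simpa using tendsto_const_nhds.sub (hlim.const_mul 2)
  simp only [heq] at t1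
  exact tendsto_nhds_unique t1 t2

end ibp
end Conc

namespace Conc
open Topology Set Module Metric

section mv
variable {F : Type} [NormedAddCommGroup F] [InnerProductSpace ℝ F] [FiniteDimensional ℝ F]
variable [MeasurableSpace F] [BorelSpace F]
variable {al be : ℝ}

lemma pos_pow_deriv (t : ℝ) : HasDerivAt (fun t : ℝ => max t 0 ^ 4) (4 * max t 0 ^ 3) t := by
  rcases lt_trichotomy t 0 with h | h | h
  · rw [max_eq_right h.le]
    refine HasDerivAt.congr_of_eventuallyEq (f := fun _ => (0 : ℝ)) (by simpa using hasDerivAt_const t (0 : ℝ)) ?_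
    filter_upwards [gt_mem_nhds h] with s hs
    rw [max_eq_right hs.le]; simp
  · subst h
    rw [hasDerivAt_iff_isLittleO_nhds_zero]
    simp only [max_self, zero_add]
    have h1 : (fun h : ℝ => max h 0 ^ 4 - 0 ^ 4 - h • (4 * (0 : ℝ) ^ 3)) =O[𝓝 0] fun h => h ^ 4 := by
      refine Asymptotics.IsBigO.of_bound 1 (Eventually.of_forall fun h => ?_)
      rcases le_total h 0 with hh | hh
      · rw [max_eq_right hh]; simp
      · rw [max_eq_left hh]; simp
    exact h1.trans_isLittleO (by simpa using Asymptotics.isLittleO_pow_id (n := 4) (𝕜 := ℝ) (by norm_num))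
  · rw [max_eq_left h.le]
    refine HasDerivAt.congr_of_eventuallyEq (f := fun t => t ^ 4) (by simpa using hasDerivAt_pow 4 t) ?_
    filter_upwards [lt_mem_nhds h] with s hs
    rw [max_eq_left hs.le]

/-- weight -/
def eta (z : F) : ℝ := max (1 - ‖z‖ ^ 2) 0 ^ 3
/-- its potential -/
def zet (z : F) : ℝ := max (1 - ‖z‖ ^ 2) 0 ^ 4 / 8

lemma eta_cont : Continuous (eta (F := F)) := by unfold eta; fun_prop
lemma eta_nonneg (z : F) : 0 ≤ eta z := by unfold eta; positivity
lemma eta_le (z : F) : eta z ≤ 1 := by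
  unfold eta
  exact pow_le_one₀ (by positivity) (max_le (by nlinarith [sq_nonneg ‖z‖]) (by norm_num))
lemma eta_zero {z : F} (h : z ∉ ball (0 : F) 1) : eta z = 0 := by
  have : 1 ≤ ‖z‖ := by simpa using h
  unfold eta
  rw [max_eq_right (by nlinarith)]; simp
lemma zet_zero {z : F} (h : z ∉ ball (0 : F) 1) : zet z = 0 := by
  have : 1 ≤ ‖z‖ := by simpa using h
  unfold zet
  rw [max_eq_right (by nlinarith)]; simp
lemma zet_nonneg (z : F) : 0 ≤ zet z := by unfold zet; positivity
lemma zet_le (z : F) : zet z ≤ eta z / 8 := by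
  unfold zet eta
  have h0 : 0 ≤ max (1 - ‖z‖ ^ 2) 0 := le_max_right _ _
  have h1 : max (1 - ‖z‖ ^ 2) 0 ≤ 1 := max_le (by nlinarith [sq_nonneg ‖z‖]) (by norm_num)
  have : max (1 - ‖z‖ ^ 2) 0 ^ 4 ≤ max (1 - ‖z‖ ^ 2) 0 ^ 3 := pow_le_pow_of_le_one h0 h1 (by norm_num)
  linarith
lemma eta_cs : HasCompactSupport (eta (F := F)) :=
  HasCompactSupport.intro (isCompact_closedBall (0 : F) 1) fun z hz => eta_zero fun h => hz (ball_subset_closedBall h)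
lemma zet_cs : HasCompactSupport (zet (F := F)) :=
  HasCompactSupport.intro (isCompact_closedBall (0 : F) 1) fun z hz => zet_zero fun h => hz (ball_subset_closedBall h)

/-- total weight -/
def cE (F : Type) [NormedAddCommGroup F] [InnerProductSpace ℝ F] [FiniteDimensional ℝ F]
    [MeasurableSpace F] [BorelSpace F] : ℝ := ∫ z : F, eta z

lemma cE_pos : 0 < cE F := by
  refine eta_cont.integral_pos_of_hasCompactSupport_nonneg_nonzero eta_cs eta_nonneg (x := 0) ?_
  simp [eta]

lemma zet_eq (z : F) : zet z = (fun q : ℝ => max (1 - q) 0 ^ 4 / 8) (‖z - 0‖ ^ 2) := by simp [zet]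

lemma zet_d (q : ℝ) : HasDerivAt (fun q : ℝ => max (1 - q) 0 ^ 4 / 8) (-(max (1 - q) 0 ^ 3 / 2)) q := by
  have h1 : HasDerivAt (fun q : ℝ => 1 - q) (-1) q := by simpa using (hasDerivAt_id' q).const_sub 1
  have := ((pos_pow_deriv (1 - q)).comp q h1).div_const 8
  refine this.congr_deriv ?_
  ring

lemma zet_C1 : ContDiff ℝ 1 (zet (F := F)) := by
  have h1 : ContDiff ℝ 1 (fun q : ℝ => max (1 - q) 0 ^ 4 / 8) := by
    rw [contDiff_one_iff_deriv]
    refine ⟨fun q => (zet_d q).differentiableAt, ?_⟩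
    have : deriv (fun q : ℝ => max (1 - q) 0 ^ 4 / 8) = fun q => -(max (1 - q) 0 ^ 3 / 2) := funext fun q => (zet_d q).deriv
    rw [this]; fun_prop
  have := h1.comp (contDiff_sq (0 : F) (n := 1))
  exact (funext zet_eq : (zet (F := F)) = _) ▸ this

lemma zet_pd (z : F) (i) : pd i zet z = - (eta z * inner ℝ z (stdOrthonormalBasis ℝ F i)) := by
  have : (zet (F := F)) = fun z => (fun q : ℝ => max (1 - q) 0 ^ 4 / 8) (‖z - 0‖ ^ 2) := funext zet_eq
  rw [this, pd_radial 0 (zet_d _)]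
  simp only [sub_zero, eta]; ring

lemma fderiv_expand (w : F → ℝ) (x z : F) :
    fderiv ℝ w x z = ∑ i, inner ℝ z (stdOrthonormalBasis ℝ F i) * pd i w x := by
  conv_lhs => rw [← (stdOrthonormalBasis ℝ F).sum_repr' z]
  rw [map_sum]
  refine Finset.sum_congr rfl fun i _ => ?_
  rw [map_smul, smul_eq_mul, real_inner_comm]; rfl

variable {w : F → ℝ} {x0 : F}

/-- averaged function -/
def MM (w : F → ℝ) (x0 : F) (t : ℝ) : ℝ := ∫ z : F, eta z * w (x0 + t • z)

lemma MM_intg (hw : Continuous w) (t : ℝ) : Integrable (fun z : F => eta z * w (x0 + t • z)) :=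
  Continuous.integrable_of_hasCompactSupport (eta_cont.mul (hw.comp (by fun_prop))) eta_cs.mul_right

lemma MM_zero : MM w x0 0 = w x0 * cE F := by
  unfold MM cE; simp only [zero_smul, add_zero]; rw [integral_mul_const]; ring

lemma zl_intg (hw : ContDiff ℝ 2 w) (t : ℝ) : Integrable (fun z : F => zet z * lap w (x0 + t • z)) := by
  have hl : Continuous (lap w) := continuous_iff_continuousAt.2 fun x => lap_continuousAt hw.contDiffAt
  exact Continuous.integrable_of_hasCompactSupport (zet_C1.continuous.mul (hl.comp (by fun_prop))) zet_cs.mul_right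

lemma MM_deriv (hw : ContDiff ℝ 2 w) (t0 : ℝ) :
    HasDerivAt (MM w x0) (t0 * ∫ z : F, zet z * lap w (x0 + t0 • z)) t0 := by
  have hw1 : ContDiff ℝ 1 w := hw.of_le (by norm_num)
  have hfc : Continuous (fderiv ℝ w) := hw.continuous_fderiv (by norm_num)
  obtain ⟨C, hC⟩ := (isCompact_closedBall x0 (|t0| + 1)).exists_bound_of_continuousOn hfc.continuousOn
  have hC0 : 0 ≤ C := (norm_nonneg _).trans (hC x0 (by simp; positivity))
  have hcont : ∀ t : ℝ, Continuous fun z : F => eta z * fderiv ℝ w (x0 + t • z) z := fun t =>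
    eta_cont.mul ((hfc.comp (by fun_prop)).clm_apply continuous_id)
  have key := hasDerivAt_integral_of_dominated_loc_of_deriv_le (μ := (volume : Measure F)) (𝕜 := ℝ)
    (F := fun t z => eta z * w (x0 + t • z)) (F' := fun t z => eta z * fderiv ℝ w (x0 + t • z) z) (x₀ := t0)
    (s := ball t0 1) (bound := fun z => eta z * C) (ball_mem_nhds t0 one_pos)
    (Eventually.of_forall fun t => (MM_intg hw.continuous t).aestronglyMeasurable)
    (MM_intg hw.continuous t0) (hcont t0).aestronglyMeasurable ?_ ?_ ?_
  · have h := key.2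
    refine h.congr_deriv ?_
    have e1 : ∀ z : F, eta z * fderiv ℝ w (x0 + t0 • z) z = ∑ i, -(pd i w (x0 + t0 • z) * pd i zet z) := by
      intro z
      rw [fderiv_expand, Finset.mul_sum]
      refine Finset.sum_congr rfl fun i _ => ?_
      rw [zet_pd]; ring
    simp only [e1]
    have hf1 : ∀ i, ContDiff ℝ 1 (fun z : F => pd i w (x0 + t0 • z)) := fun i => by
      have : ContDiff ℝ 1 (pd i w) := contDiff_iff_contDiffAt.2 fun x => contDiffAt_pd (n := 1) hw.contDiffAt i
      exact this.comp (by fun_prop)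
    have hpd : ∀ i (z : F), pd i (fun z : F => pd i w (x0 + t0 • z)) z = t0 * pd i (pd i w) (x0 + t0 • z) := by
      intro i z
      unfold pd
      have h1 : HasFDerivAt (fun z : F => x0 + t0 • z) (t0 • ContinuousLinearMap.id ℝ F) z :=
        ((hasFDerivAt_id z).const_smul t0).const_add x0
      have h2 : DifferentiableAt ℝ (pd i w) (x0 + t0 • z) := differentiableAt_pd hw.contDiffAt i
      have := (h2.hasFDerivAt.comp z h1).fderiv
      have h3 : (fun z : F => fderiv ℝ w (x0 + t0 • z) (stdOrthonormalBasis ℝ F i)) = pd i w ∘ fun z => x0 + t0 • z := rfl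
      rw [h3, this]; simp; left; rfl
    have hi := fun i => ibp_i (O := univ) (f := fun z : F => pd i w (x0 + t0 • z)) (ψ := zet) (fun x _ => (hf1 i).contDiffAt) zet_C1 zet_cs
      (subset_univ _) i
    rw [integral_finsetSum (f := fun i z => -(pd i w (x0 + t0 • z) * pd i zet z)) _ fun i _ => (hi i).1.neg]
    have e2 : ∀ z : F, zet z * lap w (x0 + t0 • z) = ∑ i, zet z * pd i (pd i w) (x0 + t0 • z) := fun z => by
      unfold lap; rw [Finset.mul_sum]
    simp only [e2]
    rw [← integral_const_mul]
    simp only [Finset.mul_sum]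
    have e3 : ∀ i (z : F), t0 * (zet z * pd i (pd i w) (x0 + t0 • z)) = zet z * pd i (fun z : F => pd i w (x0 + t0 • z)) z := fun i z => by
      rw [hpd]; ring
    simp only [e3]
    rw [integral_finsetSum _ fun i _ => (hi i).2.1]
    refine Finset.sum_congr rfl fun i _ => ?_
    rw [integral_neg, (hi i).2.2, neg_neg]
  · refine Eventually.of_forall fun z t ht => ?_
    by_cases hz : z ∈ ball (0 : F) 1
    · have hz1 : ‖z‖ ≤ 1 := by
        have : ‖z‖ < 1 := by simpa using hz
        exact this.le
      rw [Real.norm_eq_abs, abs_mul, abs_of_nonneg (eta_nonneg z)]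
      gcongr
      · exact eta_nonneg z
      have ht' : |t| ≤ |t0| + 1 := by
        have : |t - t0| < 1 := ht
        have := abs_sub_abs_le_abs_sub t t0
        linarith
      have hmem : x0 + t • z ∈ closedBall x0 (|t0| + 1) := by
        rw [mem_closedBall, dist_eq_norm, add_sub_cancel_left, norm_smul, Real.norm_eq_abs]
        nlinarith [abs_nonneg t, norm_nonneg z]
      calc |fderiv ℝ w (x0 + t • z) z| ≤ ‖fderiv ℝ w (x0 + t • z)‖ * ‖z‖ := (fderiv ℝ w (x0 + t • z)).le_opNorm z
        _ ≤ C * 1 := by gcongr; exact hC _ hmem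
        _ = C := mul_one _
    · rw [eta_zero hz]; simp
  · exact (eta_cont.integrable_of_hasCompactSupport eta_cs).mul_const C
  · refine Eventually.of_forall fun z t ht => ?_
    have h1 : HasDerivAt (fun t : ℝ => x0 + t • z) z t := by
      simpa using ((hasDerivAt_id' t).smul_const z).const_add x0
    have h2 := (hw1.differentiable (by norm_num) (x0 + t • z)).hasFDerivAt.comp_hasDerivAt t h1
    exact h2.const_mul (eta z)

lemma mv_pt {r t : ℝ} (ht : 0 ≤ t) (htr : t ≤ r) {z : F} (hz : z ∈ ball (0 : F) 1) (hr : 0 < r) : x0 + t • z ∈ ball x0 r := by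
  have hz1 : ‖z‖ < 1 := by simpa using hz
  rw [mem_ball, dist_eq_norm, add_sub_cancel_left, norm_smul, Real.norm_eq_abs, abs_of_nonneg ht]
  rcases ht.eq_or_lt with h | h
  · rw [← h]; simpa
  · nlinarith

lemma MM_gron {κ r : ℝ} (hr : 0 < r) {g : ℝ → ℝ} (g' : ℝ → ℝ) (hg : ∀ t, HasDerivAt g (g' t) t)
    (h : ∀ t, 0 ≤ t → t ≤ r → -(t * κ / 8 * g t) ≤ g' t) : g 0 ≤ exp (κ * r ^ 2 / 16) * g r := by
  have hd : ∀ t, HasDerivAt (fun t => exp (κ * t ^ 2 / 16) * g t)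
      (exp (κ * t ^ 2 / 16) * (κ * t / 8) * g t + exp (κ * t ^ 2 / 16) * g' t) t := fun t => by
    have h1 : HasDerivAt (fun t : ℝ => κ * t ^ 2 / 16) (κ * t / 8) t := by
      refine (((hasDerivAt_pow 2 t).const_mul κ).div_const 16).congr_deriv ?_
      simp; ring
    exact h1.exp.mul (hg t)
  have hm : MonotoneOn (fun t => exp (κ * t ^ 2 / 16) * g t) (Icc 0 r) := by
    refine monotoneOn_of_deriv_nonneg (convex_Icc _ _) (fun t _ => (hd t).continuousAt.continuousWithinAt)
      (fun t _ => (hd t).differentiableAt.differentiableWithinAt) fun t ht => ?_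
    rw [interior_Icc] at ht
    rw [(hd t).deriv]
    have := h t ht.1.le ht.2.le
    have h2 : exp (κ * t ^ 2 / 16) * (κ * t / 8) * g t + exp (κ * t ^ 2 / 16) * g' t
      = exp (κ * t ^ 2 / 16) * (g' t + t * κ / 8 * g t) := by ring
    rw [h2]
    exact mul_nonneg (exp_pos _).le (by linarith)
  have := hm (left_mem_Icc.2 hr.le) (right_mem_Icc.2 hr.le) hr.le
  simpa using this

lemma mean_sub {κ r : ℝ} (hκ : 0 ≤ κ) (hr : 0 < r) (hw : ContDiff ℝ 2 w) (h0 : ∀ x ∈ ball x0 r, 0 ≤ w x)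
    (hl : ∀ x ∈ ball x0 r, -lap w x ≤ κ * w x) : w x0 * cE F ≤ exp (κ * r ^ 2 / 16) * MM w x0 r := by
  rw [← MM_zero]
  refine MM_gron hr _ (MM_deriv hw) fun t ht htr => ?_
  have : -(κ / 8 * MM w x0 t) ≤ ∫ z : F, zet z * lap w (x0 + t • z) := by
    unfold MM
    rw [← integral_const_mul, ← integral_neg]
    refine integral_mono ((MM_intg hw.continuous t).const_mul _).neg (zl_intg hw t) fun z => ?_
    by_cases hz : z ∈ ball (0 : F) 1
    · have hp := mv_pt (x0 := x0) ht htr hz hr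
      have h1 := hl _ hp
      have h2 := h0 _ hp
      have h3 := zet_le z
      have h4 := zet_nonneg z
      simp only
      have h5 : zet z * (-lap w (x0 + t • z)) ≤ zet z * (κ * w (x0 + t • z)) := mul_le_mul_of_nonneg_left h1 h4
      have h6 : zet z * (κ * w (x0 + t • z)) ≤ eta z / 8 * (κ * w (x0 + t • z)) := mul_le_mul_of_nonneg_right h3 (by positivity)
      linarith
    · simp [eta_zero hz, zet_zero hz]
  nlinarith

lemma mean_super {κ r : ℝ} (hκ : 0 ≤ κ) (hr : 0 < r) (hw : ContDiff ℝ 2 w) (h0 : ∀ x ∈ ball x0 r, 0 ≤ w x)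
    (hl : ∀ x ∈ ball x0 r, lap w x ≤ κ * w x) : MM w x0 r ≤ exp (κ * r ^ 2 / 16) * (w x0 * cE F) := by
  have hg := MM_gron (κ := -κ) hr (g := fun t => - MM w x0 t) _ (fun t => (MM_deriv (x0 := x0) hw t).neg) fun t ht htr => ?_
  · rw [MM_zero] at hg
    have h1 : exp (κ * r ^ 2 / 16) * exp (-κ * r ^ 2 / 16) = 1 := by rw [← exp_add]; ring_nf; simp
    have h2 : exp (-κ * r ^ 2 / 16) * MM w x0 r ≤ w x0 * cE F := by linarith
    have h3 := mul_le_mul_of_nonneg_left h2 (exp_pos (κ * r ^ 2 / 16)).le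
    rw [← mul_assoc, h1, one_mul] at h3
    exact h3
  · have : ∫ z : F, zet z * lap w (x0 + t • z) ≤ κ / 8 * MM w x0 t := by
      unfold MM
      rw [← integral_const_mul]
      refine integral_mono (zl_intg hw t) ((MM_intg hw.continuous t).const_mul _) fun z => ?_
      by_cases hz : z ∈ ball (0 : F) 1
      · have hp := mv_pt (x0 := x0) ht htr hz hr
        have h1 := hl _ hp
        have h2 := h0 _ hp
        have h3 := zet_le z
        have h4 := zet_nonneg z
        simp only
        have h5 : zet z * (lap w (x0 + t • z)) ≤ zet z * (κ * w (x0 + t • z)) := mul_le_mul_of_nonneg_left h1 h4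
        have h6 : zet z * (κ * w (x0 + t • z)) ≤ eta z / 8 * (κ * w (x0 + t • z)) := mul_le_mul_of_nonneg_right h3 (by positivity)
        linarith
      · simp [eta_zero hz, zet_zero hz]
    nlinarith

end mv
end Conc

namespace Conc
open Topology Set Module Metric

section mv2
variable {F : Type} [NormedAddCommGroup F] [InnerProductSpace ℝ F] [FiniteDimensional ℝ F]
variable [MeasurableSpace F] [BorelSpace F]
variable {al be : ℝ}

lemma lap_comp {v : F → ℝ} {x : F} {φ φ' : ℝ → ℝ} {φ'' : ℝ} (h : ∀ t, HasDerivAt φ (φ' t) t) (h2 : HasDerivAt φ' φ'' (v x))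
    (hv : ContDiffAt ℝ 2 v x) : lap (fun y => φ (v y)) x = φ' (v x) * lap v x + φ'' * gdot v v x := by
  unfold lap gdot
  rw [Finset.mul_sum, Finset.mul_sum, ← Finset.sum_add_distrib]
  refine Finset.sum_congr rfl fun i _ => ?_
  have hd : DifferentiableAt ℝ v x := hv.differentiableAt (by norm_num)
  have e : pd i (fun y => φ (v y)) =ᶠ[𝓝 x] fun y => φ' (v y) * pd i v y := by
    filter_upwards [C2_ev hv] with y hy
    exact pd_comp (h _) (hy.differentiableAt (by norm_num)) i
  have hd2 : DifferentiableAt ℝ (fun y => φ' (v y)) x := h2.differentiableAt.comp x hd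
  rw [pd_congr e, pd_mul (f := fun y => φ' (v y)) hd2 (differentiableAt_pd hv i),
    pd_comp h2 hd]
  ring

lemma lap_const (c : ℝ) (x : F) : lap (fun _ : F => c) x = 0 := by
  have : ∀ i, pd i (fun _ : F => c) = fun _ => 0 := fun i => by funext y; simp [pd]
  unfold lap
  refine Finset.sum_eq_zero fun i _ => ?_
  rw [this]; simp [pd]

variable {v : F → ℝ} {x0 : F}

lemma mean_v {κ r : ℝ} (hκ : 0 ≤ κ) (hr : 0 < r) (hv : Continuous v) (h0 : ∀ z, z ∉ DD F al be → v z = 0)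
    (hn : ∀ z, 0 ≤ v z) (h2 : ∀ x ∈ DD F al be, ContDiffAt ℝ 2 v x) (hl : ∀ x ∈ DD F al be, -lap v x ≤ κ * v x) :
    v x0 * cE F ≤ exp (κ * r ^ 2 / 16) * MM v x0 r := by
  have key : ∀ ε > 0, v x0 * cE F ≤ exp (κ * r ^ 2 / 16) * (MM v x0 r + 2 * ε * cE F) := by
    intro ε hε
    have hc : ContDiff ℝ 2 (fun x => th ε (v x)) := th_contDiff (n := 2) hε hv h0 le_rfl h2
    have hc2 : ContDiff ℝ 2 (fun x => th ε (v x) + 2 * ε) := hc.add contDiff_const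
    have hlap : ∀ x, lap (fun x => th ε (v x) + 2 * ε) x = lap (fun x => th ε (v x)) x := fun x => by
      rw [lap_add hc.contDiffAt contDiffAt_const, lap_const, add_zero]
    have h1 := mean_sub (x0 := x0) hκ hr hc2 (fun x _ => by have := th_nonneg hε (v x); positivity) (fun x _ => by
      rw [hlap]
      by_cases hx : x ∈ DD F al be
      · have hm : 0 ≤ deriv (thd ε) (v x) := (thd_mono hε).deriv_nonneg
        rw [lap_comp (th_deriv hε) ((thd_smooth (n := 1)).differentiable (by norm_num) (v x)).hasDerivAt (h2 x hx)]
        have g1 := th_ge hε (v x)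
        have g2 := thd_nonneg (ε := ε) (v x)
        have g3 := thd_le (ε := ε) (v x)
        have g4 := hl x hx
        have g5 : 0 ≤ deriv (thd ε) (v x) * gdot v v x := mul_nonneg hm (gdot_self_nonneg _ _)
        have g6 : thd ε (v x) * (-lap v x) ≤ thd ε (v x) * (κ * v x) := mul_le_mul_of_nonneg_left g4 g2
        have g7 : thd ε (v x) * (κ * v x) ≤ 1 * (κ * v x) := mul_le_mul_of_nonneg_right g3 (mul_nonneg hκ (hn x))
        have g8 : κ * v x ≤ κ * (th ε (v x) + 2 * ε) := mul_le_mul_of_nonneg_left (by linarith) hκ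
        linarith
      · have : x ∉ tsupport (fun x => th ε (v x)) := fun h => hx (lev_sub hε h0 (th_tsupp hε hv h))
        have e := notMem_tsupport_iff_eventuallyEq.1 this
        rw [lap_congr e]
        have : lap (0 : F → ℝ) x = 0 := lap_const 0 x
        rw [this]
        have := th_nonneg hε (v x)
        simp only [neg_zero]
        positivity)
    have h3 : v x0 ≤ th ε (v x0) + 2 * ε := by linarith [th_ge hε (v x0)]
    have h4 : MM (fun x => th ε (v x) + 2 * ε) x0 r ≤ MM v x0 r + 2 * ε * cE F := by
      unfold MM cE
      rw [← integral_const_mul, ← integral_add (MM_intg hv r) ((eta_cont.integrable_of_hasCompactSupport eta_cs).const_mul _)]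
      refine integral_mono (MM_intg hc2.continuous r) ((MM_intg hv r).add ((eta_cont.integrable_of_hasCompactSupport eta_cs).const_mul _)) fun z => ?_
      have := mul_le_mul_of_nonneg_left (th_le hε (hn (x0 + r • z))) (eta_nonneg z)
      simp only
      linarith
    calc v x0 * cE F ≤ (th ε (v x0) + 2 * ε) * cE F := mul_le_mul_of_nonneg_right h3 cE_pos.le
      _ ≤ _ := h1
      _ ≤ _ := mul_le_mul_of_nonneg_left h4 (exp_pos _).le
  have hlim : Tendsto (fun ε : ℝ => exp (κ * r ^ 2 / 16) * (MM v x0 r + 2 * ε * cE F)) (𝓝[>] 0)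
      (𝓝 (exp (κ * r ^ 2 / 16) * (MM v x0 r + 2 * 0 * cE F))) := by
    refine Tendsto.mono_left ?_ nhdsWithin_le_nhds
    exact Continuous.tendsto (by fun_prop) 0
  have := ge_of_tendsto hlim (eventually_mem_nhdsWithin.mono fun ε hε => key ε hε)
  simpa using this

/-- local boundedness in terms of a convex functional -/
lemma mvG {κ : ℝ} (hκ : 0 < κ) (hv : Continuous v) (h0 : ∀ z, z ∉ DD F al be → v z = 0)
    (hn : ∀ z, 0 ≤ v z) (h2 : ∀ x ∈ DD F al be, ContDiffAt ℝ 2 v x) (hl : ∀ x ∈ DD F al be, -lap v x ≤ κ * v x)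
    {G : ℝ → ℝ} (hG : Continuous G) (hGn : ∀ t, 0 ≤ G t) (hGc : ∀ τ t, 0 < τ → τ ≤ t → t * G τ ≤ τ * G t) (hx : 0 < v x0) :
    cE F * G (v x0 / 4) ≤ (√κ) ^ finrank ℝ F * ∫ x in ball x0 (1 / √κ), G (v x) := by
  set r := 1 / √κ with hr
  have hsk : 0 < √κ := sqrt_pos.2 hκ
  have hr0 : 0 < r := by positivity
  set τ := v x0 / 4 with hτ
  have hτ0 : 0 < τ := by positivity
  set I := ∫ x in ball x0 r, G (v x) with hI
  have hI0 : 0 ≤ I := setIntegral_nonneg measurableSet_ball fun x _ => hGn _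
  rcases (hGn τ).eq_or_lt with h | hGτ
  · rw [← h, mul_zero]; positivity
  have hkr : κ * r ^ 2 = 1 := by rw [hr, div_pow, sq_sqrt hκ.le]; field_simp
  have h1 := mean_v (x0 := x0) hκ.le hr0 hv h0 hn h2 hl
  rw [hkr] at h1
  have hexp : exp ((1 : ℝ) / 16) ≤ 2 := by
    have h3 : exp ((1 : ℝ) / 16) ≤ 1 / (1 - 1 / 16) := by
      have h5 := add_one_le_exp (-(1 / 16 : ℝ))
      rw [exp_neg] at h5
      have h6 := exp_pos (1 / 16 : ℝ)
      rw [le_div_iff₀ (by norm_num)]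
      have h7 : exp (1 / 16 : ℝ) * (exp (1 / 16 : ℝ))⁻¹ = 1 := mul_inv_cancel₀ h6.ne'
      nlinarith
    refine h3.trans (by norm_num)
  have hpt : ∀ t, 0 ≤ t → t ≤ τ + τ / G τ * G t := by
    intro t ht
    rcases le_total t τ with h | h
    · have : 0 ≤ τ / G τ * G t := mul_nonneg (by positivity) (hGn t)
      linarith
    · have := hGc τ t hτ0 h
      have h3 : t ≤ τ / G τ * G t := by
        rw [div_mul_eq_mul_div, le_div_iff₀ hGτ]; exact this
      linarith
  have hitg0 : Integrable (fun x => (ball x0 r).indicator (fun x => G (v x)) x) := by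
    rw [integrable_indicator_iff measurableSet_ball]
    exact ((hG.comp hv).continuousOn.integrableOn_compact (isCompact_closedBall x0 r)).mono_set ball_subset_closedBall
  have hint2 : Integrable (fun z : F => (ball x0 r).indicator (fun x => G (v x)) (x0 + r • z)) := by
    have := (hitg0.comp_add_left x0)
    exact (integrable_comp_smul_iff (volume : Measure F) (fun z => (ball x0 r).indicator (fun x => G (v x)) (x0 + z)) hr0.ne').2 this
  have h2' : MM v x0 r ≤ τ * cE F + τ / G τ * ((√κ) ^ finrank ℝ F * I) := by
    have e1 : (√κ) ^ finrank ℝ F * I = ∫ z : F, (ball x0 r).indicator (fun x => G (v x)) (x0 + r • z) := by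
      rw [Measure.integral_comp_smul (volume : Measure F) (fun z => (ball x0 r).indicator (fun x => G (v x)) (x0 + z)) r,
        integral_add_left_eq_self (fun z => (ball x0 r).indicator (fun x => G (v x)) z) x0, integral_indicator measurableSet_ball,
        abs_of_pos (by positivity), ← hI, smul_eq_mul]
      congr 1
      rw [hr, one_div, inv_pow, inv_inv]
    rw [e1]
    unfold MM cE
    rw [← integral_const_mul, ← integral_const_mul, ← integral_add ((eta_cont.integrable_of_hasCompactSupport eta_cs).const_mul _) (hint2.const_mul _)]
    refine integral_mono (MM_intg hv r) (((eta_cont.integrable_of_hasCompactSupport eta_cs).const_mul _).add (hint2.const_mul _)) fun z => ?_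
    simp only
    by_cases hz : z ∈ ball (0 : F) 1
    · rw [indicator_of_mem (mv_pt hr0.le le_rfl hz hr0)]
      have g1 := hpt _ (hn (x0 + r • z))
      have g2 := mul_le_mul_of_nonneg_left g1 (eta_nonneg z)
      have g3 : eta z * (τ / G τ * G (v (x0 + r • z))) ≤ 1 * (τ / G τ * G (v (x0 + r • z))) :=
        mul_le_mul_of_nonneg_right (eta_le z) (mul_nonneg (by positivity) (hGn _))
      linarith
    · rw [eta_zero hz]
      simp only [zero_mul, mul_zero, zero_add]
      exact mul_nonneg (by positivity) (indicator_nonneg (fun x _ => hGn _) _)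
  have hMM : 0 ≤ MM v x0 r := integral_nonneg fun z => mul_nonneg (eta_nonneg z) (hn _)
  have h3 : 4 * τ * cE F ≤ 2 * (τ * cE F + τ / G τ * ((√κ) ^ finrank ℝ F * I)) := by
    have e : 4 * τ = v x0 := by rw [hτ]; ring
    rw [e]
    calc _ ≤ _ := h1
      _ ≤ 2 * MM v x0 r := mul_le_mul_of_nonneg_right hexp hMM
      _ ≤ _ := by linarith
  have h4 : τ * cE F ≤ τ / G τ * ((√κ) ^ finrank ℝ F * I) := by linarith
  have h5 : τ / G τ * ((√κ) ^ finrank ℝ F * I) = (τ * ((√κ) ^ finrank ℝ F * I)) / G τ := by ring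
  rw [h5, le_div_iff₀ hGτ, mul_assoc] at h4
  exact le_of_mul_le_mul_left h4 hτ0

lemma DD_conn (hN : 3 ≤ finrank ℝ F) : IsPreconnected (DD F al be) := by
  by_cases hal0 : 0 ≤ al
  swap
  · -- ball case, not needed in practice
    have : DD F al be = ball (0 : F) be := by
      ext z; constructor
      · intro h; simpa using h.2
      · intro h; exact ⟨by have := norm_nonneg z; push Not at hal0; linarith, by simpa using h⟩
    rw [this]; exact (convex_ball _ _).isPreconnected
  have hrank : 1 < Module.rank ℝ F := by
    rw [← finrank_eq_rank]; exact_mod_cast (by omega : 1 < finrank ℝ F)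
  have h1 : IsPreconnected ((Ioo al be) ×ˢ (sphere (0 : F) 1)) := isPreconnected_Ioo.prod (isPreconnected_sphere hrank 0 1)
  have h2 : DD F al be = (fun q : ℝ × F => q.1 • q.2) '' ((Ioo al be) ×ˢ (sphere (0 : F) 1)) := by
    ext z; constructor
    · intro h
      have hz : ‖z‖ ≠ 0 := by have := h.1; linarith
      refine ⟨(‖z‖, ‖z‖⁻¹ • z), ⟨⟨h.1, h.2⟩, ?_⟩, ?_⟩
      · simp [norm_smul, hz]
      · simp [smul_smul, hz]
    · rintro ⟨⟨t, y⟩, ⟨ht, hy⟩, rfl⟩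
      have hy' : ‖y‖ = 1 := by simpa using hy
      have : ‖t • y‖ = t := by rw [norm_smul, hy', mul_one, Real.norm_eq_abs, abs_of_nonneg (hal0.trans ht.1.le)]
      exact ⟨by simpa [this] using ht.1, by simpa [this] using ht.2⟩
  rw [h2]
  exact h1.image _ (by fun_prop)

lemma smp_local {κ : ℝ} (hκ : 0 ≤ κ) {O : Set F} (hO : IsOpen O) (hx : x0 ∈ O) (hn : ∀ z, 0 ≤ v z) (h2 : ∀ x ∈ O, ContDiffAt ℝ 2 v x)
    (hl : ∀ x ∈ O, lap v x ≤ κ * v x) (hz : v x0 = 0) : ∀ᶠ x in 𝓝 x0, v x = 0 := by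
  obtain ⟨R, hR, hRO⟩ := Metric.isOpen_iff.1 hO x0 hx
  let b : ContDiffBump x0 := ⟨R / 3, R / 2, by positivity, by linarith⟩
  have hcl : closedBall x0 (R / 2) ⊆ O := fun y hy => hRO (by
    have : dist y x0 ≤ R / 2 := hy
    exact mem_ball.2 (by linarith))
  have hw : ContDiff ℝ 2 (fun x => b x * v x) := by
    rw [contDiff_iff_contDiffAt]
    intro x
    by_cases hx' : x ∈ closedBall x0 (R / 2)
    · exact b.contDiffAt.mul (h2 x (hcl hx'))
    · refine (contDiffAt_const (c := (0 : ℝ))).congr_of_eventuallyEq ?_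
      have : x ∉ tsupport b := by rw [b.tsupport_eq]; exact hx'
      filter_upwards [notMem_tsupport_iff_eventuallyEq.1 this] with y hy
      simp [hy]
  have he : ∀ x ∈ ball x0 (R / 3), (fun x => b x * v x) =ᶠ[𝓝 x] v := by
    intro x hx'
    filter_upwards [isOpen_ball.mem_nhds hx'] with y hy
    rw [b.one_of_mem_closedBall (ball_subset_closedBall hy), one_mul]
  have h1 := mean_super (w := fun x => b x * v x) (x0 := x0) hκ (show 0 < R / 3 by positivity) hw
    (fun x _ => mul_nonneg b.nonneg (hn x)) (fun x hx' => by
      rw [lap_congr (he x hx'), b.one_of_mem_closedBall (ball_subset_closedBall hx'), one_mul]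
      exact hl x (hRO (ball_subset_ball (by linarith) hx')))
  simp only [hz, mul_zero, zero_mul] at h1
  have hc : Continuous fun z : F => eta z * (b (x0 + (R / 3) • z) * v (x0 + (R / 3) • z)) :=
    eta_cont.mul (hw.continuous.comp (g := fun x => b x * v x) (f := fun z : F => x0 + (R / 3) • z) (by fun_prop))
  have h3 : ∀ z : F, eta z * (b (x0 + (R / 3) • z) * v (x0 + (R / 3) • z)) = 0 := by
    by_contra hcon
    push Not at hcon
    obtain ⟨z, hzz⟩ := hcon
    have := hc.integral_pos_of_hasCompactSupport_nonneg_nonzero (μ := (volume : Measure F)) eta_cs.mul_right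
      (fun z => mul_nonneg (eta_nonneg z) (mul_nonneg b.nonneg (hn _))) hzz
    exact absurd h1 (not_le.2 this)
  filter_upwards [ball_mem_nhds x0 (show 0 < R / 3 by positivity)] with y hy
  have hR3 : (R / 3) ≠ 0 := by positivity
  have hy' : dist y x0 < R / 3 := hy
  have h4 := h3 ((R / 3)⁻¹ • (y - x0))
  rw [smul_smul, mul_inv_cancel₀ hR3, one_smul, add_sub_cancel] at h4
  rw [b.one_of_mem_closedBall (ball_subset_closedBall hy), one_mul] at h4
  refine (mul_eq_zero.1 h4).resolve_left ?_
  unfold eta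
  have h5 : ‖(R / 3)⁻¹ • (y - x0)‖ < 1 := by
    rw [norm_smul, norm_inv, Real.norm_of_nonneg (by positivity), ← dist_eq_norm, inv_mul_lt_iff₀ (by positivity)]; linarith
  have h6 : 0 < 1 - ‖(R / 3)⁻¹ • (y - x0)‖ ^ 2 := by nlinarith [norm_nonneg ((R / 3)⁻¹ • (y - x0))]
  rw [max_eq_left h6.le]; positivity

/-- strong maximum principle -/
lemma smp (hN : 3 ≤ finrank ℝ F) {κ : ℝ} (hκ : 0 ≤ κ) (hn : ∀ z, 0 ≤ v z) (h2 : ∀ x ∈ DD F al be, ContDiffAt ℝ 2 v x)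
    (hl : ∀ x ∈ DD F al be, lap v x ≤ κ * v x) {x1 : F} (hx1 : x1 ∈ DD F al be) (hp : 0 < v x1) {x : F} (hx : x ∈ DD F al be) : 0 < v x := by
  by_contra hcon
  have hz : v x = 0 := le_antisymm (not_lt.1 hcon) (hn x)
  have o1 : IsOpen {y | y ∈ DD F al be ∧ 0 < v y} := by
    rw [isOpen_iff_mem_nhds]
    rintro y ⟨hy, hy'⟩
    filter_upwards [(DD_open al be).mem_nhds hy, (h2 y hy).continuousAt.eventually (lt_mem_nhds hy')] with w a b using ⟨a, b⟩
  have o2 : IsOpen {y | y ∈ DD F al be ∧ v y = 0} := by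
    rw [isOpen_iff_mem_nhds]
    rintro y ⟨hy, hy'⟩
    filter_upwards [(DD_open al be).mem_nhds hy, smp_local hκ (DD_open al be) hy hn h2 hl hy'] with w a b using ⟨a, b⟩
  obtain ⟨y, -, hy1, hy2⟩ := DD_conn (al := al) (be := be) hN _ _ o1 o2 (fun y hy => by
    rcases (hn y).eq_or_lt with h | h
    · exact Or.inr ⟨hy, h.symm⟩
    · exact Or.inl ⟨hy, h⟩) ⟨x1, hx1, hx1, hp⟩ ⟨x, hx, hx, hz⟩
  have a := hy1.2
  rw [hy2.2] at a
  exact lt_irrefl _ a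

end mv2
end Conc

namespace Conc
open Topology Set Module Metric

section adm
variable {F : Type} [NormedAddCommGroup F] [InnerProductSpace ℝ F] [FiniteDimensional ℝ F]
variable [MeasurableSpace F] [BorelSpace F]
variable {al be lam : ℝ} {e : F}

/-- admissible functions -/
structure Adm (e : F) (al be : ℝ) (φ : F → ℝ) : Prop where
  cls : Cls e al be φ
  nn : ∀ z, 0 ≤ φ z
  c1 : ∀ x ∈ DD F al be, ContDiffAt ℝ 1 φ x
  gb : ∃ C, ∀ x ∈ DD F al be, gdot φ φ x ≤ C

/-- the energy form -/
def BB (al be lam : ℝ) (φ ψ : F → ℝ) : ℝ := ∫ x in DD F al be, (gdot φ ψ x + lam * (VV x * (φ x * ψ x)))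

lemma VV_cA (hal : 0 < al) {x : F} (hx : x ∈ DD F al be) : ContinuousAt (VV (F := F)) x :=
  (VV_smooth (n := 0) (DD_ne hal hx)).continuousAt

lemma VV_up (hal : 0 < al) {x : F} (hx : x ∈ DD F al be) : VV x ≤ 1 / (2 * al) := by
  unfold VV
  exact one_div_le_one_div_of_le (by positivity) (by linarith [hx.1])

lemma VV_lo (hal : 0 < al) {x : F} (hx : x ∈ DD F al be) : 1 / (2 * be) ≤ VV x := by
  unfold VV
  have := hx.1
  exact one_div_le_one_div_of_le (by linarith) (by linarith [hx.2])

lemma DD_ms : MeasurableSet (DD F al be) := (DD_open al be).measurableSet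

/-- integrability of V f for bounded continuous f -/
lemma V_intg (hal : 0 < al) {f : F → ℝ} (hf : ContinuousOn f (DD F al be)) (hb : ∃ C, ∀ x ∈ DD F al be, |f x| ≤ C) :
    IntegrableOn (fun x => VV x * f x) (DD F al be) := by
  obtain ⟨C, hC⟩ := hb
  refine intg_D (fun x hx => (VV_cA hal hx).continuousWithinAt.mul (hf x hx)) ⟨1 / (2 * al) * C, fun x hx => ?_⟩
  rw [abs_mul, abs_of_nonneg (VV_nonneg x)]
  exact mul_le_mul (VV_up hal hx) (hC x hx) (abs_nonneg _) (by positivity)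

lemma bdd_D {f : F → ℝ} (hf : Continuous f) : ∃ C, ∀ x ∈ DD F al be, |f x| ≤ C := by
  obtain ⟨M, hM⟩ := (cD_compact (F := F) (al := al) (be := be)).exists_bound_of_continuousOn hf.continuousOn
  exact ⟨M, fun x hx => hM x (DD_sub hx)⟩

lemma V_intg' (hal : 0 < al) {f : F → ℝ} (hf : Continuous f) :
    IntegrableOn (fun x => VV x * f x) (DD F al be) := V_intg hal hf.continuousOn (bdd_D hf)

lemma g_intg {φ ψ : F → ℝ} (h1 : ∀ x ∈ DD F al be, ContDiffAt ℝ 1 φ x) (h2 : ∀ x ∈ DD F al be, ContDiffAt ℝ 1 ψ x)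
    (b1 : ∃ C, ∀ x ∈ DD F al be, gdot φ φ x ≤ C) (b2 : ∃ C, ∀ x ∈ DD F al be, gdot ψ ψ x ≤ C) :
    IntegrableOn (gdot φ ψ) (DD F al be) := by
  obtain ⟨C1, hC1⟩ := b1
  obtain ⟨C2, hC2⟩ := b2
  exact intg_D (fun x hx => (gdot_continuousAt (h1 x hx) (h2 x hx)).continuousWithinAt)
    ⟨C1 + C2, fun x hx => (gdot_abs_le _ _ _).trans (add_le_add (hC1 x hx) (hC2 x hx))⟩

lemma Adm.gi {φ ψ : F → ℝ} (h : Adm e al be φ) (h' : Adm e al be ψ) : IntegrableOn (gdot φ ψ) (DD F al be) :=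
  g_intg h.c1 h'.c1 h.gb h'.gb

lemma Adm.vi (hal : 0 < al) {φ ψ : F → ℝ} (h : Adm e al be φ) (h' : Adm e al be ψ) :
    IntegrableOn (fun x => lam * (VV x * (φ x * ψ x))) (DD F al be) :=
  (V_intg' hal (h.cls.cont.mul h'.cls.cont)).const_mul lam

lemma Adm.bi (hal : 0 < al) {φ ψ : F → ℝ} (h : Adm e al be φ) (h' : Adm e al be ψ) :
    IntegrableOn (fun x => gdot φ ψ x + lam * (VV x * (φ x * ψ x))) (DD F al be) := (h.gi h').add (h.vi hal h')

lemma BB_nonneg (hlam : 0 ≤ lam) (φ : F → ℝ) : 0 ≤ BB al be lam φ φ :=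
  setIntegral_nonneg DD_ms fun x _ => add_nonneg (gdot_self_nonneg _ _)
    (mul_nonneg hlam (mul_nonneg (VV_nonneg x) (mul_self_nonneg _)))

lemma gdot_smul {φ : F → ℝ} {x : F} (h : ContDiffAt ℝ 1 φ x) (c : ℝ) :
    gdot (fun y => c * φ y) (fun y => c * φ y) x = c ^ 2 * gdot φ φ x := by
  unfold gdot
  rw [Finset.mul_sum]
  refine Finset.sum_congr rfl fun i _ => ?_
  rw [pd_const_mul c (h.differentiableAt (by norm_num))]; ring

lemma Adm.smul {φ : F → ℝ} (h : Adm e al be φ) {c : ℝ} (hc : 0 ≤ c) : Adm e al be (fun x => c * φ x) := by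
  refine ⟨h.cls.smul c, fun z => mul_nonneg hc (h.nn z), fun x hx => contDiffAt_const.mul (h.c1 x hx), ?_⟩
  obtain ⟨C, hC⟩ := h.gb
  refine ⟨c ^ 2 * C, fun x hx => ?_⟩
  rw [gdot_smul (h.c1 x hx)]
  exact mul_le_mul_of_nonneg_left (hC x hx) (sq_nonneg _)

lemma BB_smul {φ : F → ℝ} (h : ∀ x ∈ DD F al be, ContDiffAt ℝ 1 φ x) (c : ℝ) :
    BB al be lam (fun x => c * φ x) (fun x => c * φ x) = c ^ 2 * BB al be lam φ φ := by
  unfold BB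
  rw [← integral_const_mul]
  refine setIntegral_congr_fun DD_ms fun x hx => ?_
  simp only [gdot_smul (h x hx)]; ring

lemma BB_quad (hal : 0 < al) {W φ : F → ℝ} (hW : Adm e al be W) (hφ : Adm e al be φ) (s : ℝ) :
    lam * ∫ x in DD F al be, VV x * (W x - s * φ x) ^ 2 ≤
      BB al be lam W W - 2 * s * BB al be lam W φ + s ^ 2 * BB al be lam φ φ := by
  unfold BB
  have i1 : Integrable (fun x => gdot W W x + lam * (VV x * (W x * W x)) - 2 * s * (gdot W φ x + lam * (VV x * (W x * φ x))))
    (volume.restrict (DD F al be)) := (hW.bi hal hW).sub ((hW.bi hal hφ).const_mul _)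
  rw [← integral_const_mul, ← integral_const_mul, ← integral_const_mul,
    ← integral_sub (hW.bi hal hW) ((hW.bi hal hφ).const_mul _),
    ← integral_add i1 ((hφ.bi hal hφ).const_mul _)]
  refine setIntegral_mono_on ?_ (i1.add ((hφ.bi hal hφ).const_mul _)) DD_ms fun x hx => ?_
  · exact (V_intg' hal ((hW.cls.cont.sub (hφ.cls.cont.const_mul s)).pow 2)).const_mul lam
  · have : 0 ≤ gdot W W x - 2 * s * gdot W φ x + s ^ 2 * gdot φ φ x := by
      unfold gdot
      rw [Finset.mul_sum, Finset.mul_sum, ← Finset.sum_sub_distrib, ← Finset.sum_add_distrib]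
      refine Finset.sum_nonneg fun i _ => ?_
      nlinarith [sq_nonneg (pd i W x - s * pd i φ x)]
    have e2 : lam * (VV x * (W x - s * φ x) ^ 2) = lam * (VV x * (W x * W x)) - 2 * s * (lam * (VV x * (W x * φ x)))
      + s ^ 2 * (lam * (VV x * (φ x * φ x))) := by ring
    linarith

lemma V_zero (hal : 0 < al) {f : F → ℝ} (hf : Continuous f) (hn : ∀ x ∈ DD F al be, 0 ≤ f x)
    (h : ∫ x in DD F al be, VV x * f x ≤ 0) : ∀ x ∈ DD F al be, f x = 0 := by
  intro x hx
  by_contra hne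
  have hpos : 0 < f x := lt_of_le_of_ne (hn x hx) (Ne.symm hne)
  have : 0 < ∫ x in DD F al be, VV x * f x := by
    rw [setIntegral_pos_iff_support_of_nonneg_ae ?_ (V_intg' hal hf)]
    · have ho : IsOpen ({y | 0 < f y} ∩ DD F al be) := (isOpen_lt continuous_const hf).inter (DD_open al be)
      refine (ho.measure_pos volume ⟨x, hpos, hx⟩).trans_le (measure_mono ?_)
      rintro y ⟨hy, hy'⟩
      exact ⟨(mul_pos (VV_pos (DD_ne hal hy')) hy).ne', hy'⟩
    · exact (ae_restrict_iff' DD_ms).2 (Eventually.of_forall fun y hy => mul_nonneg (VV_nonneg y) (hn y hy))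
  linarith

lemma gb_of_U (hal : 0 < al) {φ U : F → ℝ} (hU : ∀ x, x ≠ 0 → ContDiffAt ℝ 1 U x)
    (h : ∀ x ∈ DD F al be, φ x = U x) : (∀ x ∈ DD F al be, ContDiffAt ℝ 1 φ x) ∧ ∃ C, ∀ x ∈ DD F al be, gdot φ φ x ≤ C := by
  have he : ∀ x ∈ DD F al be, φ =ᶠ[𝓝 x] U := fun x hx => by
    filter_upwards [(DD_open al be).mem_nhds hx] with y hy using h y hy
  have hne : ∀ x : F, al ≤ ‖x‖ ∧ ‖x‖ ≤ be → x ≠ 0 := fun x hx => norm_pos_iff.1 (hal.trans_le hx.1)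
  obtain ⟨C, hC⟩ := (cD_compact (F := F) (al := al) (be := be)).exists_bound_of_continuousOn (f := gdot U U)
    (fun x hx => (gdot_continuousAt (hU x (hne x hx)) (hU x (hne x hx))).continuousWithinAt)
  refine ⟨fun x hx => (hU x (DD_ne hal hx)).congr_of_eventuallyEq (he x hx), C, fun x hx => ?_⟩
  rw [gdot_congr (he x hx) (he x hx)]
  exact (le_abs_self _).trans (hC x (DD_sub hx))

lemma LinTh.adm {R : (F → ℝ) → F → ℝ} (L : LinTh e al be lam R) (hal : 0 < al) (hlam : 0 < lam) {h : F → ℝ}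
    (hh : Cls e al be h) (h1 : ∀ x ∈ DD F al be, ContDiffAt ℝ 1 h x) (h0 : ∀ z, 0 ≤ h z) : Adm e al be (R h) := by
  obtain ⟨U, hU, hR⟩ := L.c1 h hh
  have := gb_of_U hal hU (fun x hx => hR x (DD_sub hx))
  exact ⟨L.cls h hh, L.nonneg hal hlam hh h1 h0, this.1, this.2⟩

/-- weak formulation for a C2 solution -/
lemma weak (hal : 0 < al) {W h φ : F → ℝ} (hW : Cls e al be W) (h2 : ∀ x ∈ DD F al be, ContDiffAt ℝ 2 W x)
    (hg : ∃ C, ∀ x ∈ DD F al be, gdot W W x ≤ C) (hh : Continuous h)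
    (heq : ∀ x ∈ DD F al be, -lap W x + lam * (VV x * W x) = VV x * h x) (hφ : Adm e al be φ) :
    BB al be lam W φ = ∫ x in DD F al be, VV x * (h x * φ x) := by
  have hWl : ∃ C, ∀ x ∈ DD F al be, |lap W x| ≤ C := by
    obtain ⟨C, hC⟩ := bdd_D (al := al) (be := be) ((hW.cont.const_mul lam).sub hh)
    refine ⟨1 / (2 * al) * C, fun x hx => ?_⟩
    have : lap W x = VV x * (lam * W x - h x) := by have := heq x hx; linarith
    rw [this, abs_mul, abs_of_nonneg (VV_nonneg x)]
    exact mul_le_mul (VV_up hal hx) (hC x hx) (abs_nonneg _) (by positivity)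
  have key := ibp0 h2 hg hWl hφ.cls.cont hφ.cls.zero hφ.nn hφ.c1 hφ.gb
  have hgi := g_intg (fun x hx => (h2 x hx).of_le (by norm_num)) hφ.c1 hg hφ.gb
  have hvi : Integrable (fun x => lam * (VV x * (W x * φ x))) (volume.restrict (DD F al be)) :=
    (V_intg' (be := be) hal (hW.cont.mul hφ.cls.cont)).const_mul lam
  unfold BB
  rw [integral_add hgi hvi, key, eq_comm]
  have e1 : ∫ x in DD F al be, VV x * (h x * φ x) = ∫ x in DD F al be, (-lap W x * φ x + lam * (VV x * (W x * φ x))) :=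
    setIntegral_congr_fun DD_ms fun x hx => by
      have := heq x hx
      linear_combination (-φ x) * this
  rw [e1]
  refine integral_add ?_ hvi
  have e2 : IntegrableOn (fun x => VV x * (h x * φ x) - lam * (VV x * (W x * φ x))) (DD F al be) :=
    (V_intg' hal (hh.mul hφ.cls.cont)).sub hvi
  refine e2.congr_fun (fun x hx => ?_) DD_ms
  have := heq x hx
  simp only
  linear_combination (-φ x) * this

lemma int_dct {f : ℕ → F → ℝ} {g : F → ℝ} {C : ℝ} (hf : ∀ n, ContinuousOn (f n) (DD F al be))
    (hb : ∀ n, ∀ x ∈ DD F al be, |f n x| ≤ C) (hl : ∀ x ∈ DD F al be, Tendsto (fun n => f n x) atTop (𝓝 (g x))) :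
    Tendsto (fun n => ∫ x in DD F al be, f n x) atTop (𝓝 (∫ x in DD F al be, g x)) := by
  have : IsFiniteMeasure (volume.restrict (DD F al be)) := ⟨by
    rw [Measure.restrict_apply_univ]
    exact ((measure_mono DD_sub).trans_lt (cD_compact (F := F) (al := al) (be := be)).measure_lt_top)⟩
  refine tendsto_integral_of_dominated_convergence (fun _ => C) (fun n => (hf n).aestronglyMeasurable DD_ms)
    (integrable_const C) (fun n => ?_) ?_
  · exact (ae_restrict_iff' DD_ms).2 (Eventually.of_forall (hb n))
  · exact (ae_restrict_iff' DD_ms).2 (Eventually.of_forall hl)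

/-- a fixed test function -/
def tst (al be : ℝ) (z : F) : ℝ := max 0 ((‖z‖ - al) * (be - ‖z‖))

lemma tst_pos {z : F} (hz : z ∈ DD F al be) : 0 < (‖z‖ - al) * (be - ‖z‖) :=
  mul_pos (by linarith [hz.1]) (by linarith [hz.2])

lemma tst_adm (hal : 0 < al) (hab : al < be) : Adm e al be (tst al be) := by
  have h0 : ∀ z : F, z ∉ DD F al be → tst al be z = 0 := fun z hz => by
    unfold tst
    refine max_eq_left ?_
    by_contra hcon
    push Not at hcon
    apply hz
    rcases pos_and_pos_or_neg_and_neg_of_mul_pos hcon with h | h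
    · exact ⟨by linarith [h.1], by linarith [h.2]⟩
    · linarith [h.1, h.2]
  have := gb_of_U (be := be) hal (φ := tst al be) (U := fun z : F => (‖z‖ - al) * (be - ‖z‖)) (fun x hx =>
    ((contDiffAt_norm ℝ hx).sub contDiffAt_const).mul (contDiffAt_const.sub (contDiffAt_norm ℝ hx)))
    (fun x hx => max_eq_right (tst_pos hx).le)
  refine ⟨⟨?_, h0, fun A _ z => by simp [tst]⟩, fun z => le_max_left _ _, this.1, this.2⟩
  unfold tst; fun_prop

lemma DD_nonempty (hN : 3 ≤ finrank ℝ F) (hal : 0 < al) (hab : al < be) : ∃ z : F, z ∈ DD F al be := by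
  have : Nontrivial F := nontrivial_of_finrank_pos (R := ℝ) (by omega)
  obtain ⟨z, hz⟩ := exists_norm_eq F (show 0 ≤ (al + be) / 2 by linarith)
  exact ⟨z, by show al < ‖z‖; linarith, by show ‖z‖ < be; linarith⟩

end adm
end Conc

namespace Conc
open Topology Set Module Metric

section var
variable {F : Type} [NormedAddCommGroup F] [InnerProductSpace ℝ F] [FiniteDimensional ℝ F]
variable [MeasurableSpace F] [BorelSpace F]
variable {al be lam : ℝ} {e : F}

/-- bounded nonlinearities -/
structure NL (g G : ℝ → ℝ) : Prop where
  g1 : ContDiff ℝ 1 g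
  g0 : ∀ t ≤ 0, g t = 0
  mono : Monotone g
  bd : ∃ C, ∀ t, |g t| ≤ C
  lip : ∃ C, 0 ≤ C ∧ ∀ s t, |g t - g s| ≤ C * |t - s|
  dG : ∀ t, HasDerivAt G (g t) t
  G0 : G 0 = 0
  pos : ∀ t, 0 < t → 0 < G t

variable {g G : ℝ → ℝ}

lemma NL.gn (n : NL g G) (t : ℝ) : 0 ≤ g t := by
  rcases le_total t 0 with h | h
  · rw [n.g0 t h]
  · rw [← n.g0 0 le_rfl]; exact n.mono h

lemma NL.gc (n : NL g G) : Continuous g := n.g1.continuous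
lemma NL.Gc (n : NL g G) : Continuous G := continuous_iff_continuousAt.2 fun t => (n.dG t).continuousAt

lemma NL.conv (n : NL g G) (a b : ℝ) : G a + g a * (b - a) ≤ G b := by
  rcases lt_trichotomy a b with h | h | h
  · obtain ⟨c, hc, e⟩ := exists_hasDerivAt_eq_slope G g h n.Gc.continuousOn (fun x _ => n.dG x)
    rw [eq_div_iff (by linarith)] at e
    have := mul_le_mul_of_nonneg_right (n.mono hc.1.le) (sub_nonneg.2 h.le)
    linarith
  · subst h; simp
  · obtain ⟨c, hc, e⟩ := exists_hasDerivAt_eq_slope G g h n.Gc.continuousOn (fun x _ => n.dG x)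
    rw [eq_div_iff (by linarith)] at e
    have := mul_le_mul_of_nonneg_right (n.mono hc.2.le) (sub_nonneg.2 h.le)
    linarith

lemma NL.Gn (n : NL g G) (t : ℝ) : 0 ≤ G t := by
  have := n.conv 0 t
  rw [n.G0, n.g0 0 le_rfl] at this; linarith

lemma NL.Gle (n : NL g G) (t : ℝ) : G t ≤ g t * t := by
  have := n.conv t 0
  rw [n.G0] at this; linarith

/-- nonlinear functional -/
def JJ (al be : ℝ) (G : ℝ → ℝ) (φ : F → ℝ) : ℝ := ∫ x in DD F al be, VV x * G (φ x)

lemma Adm.ggC {φ : F → ℝ} (n : NL g G) (h : Cls e al be φ) : Cls e al be (fun x => g (φ x)) := h.comp n.gc (n.g0 0 le_rfl)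

lemma gC1 {φ : F → ℝ} (n : NL g G) (h : ∀ x ∈ DD F al be, ContDiffAt ℝ 1 φ x) : ∀ x ∈ DD F al be, ContDiffAt ℝ 1 (fun x => g (φ x)) x :=
  fun x hx => n.g1.contDiffAt.comp x (h x hx)

lemma JJ_ub (hal : 0 < al) (hlam : 0 < lam) (n : NL g G) : ∃ C, ∀ φ, Adm e al be φ → BB al be lam φ φ ≤ 1 → JJ al be G φ ≤ C := by
  obtain ⟨C, hC⟩ := n.bd
  have hC0 : 0 ≤ C := (abs_nonneg _).trans (hC 0)
  refine ⟨C * ((∫ x in DD F al be, VV x * 1) + 1 / lam), fun φ hφ hN => ?_⟩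
  have h1 : lam * ∫ x in DD F al be, VV x * (φ x * φ x) ≤ 1 := by
    refine le_trans ?_ hN
    rw [← integral_const_mul]
    refine setIntegral_mono_on (hφ.vi hal hφ) (hφ.bi hal hφ) DD_ms fun x hx => ?_
    linarith [gdot_self_nonneg φ x]
  have h2 : ∫ x in DD F al be, VV x * (φ x * φ x) ≤ 1 / lam := by rw [le_div_iff₀ hlam]; linarith
  have h3 : JJ al be G φ ≤ ∫ x in DD F al be, C * (VV x * 1 + VV x * (φ x * φ x)) := by
    refine setIntegral_mono_on (V_intg' hal (n.Gc.comp hφ.cls.cont)) ?_ DD_ms fun x hx => ?_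
    · exact ((V_intg' hal continuous_const).add (V_intg' hal (hφ.cls.cont.mul hφ.cls.cont))).const_mul C
    · have a1 : G (φ x) ≤ C * (1 + φ x * φ x) := by
        have := n.Gle (φ x)
        have b1 : g (φ x) * φ x ≤ C * φ x := mul_le_mul_of_nonneg_right ((le_abs_self _).trans (hC _)) (hφ.nn x)
        have b2 : φ x ≤ 1 + φ x * φ x := by nlinarith [sq_nonneg (φ x - 1), hφ.nn x]
        have b3 := mul_le_mul_of_nonneg_left b2 hC0
        linarith
      have := mul_le_mul_of_nonneg_left a1 (VV_nonneg x)
      linarith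
  have i5 : IntegrableOn (fun x => VV x * (φ x * φ x)) (DD F al be) := V_intg' hal (hφ.cls.cont.mul hφ.cls.cont)
  rw [integral_const_mul, integral_add (V_intg' hal continuous_const) i5] at h3
  refine h3.trans (mul_le_mul_of_nonneg_left ?_ hC0)
  exact add_le_add_right h2 _

variable {R : (F → ℝ) → F → ℝ}

lemma imp (L : LinTh e al be lam R) (hal : 0 < al) (hlam : 0 < lam) (n : NL g G) {φ : F → ℝ} (hφ : Adm e al be φ)
    (hN : BB al be lam φ φ ≤ 1) (hJ : 0 < JJ al be G φ) {W : F → ℝ} (hW : W = R (fun x => g (φ x))) :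
    ∃ s, 0 < s ∧ BB al be lam W W = s ^ 2 ∧ s ^ 2 = (∫ x in DD F al be, VV x * (g (φ x) * W x)) ∧ JJ al be G φ ≤ s ∧
      Adm e al be (fun x => s⁻¹ * W x) ∧ BB al be lam (fun x => s⁻¹ * W x) (fun x => s⁻¹ * W x) = 1 ∧ Adm e al be W ∧
      BB al be lam W φ ≤ s ∧ JJ al be G φ + (s - BB al be lam W φ) ≤ JJ al be G (fun x => s⁻¹ * W x) := by
  have hc := Adm.ggC n hφ.cls
  have hc1 := gC1 n hφ.c1
  have hWa : Adm e al be W := hW ▸ L.adm hal hlam hc hc1 (fun z => n.gn _)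
  have hc2 := L.c2 _ hc hc1
  rw [← hW] at hc2
  have w1 := weak hal hWa.cls (fun x hx => (hc2 x hx).1) hWa.gb hc.cont (fun x hx => (hc2 x hx).2) hφ
  have w2 := weak hal hWa.cls (fun x hx => (hc2 x hx).1) hWa.gb hc.cont (fun x hx => (hc2 x hx).2) hWa
  have hJB : JJ al be G φ ≤ BB al be lam W φ := by
    rw [w1]
    exact setIntegral_mono_on (V_intg' hal (n.Gc.comp hφ.cls.cont)) (V_intg' hal (hc.cont.mul hφ.cls.cont)) DD_ms
      fun x _ => mul_le_mul_of_nonneg_left (n.Gle _) (VV_nonneg x)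
  have hq : ∀ t, 0 ≤ BB al be lam W W - 2 * t * BB al be lam W φ + t ^ 2 * BB al be lam φ φ := fun t =>
    le_trans (mul_nonneg hlam.le (setIntegral_nonneg DD_ms fun x _ => mul_nonneg (VV_nonneg x) (sq_nonneg _)))
      (BB_quad hal hWa hφ t)
  have hB0 : 0 < BB al be lam W W := by
    refine lt_of_le_of_ne (BB_nonneg hlam.le W) fun h => ?_
    have := hq (BB al be lam W φ)
    rw [← h] at this
    have h3 : 0 < BB al be lam W φ := hJ.trans_le hJB
    nlinarith [mul_le_mul_of_nonneg_left hN (sq_nonneg (BB al be lam W φ)), mul_pos h3 h3]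
  have hs : 0 < √(BB al be lam W W) := sqrt_pos.2 hB0
  have hs2 : √(BB al be lam W W) ^ 2 = BB al be lam W W := sq_sqrt hB0.le
  set s := √(BB al be lam W W) with hsd
  have hBs : BB al be lam W φ ≤ s := by
    have := hq s
    rw [← hs2] at this
    have h4 := mul_le_mul_of_nonneg_left hN (sq_nonneg s)
    by_contra hcon
    push Not at hcon
    nlinarith [mul_lt_mul_of_pos_left hcon hs]
  refine ⟨s, hs, hs2.symm, hs2.trans w2, hJB.trans hBs, hWa.smul (by positivity), ?_, hWa, hBs, ?_⟩
  · rw [BB_smul hWa.c1, ← hs2]; field_simp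
  · have i1 := V_intg' (be := be) hal (n.Gc.comp hφ.cls.cont)
    have i2 := (V_intg' (be := be) hal (hc.cont.mul hWa.cls.cont)).const_mul s⁻¹
    have i3 := V_intg' (be := be) hal (hc.cont.mul hφ.cls.cont)
    have i4 := V_intg' (be := be) hal (n.Gc.comp (hWa.cls.cont.const_mul s⁻¹))
    have e1 : s = s⁻¹ * ∫ x in DD F al be, VV x * (g (φ x) * W x) := by
      rw [← w2, ← hs2]; field_simp
    have e2 : JJ al be G φ + (s - BB al be lam W φ) =
        ∫ x in DD F al be, (VV x * G (φ x) + (s⁻¹ * (VV x * (g (φ x) * W x)) - VV x * (g (φ x) * φ x))) := by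
      have j1 := integral_add i1 (i2.sub i3)
      have j2 := integral_sub i2 i3
      simp only [Function.comp, Pi.mul_apply, Pi.sub_apply] at j1 j2
      rw [j1, j2, integral_const_mul, ← e1, ← w1]; rfl
    rw [e2]
    refine setIntegral_mono_on (i1.add (i2.sub i3)) i4 DD_ms fun x hx => ?_
    have := mul_le_mul_of_nonneg_left (n.conv (φ x) (s⁻¹ * W x)) (VV_nonneg x)
    simp only [Function.comp]
    linarith

/-- uniform convergence -/
def UC (f : ℕ → F → ℝ) (h : F → ℝ) : Prop := ∀ ε > 0, ∀ᶠ n in atTop, ∀ z, |f n z - h z| ≤ ε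

lemma UC.pt {f : ℕ → F → ℝ} {h : F → ℝ} (H : UC f h) (z : F) : Tendsto (fun n => f n z) atTop (𝓝 (h z)) := by
  rw [Metric.tendsto_nhds]
  intro ε hε
  filter_upwards [H (ε / 2) (by positivity)] with n hn
  rw [Real.dist_eq]; exact (hn z).trans_lt (by linarith)

lemma UC.smul {f : ℕ → F → ℝ} {h : F → ℝ} (H : UC f h) {M : ℝ} (hM : ∀ z, |h z| ≤ M) {a : ℕ → ℝ} {b : ℝ}
    (ha : Tendsto a atTop (𝓝 b)) : UC (fun n z => a n * f n z) (fun z => b * h z) := by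
  intro ε hε
  have hM0 : 0 ≤ M := (abs_nonneg _).trans (hM 0)
  have e1 : ∀ᶠ n in atTop, |a n - b| < min 1 (ε / (2 * (M + 1))) := by
    have := (Metric.tendsto_nhds.1 ha) (min 1 (ε / (2 * (M + 1)))) (by positivity)
    simpa [Real.dist_eq] using this
  filter_upwards [e1, H (ε / (2 * (|b| + 1))) (by positivity)] with n h1 h2 z
  have h3 : |a n| ≤ |b| + 1 := by
    have := abs_sub_abs_le_abs_sub (a n) b
    linarith [h1.trans_le (min_le_left _ _)]
  have h4 : |a n - b| ≤ ε / (2 * (M + 1)) := (h1.trans_le (min_le_right _ _)).le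
  have e2 : a n * f n z - b * h z = a n * (f n z - h z) + (a n - b) * h z := by ring
  rw [e2]
  have h5 : |a n * (f n z - h z)| ≤ (|b| + 1) * (ε / (2 * (|b| + 1))) := by
    rw [abs_mul]; exact mul_le_mul h3 (h2 z) (abs_nonneg _) (by positivity)
  have h6 : |(a n - b) * h z| ≤ (ε / (2 * (M + 1))) * (M + 1) := by
    rw [abs_mul]; exact mul_le_mul h4 ((hM z).trans (by linarith)) (abs_nonneg _) (by positivity)
  have e3 : (|b| + 1) * (ε / (2 * (|b| + 1))) = ε / 2 := by field_simp
  have e4 : (ε / (2 * (M + 1))) * (M + 1) = ε / 2 := by field_simp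
  exact (abs_add_le _ _).trans (by linarith)

lemma UC.bd {f : ℕ → F → ℝ} {h : F → ℝ} (H : UC f h) {M : ℝ} (hM : ∀ z, |h z| ≤ M) : ∀ᶠ n in atTop, ∀ z, |f n z| ≤ M + 1 := by
  filter_upwards [H 1 one_pos] with n hn z
  have := abs_sub_abs_le_abs_sub (f n z) (h z)
  linarith [hn z, hM z]

lemma LinTh.bd (L : LinTh e al be lam R) (M : ℝ) : ∃ C, ∀ h, Cls e al be h → (∀ z, |h z| ≤ M) → ∀ z, |R h z| ≤ C := by
  obtain ⟨C, hC0, hC⟩ := L.lip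
  have h0 : Cls e al be (fun _ : F => (0 : ℝ)) := ⟨continuous_const, fun _ _ => rfl, fun _ _ _ => rfl⟩
  obtain ⟨M0, -, hM0⟩ := (L.cls _ h0).bdd
  refine ⟨C * M + M0, fun h hh hM z => ?_⟩
  have h1 := hC h _ hh h0 M (fun z => by simpa using hM z) z
  have := abs_sub_abs_le_abs_sub (R h z) (R (fun _ => 0) z)
  linarith [hM0 z]

/-- maximising sequences -/
structure Mx (e : F) (al be lam S : ℝ) (G : ℝ → ℝ) (ψ : ℕ → F → ℝ) : Prop where
  adm : ∀ n, Adm e al be (ψ n)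
  le : ∀ n, BB al be lam (ψ n) (ψ n) ≤ 1
  lo : ∀ n, S / 2 ≤ JJ al be G (ψ n)
  lim : Tendsto (fun n => JJ al be G (ψ n)) atTop (𝓝 S)

lemma Mx.J (hal : 0 < al) (n : NL g G) {S : ℝ} {ψ : ℕ → F → ℝ} (H : Mx e al be lam S G ψ) {w : F → ℝ} (hw : Cls e al be w) (hu : UC ψ w) :
    JJ al be G w = S := by
  obtain ⟨M, hM0, hM⟩ := hw.bdd
  obtain ⟨n0, hn0⟩ := eventually_atTop.1 (hu.bd hM)
  obtain ⟨C, hC⟩ := (isCompact_Icc (a := -(M + 1)) (b := M + 1)).exists_bound_of_continuousOn n.Gc.continuousOn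
  have h1 : Tendsto (fun k => JJ al be G (ψ (k + n0))) atTop (𝓝 (JJ al be G w)) := by
    refine int_dct (C := 1 / (2 * al) * C) (fun k x hx => ((VV_cA hal hx).mul (n.Gc.comp (H.adm _).cls.cont).continuousAt).continuousWithinAt) (fun k x hx => ?_) (fun x hx => ?_)
    · rw [abs_mul, abs_of_nonneg (VV_nonneg x)]
      exact mul_le_mul (VV_up hal hx) (hC _ (abs_le.1 (hn0 (k + n0) (by omega) x))) (abs_nonneg _) (by positivity)
    · exact (((n.Gc.tendsto _).comp ((hu.pt x).comp (tendsto_add_atTop_nat n0))).const_mul _)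
  exact tendsto_nhds_unique h1 (H.lim.comp (tendsto_add_atTop_nat n0))

lemma Mx.step (L : LinTh e al be lam R) (hal : 0 < al) (hlam : 0 < lam) (n : NL g G) {S : ℝ} (hS : 0 < S)
    (hub : ∀ φ, Adm e al be φ → BB al be lam φ φ ≤ 1 → JJ al be G φ ≤ S) {ψ : ℕ → F → ℝ} (H : Mx e al be lam S G ψ)
    {w : F → ℝ} (hw : Cls e al be w) (hu : UC ψ w) {W : F → ℝ} (hW : W = R (fun x => g (w x))) :
    ∃ s, 0 < s ∧ s ^ 2 = (∫ x in DD F al be, VV x * (g (w x) * W x)) ∧ ∃ ψ', Mx e al be lam S G ψ' ∧ UC ψ' (fun x => s⁻¹ * W x) := by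
  have hpos : ∀ k, 0 < JJ al be G (ψ k) := fun k => by linarith [H.lo k]
  choose s hs hss hsq hJs ha hN1 haW hBs hJ using fun k => imp L hal hlam n (H.adm k) (H.le k) (hpos k) rfl
  obtain ⟨Cg, hCg⟩ := n.bd
  obtain ⟨CR, hCR⟩ := L.bd Cg
  have hcg : ∀ k, Cls e al be (fun x => g (ψ k x)) := fun k => Adm.ggC n (H.adm k).cls
  have hcw := Adm.ggC n hw
  have hWu : UC (fun k => R (fun x => g (ψ k x))) W := by
    obtain ⟨C, hC0, hC⟩ := L.lip
    obtain ⟨Lg, hLg0, hLg⟩ := n.lip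
    intro ε hε
    filter_upwards [hu (ε / ((C + 1) * (Lg + 1))) (by positivity)] with k hk z
    rw [hW]
    have h1 := hC _ _ (hcg k) hcw (Lg * (ε / ((C + 1) * (Lg + 1)))) (fun z => (hLg _ _).trans (mul_le_mul_of_nonneg_left (hk z) hLg0)) z
    refine h1.trans ?_
    have : C * (Lg * (ε / ((C + 1) * (Lg + 1)))) = ε * (C / (C + 1)) * (Lg / (Lg + 1)) := by field_simp
    rw [this]
    have b1 : C / (C + 1) ≤ 1 := by rw [div_le_one (by positivity)]; linarith
    have b2 : Lg / (Lg + 1) ≤ 1 := by rw [div_le_one (by positivity)]; linarith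
    calc ε * (C / (C + 1)) * (Lg / (Lg + 1)) ≤ ε * 1 * 1 := by gcongr
      _ = ε := by ring
  have hlim : Tendsto (fun k => s k ^ 2) atTop (𝓝 (∫ x in DD F al be, VV x * (g (w x) * W x))) := by
    simp only [hsq]
    refine int_dct (C := 1 / (2 * al) * (Cg * CR)) (fun k x hx =>
      ((VV_cA hal hx).mul ((hcg k).cont.mul (haW k).cls.cont).continuousAt).continuousWithinAt) (fun k x hx => ?_) (fun x hx => ?_)
    · rw [abs_mul, abs_of_nonneg (VV_nonneg x), abs_mul]
      exact mul_le_mul (VV_up hal hx) (mul_le_mul (hCg _) (hCR _ (hcg k) (fun z => hCg _) x) (abs_nonneg _) ((abs_nonneg _).trans (hCg 0)))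
        (by positivity) (by positivity)
    · exact ((((n.gc.tendsto _).comp (hu.pt x)).mul (hWu.pt x)).const_mul _)
  set Q := ∫ x in DD F al be, VV x * (g (w x) * W x) with hQ
  have hQpos : 0 < Q := by
    have : (S / 2) ^ 2 ≤ Q := ge_of_tendsto' hlim fun k => by
      have := (H.lo k).trans (hJs k)
      exact pow_le_pow_left₀ (by positivity) this 2
    exact lt_of_lt_of_le (by positivity) this
  have hWc : Cls e al be W := hW ▸ L.cls _ hcw
  obtain ⟨M, -, hM⟩ := hWc.bdd
  have hs' : Tendsto s atTop (𝓝 (√Q)) := by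
    have := (continuous_sqrt.tendsto Q).comp hlim
    refine this.congr fun k => ?_
    simp only [Function.comp]; exact sqrt_sq (hs k).le
  refine ⟨√Q, sqrt_pos.2 hQpos, sq_sqrt hQpos.le, fun k x => (s k)⁻¹ * R (fun x => g (ψ k x)) x, ?_, ?_⟩
  · have hge : ∀ k, JJ al be G (ψ k) ≤ JJ al be G (fun x => (s k)⁻¹ * R (fun x => g (ψ k x)) x) := fun k => by
      linarith [hJ k, hBs k]
    refine ⟨ha, fun k => (hN1 k).le, fun k => (H.lo k).trans (hge k), ?_⟩
    exact tendsto_of_tendsto_of_tendsto_of_le_of_le H.lim tendsto_const_nhds hge (fun k => hub _ (ha k) (hN1 k).le)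
  · exact hWu.smul hM (hs'.inv₀ (sqrt_pos.2 hQpos).ne')

lemma Mx.first (L : LinTh e al be lam R) (hal : 0 < al) (hlam : 0 < lam) (n : NL g G) {S : ℝ} (hS : 0 < S)
    (hub : ∀ φ, Adm e al be φ → BB al be lam φ φ ≤ 1 → JJ al be G φ ≤ S) {ψ : ℕ → F → ℝ} (H : Mx e al be lam S G ψ) :
    ∃ w ψ', Cls e al be w ∧ Mx e al be lam S G ψ' ∧ UC ψ' w := by
  have hpos : ∀ k, 0 < JJ al be G (ψ k) := fun k => by linarith [H.lo k]
  choose s hs hss hsq hJs ha hN1 haW hBs hJ using fun k => imp L hal hlam n (H.adm k) (H.le k) (hpos k) rfl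
  obtain ⟨Cg, hCg⟩ := n.bd
  obtain ⟨CR, hCR⟩ := L.bd Cg
  have hcg : ∀ k, Cls e al be (fun x => g (ψ k x)) := fun k => Adm.ggC n (H.adm k).cls
  obtain ⟨σ, hσ, w, hw, hwu⟩ := L.cpt _ Cg hcg (fun k z => hCg _)
  have hsb : ∃ B, ∀ k, s k ≤ B := by
    refine ⟨1 + ∫ x in DD F al be, VV x * (Cg * CR), fun k => ?_⟩
    have h1 : s k ^ 2 ≤ ∫ x in DD F al be, VV x * (Cg * CR) := by
      rw [hsq]
      refine setIntegral_mono_on (V_intg' hal ((hcg k).cont.mul (haW k).cls.cont)) (V_intg' hal continuous_const) DD_ms fun x hx => ?_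
      refine mul_le_mul_of_nonneg_left ?_ (VV_nonneg x)
      exact mul_le_mul ((le_abs_self _).trans (hCg _)) ((le_abs_self _).trans (hCR _ (hcg k) (fun z => hCg _) x)) ((haW k).nn x)
        ((abs_nonneg _).trans (hCg 0))
    nlinarith [sq_nonneg (s k - 1)]
  obtain ⟨B, hB⟩ := hsb
  obtain ⟨t, ht, τ, hτ, htl⟩ := (isCompact_Icc (a := S / 2) (b := B)).tendsto_subseq (x := fun k => s (σ k))
    (fun k => ⟨(H.lo _).trans (hJs _), hB _⟩)
  have ht0 : t ≠ 0 := by linarith [ht.1]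
  obtain ⟨M, -, hM⟩ := hw.bdd
  have hu2 : UC (fun k => R (fun x => g (ψ (σ (τ k)) x))) w := fun ε hε => hτ.tendsto_atTop.eventually (hwu ε hε)
  refine ⟨fun z => t⁻¹ * w z, fun k x => (s (σ (τ k)))⁻¹ * R (fun x => g (ψ (σ (τ k)) x)) x, hw.smul _, ?_, hu2.smul hM (htl.inv₀ ht0)⟩
  have hge : ∀ k, JJ al be G (ψ k) ≤ JJ al be G (fun x => (s k)⁻¹ * R (fun x => g (ψ k x)) x) := fun k => by
    linarith [hJ k, hBs k]
  refine ⟨fun k => ha _, fun k => (hN1 _).le, fun k => (H.lo _).trans (hge _), ?_⟩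
  have := H.lim.comp ((hσ.comp hτ).tendsto_atTop)
  exact tendsto_of_tendsto_of_tendsto_of_le_of_le this tendsto_const_nhds (fun k => hge _) (fun k => hub _ (ha _) (hN1 _).le)

theorem var_exists (hN3 : 3 ≤ finrank ℝ F) (hal : 0 < al) (hab : al < be) (hlam : 0 < lam) (e : F) (n : NL g G) :
    ∃ (ω : F → ℝ) (μ : ℝ), Adm e al be ω ∧ (∀ x ∈ DD F al be, ContDiffAt ℝ 2 ω x) ∧
      (∃ U : F → ℝ, (∀ x, x ≠ 0 → ContDiffAt ℝ 1 U x) ∧ ∀ x : F, al ≤ ‖x‖ ∧ ‖x‖ ≤ be → ω x = U x) ∧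
      0 < μ ∧ BB al be lam ω ω = 1 ∧ (∀ x ∈ DD F al be, -lap ω x + lam * (VV x * ω x) = VV x * (μ * g (ω x))) ∧
      (∀ φ, Adm e al be φ → BB al be lam φ φ ≤ 1 → JJ al be G φ ≤ JJ al be G ω) ∧ μ * JJ al be G ω ≤ 1 ∧ 0 < JJ al be G ω := by
  obtain ⟨R, L⟩ := linTh_exists (e := e) hN3 hal hab hlam
  -- the supremum
  set T : Set ℝ := {y | ∃ φ, Adm e al be φ ∧ BB al be lam φ φ ≤ 1 ∧ y = JJ al be G φ} with hT
  obtain ⟨C, hC⟩ := JJ_ub (e := e) (be := be) hal hlam n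
  have hTb : BddAbove T := ⟨C, by rintro y ⟨φ, h1, h2, rfl⟩; exact hC φ h1 h2⟩
  have hTp : ∃ y ∈ T, 0 < y := by
    have h1 := tst_adm (e := e) hal hab
    set c := (√(BB al be lam (tst al be : F → ℝ) (tst al be) + 1))⁻¹ with hc
    have hb : 0 ≤ BB al be lam (tst al be : F → ℝ) (tst al be) := BB_nonneg hlam.le _
    have hc0 : 0 < c := by positivity
    have h2 := h1.smul hc0.le
    refine ⟨_, ⟨_, h2, ?_, rfl⟩, ?_⟩
    · rw [BB_smul h1.c1, hc, inv_pow, sq_sqrt (by linarith), inv_mul_le_iff₀ (by linarith)]; linarith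
    · by_contra hcon
      push Not at hcon
      obtain ⟨z, hz⟩ := DD_nonempty (F := F) hN3 hal hab
      have := V_zero hal (n.Gc.comp h2.cls.cont) (fun x _ => n.Gn _) hcon z hz
      have hp : 0 < c * tst al be z := mul_pos hc0 (by unfold tst; exact lt_max_of_lt_right (tst_pos hz))
      exact (n.pos _ hp).ne' this
  obtain ⟨y0, hy0T, hy0⟩ := hTp
  set S := sSup T with hSd
  have hS : 0 < S := hy0.trans_le (le_csSup hTb hy0T)
  have hub : ∀ φ, Adm e al be φ → BB al be lam φ φ ≤ 1 → JJ al be G φ ≤ S := fun φ h1 h2 => le_csSup hTb ⟨φ, h1, h2, rfl⟩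
  have hseq : ∃ ψ : ℕ → F → ℝ, Mx e al be lam S G ψ := by
    have : ∀ k : ℕ, ∃ φ, Adm e al be φ ∧ BB al be lam φ φ ≤ 1 ∧ S - S / (k + 2) < JJ al be G φ := fun k => by
      obtain ⟨y, ⟨φ, h1, h2, rfl⟩, h3⟩ := exists_lt_of_lt_csSup ⟨y0, hy0T⟩ (show S - S / (k + 2) < sSup T by
        have : 0 < S / ((k : ℝ) + 2) := by positivity
        linarith)
      exact ⟨φ, h1, h2, h3⟩
    choose ψ h1 h2 h3 using this
    refine ⟨ψ, h1, h2, fun k => ?_, ?_⟩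
    · have : S / ((k : ℝ) + 2) ≤ S / 2 := div_le_div_of_nonneg_left hS.le (by norm_num) (by
        have := Nat.cast_nonneg (α := ℝ) k; linarith)
      linarith [h3 k]
    · refine tendsto_of_tendsto_of_tendsto_of_le_of_le (g := fun k : ℕ => S - S / ((k : ℝ) + 2)) ?_ tendsto_const_nhds (fun k => (h3 k).le) (fun k => hub _ (h1 k) (h2 k))
      have : Tendsto (fun k : ℕ => S / ((k : ℝ) + 2)) atTop (𝓝 0) :=
        (tendsto_atTop_add_const_right _ _ tendsto_natCast_atTop_atTop).const_div_atTop S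
      simpa using this.const_sub S
  obtain ⟨ψ0, H0⟩ := hseq
  obtain ⟨w1, ψ1, hw1, H1, u1⟩ := H0.first L hal hlam n hS hub
  obtain ⟨s2, hs2, -, ψ2, H2, u2⟩ := H1.step L hal hlam n hS hub hw1 u1 rfl
  set w2 : F → ℝ := fun x => s2⁻¹ * R (fun x => g (w1 x)) x with hw2d
  have hw2 : Cls e al be w2 := (L.cls _ (Adm.ggC n hw1)).smul _
  have hw2c : ∀ x ∈ DD F al be, ContDiffAt ℝ 1 w2 x := by
    obtain ⟨U, hU, hR⟩ := L.c1 _ (Adm.ggC n hw1)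
    intro x hx
    exact contDiffAt_const.mul ((gb_of_U hal hU (fun x hx => hR x (DD_sub hx))).1 x hx)
  obtain ⟨s3, hs3, hsq3, ψ3, H3, u3⟩ := H2.step L hal hlam n hS hub hw2 u2 rfl
  have hg2 := Adm.ggC n hw2
  have hg2c := gC1 n hw2c
  have ha3 := L.adm hal hlam hg2 hg2c (fun z => n.gn _)
  have hc3 := L.c2 _ hg2 hg2c
  set W3 := R (fun x => g (w2 x)) with hW3
  have hω : Adm e al be (fun x => s3⁻¹ * W3 x) := ha3.smul (by positivity)
  have hω1 : BB al be lam (fun x => s3⁻¹ * W3 x) (fun x => s3⁻¹ * W3 x) = 1 := by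
    rw [BB_smul ha3.c1, weak hal ha3.cls (fun x hx => (hc3 x hx).1) ha3.gb hg2.cont (fun x hx => (hc3 x hx).2) ha3, ← hsq3]
    field_simp
  have hωJ := H3.J hal n hω.cls u3
  set ω : F → ℝ := fun x => s3⁻¹ * W3 x with hωd
  obtain ⟨s, hs, hss, hsq, hJs, ha, hN1, haW, hBs, hJ⟩ := imp L hal hlam n hω hω1.le (by rw [hωJ]; exact hS) rfl
  have hgω := Adm.ggC n hω.cls
  have hc := L.c2 _ hgω (gC1 n hω.c1)
  obtain ⟨U, hU, hUR⟩ := L.c1 _ hgω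
  set W := R (fun x => g (ω x)) with hW
  have h1 := hub _ ha hN1.le
  have h2 : s ≤ BB al be lam W ω := by rw [hωJ] at hJ; linarith
  have h3 : ∫ x in DD F al be, VV x * (W x - s * ω x) ^ 2 ≤ 0 := by
    have h4 := BB_quad (lam := lam) hal haW hω s
    rw [hss, hω1] at h4
    have h5 : lam * ∫ x in DD F al be, VV x * (W x - s * ω x) ^ 2 ≤ 0 := by nlinarith
    by_contra hcon
    push Not at hcon
    have := mul_pos hlam hcon
    linarith
  have h4 := V_zero hal ((haW.cls.cont.sub (hω.cls.cont.const_mul s)).pow 2) (fun x _ => sq_nonneg _) h3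
  have h5 : ω = fun x => s⁻¹ * W x := by
    funext x
    by_cases hx : x ∈ DD F al be
    · have h6 : W x - s * ω x = 0 := pow_eq_zero_iff (two_ne_zero) |>.1 (h4 x hx)
      have h7 : W x = s * ω x := by linarith
      rw [h7]; field_simp
    · rw [hω.cls.zero x hx, haW.cls.zero x hx, mul_zero]
  refine ⟨ω, s⁻¹, hω, ?_, ⟨fun x => s⁻¹ * U x, fun x hx => contDiffAt_const.mul (hU x hx), fun x hx => ?_⟩, by positivity, hω1, ?_, ?_, ?_, ?_⟩
  · intro x hx; rw [h5]; exact contDiffAt_const.mul (hc x hx).1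
  · have := congrFun h5 x
    rw [this, hUR x hx]
  · intro x hx
    have e1 : lap ω x = s⁻¹ * lap W x := by rw [h5]; exact lap_const_mul _ (hc x hx).1
    have e2 : ω x = s⁻¹ * W x := congrFun h5 x
    have e3 := (hc x hx).2
    calc -lap ω x + lam * (VV x * ω x) = s⁻¹ * (-lap W x + lam * (VV x * W x)) := by rw [e1, e2]; ring
      _ = _ := by rw [e3]; ring
  · intro φ h1 h2; rw [hωJ]; exact hub φ h1 h2
  · rw [inv_mul_le_iff₀ hs]; linarith
  · rw [hωJ]; exact hS

end var
end Conc

namespace Conc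
open Topology Set Module Metric

/-- truncated derivative of the nonlinearity -/
def hk (p k s : ℝ) : ℝ := p * (min (max s 0) k) ^ (p - 1) * max 0 (min 1 (1 - (s - k)))
/-- truncated nonlinearity -/
def gk (p k t : ℝ) : ℝ := ∫ s in (0 : ℝ)..t, hk p k s
/-- its primitive -/
def Gk (p k t : ℝ) : ℝ := ∫ s in (0 : ℝ)..t, gk p k s

section trunc
variable {p k : ℝ}

lemma hk_cont (hp : 1 < p) : Continuous (hk p k) := by
  unfold hk
  refine (continuous_const.mul ?_).mul (by fun_prop)
  exact Continuous.rpow_const (by fun_prop) (fun x => Or.inr (by linarith))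

lemma hk_nonneg (hp : 1 < p) (hk0 : 0 < k) (s : ℝ) : 0 ≤ hk p k s := by
  unfold hk
  have : 0 ≤ min (max s 0) k := le_min (le_max_right _ _) hk0.le
  have := rpow_nonneg this (p - 1)
  have : 0 ≤ max 0 (min 1 (1 - (s - k))) := le_max_left _ _
  positivity

lemma hk_le (hp : 1 < p) (hk0 : 0 < k) {s m : ℝ} (hm : min (max s 0) k ≤ m) : hk p k s ≤ p * m ^ (p - 1) := by
  unfold hk
  have h0 : 0 ≤ min (max s 0) k := le_min (le_max_right _ _) hk0.le
  have h1 := rpow_le_rpow h0 hm (by linarith : 0 ≤ p - 1)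
  have h2 := rpow_nonneg h0 (p - 1)
  have h3 : max 0 (min 1 (1 - (s - k))) ≤ 1 := max_le zero_le_one (min_le_left _ _)
  calc _ ≤ p * (min (max s 0) k) ^ (p - 1) * 1 := mul_le_mul_of_nonneg_left h3 (by positivity)
    _ ≤ _ := by rw [mul_one]; exact mul_le_mul_of_nonneg_left h1 (by linarith)

lemma hk_neg (hp : 1 < p) (hk0 : 0 < k) {s : ℝ} (hs : s ≤ 0) : hk p k s = 0 := by
  unfold hk
  rw [max_eq_right hs, min_eq_left hk0.le, zero_rpow (by linarith)]; ring

lemma hk_big {s : ℝ} (hs : k + 1 ≤ s) : hk p k s = 0 := by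
  unfold hk
  have : max 0 (min 1 (1 - (s - k))) = 0 := max_eq_left ((min_le_right _ _).trans (by linarith))
  rw [this, mul_zero]

lemma hk_mid {s : ℝ} (h0 : 0 ≤ s) (hs : s ≤ k) : hk p k s = p * s ^ (p - 1) := by
  unfold hk
  rw [max_eq_left h0, min_eq_left hs, min_eq_left (by linarith), max_eq_right zero_le_one, mul_one]

lemma gk_deriv (hp : 1 < p) (t : ℝ) : HasDerivAt (gk p k) (hk p k t) t :=
  intervalIntegral.integral_hasDerivAt_right ((hk_cont hp).intervalIntegrable _ _)
    (hk_cont hp).aestronglyMeasurable.stronglyMeasurableAtFilter (hk_cont hp).continuousAt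

lemma gk_cont (hp : 1 < p) : Continuous (gk p k) := continuous_iff_continuousAt.2 fun t => (gk_deriv hp t).continuousAt

lemma Gk_deriv (hp : 1 < p) (t : ℝ) : HasDerivAt (Gk p k) (gk p k t) t :=
  intervalIntegral.integral_hasDerivAt_right ((gk_cont hp).intervalIntegrable _ _)
    (gk_cont hp).aestronglyMeasurable.stronglyMeasurableAtFilter (gk_cont hp).continuousAt

lemma gk_mono (hp : 1 < p) (hk0 : 0 < k) : Monotone (gk p k) :=
  monotone_of_deriv_nonneg (fun t => (gk_deriv hp t).differentiableAt) fun t => by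
    rw [(gk_deriv hp t).deriv]; exact hk_nonneg hp hk0 t

lemma gk_zero : gk p k 0 = 0 := by simp [gk]

lemma gk_neg (hp : 1 < p) (hk0 : 0 < k) {t : ℝ} (ht : t ≤ 0) : gk p k t = 0 := by
  unfold gk
  rw [intervalIntegral.integral_congr (g := fun _ => (0 : ℝ))]
  · simp
  · intro s hs
    rw [uIcc_of_ge ht] at hs
    exact hk_neg hp hk0 hs.2

lemma gk_sub (hp : 1 < p) (hk0 : 0 < k) {m s t : ℝ} (hst : s ≤ t) (hm : min (max t 0) k ≤ m) :
    gk p k t - gk p k s ≤ p * m ^ (p - 1) * (t - s) := by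
  rcases hst.eq_or_lt with h | h
  · subst h; simp
  obtain ⟨c, hc, e⟩ := exists_hasDerivAt_eq_slope (gk p k) (hk p k) h (gk_cont hp).continuousOn (fun x _ => gk_deriv hp x)
  rw [eq_div_iff (by linarith)] at e
  rw [← e]
  refine mul_le_mul_of_nonneg_right (hk_le hp hk0 (le_trans ?_ hm)) (by linarith)
  exact min_le_min_right _ (max_le_max_right _ hc.2.le)

lemma gk_le (hp : 1 < p) (hk0 : 0 < k) {m t : ℝ} (ht : 0 ≤ t) (hm : min t k ≤ m) : gk p k t ≤ p * m ^ (p - 1) * t := by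
  have := gk_sub hp hk0 ht (m := m) (by rwa [max_eq_left ht])
  rw [gk_zero] at this; simpa using this

lemma gk_pow (hp : 1 < p) {t : ℝ} (h0 : 0 ≤ t) (ht : t ≤ k) : gk p k t = t ^ p := by
  unfold gk
  rw [intervalIntegral.integral_congr (g := fun s => p * s ^ (p - 1)), intervalIntegral.integral_const_mul,
    integral_rpow (Or.inl (by linarith)), zero_rpow (by linarith)]
  · rw [sub_add_cancel]; field_simp; ring
  · intro s hs
    rw [uIcc_of_le h0] at hs
    exact hk_mid hs.1 (hs.2.trans ht)

lemma Gk_pow (hp : 1 < p) {t : ℝ} (h0 : 0 ≤ t) (ht : t ≤ k) : Gk p k t = t ^ (p + 1) / (p + 1) := by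
  unfold Gk
  rw [intervalIntegral.integral_congr (g := fun s => s ^ p),
    integral_rpow (Or.inl (by linarith)), zero_rpow (by linarith), sub_zero]
  · intro s hs
    rw [uIcc_of_le h0] at hs
    exact gk_pow hp hs.1 (hs.2.trans ht)

lemma gk_NL (hp : 1 < p) (hk0 : 0 < k) : NL (gk p k) (Gk p k) := by
  have hgn : ∀ t, 0 ≤ gk p k t := fun t => by
    rcases le_total t 0 with h | h
    · rw [gk_neg hp hk0 h]
    · rw [← gk_zero (p := p) (k := k)]; exact gk_mono hp hk0 h
  have hGm : Monotone (Gk p k) := monotone_of_deriv_nonneg (fun t => (Gk_deriv hp t).differentiableAt) fun t => by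
    rw [(Gk_deriv hp t).deriv]; exact hgn t
  refine ⟨?_, fun t ht => gk_neg hp hk0 ht, gk_mono hp hk0, ?_, ?_, Gk_deriv hp, by simp [Gk], fun t ht => ?_⟩
  · rw [contDiff_one_iff_deriv]
    refine ⟨fun t => (gk_deriv hp t).differentiableAt, ?_⟩
    have : deriv (gk p k) = hk p k := funext fun t => (gk_deriv hp t).deriv
    rw [this]; exact hk_cont hp
  · refine ⟨gk p k (k + 1), fun t => ?_⟩
    rw [abs_of_nonneg (hgn t)]
    rcases le_total t (k + 1) with h | h
    · exact gk_mono hp hk0 h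
    · have e : gk p k t = gk p k (k + 1) := by
        have : gk p k t - gk p k (k + 1) = 0 := by
          unfold gk
          rw [intervalIntegral.integral_interval_sub_left ((hk_cont hp).intervalIntegrable _ _) ((hk_cont hp).intervalIntegrable _ _),
            intervalIntegral.integral_congr (g := fun _ => (0 : ℝ))]
          · simp
          · intro s hs
            rw [uIcc_of_le h] at hs
            exact hk_big hs.1
        linarith
      rw [e]
  · have hpk : 0 ≤ p * k ^ (p - 1) := by positivity
    refine ⟨p * k ^ (p - 1), hpk, fun s t => ?_⟩
    rcases le_total s t with h | h
    · rw [abs_of_nonneg (sub_nonneg.2 (gk_mono hp hk0 h)), abs_of_nonneg (sub_nonneg.2 h)]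
      exact gk_sub hp hk0 h (min_le_right _ _)
    · rw [abs_sub_comm, abs_sub_comm t, abs_of_nonneg (sub_nonneg.2 (gk_mono hp hk0 h)), abs_of_nonneg (sub_nonneg.2 h)]
      exact gk_sub hp hk0 h (min_le_right _ _)
  · have h1 : 0 < min t k := lt_min ht hk0
    refine lt_of_lt_of_le ?_ (hGm (min_le_left t k))
    rw [Gk_pow hp h1.le (min_le_right _ _)]
    have := rpow_pos_of_pos h1 (p + 1)
    positivity

end trunc

lemma NL.Gstar {g G : ℝ → ℝ} (n : NL g G) {τ t : ℝ} (h0 : 0 < τ) (ht : τ ≤ t) : t * G τ ≤ τ * G t := by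
  have h1 := n.conv τ t
  have h2 := n.conv τ 0
  rw [n.G0] at h2
  have h3 : G τ + (G τ / τ) * (t - τ) ≤ G t := by
    have : G τ / τ ≤ g τ := by rw [div_le_iff₀ h0]; linarith
    have := mul_le_mul_of_nonneg_right this (sub_nonneg.2 ht)
    linarith
  have h4 : τ * (G τ + (G τ / τ) * (t - τ)) = t * G τ := by field_simp; ring
  rw [← h4]; exact mul_le_mul_of_nonneg_left h3 h0.le

section main
variable {F : Type} [NormedAddCommGroup F] [InnerProductSpace ℝ F] [FiniteDimensional ℝ F]
variable [MeasurableSpace F] [BorelSpace F]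
variable {al be lam p : ℝ}

/-- integral over a ball is controlled by the weighted integral over D -/
lemma ball_V (hal : 0 < al) (hab : al < be) {f : F → ℝ} (hf : Continuous f) (hn : ∀ x, 0 ≤ f x)
    (h0 : ∀ x, x ∉ DD F al be → f x = 0) (x0 : F) (r : ℝ) :
    ∫ x in ball x0 r, f x ≤ 2 * be * ∫ x in ball x0 r ∩ DD F al be, VV x * f x := by
  have hbe : 0 < be := hal.trans hab
  have e1 : ∫ x in ball x0 r, f x = ∫ x in ball x0 r ∩ DD F al be, f x := by
    have hz : ∀ x ∈ ball x0 r \ (ball x0 r ∩ DD F al be), f x = 0 := by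
      rintro x ⟨hx, hx'⟩
      exact h0 x fun h => hx' ⟨hx, h⟩
    exact (setIntegral_eq_of_subset_of_forall_sdiff_eq_zero (f := f) (μ := volume) (s := ball x0 r ∩ DD F al be)
      (t := ball x0 r) measurableSet_ball inter_subset_left hz)
  rw [e1, ← integral_const_mul]
  refine setIntegral_mono_on ?_ (((V_intg' hal hf).mono_set inter_subset_right).const_mul _) (measurableSet_ball.inter DD_ms) fun x hx => ?_
  · exact (intg_D hf.continuousOn (bdd_D hf)).mono_set inter_subset_right
  · have := VV_lo hal hx.2
    rw [div_le_iff₀ (by positivity)] at this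
    have := mul_le_mul_of_nonneg_right this (hn x)
    linarith

lemma sup_bound (hN3 : 3 ≤ finrank ℝ F) (hal : 0 < al) (hab : al < be) (hp : 1 < p) {k μ : ℝ} (hk0 : 0 < k) {ω : F → ℝ} {e : F} (hlam : 0 < lam)
    (hω : Adm e al be ω) (h2 : ∀ x ∈ DD F al be, ContDiffAt ℝ 2 ω x) (hμ : 0 < μ)
    (heq : ∀ x ∈ DD F al be, -lap ω x + lam * (VV x * ω x) = VV x * (μ * gk p k (ω x)))
    (hJ : μ * JJ al be (Gk p k) ω ≤ 1) {x0 : F} (hM : ∀ x, ω x ≤ ω x0) (h0 : 0 < ω x0) {m : ℝ} (hm : m = min (ω x0) k) :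
    cE F * (m / 4) ^ (p + 1) / (p + 1) ≤ (√(μ * (1 / (2 * al)) * p * m ^ (p - 1))) ^ finrank ℝ F * (2 * be / μ) := by
  have n := gk_NL hp hk0
  have hm0 : 0 < m := hm ▸ lt_min h0 hk0
  set κ := μ * (1 / (2 * al)) * p * m ^ (p - 1) with hκ
  have hκ0 : 0 < κ := by positivity
  have hbe : 0 < be := hal.trans hab
  have key := mvG (x0 := x0) hκ0 hω.cls.cont hω.cls.zero hω.nn h2 (fun x hx => by
    have h1 := heq x hx
    have h3 : gk p k (ω x) ≤ p * m ^ (p - 1) * ω x := gk_le hp hk0 (hω.nn x) (hm ▸ min_le_min_right _ (hM x))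
    have h4 : 0 ≤ lam * (VV x * ω x) := mul_nonneg hlam.le (mul_nonneg (VV_nonneg x) (hω.nn x))
    have h5 : VV x * (μ * gk p k (ω x)) ≤ 1 / (2 * al) * (μ * (p * m ^ (p - 1) * ω x)) :=
      mul_le_mul (VV_up hal hx) (mul_le_mul_of_nonneg_left h3 hμ.le) (mul_nonneg hμ.le (n.gn _)) (by positivity)
    rw [hκ]
    linarith) n.Gc n.Gn (fun τ t a b => n.Gstar a b) h0
  have h3 : ∫ x in ball x0 (1 / √κ), Gk p k (ω x) ≤ 2 * be / μ := by
    refine (ball_V hal hab (n.Gc.comp hω.cls.cont) (fun x => n.Gn _) (fun x hx => by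
      simp only [Function.comp]; rw [hω.cls.zero x hx, n.G0]) x0 _).trans ?_
    have h4 : ∫ x in ball x0 (1 / √κ) ∩ DD F al be, VV x * (Gk p k ∘ ω) x ≤ JJ al be (Gk p k) ω := by
      refine setIntegral_mono_set (V_intg' hal (n.Gc.comp hω.cls.cont)) ?_ (LE.le.eventuallyLE inter_subset_right)
      exact Eventually.of_forall fun x => mul_nonneg (VV_nonneg x) (n.Gn _)
    have h5 : JJ al be (Gk p k) ω ≤ 1 / μ := by rw [le_div_iff₀ hμ]; linarith
    calc _ ≤ 2 * be * (1 / μ) := mul_le_mul_of_nonneg_left (h4.trans h5) (by positivity)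
      _ = _ := by ring
  have h4 : (m / 4) ^ (p + 1) / (p + 1) ≤ Gk p k (ω x0 / 4) := by
    have hmk : m ≤ k := hm ▸ min_le_right _ _
    have hmM : m ≤ ω x0 := hm ▸ min_le_left _ _
    rw [← Gk_pow hp (by positivity) (by linarith : m / 4 ≤ k)]
    have := n.conv (m / 4) (ω x0 / 4)
    have h6 := mul_nonneg (n.gn (m / 4)) (by linarith : 0 ≤ ω x0 / 4 - m / 4)
    linarith
  calc cE F * (m / 4) ^ (p + 1) / (p + 1) = cE F * ((m / 4) ^ (p + 1) / (p + 1)) := by ring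
    _ ≤ cE F * Gk p k (ω x0 / 4) := mul_le_mul_of_nonneg_left h4 cE_pos.le
    _ ≤ _ := key
    _ ≤ _ := mul_le_mul_of_nonneg_left h3 (by positivity)

end main
end Conc

namespace Conc
open Topology Set Module Metric

lemma sqrt_npow {κ : ℝ} (hκ : 0 ≤ κ) (N : ℕ) : (√κ) ^ N = κ ^ ((N : ℝ) / 2) := by
  rw [sqrt_eq_rpow, ← rpow_natCast, ← rpow_mul hκ]; congr 1; ring

lemma pow_solve {A B m a q : ℝ} (hA : 0 < A) (hB : 0 ≤ B) (hm : 0 < m) (hq : q < a) (h : A * m ^ a ≤ B * m ^ q) :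
    m ≤ (B / A) ^ (1 / (a - q)) := by
  have h1 : m ^ (a - q) ≤ B / A := by
    rw [rpow_sub hm, div_le_div_iff₀ (rpow_pos_of_pos hm q) hA]; linarith
  have h2 := rpow_le_rpow (rpow_nonneg hm.le _) h1 (by have : 0 < a - q := by linarith
                                                       positivity : 0 ≤ 1 / (a - q))
  rwa [← rpow_mul hm.le, mul_one_div_cancel (by linarith), rpow_one] at h2

section main
variable {F : Type} [NormedAddCommGroup F] [InnerProductSpace ℝ F] [FiniteDimensional ℝ F]
variable [MeasurableSpace F] [BorelSpace F]
variable {al be lam p : ℝ}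

/-- ground states -/
structure Sol (e : F) (al be lam p : ℝ) (v : F → ℝ) (E : ℝ) : Prop where
  adm : Adm e al be v
  c2 : ∀ x ∈ DD F al be, ContDiffAt ℝ 2 v x
  rep : ∃ U : F → ℝ, (∀ x, x ≠ 0 → ContDiffAt ℝ 1 U x) ∧ ∀ x : F, al ≤ ‖x‖ ∧ ‖x‖ ≤ be → v x = U x
  eq : ∀ x ∈ DD F al be, -lap v x + lam * (VV x * v x) = VV x * (v x) ^ p
  pos : ∀ x ∈ DD F al be, 0 < v x
  Epos : 0 < E
  EN : BB al be lam v v = E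
  EV : ∫ x in DD F al be, VV x * (v x) ^ (p + 1) = E
  comp : ∀ φ, Adm e al be φ → E ^ ((p - 1) / 2) * (∫ x in DD F al be, VV x * (φ x) ^ (p + 1)) ≤ (BB al be lam φ φ) ^ ((p + 1) / 2)

lemma max_pt (hN3 : 3 ≤ finrank ℝ F) (hal : 0 < al) (hab : al < be) {e : F} {v : F → ℝ} (hv : Adm e al be v) (hp : ∃ x ∈ DD F al be, 0 < v x) :
    ∃ x0 ∈ DD F al be, 0 < v x0 ∧ ∀ x, v x ≤ v x0 := by
  obtain ⟨z, hz, hvz⟩ := hp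
  obtain ⟨x0, hx0, hmax⟩ := (cD_compact (F := F) (al := al) (be := be)).exists_isMaxOn ⟨z, DD_sub hz⟩ hv.cls.cont.continuousOn
  have h0 : 0 < v x0 := hvz.trans_le (hmax (DD_sub hz))
  have hD : x0 ∈ DD F al be := by
    by_contra h
    rw [hv.cls.zero x0 h] at h0
    exact lt_irrefl _ h0
  refine ⟨x0, hD, h0, fun x => ?_⟩
  by_cases hx : x ∈ DD F al be
  · exact hmax (DD_sub hx)
  · rw [hv.cls.zero x hx]; exact h0.le

lemma JJ_pow (hp : 1 < p) {k : ℝ} {φ : F → ℝ} (h0 : ∀ x, 0 ≤ φ x) (hk : ∀ x, φ x ≤ k) :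
    JJ al be (Gk p k) φ = (∫ x in DD F al be, VV x * (φ x) ^ (p + 1)) / (p + 1) := by
  unfold JJ
  rw [← integral_div]
  refine setIntegral_congr_fun DD_ms fun x _ => ?_
  rw [Gk_pow hp (h0 x) (hk x)]; ring

theorem sol_exists (hN3 : 3 ≤ finrank ℝ F) (hal : 0 < al) (hab : al < be) (hlam : 0 < lam) (hp : 1 < p)
    (hθ : (p - 1) * ((finrank ℝ F : ℝ) / 2) < p + 1) (e : F) : ∃ v E, Sol e al be lam p v E := by
  have hbe : 0 < be := hal.trans hab
  have hNr : (3 : ℝ) ≤ finrank ℝ F := by exact_mod_cast hN3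
  -- a fixed comparison function
  have h1 := tst_adm (e := e) hal hab
  obtain ⟨B0, hB00, hB0⟩ := h1.cls.bdd
  set N0 := BB al be lam (tst al be : F → ℝ) (tst al be) with hN0
  have hb : 0 ≤ N0 := BB_nonneg hlam.le _
  set c := min (√(N0 + 1))⁻¹ (B0 + 1)⁻¹ with hc
  have hc0 : 0 < c := by positivity
  have hφ0 := h1.smul hc0.le
  have hφN : BB al be lam (fun x : F => c * tst al be x) (fun x => c * tst al be x) ≤ 1 := by
    rw [BB_smul h1.c1]
    have : c ^ 2 ≤ ((√(N0 + 1))⁻¹) ^ 2 := pow_le_pow_left₀ hc0.le (min_le_left _ _) 2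
    rw [inv_pow, sq_sqrt (by linarith)] at this
    calc _ ≤ (N0 + 1)⁻¹ * N0 := mul_le_mul_of_nonneg_right this hb
      _ ≤ 1 := by rw [inv_mul_le_iff₀ (by linarith)]; linarith
  have hφ1 : ∀ x : F, c * tst al be x ≤ 1 := fun x => by
    have h2 : c ≤ (B0 + 1)⁻¹ := min_le_right _ _
    calc _ ≤ (B0 + 1)⁻¹ * (B0 + 1) := mul_le_mul h2 (((le_abs_self _).trans (hB0 x)).trans (by linarith)) (h1.nn x) (by positivity)
      _ = 1 := inv_mul_cancel₀ (by linarith)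
  set J0 := (∫ x in DD F al be, VV x * (c * tst al be x) ^ (p + 1)) / (p + 1) with hJ0
  have hpc : Continuous fun t : ℝ => t ^ (p + 1) := continuous_rpow_const (by linarith)
  have hJ0p : 0 < J0 := by
    refine div_pos ?_ (by linarith)
    by_contra hcon
    push Not at hcon
    obtain ⟨z, hz⟩ := DD_nonempty (F := F) hN3 hal hab
    have := V_zero hal (hpc.comp hφ0.cls.cont) (fun x _ => rpow_nonneg (hφ0.nn x) _) hcon z hz
    have hp' : 0 < c * tst al be z := mul_pos hc0 (by unfold tst; exact lt_max_of_lt_right (tst_pos hz))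
    exact (rpow_pos_of_pos hp' (p + 1)).ne' this
  -- the truncated maximisers
  have hex : ∀ k : ℝ, 1 ≤ k → ∃ (ω : F → ℝ) (μ : ℝ), Adm e al be ω ∧ (∀ x ∈ DD F al be, ContDiffAt ℝ 2 ω x) ∧
      (∃ U : F → ℝ, (∀ x, x ≠ 0 → ContDiffAt ℝ 1 U x) ∧ ∀ x : F, al ≤ ‖x‖ ∧ ‖x‖ ≤ be → ω x = U x) ∧
      0 < μ ∧ BB al be lam ω ω = 1 ∧ (∀ x ∈ DD F al be, -lap ω x + lam * (VV x * ω x) = VV x * (μ * gk p k (ω x))) ∧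
      (∀ φ, Adm e al be φ → BB al be lam φ φ ≤ 1 → JJ al be (Gk p k) φ ≤ JJ al be (Gk p k) ω) ∧ μ * JJ al be (Gk p k) ω ≤ 1 ∧ 
      μ ≤ 1 / J0 ∧ ∃ x0 ∈ DD F al be, 0 < ω x0 ∧ ∀ x, ω x ≤ ω x0 := fun k hk => by
    have n := gk_NL hp (by linarith : 0 < k)
    obtain ⟨ω, μ, a1, a2, a3, a4, a5, a6, a7, a8, a9⟩ := var_exists hN3 hal hab hlam e n
    refine ⟨ω, μ, a1, a2, a3, a4, a5, a6, a7, a8, ?_, ?_⟩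
    · have := a7 _ hφ0 hφN
      rw [JJ_pow hp hφ0.nn (fun x => (hφ1 x).trans hk)] at this
      rw [le_div_iff₀ hJ0p]
      exact (mul_le_mul_of_nonneg_left this a4.le).trans a8
    · refine max_pt hN3 hal hab a1 ?_
      by_contra hcon
      push Not at hcon
      have : JJ al be (Gk p k) ω = 0 := by
        unfold JJ
        rw [setIntegral_congr_fun (g := fun _ => (0 : ℝ)) DD_ms]
        · simp
        · intro x hx
          have : ω x = 0 := le_antisymm (hcon x hx) (a1.nn x)
          simp only [this, n.G0, mul_zero]
      linarith
  -- the bound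
  set D1 := cE F * (1 / 4) ^ (p + 1) / (p + 1) with hD1
  have hD1p : 0 < D1 := by have := cE_pos (F := F); positivity
  set D2 := ((1 / (2 * al)) * p) ^ ((finrank ℝ F : ℝ) / 2) * (2 * be) * (1 / J0) ^ ((finrank ℝ F : ℝ) / 2 - 1) with hD2
  have hD2p : 0 < D2 := by positivity
  set M0 := (D2 / D1) ^ (1 / ((p + 1) - (p - 1) * ((finrank ℝ F : ℝ) / 2))) with hM0
  have hbd : ∀ (k : ℝ) (ω : F → ℝ) (μ : ℝ) (x0 : F), 1 ≤ k → Adm e al be ω → (∀ x ∈ DD F al be, ContDiffAt ℝ 2 ω x) →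
      0 < μ → (∀ x ∈ DD F al be, -lap ω x + lam * (VV x * ω x) = VV x * (μ * gk p k (ω x))) → μ * JJ al be (Gk p k) ω ≤ 1 →
      μ ≤ 1 / J0 → 0 < ω x0 → (∀ x, ω x ≤ ω x0) → min (ω x0) k ≤ M0 := by
    intro k ω μ x0 hk a1 a2 a4 a6 a8 a9 a10 a11
    have hm : 0 < min (ω x0) k := lt_min a10 (by linarith)
    have := sup_bound hN3 hal hab hp (by linarith) hlam a1 a2 a4 a6 a8 a11 a10 rfl
    set m := min (ω x0) k with hmd
    refine pow_solve hD1p hD2p.le hm hθ ?_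
    rw [sqrt_npow (by positivity)] at this
    have e1 : cE F * (m / 4) ^ (p + 1) / (p + 1) = D1 * m ^ (p + 1) := by
      rw [hD1, div_eq_mul_one_div m, mul_rpow hm.le (by norm_num)]; ring
    have e2 : (μ * (1 / (2 * al)) * p * m ^ (p - 1)) ^ ((finrank ℝ F : ℝ) / 2) * (2 * be / μ) =
        ((1 / (2 * al)) * p) ^ ((finrank ℝ F : ℝ) / 2) * (2 * be) * μ ^ ((finrank ℝ F : ℝ) / 2 - 1) * m ^ ((p - 1) * ((finrank ℝ F : ℝ) / 2)) := by
      rw [show μ * (1 / (2 * al)) * p * m ^ (p - 1) = μ * ((1 / (2 * al)) * p) * m ^ (p - 1) by ring,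
        mul_rpow (by positivity) (by positivity), mul_rpow (by positivity) (by positivity), ← rpow_mul hm.le, rpow_sub a4, rpow_one]
      ring
    rw [e1, e2] at this
    refine this.trans ?_
    have h5 : μ ^ ((finrank ℝ F : ℝ) / 2 - 1) ≤ (1 / J0) ^ ((finrank ℝ F : ℝ) / 2 - 1) := rpow_le_rpow a4.le a9 (by linarith)
    rw [hD2]
    gcongr
  set k0 := max M0 1 + 1 with hk0
  have hk01 : 1 ≤ k0 := by have := le_max_right M0 1; linarith
  have hk0M : M0 < k0 := by have := le_max_left M0 1; linarith
  have hbd2 : ∀ (k t : ℝ), k0 ≤ k → min t k ≤ M0 → t ≤ M0 := fun k t hk h => by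
    rcases min_le_iff.1 h with h | h
    · exact h
    · linarith
  obtain ⟨ω, μ, hω, hω2, ⟨U, hU, hUω⟩, hμ, hωN, hωeq, hωmax, hωJ, hμ0, x0, hx0, hx0p, hx0m⟩ := hex k0 hk01
  have hωM : ∀ x, ω x ≤ M0 := fun x => (hx0m x).trans (hbd2 k0 _ le_rfl (hbd k0 ω μ x0 hk01 hω hω2 hμ hωeq hωJ hμ0 hx0p hx0m))
  have hωk : ∀ x, ω x ≤ k0 := fun x => (hωM x).trans hk0M.le
  have hωeq' : ∀ x ∈ DD F al be, -lap ω x + lam * (VV x * ω x) = VV x * (μ * (ω x) ^ p) := fun x hx => by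
    rw [hωeq x hx, gk_pow hp (hω.nn x) (hωk x)]
  have hpc' : Continuous fun t : ℝ => t ^ p := continuous_rpow_const (by linarith)
  have hωV : ∫ x in DD F al be, VV x * (ω x) ^ (p + 1) = 1 / μ := by
    have hh : Continuous fun x => μ * (ω x) ^ p := continuous_const.mul (hpc'.comp hω.cls.cont)
    have := weak hal hω.cls hω2 hω.gb hh hωeq' hω
    rw [hωN] at this
    have e1 : ∫ x in DD F al be, VV x * (μ * (ω x) ^ p * ω x) = μ * ∫ x in DD F al be, VV x * (ω x) ^ (p + 1) := by
      rw [← integral_const_mul]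
      refine setIntegral_congr_fun DD_ms fun x _ => ?_
      rw [rpow_add_one' (hω.nn x) (by linarith)]; ring
    rw [e1] at this
    rw [eq_div_iff hμ.ne']; linarith
  have hcomp : ∀ φ, Adm e al be φ → BB al be lam φ φ ≤ 1 → μ * (∫ x in DD F al be, VV x * (φ x) ^ (p + 1)) ≤ 1 := by
    intro φ hφ hφN
    obtain ⟨Bφ, -, hBφ⟩ := hφ.cls.bdd
    set k := max k0 Bφ with hk
    have hkk : k0 ≤ k := le_max_left _ _
    obtain ⟨ω', μ', hω', hω2', -, hμ', hωN', hωeq', hωmax', hωJ', hμ0', x0', hx0', hx0p', hx0m'⟩ := hex k (hk01.trans hkk)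
    have hωM' : ∀ x, ω' x ≤ M0 := fun x => (hx0m' x).trans (hbd2 k _ hkk (hbd k ω' μ' x0' (hk01.trans hkk) hω' hω2' hμ' hωeq' hωJ' hμ0' hx0p' hx0m'))
    have s1 := hωmax' φ hφ hφN
    rw [JJ_pow hp hφ.nn (fun x => ((le_abs_self _).trans (hBφ x)).trans (le_max_right _ _)),
      JJ_pow hp hω'.nn (fun x => ((hωM' x).trans hk0M.le).trans hkk)] at s1
    have s2 := hωmax ω' hω' hωN'.le
    rw [JJ_pow hp hω'.nn (fun x => (hωM' x).trans hk0M.le), JJ_pow hp hω.nn hωk, hωV] at s2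
    have s3 := s1.trans s2
    rw [div_le_div_iff_of_pos_right (by linarith), le_div_iff₀ hμ] at s3
    linarith
  -- rescaling
  have hp1 : 0 < p - 1 := by linarith
  set c1 := μ ^ (1 / (p - 1)) with hc1
  have hc1p : 0 < c1 := by positivity
  have hc1e : c1 ^ (p - 1) = μ := by rw [hc1, ← rpow_mul hμ.le, one_div_mul_cancel hp1.ne', rpow_one]
  have hcp : c1 ^ p = μ * c1 := by rw [← hc1e, ← rpow_add_one hc1p.ne']; congr 1; ring
  have hcp1 : c1 ^ (p + 1) = μ * c1 ^ 2 := by rw [rpow_add_one hc1p.ne', hcp]; ring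
  have hE : (c1 ^ 2) ^ ((p - 1) / 2) = μ := by
    rw [← rpow_natCast, ← rpow_mul hc1p.le, ← hc1e]; congr 1; push_cast; ring
  have hva := hω.smul hc1p.le
  have hv2 : ∀ x ∈ DD F al be, ContDiffAt ℝ 2 (fun x => c1 * ω x) x := fun x hx => contDiffAt_const.mul (hω2 x hx)
  have hveq : ∀ x ∈ DD F al be, -lap (fun x => c1 * ω x) x + lam * (VV x * (c1 * ω x)) = VV x * (c1 * ω x) ^ p := fun x hx => by
    rw [lap_const_mul _ (hω2 x hx), mul_rpow hc1p.le (hω.nn x), hcp]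
    linear_combination c1 * hωeq' x hx
  refine ⟨fun x => c1 * ω x, c1 ^ 2, hva, hv2, ⟨fun x => c1 * U x, fun x hx => contDiffAt_const.mul (hU x hx), fun x hx => by rw [hUω x hx]⟩, hveq, ?_, by positivity, ?_, ?_, ?_⟩
  · intro x hx
    refine smp hN3 (κ := lam * (1 / (2 * al))) (by positivity) hva.nn hv2 (fun x hx => ?_) hx0 (mul_pos hc1p hx0p) hx
    have a1 := hveq x hx
    have a2 : 0 ≤ VV x * (c1 * ω x) ^ p := mul_nonneg (VV_nonneg x) (rpow_nonneg (hva.nn x) _)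
    have a3 := mul_le_mul_of_nonneg_left (mul_le_mul_of_nonneg_right (VV_up hal hx) (hva.nn x)) hlam.le
    linarith
  · rw [BB_smul hω.c1, hωN, mul_one]
  · have : ∀ x, VV x * (c1 * ω x) ^ (p + 1) = (μ * c1 ^ 2) * (VV x * (ω x) ^ (p + 1)) := fun x => by
      rw [mul_rpow hc1p.le (hω.nn x), hcp1]; ring
    simp only [this]
    rw [integral_const_mul, hωV]; field_simp
  · intro φ hφ
    rw [hE]
    have hNn : 0 ≤ BB al be lam φ φ := BB_nonneg hlam.le φ
    rcases hNn.eq_or_lt with h | h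
    · rw [← h, zero_rpow (by linarith)]
      have h3 : lam * ∫ x in DD F al be, VV x * (φ x * φ x) ≤ 0 := by
        rw [h, ← integral_const_mul]
        refine setIntegral_mono_on (hφ.vi hal hφ) (hφ.bi hal hφ) DD_ms fun x hx => ?_
        linarith [gdot_self_nonneg φ x]
      have h4 := V_zero hal (hφ.cls.cont.mul hφ.cls.cont) (fun x _ => mul_self_nonneg _)
        (show ∫ x in DD F al be, VV x * (φ x * φ x) ≤ 0 by
          by_contra hcon
          push Not at hcon
          have := mul_pos hlam hcon
          linarith)
      rw [setIntegral_congr_fun (g := fun _ => (0 : ℝ)) DD_ms]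
      · simp
      · intro x hx
        have : φ x = 0 := mul_self_eq_zero.1 (h4 x hx)
        simp only [this]
        rw [zero_rpow (by linarith), mul_zero]
    · set N := BB al be lam φ φ with hNd
      have hs : 0 < √N := sqrt_pos.2 h
      have h5 := hcomp _ (hφ.smul (c := (√N)⁻¹) (by positivity)) (by
        rw [BB_smul hφ.c1, inv_pow, sq_sqrt h.le, inv_mul_cancel₀ h.ne'])
      have e1 : ∀ x, VV x * ((√N)⁻¹ * φ x) ^ (p + 1) = (N ^ ((p + 1) / 2))⁻¹ * (VV x * (φ x) ^ (p + 1)) := fun x => by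
        have : ((√N)⁻¹) ^ (p + 1) = (N ^ ((p + 1) / 2))⁻¹ := by
          rw [inv_rpow hs.le, sqrt_eq_rpow, ← rpow_mul h.le]; congr 2; ring
        rw [mul_rpow (by positivity) (hφ.nn x), this]; ring
      simp only [e1] at h5
      rw [integral_const_mul] at h5
      have hNp : 0 < N ^ ((p + 1) / 2) := rpow_pos_of_pos h _
      have : μ * ((N ^ ((p + 1) / 2))⁻¹ * ∫ x in DD F al be, VV x * (φ x) ^ (p + 1)) =
        (N ^ ((p + 1) / 2))⁻¹ * (μ * ∫ x in DD F al be, VV x * (φ x) ^ (p + 1)) := by ring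
      rw [this, inv_mul_le_iff₀ hNp, mul_one] at h5
      exact h5

end main
end Conc

namespace Conc
open Topology Set Module Metric

section main
variable {F : Type} [NormedAddCommGroup F] [InnerProductSpace ℝ F] [FiniteDimensional ℝ F]
variable [MeasurableSpace F] [BorelSpace F]
variable {al be lam p : ℝ} {e : F}

lemma int_scale (f : F → ℝ) (x1 z1 : F) {σ : ℝ} (hσ : 0 < σ) :
    ∫ z, f (x1 + σ • (z - z1)) = (σ ^ finrank ℝ F)⁻¹ * ∫ z, f z := by
  rw [integral_sub_right_eq_self (fun z => f (x1 + σ • z)) z1,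
    Measure.integral_comp_smul volume (fun z => f (x1 + z)) σ, integral_add_left_eq_self f x1,
    abs_of_pos (by positivity), smul_eq_mul]

lemma gdot_scale {w : F → ℝ} (x1 z1 : F) (σ : ℝ) (z : F) (hw : ContDiff ℝ 1 w) :
    gdot (fun z => w (x1 + σ • (z - z1))) (fun z => w (x1 + σ • (z - z1))) z = σ ^ 2 * gdot w w (x1 + σ • (z - z1)) := by
  have h : ∀ i, pd i (fun z => w (x1 + σ • (z - z1))) z = σ * pd i w (x1 + σ • (z - z1)) := fun i => by
    unfold pd
    have hT : HasFDerivAt (fun z : F => x1 + σ • (z - z1)) (σ • ContinuousLinearMap.id ℝ F) z :=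
      (((hasFDerivAt_id z).sub_const z1).const_smul σ).const_add x1
    have := ((hw.differentiable (by norm_num) (x1 + σ • (z - z1))).hasFDerivAt.comp z hT).fderiv
    have e1 : (w ∘ fun z : F => x1 + σ • (z - z1)) = fun z => w (x1 + σ • (z - z1)) := rfl
    rw [e1] at this
    rw [this]; simp
  unfold gdot
  rw [Finset.mul_sum]
  exact Finset.sum_congr rfl fun i _ => by rw [h i]; ring

/-- continuity and support of gdot -/
lemma gdot_cont {w : F → ℝ} (hw : ContDiff ℝ 1 w) : Continuous (gdot w w) :=
  continuous_iff_continuousAt.2 fun x => gdot_continuousAt hw.contDiffAt hw.contDiffAt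

lemma gdot_cs {w : F → ℝ} (hc : HasCompactSupport w) : HasCompactSupport (gdot w w) := by
  refine hc.of_isClosed_subset (isClosed_tsupport _) (closure_minimal (fun x hx => ?_) (isClosed_tsupport w))
  by_contra h
  apply hx
  have h1 : w =ᶠ[𝓝 x] fun _ => (0 : ℝ) := notMem_tsupport_iff_eventuallyEq.1 h
  rw [gdot_congr h1 h1]
  simp [gdot, pd]

lemma cs_comp {w : F → ℝ} (hc : HasCompactSupport w) {g : ℝ → ℝ} (h0 : g 0 = 0) : HasCompactSupport fun x => g (w x) :=
  hc.comp_left h0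

/-- energy comparison with transplanted functions -/
lemma transp {v : F → ℝ} {E : ℝ} (S : Sol e al be lam p v E) (hal : 0 < al) (hlam : 0 < lam) (hp : 1 < p)
    {w : F → ℝ} (hw : ContDiff ℝ 1 w) (hcs : HasCompactSupport w) (h0 : ∀ x, 0 ≤ w x)
    (hs : ∀ A : F ≃ₗᵢ[ℝ] F, A e = e → ∀ z, w (A z) = w z) {σ : ℝ} (hσ : 0 < σ) (t1 t2 : ℝ) {Vl Vh : ℝ} (hVl : 0 ≤ Vl) (hVh : 0 ≤ Vh)
    (hT : ∀ z, w (t1 • e + σ • (z - t2 • e)) ≠ 0 → z ∈ DD F al be ∧ Vl ≤ VV z ∧ VV z ≤ Vh) :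
    E ^ ((p - 1) / 2) * (Vl * ((σ ^ finrank ℝ F)⁻¹ * ∫ x, w x ^ (p + 1))) ≤
      ((σ ^ finrank ℝ F)⁻¹ * (σ ^ 2 * (∫ x, gdot w w x) + lam * (Vh * ∫ x, w x * w x))) ^ ((p + 1) / 2) := by
  set φ : F → ℝ := fun z => w (t1 • e + σ • (z - t2 • e)) with hφ
  have hφ1 : ContDiff ℝ 1 φ := by
    have : ContDiff ℝ 1 fun z : F => t1 • e + σ • (z - t2 • e) := by fun_prop
    exact hw.comp this
  have hzero : ∀ z, z ∉ DD F al be → φ z = 0 := fun z hz => by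
    by_contra h
    exact hz (hT z h).1
  have hg : ∀ z, gdot φ φ z = σ ^ 2 * gdot w w (t1 • e + σ • (z - t2 • e)) := fun z => gdot_scale _ _ _ _ hw
  have hpc : Continuous fun t : ℝ => t ^ (p + 1) := continuous_rpow_const (by linarith)
  have hadm : Adm e al be φ := by
    refine ⟨⟨hφ1.continuous, hzero, fun A hA z => ?_⟩, fun z => h0 _, fun x _ => hφ1.contDiffAt, ?_⟩
    · have : t1 • e + σ • (A z - t2 • e) = A (t1 • e + σ • (z - t2 • e)) := by simp [hA]
      simp only [hφ]
      rw [this, hs A hA]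
    · obtain ⟨C, hC⟩ := (gdot_cont hw).bounded_above_of_compact_support (gdot_cs hcs)
      refine ⟨σ ^ 2 * C, fun x _ => ?_⟩
      rw [hg]
      exact mul_le_mul_of_nonneg_left ((le_abs_self _).trans (hC _)) (by positivity)
  have hTc : Continuous fun z : F => t1 • e + σ • (z - t2 • e) := by fun_prop
  have hinv : IsProperMap (fun z : F => t1 • e + σ • (z - t2 • e)) := by
    have h1 := (((Homeomorph.subRight (t2 • e)).trans (Homeomorph.smulOfNeZero σ hσ.ne')).trans (Homeomorph.addLeft (t1 • e)))
    have : (fun z : F => t1 • e + σ • (z - t2 • e)) = (((Homeomorph.subRight (t2 • e)).trans (Homeomorph.smulOfNeZero σ hσ.ne')).trans (Homeomorph.addLeft (t1 • e))) := by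
      ext z; simp
    rw [this]
    exact Homeomorph.isProperMap _
  have hitg0 : ∀ f : F → ℝ, Continuous f → HasCompactSupport f → Integrable fun z => f (t1 • e + σ • (z - t2 • e)) := fun f hf hc => by
    refine (hf.comp hTc).integrable_of_hasCompactSupport ?_
    refine HasCompactSupport.intro (hinv.isCompact_preimage hc) fun z hz => ?_
    exact image_eq_zero_of_notMem_tsupport (f := f) hz
  refine le_trans ?_ ((S.comp φ hadm).trans ?_)
  · refine mul_le_mul_of_nonneg_left ?_ (rpow_nonneg S.Epos.le _)
    rw [← int_scale (fun x => w x ^ (p + 1)) (t1 • e) (t2 • e) hσ, ← integral_const_mul]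
    have e1 : ∫ z, Vl * w (t1 • e + σ • (z - t2 • e)) ^ (p + 1) = ∫ z in DD F al be, Vl * w (t1 • e + σ • (z - t2 • e)) ^ (p + 1) := by
      refine (setIntegral_eq_integral_of_forall_compl_eq_zero fun z hz => ?_).symm
      have := hzero z hz
      simp only [hφ] at this
      rw [this, zero_rpow (by linarith), mul_zero]
    rw [e1]
    have hi := hitg0 (fun x => w x ^ (p + 1)) (hpc.comp hw.continuous) (cs_comp (g := fun t => t ^ (p + 1)) hcs (zero_rpow (by linarith)))
    refine setIntegral_mono_on (hi.const_mul Vl).integrableOn (V_intg' hal (hpc.comp hφ1.continuous)) DD_ms fun z hz => ?_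
    by_cases hz0 : φ z = 0
    · simp only [hφ] at hz0 ⊢
      rw [hz0, zero_rpow (by linarith), mul_zero, mul_zero]
    · exact mul_le_mul_of_nonneg_right (hT z hz0).2.1 (rpow_nonneg (h0 _) _)
  · refine rpow_le_rpow (BB_nonneg hlam.le _) ?_ (by linarith)
    have i1 := hitg0 (gdot w w) (gdot_cont hw) (gdot_cs hcs)
    have i2 := hitg0 (fun x => w x * w x) (hw.continuous.mul hw.continuous) (cs_comp (g := fun t => t * t) hcs (by simp))
    have e1 : (σ ^ finrank ℝ F)⁻¹ * (σ ^ 2 * (∫ x, gdot w w x) + lam * (Vh * ∫ x, w x * w x)) =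
        ∫ z, (σ ^ 2 * gdot w w (t1 • e + σ • (z - t2 • e)) + lam * (Vh * (w (t1 • e + σ • (z - t2 • e)) * w (t1 • e + σ • (z - t2 • e))))) := by
      rw [integral_add (i1.const_mul _) ((i2.const_mul Vh).const_mul lam), integral_const_mul, integral_const_mul, integral_const_mul,
        int_scale (gdot w w) _ _ hσ, int_scale (fun x => w x * w x) _ _ hσ]
      ring
    rw [e1]
    have hI := (i1.const_mul (σ ^ 2)).add ((i2.const_mul Vh).const_mul lam)
    refine le_trans (setIntegral_mono_on (hadm.bi hal hadm) hI.integrableOn DD_ms fun z hz => ?_) (setIntegral_le_integral hI (Eventually.of_forall fun z => ?_))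
    · simp only [hg z, Pi.add_apply]
      refine add_le_add le_rfl (mul_le_mul_of_nonneg_left ?_ hlam.le)
      by_cases hz0 : φ z = 0
      · simp only [hφ] at hz0 ⊢
        rw [hz0]; simp
      · exact mul_le_mul_of_nonneg_right (hT z hz0).2.2 (mul_self_nonneg _)
    · have := gdot_self_nonneg w (t1 • e + σ • (z - t2 • e))
      have := mul_self_nonneg (w (t1 • e + σ • (z - t2 • e)))
      have h3 := mul_nonneg hlam.le (mul_nonneg hVh this)
      have h4 := mul_nonneg (sq_nonneg σ) (gdot_self_nonneg w (t1 • e + σ • (z - t2 • e)))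
      exact add_nonneg h4 h3

/-- energy upper bound -/
lemma E_upper (hN3 : 3 ≤ finrank ℝ F) (hal : 0 < al) (hab : al < be) (hp : 1 < p) (he : ‖e‖ = 1) :
    ∃ C, 0 < C ∧ ∀ lam, 1 ≤ lam → ∀ v E, Sol e al be lam p v E → E ≤ C * lam ^ ((p + 1) / (p - 1) - (finrank ℝ F : ℝ) / 2) := by
  have hbe : 0 < be := hal.trans hab
  set N := finrank ℝ F with hN
  set r0 := (be - al) / 4 with hr0
  have hr0p : 0 < r0 := by rw [hr0]; linarith
  set I1 := ∫ x : F, zet x ^ (p + 1) with hI1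
  set I2 := ∫ x : F, gdot zet zet x with hI2
  set I3 := ∫ x : F, zet x * zet x with hI3
  have hpc : Continuous fun t : ℝ => t ^ (p + 1) := continuous_rpow_const (by linarith)
  have hI1p : 0 < I1 := by
    refine Continuous.integral_pos_of_hasCompactSupport_nonneg_nonzero (hpc.comp zet_C1.continuous)
      (cs_comp (g := fun t => t ^ (p + 1)) zet_cs (zero_rpow (by linarith))) (fun x => rpow_nonneg (zet_nonneg x) _) (x := 0) ?_
    exact (rpow_pos_of_pos (by simp [zet]) _).ne'
  have hI2n : 0 ≤ I2 := integral_nonneg fun x => gdot_self_nonneg _ x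
  have hI3n : 0 ≤ I3 := integral_nonneg fun x => mul_self_nonneg _
  set A := 1 / (2 * be) * (r0 ^ N * I1) with hA
  set B := r0 ^ N * ((r0 ^ 2)⁻¹ * I2 + 1 / (2 * al) * I3) with hB
  have hAp : 0 < A := by positivity
  have hBn : 0 ≤ B := by positivity
  have hp1 : 0 < p - 1 := by linarith
  refine ⟨(B ^ ((p + 1) / 2) / A) ^ (2 / (p - 1)) + 1, by positivity, fun lam hlam v E S => ?_⟩
  have hl0 : 0 < lam := by linarith
  have hsl : 1 ≤ √lam := one_le_sqrt.2 hlam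
  have hσ : 0 < √lam / r0 := by positivity
  have key := transp S hal hl0 hp zet_C1 zet_cs zet_nonneg (fun A _ z => by simp [zet]) hσ 0 ((al + be) / 2) (Vl := 1 / (2 * be)) (Vh := 1 / (2 * al))
    (by positivity) (by positivity) (fun z hz => by
      have h1 : (0 : ℝ) • e + (√lam / r0) • (z - ((al + be) / 2) • e) ∈ ball (0 : F) 1 := by
        by_contra h; exact hz (zet_zero h)
      rw [mem_ball_zero_iff, zero_smul, zero_add, norm_smul, Real.norm_of_nonneg hσ.le, div_mul_eq_mul_div, div_lt_one hr0p] at h1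
      have h2 : ‖z - ((al + be) / 2) • e‖ < r0 := by nlinarith [norm_nonneg (z - ((al + be) / 2) • e)]
      have h3 : ‖((al + be) / 2) • e‖ = (al + be) / 2 := by rw [norm_smul, he, mul_one, Real.norm_of_nonneg (by linarith)]
      have h4 := norm_sub_norm_le z (((al + be) / 2) • e)
      have h5 := norm_sub_norm_le (((al + be) / 2) • e) z
      rw [norm_sub_rev] at h5
      have hz : z ∈ DD F al be := by
        constructor
        · show al < ‖z‖
          linarith
        · show ‖z‖ < be
          linarith
      exact ⟨hz, VV_lo hal hz, VV_up hal hz⟩)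
  have hσN : ((√lam / r0) ^ N)⁻¹ = lam ^ (-((N : ℝ) / 2)) * r0 ^ N := by
    rw [div_pow, sqrt_npow hl0.le, inv_div, rpow_neg hl0.le]; field_simp
  have hσ2 : (√lam / r0) ^ 2 = lam * (r0 ^ 2)⁻¹ := by rw [div_pow, sq_sqrt hl0.le]; rfl
  rw [hσN, hσ2] at key
  have e1 : 1 / (2 * be) * (lam ^ (-((N : ℝ) / 2)) * r0 ^ N * ∫ x : F, zet x ^ (p + 1)) = A * lam ^ (-((N : ℝ) / 2)) := by rw [hA]; ring
  have e2 : lam ^ (-((N : ℝ) / 2)) * r0 ^ N * (lam * (r0 ^ 2)⁻¹ * (∫ x : F, gdot zet zet x) + lam * (1 / (2 * al) * ∫ x : F, zet x * zet x)) =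
      B * (lam ^ (-((N : ℝ) / 2)) * lam) := by rw [hB]; ring
  rw [e1, e2, ← rpow_add_one hl0.ne', mul_rpow hBn (by positivity), ← rpow_mul hl0.le] at key
  have h6 : E ^ ((p - 1) / 2) ≤ B ^ ((p + 1) / 2) / A * lam ^ ((-((N : ℝ) / 2) + 1) * ((p + 1) / 2) + (N : ℝ) / 2) := by
    rw [rpow_add hl0, div_mul_eq_mul_div, le_div_iff₀ hAp]
    rw [rpow_neg hl0.le] at key
    have h7 : 0 < lam ^ ((N : ℝ) / 2) := by positivity
    have h8 := mul_le_mul_of_nonneg_right key h7.le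
    calc E ^ ((p - 1) / 2) * A = E ^ ((p - 1) / 2) * (A * (lam ^ ((N : ℝ) / 2))⁻¹) * lam ^ ((N : ℝ) / 2) := by field_simp
      _ ≤ _ := h8
      _ = _ := by ring
  have h7 := rpow_le_rpow (rpow_nonneg S.Epos.le _) h6 (by positivity : 0 ≤ 2 / (p - 1))
  rw [← rpow_mul S.Epos.le, mul_rpow (by positivity) (by positivity), ← rpow_mul hl0.le] at h7
  have e3 : (p - 1) / 2 * (2 / (p - 1)) = 1 := by field_simp
  have e4 : ((-((N : ℝ) / 2) + 1) * ((p + 1) / 2) + (N : ℝ) / 2) * (2 / (p - 1)) = (p + 1) / (p - 1) - (N : ℝ) / 2 := by field_simp; ring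
  rw [e3, e4, rpow_one] at h7
  refine h7.trans (mul_le_mul_of_nonneg_right (by linarith) (by positivity))

end main
end Conc

namespace Conc
open Topology Set Module Metric

section main
variable {F : Type} [NormedAddCommGroup F] [InnerProductSpace ℝ F] [FiniteDimensional ℝ F]
variable [MeasurableSpace F] [BorelSpace F]
variable {al be lam p E : ℝ} {e : F} {v : F → ℝ}

/-- mass of v in a set -/
def ms (al be p : ℝ) (v : F → ℝ) (S : Set F) : ℝ := ∫ x in S ∩ DD F al be, VV x * (v x) ^ (p + 1)

lemma Sol.pw_cont (S : Sol e al be lam p v E) (hp : 1 < p) : Continuous fun x => v x ^ (p + 1) :=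
  (continuous_rpow_const (by linarith : (0 : ℝ) ≤ p + 1)).comp S.adm.cls.cont

lemma Sol.pi (S : Sol e al be lam p v E) (hal : 0 < al) (hp : 1 < p) : IntegrableOn (fun x => VV x * v x ^ (p + 1)) (DD F al be) :=
  V_intg' hal (S.pw_cont hp)

lemma Sol.nn' (S : Sol e al be lam p v E) (x : F) : 0 ≤ VV x * v x ^ (p + 1) :=
  mul_nonneg (VV_nonneg x) (rpow_nonneg (S.adm.nn x) _)

lemma ms_mono (S : Sol e al be lam p v E) (hal : 0 < al) (hp : 1 < p) {A B : Set F} (h : A ⊆ B) : ms al be p v A ≤ ms al be p v B :=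
  setIntegral_mono_set ((S.pi hal hp).mono_set inter_subset_right) (Eventually.of_forall fun x => S.nn' x)
    (LE.le.eventuallyLE (inter_subset_inter_left _ h))

lemma ms_le (S : Sol e al be lam p v E) (hal : 0 < al) (hp : 1 < p) (A : Set F) : ms al be p v A ≤ E := by
  refine (ms_mono S hal hp (subset_univ A)).trans ?_
  unfold ms
  rw [univ_inter, S.EV]

lemma ms_nonneg (S : Sol e al be lam p v E) (A : Set F) : 0 ≤ ms al be p v A :=
  integral_nonneg fun x => S.nn' x

lemma ms_sum (S : Sol e al be lam p v E) (hal : 0 < al) (hp : 1 < p) (K : ℕ) (A : ℕ → Set F) (hm : ∀ i, MeasurableSet (A i))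
    (hd : ∀ i < K, ∀ j < K, i ≠ j → Disjoint (A i) (A j)) : ∑ i ∈ Finset.range K, ms al be p v (A i) ≤ E := by
  unfold ms
  rw [← integral_biUnion_finset (Finset.range K) (fun i _ => (hm i).inter DD_ms)
    (fun i hi j hj hij => (hd i (Finset.mem_range.1 hi) j (Finset.mem_range.1 hj) hij).mono inter_subset_left inter_subset_left)
    (fun i _ => (S.pi hal hp).mono_set inter_subset_right), ← S.EV]
  refine setIntegral_mono_set (S.pi hal hp) (Eventually.of_forall fun x => S.nn' x) (LE.le.eventuallyLE ?_)
  exact iUnion₂_subset fun i _ => inter_subset_right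

lemma ms_add (S : Sol e al be lam p v E) (hal : 0 < al) (hp : 1 < p) {A B : Set F} (hA : MeasurableSet A) (hB : MeasurableSet B)
    (hd : Disjoint A B) : ms al be p v A + ms al be p v B = ms al be p v (A ∪ B) := by
  unfold ms
  rw [union_inter_distrib_right, setIntegral_union (hd.mono inter_subset_left inter_subset_left) (hB.inter DD_ms)
    ((S.pi hal hp).mono_set inter_subset_right) ((S.pi hal hp).mono_set inter_subset_right)]

/-- mean value estimate -/
lemma mvE (S : Sol e al be lam p v E) (hal : 0 < al) (hab : al < be) (hp : 1 < p) {κ : ℝ} (hκ : 0 < κ)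
    (hl : ∀ x ∈ DD F al be, -lap v x ≤ κ * v x) {x : F} (hx : 0 < v x) :
    cE F * (1 / 4) ^ (p + 1) * v x ^ (p + 1) ≤ κ ^ ((finrank ℝ F : ℝ) / 2) * (2 * be * ms al be p v (ball x (1 / √κ))) := by
  have hpc : Continuous fun t : ℝ => t ^ (p + 1) := continuous_rpow_const (by linarith)
  have key := mvG hκ S.adm.cls.cont S.adm.cls.zero S.adm.nn S.c2 hl (G := fun t => max t 0 ^ (p + 1))
    (hpc.comp (continuous_id.max continuous_const)) (fun t => rpow_nonneg (le_max_right _ _) _) (fun τ t h0 h => by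
      have ht : 0 < t := h0.trans_le h
      simp only [max_eq_left h0.le, max_eq_left ht.le]
      rw [rpow_add_one h0.ne', rpow_add_one ht.ne']
      have := rpow_le_rpow h0.le h (by linarith : 0 ≤ p)
      nlinarith [mul_pos ht h0]) hx
  simp only [max_eq_left (S.adm.nn _)] at key
  rw [max_eq_left (by positivity), div_eq_mul_one_div, mul_rpow hx.le (by norm_num), sqrt_npow hκ.le] at key
  have h2 := ball_V hal hab (S.pw_cont hp) (fun x => rpow_nonneg (S.adm.nn x) _) (fun x hx => by
    rw [S.adm.cls.zero x hx, zero_rpow (by linarith)]) x (1 / √κ)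
  calc _ = cE F * (v x ^ (p + 1) * (1 / 4) ^ (p + 1)) := by ring
    _ ≤ _ := key
    _ ≤ _ := mul_le_mul_of_nonneg_left h2 (by positivity)

lemma lap_le (S : Sol e al be lam p v E) (hal : 0 < al) (hp : 1 < p) (hlam : 0 < lam) {M : ℝ} (hM : ∀ x, v x ≤ M) :
    ∀ x ∈ DD F al be, -lap v x ≤ M ^ (p - 1) * (1 / (2 * al)) * v x := fun x hx => by
  have h1 := S.eq x hx
  have hv := S.pos x hx
  have h2 : v x ^ p = v x ^ (p - 1) * v x := by rw [← rpow_add_one hv.ne']; congr 1; ring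
  have h3 : v x ^ (p - 1) ≤ M ^ (p - 1) := rpow_le_rpow hv.le (hM x) (by linarith)
  have h4 : 0 ≤ lam * (VV x * v x) := mul_nonneg hlam.le (mul_nonneg (VV_nonneg x) hv.le)
  have h5 : VV x * v x ^ p ≤ 1 / (2 * al) * (M ^ (p - 1) * v x) := by
    rw [h2]
    exact mul_le_mul (VV_up hal hx) (mul_le_mul_of_nonneg_right h3 hv.le) (by positivity) (by positivity)
  linarith

lemma M_upper (hN3 : 3 ≤ finrank ℝ F) (hal : 0 < al) (hab : al < be) (hp : 1 < p) (hθ : (p - 1) * ((finrank ℝ F : ℝ) / 2) < p + 1) (he : ‖e‖ = 1) :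
    ∃ C, 0 < C ∧ ∀ lam, 1 ≤ lam → ∀ v E, Sol e al be lam p v E → ∀ x, v x ≤ C * lam ^ (1 / (p - 1)) := by
  obtain ⟨C, hC, hCE⟩ := E_upper hN3 hal hab hp he
  have hbe : 0 < be := hal.trans hab
  set N := finrank ℝ F with hN
  have hp1 : 0 < p - 1 := by linarith
  set A := cE F * (1 / 4) ^ (p + 1) with hA
  have hAp : 0 < A := mul_pos cE_pos (by positivity)
  set B := (1 / (2 * al)) ^ ((N : ℝ) / 2) * (2 * be * C) with hB
  have hBp : 0 < B := by positivity
  set s := (p + 1) - (p - 1) * ((N : ℝ) / 2) with hs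
  have hs0 : 0 < s := by rw [hs]; linarith
  refine ⟨(B / A) ^ (1 / s), by positivity, fun lam hlam v E S x => ?_⟩
  have hl0 : 0 < lam := by linarith
  obtain ⟨z, hz⟩ := DD_nonempty (F := F) hN3 hal hab
  obtain ⟨x0, hx0, hx0p, hmax⟩ := max_pt hN3 hal hab S.adm ⟨z, hz, S.pos z hz⟩
  refine (hmax x).trans ?_
  have key := mvE S hal hab hp (by positivity) (lap_le S hal hp hl0 hmax) hx0p
  have h1 := (ms_le S hal hp (ball x0 (1 / √(v x0 ^ (p - 1) * (1 / (2 * al)))))).trans (hCE lam hlam v E S)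
  rw [mul_rpow (by positivity) (by positivity), ← rpow_mul hx0p.le] at key
  have h2 : A * v x0 ^ (p + 1) ≤ (B * lam ^ ((p + 1) / (p - 1) - (N : ℝ) / 2)) * v x0 ^ ((p - 1) * ((N : ℝ) / 2)) := by
    refine key.trans ?_
    rw [hB]
    calc _ ≤ v x0 ^ ((p - 1) * ((N : ℝ) / 2)) * (1 / (2 * al)) ^ ((N : ℝ) / 2) * (2 * be * (C * lam ^ ((p + 1) / (p - 1) - (N : ℝ) / 2))) := by gcongr
      _ = _ := by ring
  have h3 := pow_solve hAp (by positivity) hx0p hθ h2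
  refine h3.trans (le_of_eq ?_)
  rw [mul_div_right_comm, mul_rpow (by positivity) (by positivity), ← rpow_mul hl0.le]
  congr 2
  rw [← hs, show (p + 1) / (p - 1) - (N : ℝ) / 2 = s / (p - 1) by rw [hs]; field_simp]
  field_simp

lemma mass_lo (hN3 : 3 ≤ finrank ℝ F) (hal : 0 < al) (hab : al < be) (hp : 1 < p) (hθ : (p - 1) * ((finrank ℝ F : ℝ) / 2) < p + 1) (he : ‖e‖ = 1) :
    ∃ r1 c1, 0 < r1 ∧ 0 < c1 ∧ ∀ lam, 1 ≤ lam → ∀ v E, Sol e al be lam p v E → ∀ x, lam ^ (1 / (p - 1)) / 2 ≤ v x →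
      c1 * E ≤ ms al be p v (ball x (r1 / √lam)) := by
  obtain ⟨C0, hC0, hCE⟩ := E_upper hN3 hal hab hp he
  obtain ⟨C, hC, hCM⟩ := M_upper hN3 hal hab hp hθ he
  have hbe : 0 < be := hal.trans hab
  set N := finrank ℝ F with hN
  have hp1 : 0 < p - 1 := by linarith
  set K := C ^ (p - 1) * (1 / (2 * al)) with hK
  have hKp : 0 < K := by positivity
  set A := cE F * (1 / 4) ^ (p + 1) with hA
  have hAp : 0 < A := mul_pos cE_pos (by positivity)
  set B := K ^ ((N : ℝ) / 2) * (2 * be) with hB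
  have hBp : 0 < B := by positivity
  refine ⟨1 / √K, A * (1 / 2) ^ (p + 1) / B / C0, by positivity, by positivity, fun lam hlam v E S x hx => ?_⟩
  have hl0 : 0 < lam := by linarith
  have hlp : 0 < lam ^ (1 / (p - 1)) := by positivity
  have hvx : 0 < v x := by linarith
  have e1 : (C * lam ^ (1 / (p - 1))) ^ (p - 1) * (1 / (2 * al)) = K * lam := by
    rw [mul_rpow hC.le hlp.le, ← rpow_mul hl0.le, one_div_mul_cancel hp1.ne', rpow_one, hK]; ring
  have key := mvE S hal hab hp (κ := K * lam) (by positivity) (e1 ▸ lap_le S hal hp hl0 (hCM lam hlam v E S)) hvx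
  have e2 : 1 / √(K * lam) = 1 / √K / √lam := by rw [sqrt_mul hKp.le]; field_simp
  rw [e2, mul_rpow hKp.le hl0.le] at key
  set μ := ms al be p v (ball x (1 / √K / √lam)) with hμ
  have h3 : lam ^ ((p + 1) / (p - 1)) * (1 / 2) ^ (p + 1) ≤ v x ^ (p + 1) := by
    have := rpow_le_rpow (by positivity) hx (by linarith : 0 ≤ p + 1)
    rw [div_eq_mul_one_div, mul_rpow hlp.le (by norm_num), ← rpow_mul hl0.le] at this
    rwa [show (p + 1) / (p - 1) = 1 / (p - 1) * (p + 1) by ring]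
  have h4 : A * (1 / 2) ^ (p + 1) * lam ^ ((p + 1) / (p - 1)) ≤ B * lam ^ ((N : ℝ) / 2) * μ := by
    calc _ = A * (lam ^ ((p + 1) / (p - 1)) * (1 / 2) ^ (p + 1)) := by ring
      _ ≤ A * v x ^ (p + 1) := mul_le_mul_of_nonneg_left h3 hAp.le
      _ ≤ _ := key
      _ = _ := by rw [hB]; ring
  have h5 := hCE lam hlam v E S
  rw [rpow_sub hl0] at h5
  have h6 : 0 < lam ^ ((N : ℝ) / 2) := by positivity
  calc A * (1 / 2) ^ (p + 1) / B / C0 * E ≤ A * (1 / 2) ^ (p + 1) / B / C0 * (C0 * (lam ^ ((p + 1) / (p - 1)) / lam ^ ((N : ℝ) / 2))) :=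
        mul_le_mul_of_nonneg_left h5 (by positivity)
    _ = A * (1 / 2) ^ (p + 1) * lam ^ ((p + 1) / (p - 1)) / (B * lam ^ ((N : ℝ) / 2)) := by field_simp
    _ ≤ μ := by rw [div_le_iff₀ (by positivity)]; linarith

/-- lower bound of the maximum -/
lemma max_lo (S : Sol e al be lam p v E) (hal : 0 < al) (hp : 1 < p) (hlam : 0 < lam) {x0 : F} (hx : x0 ∈ DD F al be) (hmax : ∀ x, v x ≤ v x0) :
    lam ^ (1 / (p - 1)) ≤ v x0 := by
  have hv := S.pos x0 hx
  have h1 := lap_nonpos_of_localMax (S.c2 x0 hx) (Eventually.of_forall hmax)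
  have h2 := S.eq x0 hx
  have hV := VV_pos (DD_ne hal hx)
  have h3 : v x0 ^ p = v x0 ^ (p - 1) * v x0 := by rw [← rpow_add_one hv.ne']; congr 1; ring
  have h4 : lam ≤ v x0 ^ (p - 1) := by
    by_contra h
    push Not at h
    have : VV x0 * v x0 ^ p < lam * (VV x0 * v x0) := by
      rw [h3]
      have := mul_lt_mul_of_pos_right h (mul_pos hV hv)
      linarith
    linarith
  have h5 := rpow_le_rpow hlam.le h4 (by have : 0 < p - 1 := by linarith
                                         positivity : 0 ≤ 1 / (p - 1))
  rwa [← rpow_mul hv.le, mul_one_div_cancel (by linarith), rpow_one] at h5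

lemma orb {h : F → ℝ} (hc : Cls e al be h) {x y : F} (h1 : inner ℝ e x = inner ℝ e y) (h2 : ‖x‖ = ‖y‖) : h x = h y := by
  have hr := Submodule.reflection_sub h2
  rw [← hr]
  refine (hc.sym _ ?_ x).symm
  refine Submodule.reflection_mem_subspace_eq_self ?_
  rw [Submodule.mem_orthogonal_singleton_iff_inner_left, inner_sub_right, h1, sub_self]

end main
end Conc

namespace Conc
open Topology Set Module Metric

section main
variable {F : Type} [NormedAddCommGroup F] [InnerProductSpace ℝ F] [FiniteDimensional ℝ F]
variable [MeasurableSpace F] [BorelSpace F]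
variable {al be lam p E : ℝ} {e : F} {v : F → ℝ}

lemma perp2 (hN3 : 3 ≤ finrank ℝ F) (he : ‖e‖ = 1) : ∃ f1 f2 : F, ‖f1‖ = 1 ∧ ‖f2‖ = 1 ∧ inner ℝ e f1 = (0 : ℝ) ∧ inner ℝ e f2 = (0 : ℝ) ∧
    inner ℝ f1 f2 = (0 : ℝ) := by
  have he0 : e ≠ 0 := norm_ne_zero_iff.1 (by rw [he]; norm_num)
  have : Fact (finrank ℝ F = (finrank ℝ F - 1) + 1) := ⟨by omega⟩
  have h1 : finrank ℝ (ℝ ∙ e)ᗮ = finrank ℝ F - 1 := Submodule.finrank_orthogonal_span_singleton he0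
  set b := stdOrthonormalBasis ℝ (ℝ ∙ e)ᗮ with hb
  have h0 : 0 < finrank ℝ (ℝ ∙ e)ᗮ := by omega
  have h2 : 1 < finrank ℝ (ℝ ∙ e)ᗮ := by omega
  refine ⟨b ⟨0, h0⟩, b ⟨1, h2⟩, b.orthonormal.1 _, b.orthonormal.1 _, ?_, ?_, ?_⟩
  · exact Submodule.mem_orthogonal_singleton_iff_inner_right.1 (b ⟨0, h0⟩).2
  · exact Submodule.mem_orthogonal_singleton_iff_inner_right.1 (b ⟨1, h2⟩).2
  · exact b.orthonormal.2 (by simp)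

lemma sqrt_large (r : ℝ) {δ : ℝ} (hδ : 0 < δ) : ∃ Λ, 1 ≤ Λ ∧ ∀ lam, Λ ≤ lam → r / √lam ≤ δ := by
  refine ⟨max 1 ((r / δ) ^ 2), le_max_left _ _, fun lam h => ?_⟩
  have h1 : 1 ≤ lam := (le_max_left _ _).trans h
  have h2 : (r / δ) ^ 2 ≤ lam := (le_max_right _ _).trans h
  have h3 : r / δ ≤ √lam := le_sqrt_of_sq_le h2
  rw [div_le_iff₀ (sqrt_pos.2 (by linarith))]
  rw [div_le_iff₀ hδ] at h3
  linarith

lemma lin_large (r : ℝ) {δ : ℝ} (hδ : 0 < δ) : ∃ Λ, 1 ≤ Λ ∧ ∀ lam, Λ ≤ lam → r / lam ≤ δ := by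
  refine ⟨max 1 (r / δ), le_max_left _ _, fun lam h => ?_⟩
  have h1 : 1 ≤ lam := (le_max_left _ _).trans h
  have h3 : r / δ ≤ lam := (le_max_right _ _).trans h
  rw [div_le_iff₀ (by linarith)]
  rw [div_le_iff₀ hδ] at h3
  linarith

/-- high points lie near the axis -/
lemma near_axis (hN3 : 3 ≤ finrank ℝ F) (hal : 0 < al) (hab : al < be) (hp : 1 < p) (hθ : (p - 1) * ((finrank ℝ F : ℝ) / 2) < p + 1) (he : ‖e‖ = 1)
    {δ : ℝ} (hδ : 0 < δ) : ∃ Λ, 1 ≤ Λ ∧ ∀ lam, Λ ≤ lam → ∀ v E, Sol e al be lam p v E → ∀ x, lam ^ (1 / (p - 1)) / 2 ≤ v x →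
      ‖x - (inner ℝ e x : ℝ) • e‖ < δ := by
  obtain ⟨r1, c1, hr1, hc1, hmass⟩ := mass_lo hN3 hal hab hp hθ he
  obtain ⟨f1, f2, n1, n2, o1, o2, o3⟩ := perp2 hN3 he
  obtain ⟨K, hK⟩ := exists_nat_gt (1 / c1)
  have hK0 : (0 : ℝ) < K := lt_trans (by positivity) hK
  obtain ⟨Λ, hΛ1, hΛ⟩ := sqrt_large r1 (δ := δ / (2 * K)) (by positivity)
  refine ⟨Λ, hΛ1, fun lam hlam v E S x hx => ?_⟩
  by_contra hcon
  push Not at hcon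
  set τ : ℝ := inner ℝ e x with hτ
  set d := ‖x - τ • e‖ with hd
  have hee : inner ℝ e e = (1 : ℝ) := by rw [real_inner_self_eq_norm_sq, he]; norm_num
  have h11 : inner ℝ f1 f1 = (1 : ℝ) := by rw [real_inner_self_eq_norm_sq, n1]; norm_num
  have h22 : inner ℝ f2 f2 = (1 : ℝ) := by rw [real_inner_self_eq_norm_sq, n2]; norm_num
  have hxn : ‖x‖ ^ 2 = τ ^ 2 + d ^ 2 := by
    have hxe : inner ℝ x e = τ := by rw [real_inner_comm]
    rw [hd, ← real_inner_self_eq_norm_sq (x - τ • e)]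
    simp only [inner_sub_left, inner_sub_right, real_inner_smul_left, real_inner_smul_right, hxe, ← hτ, real_inner_self_eq_norm_sq]
    rw [norm_smul, he, mul_one, Real.norm_eq_abs, sq_abs]
    ring
  set s : ℕ → ℝ := fun j => j / K with hs
  set P : ℕ → F := fun j => τ • e + d • (s j • f1 + √(1 - s j ^ 2) • f2) with hP
  have o1' : inner ℝ f1 e = (0 : ℝ) := by rw [real_inner_comm, o1]
  have o2' : inner ℝ f2 e = (0 : ℝ) := by rw [real_inner_comm, o2]
  have o3' : inner ℝ f2 f1 = (0 : ℝ) := by rw [real_inner_comm, o3]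
  have hsj : ∀ j < K, s j ^ 2 ≤ 1 := fun j hj => by
    have h1 : s j ≤ 1 := by rw [hs]; simp only; rw [div_le_one hK0]; exact_mod_cast hj.le
    have h2 : 0 ≤ s j := by rw [hs]; positivity
    nlinarith
  have hPv : ∀ j < K, v (P j) = v x := fun j hj => by
    refine orb S.adm.cls ?_ ?_
    · rw [← hτ, hP]
      simp only [inner_add_right, real_inner_smul_right, hee, o1, o2]
      ring
    · rw [← sq_eq_sq₀ (norm_nonneg _) (norm_nonneg _), hxn, ← real_inner_self_eq_norm_sq]
      simp only [hP, inner_add_right, inner_add_left, real_inner_smul_right, real_inner_smul_left, hee, o1, o2, o1', o2', o3, o3', h11, h22]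
      have := mul_self_sqrt (sub_nonneg.2 (hsj j hj))
      linear_combination d ^ 2 * this
  have hsep : ∀ i < K, ∀ j < K, i ≠ j → δ / K ≤ dist (P i) (P j) := fun i hi j hj hij => by
    have h1 : inner ℝ f1 (P i - P j) = d * (s i - s j) := by
      simp only [hP, inner_add_right, inner_sub_right, real_inner_smul_right, o1', o3, h11]
      ring
    have h2 := abs_real_inner_le_norm f1 (P i - P j)
    rw [h1, n1, one_mul, abs_mul, abs_of_nonneg (norm_nonneg _ : 0 ≤ d)] at h2
    rw [dist_eq_norm]
    refine le_trans ?_ h2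
    have h3 : 1 / (K : ℝ) ≤ |s i - s j| := by
      rw [hs]
      simp only
      rw [← sub_div, abs_div, abs_of_pos hK0]
      refine div_le_div_of_nonneg_right ?_ hK0.le
      have : (1 : ℤ) ≤ |(i : ℤ) - j| := Int.one_le_abs (by omega)
      exact_mod_cast this
    calc δ / K = δ * (1 / K) := by ring
      _ ≤ d * |s i - s j| := mul_le_mul hcon h3 (by positivity) (norm_nonneg _)
  have hsum := ms_sum S hal hp K (fun j => ball (P j) (r1 / √lam)) (fun j => measurableSet_ball) (fun i hi j hj hij => by
    refine ball_disjoint_ball (le_trans ?_ (hsep i hi j hj hij))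
    have := hΛ lam hlam
    have e1 : δ / (2 * K) + δ / (2 * K) = δ / K := by field_simp; ring
    linarith)
  have h4 : ∑ j ∈ Finset.range K, c1 * E ≤ E := (Finset.sum_le_sum fun j hj =>
    hmass lam (hΛ1.trans hlam) v E S (P j) (by rw [hPv j (Finset.mem_range.1 hj)]; exact hx)).trans hsum
  rw [Finset.sum_const, Finset.card_range, nsmul_eq_mul] at h4
  rw [div_lt_iff₀ hc1] at hK
  have := S.Epos
  nlinarith

/-- radial cutoff -/
def cutf (c : F) (r R : ℝ) (z : F) : ℝ := Real.smoothTransition ((R ^ 2 - ‖z - c‖ ^ 2) / (R ^ 2 - r ^ 2))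

section cut
variable {c : F} {r R : ℝ}

lemma cutf_smooth : ContDiff ℝ 1 (cutf c r R) := by
  have : ContDiff ℝ 1 fun z : F => (R ^ 2 - ‖z - c‖ ^ 2) / (R ^ 2 - r ^ 2) :=
    (contDiff_const.sub ((contDiff_id.sub contDiff_const).norm_sq ℝ)).div_const _
  exact Real.smoothTransition.contDiff.comp this

lemma cutf_nonneg (z : F) : 0 ≤ cutf c r R z := Real.smoothTransition.nonneg _
lemma cutf_le (z : F) : cutf c r R z ≤ 1 := Real.smoothTransition.le_one _

lemma cutf_one (hr : 0 < r) (hR : r < R) {z : F} (hz : ‖z - c‖ ≤ r) : cutf c r R z = 1 := by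
  refine Real.smoothTransition.one_of_one_le ?_
  have : 0 < R ^ 2 - r ^ 2 := by nlinarith
  rw [le_div_iff₀ this]
  nlinarith [norm_nonneg (z - c)]

lemma cutf_zero (hr : 0 < r) (hR : r < R) {z : F} (hz : R ≤ ‖z - c‖) : cutf c r R z = 0 := by
  refine Real.smoothTransition.zero_of_nonpos (div_nonpos_of_nonpos_of_nonneg ?_ ?_)
  · nlinarith
  · nlinarith

lemma cutf_sym (t : ℝ) (A : F ≃ₗᵢ[ℝ] F) (hA : A e = e) (z : F) : cutf (t • e) r R (A z) = cutf (t • e) r R z := by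
  unfold cutf
  have : A z - t • e = A (z - t • e) := by simp [hA]
  rw [this, LinearIsometryEquiv.norm_map]

lemma cutf_grad (hr : 0 < r) (hR : r < R) : ∃ C, 0 ≤ C ∧ ∀ c z : F, gdot (cutf c r R) (cutf c r R) z ≤ C := by
  have hcs : HasCompactSupport (cutf (0 : F) r R) := HasCompactSupport.intro (isCompact_closedBall (0 : F) R) fun z hz => by
    refine cutf_zero hr hR ?_
    rw [mem_closedBall_zero_iff, not_le] at hz
    rw [sub_zero]; exact hz.le
  obtain ⟨C, hC⟩ := (gdot_cont (cutf_smooth (c := (0 : F)) (r := r) (R := R))).bounded_above_of_compact_support (gdot_cs hcs)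
  have hC' : ∀ z, gdot (cutf (0 : F) r R) (cutf 0 r R) z ≤ C := fun z => (le_abs_self _).trans (hC z)
  refine ⟨C, (gdot_self_nonneg _ 0).trans (hC' 0), fun c z => ?_⟩
  have e1 : cutf c r R = fun z => cutf 0 r R (0 + (1 : ℝ) • (z - c)) := by ext z; simp [cutf]
  rw [e1, gdot_scale _ _ _ _ cutf_smooth]
  have := hC' (0 + (1 : ℝ) • (z - c))
  linarith

end cut

/-- multiplication of admissible functions by a cutoff -/
lemma Adm.cut {φ η : F → ℝ} (h : Adm e al be φ) (hη : ContDiff ℝ 1 η) (h0 : ∀ z, 0 ≤ η z) (h1 : ∀ z, η z ≤ 1)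
    (hs : ∀ A : F ≃ₗᵢ[ℝ] F, A e = e → ∀ z, η (A z) = η z) {C : ℝ} (hC : ∀ z, gdot η η z ≤ C) : Adm e al be (fun z => η z * φ z) := by
  obtain ⟨M, hM0, hM⟩ := h.cls.bdd
  obtain ⟨D, hD⟩ := h.gb
  refine ⟨⟨hη.continuous.mul h.cls.cont, fun z hz => by rw [h.cls.zero z hz, mul_zero], fun A hA z => by rw [hs A hA, h.cls.sym A hA]⟩,
    fun z => mul_nonneg (h0 z) (h.nn z), fun x hx => hη.contDiffAt.mul (h.c1 x hx), 2 * D + 2 * (M ^ 2 * C), fun x hx => ?_⟩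
  have hd1 := (h.c1 x hx).differentiableAt (by norm_num)
  have hd2 := hη.differentiable (by norm_num) x
  have h2 : gdot (fun z => η z * φ z) (fun z => η z * φ z) x ≤ 2 * gdot φ φ x + 2 * (M ^ 2 * gdot η η x) := by
    unfold gdot
    rw [Finset.mul_sum, Finset.mul_sum, Finset.mul_sum, ← Finset.sum_add_distrib]
    refine Finset.sum_le_sum fun i _ => ?_
    rw [pd_mul hd2 hd1]
    have a1 : η x ^ 2 ≤ 1 := pow_le_one₀ (h0 x) (h1 x)
    have a2 : φ x ^ 2 ≤ M ^ 2 := sq_le_sq' (by linarith [h.nn x]) ((le_abs_self _).trans (hM x))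
    nlinarith [sq_nonneg (η x * pd i φ x - φ x * pd i η x), mul_le_mul_of_nonneg_right a1 (sq_nonneg (pd i φ x)),
      mul_le_mul_of_nonneg_right a2 (sq_nonneg (pd i η x))]
  have := hD x hx
  have := mul_le_mul_of_nonneg_left (hC x) (sq_nonneg M)
  linarith

lemma Sol.v2 (S : Sol e al be lam p v E) (hal : 0 < al) (hab : al < be) (hlam : 0 < lam) : ∫ x in DD F al be, v x * v x ≤ 2 * be * E / lam := by
  have hbe : 0 < be := hal.trans hab
  have hi : IntegrableOn (fun x => v x * v x) (DD F al be) :=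
    intg_D (S.adm.cls.cont.mul S.adm.cls.cont).continuousOn (bdd_D (S.adm.cls.cont.mul S.adm.cls.cont))
  have h1 : lam / (2 * be) * ∫ x in DD F al be, v x * v x ≤ E := by
    rw [← S.EN, ← integral_const_mul]
    refine setIntegral_mono_on (hi.const_mul _) (S.adm.bi hal S.adm) DD_ms fun x hx => ?_
    have h2 := mul_le_mul_of_nonneg_left (mul_le_mul_of_nonneg_right (VV_lo hal hx) (mul_self_nonneg (v x))) hlam.le
    have h3 := gdot_self_nonneg v x
    calc lam / (2 * be) * (v x * v x) = lam * (1 / (2 * be) * (v x * v x)) := by ring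
      _ ≤ _ := by linarith
  rw [le_div_iff₀ hlam]
  calc _ = 2 * be * (lam / (2 * be) * ∫ x in DD F al be, v x * v x) := by field_simp
    _ ≤ _ := mul_le_mul_of_nonneg_left h1 (by positivity)

lemma cut_energy (S : Sol e al be lam p v E) (hal : 0 < al) (hab : al < be) (hlam : 0 < lam) (hp : 1 < p) {η : F → ℝ} (hη : ContDiff ℝ 1 η)
    (h0 : ∀ z, 0 ≤ η z) (h1 : ∀ z, η z ≤ 1) (hs : ∀ A : F ≃ₗᵢ[ℝ] F, A e = e → ∀ z, η (A z) = η z) {C : ℝ} (hC0 : 0 ≤ C) (hC : ∀ z, gdot η η z ≤ C) :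
    BB al be lam (fun z => η z * v z) (fun z => η z * v z) ≤ (∫ x in DD F al be, VV x * (η x ^ 2 * v x ^ (p + 1))) + C * (2 * be * E / lam) := by
  have a1 := S.adm.cut hη h0 h1 hs hC
  have a2 := a1.cut hη h0 h1 hs hC
  have hpc : Continuous fun x => v x ^ p := (continuous_rpow_const (by linarith : (0 : ℝ) ≤ p)).comp S.adm.cls.cont
  have hw := weak hal S.adm.cls S.c2 S.adm.gb hpc S.eq a2
  have e1 : ∫ x in DD F al be, VV x * (v x ^ p * (η x * (η x * v x))) = ∫ x in DD F al be, VV x * (η x ^ 2 * v x ^ (p + 1)) := by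
    refine setIntegral_congr_fun DD_ms fun x _ => ?_
    rw [rpow_add_one' (S.adm.nn x) (by linarith)]; ring
  rw [e1] at hw
  have hi : IntegrableOn (fun x => v x * v x) (DD F al be) :=
    intg_D (S.adm.cls.cont.mul S.adm.cls.cont).continuousOn (bdd_D (S.adm.cls.cont.mul S.adm.cls.cont))
  have h2 : BB al be lam (fun z => η z * v z) (fun z => η z * v z) ≤
      BB al be lam v (fun z => η z * (η z * v z)) + C * ∫ x in DD F al be, v x * v x := by
    unfold BB
    rw [← integral_const_mul, ← integral_add (S.adm.bi hal a2) (hi.const_mul C)]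
    refine setIntegral_mono_on (a1.bi hal a1) ((S.adm.bi hal a2).add (hi.const_mul C)) DD_ms fun x hx => ?_
    have hd1 := (S.adm.c1 x hx).differentiableAt (by norm_num)
    have hd2 := hη.differentiable (by norm_num) x
    have e2 : gdot (fun z => η z * v z) (fun z => η z * v z) x = gdot v (fun z => η z * (η z * v z)) x + v x * v x * gdot η η x := by
      unfold gdot
      rw [Finset.mul_sum, ← Finset.sum_add_distrib]
      refine Finset.sum_congr rfl fun i _ => ?_
      rw [pd_mul hd2 ((a1.c1 x hx).differentiableAt (by norm_num)), pd_mul hd2 hd1]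
      ring
    rw [e2]
    have := mul_le_mul_of_nonneg_left (hC x) (mul_self_nonneg (v x))
    have e3 : lam * (VV x * (η x * v x * (η x * v x))) = lam * (VV x * (v x * (η x * (η x * v x)))) := by ring
    rw [e3]
    linarith
  rw [hw] at h2
  exact h2.trans (add_le_add le_rfl (mul_le_mul_of_nonneg_left (S.v2 hal hab hlam) hC0))

lemma scal {c1 ε k : ℝ} (hc : 0 < c1) (hε : 0 < ε) (hk : 1 < k) : ∃ ω, 0 < ω ∧ ∀ t, c1 ≤ t → t ≤ (t + ω) ^ k → 1 - ε ≤ t := by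
  set β := max (1 - ε / 2) (1 / 2) with hβ
  have hβ0 : 0 < β := lt_max_of_lt_right (by norm_num)
  have hβ1 : β < 1 := max_lt (by linarith) (by norm_num)
  set b := β ^ (k - 1) with hb
  have hb1 : b < 1 := rpow_lt_one hβ0.le hβ1 (by linarith)
  have hb0 : 0 < b := by positivity
  have hb2 : 0 < 1 - b := by linarith
  have hq : 0 < c1 * (1 - b) / 2 := by positivity
  refine ⟨min (ε / 2) (c1 * (1 - b) / 2), lt_min (by linarith) hq, fun t ht h => ?_⟩
  set ω := min (ε / 2) (c1 * (1 - b) / 2) with hω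
  have hω1 : ω ≤ ε / 2 := min_le_left _ _
  have hω2 : ω ≤ c1 * (1 - b) / 2 := min_le_right _ _
  have hω0 : 0 < ω := lt_min (by linarith) hq
  by_contra hcon
  push Not at hcon
  have h1 : t + ω ≤ β := (by linarith : t + ω ≤ 1 - ε / 2).trans (le_max_left _ _)
  have h0 : 0 < t + ω := by linarith
  have h2 : (t + ω) ^ k = (t + ω) ^ (k - 1) * (t + ω) := by rw [← rpow_add_one h0.ne']; congr 1; ring
  have h3 : (t + ω) ^ (k - 1) ≤ b := rpow_le_rpow h0.le h1 (by linarith)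
  rw [h2] at h
  have h4 := mul_le_mul_of_nonneg_right h3 h0.le
  have h5 : t * (1 - b) ≤ ω * b := by linarith
  have h6 := mul_le_mul_of_nonneg_right ht (by linarith : 0 ≤ 1 - b)
  have h7 : 0 < c1 * (1 - b) := mul_pos hc (by linarith)
  nlinarith

end main
end Conc

namespace Conc
open Topology Set Module Metric

section main
variable {F : Type} [NormedAddCommGroup F] [InnerProductSpace ℝ F] [FiniteDimensional ℝ F]
variable [MeasurableSpace F] [BorelSpace F]
variable {al be lam p E : ℝ} {e : F} {v : F → ℝ}

/-- mass concentration near the axis point -/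
lemma conc1 (hN3 : 3 ≤ finrank ℝ F) (hal : 0 < al) (hab : al < be) (hp : 1 < p) (hθ : (p - 1) * ((finrank ℝ F : ℝ) / 2) < p + 1) (he : ‖e‖ = 1)
    {ρ ε : ℝ} (hρ : 0 < ρ) (hε : 0 < ε) : ∃ Λ, 1 ≤ Λ ∧ ∀ lam, Λ ≤ lam → ∀ v E, Sol e al be lam p v E → ∀ x, lam ^ (1 / (p - 1)) / 2 ≤ v x →
      (1 - ε) * E ≤ ms al be p v (ball ((inner ℝ e x : ℝ) • e) ρ) := by
  obtain ⟨r1, c1, hr1, hc1, hmass⟩ := mass_lo hN3 hal hab hp hθ he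
  obtain ⟨Λ1, hΛ1, hax⟩ := near_axis hN3 hal hab hp hθ he (δ := ρ / 4) (by linarith)
  obtain ⟨Λ2, hΛ2, hsq⟩ := sqrt_large r1 (δ := ρ / 4) (by linarith)
  obtain ⟨ω, hω, hsc⟩ := scal (k := (p + 1) / 2) hc1 hε (by linarith)
  obtain ⟨J, hJ⟩ := exists_nat_gt (2 / ω)
  have hJ0 : (0 : ℝ) < J := lt_trans (by positivity) hJ
  set r : ℕ → ℝ := fun j => ρ / 2 + j * (ρ / (2 * J)) with hr
  have hr0 : ∀ j, ρ / 2 ≤ r j := fun j => by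
    have : 0 ≤ (j : ℝ) * (ρ / (2 * J)) := by positivity
    simp only [hr]; linarith
  have hrm : ∀ i j, i ≤ j → r i ≤ r j := fun i j hij => by
    have h1 : (i : ℝ) ≤ j := by exact_mod_cast hij
    have := mul_le_mul_of_nonneg_right h1 (by positivity : 0 ≤ ρ / (2 * J))
    simp only [hr]; linarith
  have hrs : ∀ j, r j < r (j + 1) := fun j => by
    have : 0 < ρ / (2 * J) := by positivity
    simp only [hr]; push_cast; linarith
  have hrJ : ∀ j, j ≤ J → r j ≤ ρ := fun j hj => by
    refine (hrm j J hj).trans ?_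
    simp only [hr]
    rw [show (J : ℝ) * (ρ / (2 * J)) = ρ / 2 by field_simp]
    linarith
  have hgr : ∀ j, ∃ C, 0 ≤ C ∧ ∀ c z : F, gdot (cutf c (r j) (r (j + 1))) (cutf c (r j) (r (j + 1))) z ≤ C := fun j =>
    cutf_grad (by linarith [hr0 j]) (hrs j)
  choose C hC0 hC using hgr
  set Cs := ∑ j ∈ Finset.range J, C j with hCs
  obtain ⟨Λ3, hΛ3, hli⟩ := lin_large (Cs * (2 * be)) (δ := ω / 2) (by linarith)
  refine ⟨max Λ1 (max Λ2 Λ3), hΛ1.trans (le_max_left _ _), fun lam hlam v E S x hx => ?_⟩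
  have g1 : Λ1 ≤ lam := (le_max_left _ _).trans hlam
  have g2 : Λ2 ≤ lam := ((le_max_left _ _).trans (le_max_right _ _)).trans hlam
  have g3 : Λ3 ≤ lam := ((le_max_right _ _).trans (le_max_right _ _)).trans hlam
  have hl1 : 1 ≤ lam := hΛ1.trans g1
  have hl0 : 0 < lam := by linarith
  have hE := S.Epos
  set c := (inner ℝ e x : ℝ) • e with hc
  have m0 : c1 * E ≤ ms al be p v (ball c (ρ / 2)) := (hmass lam hl1 v E S x hx).trans (ms_mono S hal hp (ball_subset_ball' (by
    have h1 := hax lam g1 v E S x hx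
    have h2 := hsq lam g2
    rw [dist_eq_norm]; linarith)))
  -- choose a shell of small mass
  obtain ⟨j, hj, hshell⟩ : ∃ j < J, ms al be p v (ball c (r (j + 1)) \ ball c (r j)) ≤ E / J := by
    by_contra hcon
    push Not at hcon
    have hs := ms_sum S hal hp J (fun j => ball c (r (j + 1)) \ ball c (r j)) (fun i => measurableSet_ball.diff measurableSet_ball) (fun i hi k hk hik => by
      rw [Set.disjoint_left]
      intro z hz hz'
      rw [mem_diff, mem_ball, mem_ball, not_lt] at hz hz'
      rcases lt_or_gt_of_ne hik with h | h
      · have := hrm (i + 1) k h; linarith [hz.1, hz'.2]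
      · have := hrm (k + 1) i h; linarith [hz.2, hz'.1])
    have h2 : ∑ j ∈ Finset.range J, E / J < ∑ j ∈ Finset.range J, ms al be p v (ball c (r (j + 1)) \ ball c (r j)) :=
      Finset.sum_lt_sum_of_nonempty (Finset.nonempty_range_iff.2 (by rintro rfl; simp at hJ0)) fun j hj => hcon j (Finset.mem_range.1 hj)
    rw [Finset.sum_const, Finset.card_range, nsmul_eq_mul, mul_div_cancel₀ _ hJ0.ne'] at h2
    linarith
  have hrj : 0 < r j := by linarith [hr0 j]
  set η := cutf c (r j) (r (j + 1)) with hη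
  set m := ms al be p v (ball c (r j)) with hm
  have hηc : Continuous η := (cutf_smooth (c := c)).continuous
  have hmc : c1 * E ≤ m := m0.trans (ms_mono S hal hp (ball_subset_ball (hr0 j)))
  have hηv : Continuous fun z => (η z * v z) ^ (p + 1) :=
    (continuous_rpow_const (by linarith : (0 : ℝ) ≤ p + 1)).comp (hηc.mul S.adm.cls.cont)
  have I1 : m ≤ ∫ z in DD F al be, VV z * (η z * v z) ^ (p + 1) := by
    have e1 : m = ∫ z in ball c (r j) ∩ DD F al be, VV z * (η z * v z) ^ (p + 1) := by
      refine setIntegral_congr_fun (measurableSet_ball.inter DD_ms) fun z hz => ?_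
      have h1 := hz.1
      rw [mem_ball, dist_eq_norm] at h1
      have h2 : η z = 1 := cutf_one hrj (hrs j) h1.le
      simp only [h2, one_mul]
    rw [e1]
    exact setIntegral_mono_set (V_intg' hal hηv) (Eventually.of_forall fun z =>
      mul_nonneg (VV_nonneg z) (rpow_nonneg (mul_nonneg (cutf_nonneg z) (S.adm.nn z)) _)) (LE.le.eventuallyLE inter_subset_right)
  have I2 : ∫ z in DD F al be, VV z * (η z ^ 2 * v z ^ (p + 1)) ≤ m + E / J := by
    have hi : IntegrableOn (fun z => VV z * (η z ^ 2 * v z ^ (p + 1))) (DD F al be) := V_intg' hal ((hηc.pow 2).mul (S.pw_cont hp))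
    have e1 : ∫ z in DD F al be, VV z * (η z ^ 2 * v z ^ (p + 1)) = ∫ z in ball c (r (j + 1)) ∩ DD F al be, VV z * (η z ^ 2 * v z ^ (p + 1)) := by
      refine setIntegral_eq_of_subset_of_forall_diff_eq_zero DD_ms inter_subset_right fun z hz => ?_
      have h1 : z ∉ ball c (r (j + 1)) := fun h => hz.2 ⟨h, hz.1⟩
      rw [mem_ball, dist_eq_norm, not_lt] at h1
      have h2 : η z = 0 := cutf_zero hrj (hrs j) h1
      rw [h2]; ring
    have e2 : ∫ z in ball c (r (j + 1)) ∩ DD F al be, VV z * (η z ^ 2 * v z ^ (p + 1)) ≤ ms al be p v (ball c (r (j + 1))) := by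
      refine setIntegral_mono_on (hi.mono_set inter_subset_right) ((S.pi hal hp).mono_set inter_subset_right) (measurableSet_ball.inter DD_ms) fun z _ => ?_
      refine mul_le_mul_of_nonneg_left ?_ (VV_nonneg z)
      have : η z ^ 2 ≤ 1 := pow_le_one₀ (cutf_nonneg z) (cutf_le z)
      exact mul_le_of_le_one_left (rpow_nonneg (S.adm.nn z) _) this
    have e3 := ms_add S hal hp (A := ball c (r j)) (B := ball c (r (j + 1)) \ ball c (r j)) measurableSet_ball (measurableSet_ball.diff measurableSet_ball)
      disjoint_sdiff_right
    rw [union_diff_cancel (ball_subset_ball (hrs j).le)] at e3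
    rw [e1]; linarith
  have hsy : ∀ A : F ≃ₗᵢ[ℝ] F, A e = e → ∀ z, η (A z) = η z := fun A hA z => cutf_sym _ A hA z
  have I3 := cut_energy S hal hab hl0 hp (η := η) cutf_smooth cutf_nonneg cutf_le hsy (hC0 j) (hC j c)
  have hCj : C j * (2 * be * E / lam) ≤ ω / 2 * E := by
    have h1 : C j ≤ Cs := Finset.single_le_sum (f := C) (fun i _ => hC0 i) (Finset.mem_range.2 hj)
    have h2 := hli lam g3
    have hbe : 0 < be := hal.trans hab
    calc C j * (2 * be * E / lam) ≤ Cs * (2 * be * E / lam) := mul_le_mul_of_nonneg_right h1 (by positivity)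
      _ = Cs * (2 * be) / lam * E := by ring
      _ ≤ _ := mul_le_mul_of_nonneg_right h2 hE.le
  have hJω : E / J ≤ ω / 2 * E := by
    rw [div_lt_iff₀ hω] at hJ
    rw [div_le_iff₀ hJ0]
    nlinarith
  set t := m / E with ht
  have hmt : m = t * E := by rw [ht]; field_simp
  have hBB : BB al be lam (fun z => η z * v z) (fun z => η z * v z) ≤ (t + ω) * E := by
    rw [add_mul, ← hmt]; linarith
  have ht1 : c1 ≤ t := by rw [ht, le_div_iff₀ hE]; exact hmc
  have hcomp := S.comp _ (S.adm.cut (η := η) cutf_smooth cutf_nonneg cutf_le hsy (hC j c))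
  have h5 : E ^ ((p - 1) / 2) * (t * E) ≤ ((t + ω) * E) ^ ((p + 1) / 2) := by
    rw [← hmt]
    exact (mul_le_mul_of_nonneg_left I1 (by positivity)).trans (hcomp.trans (rpow_le_rpow (BB_nonneg hl0.le _) hBB (by linarith)))
  rw [mul_rpow (by linarith) hE.le, show (p + 1) / 2 = (p - 1) / 2 + 1 by ring, rpow_add_one hE.ne', ← show (p + 1) / 2 = (p - 1) / 2 + 1 by ring] at h5
  have h6 : t ≤ (t + ω) ^ ((p + 1) / 2) := by
    have hq : 0 < E ^ ((p - 1) / 2) * E := by positivity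
    refine le_of_mul_le_mul_right ?_ hq
    linarith
  have h7 := hsc t ht1 h6
  calc (1 - ε) * E ≤ t * E := mul_le_mul_of_nonneg_right h7 hE.le
    _ = m := hmt.symm
    _ ≤ _ := ms_mono S hal hp (ball_subset_ball (hrJ j hj.le))

/-- high points lie in one small ball -/
lemma conc2 (hN3 : 3 ≤ finrank ℝ F) (hal : 0 < al) (hab : al < be) (hp : 1 < p) (hθ : (p - 1) * ((finrank ℝ F : ℝ) / 2) < p + 1) (he : ‖e‖ = 1)
    {ρ : ℝ} (hρ : 0 < ρ) : ∃ Λ, 1 ≤ Λ ∧ ∀ lam, Λ ≤ lam → ∀ v E, Sol e al be lam p v E → ∀ x, lam ^ (1 / (p - 1)) / 2 ≤ v x →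
      ∀ y, lam ^ (1 / (p - 1)) / 2 ≤ v y → ‖y - (inner ℝ e x : ℝ) • e‖ < ρ := by
  obtain ⟨r1, c1, hr1, hc1, hmass⟩ := mass_lo hN3 hal hab hp hθ he
  obtain ⟨Λ1, hΛ1, hco⟩ := conc1 hN3 hal hab hp hθ he (ρ := ρ / 2) (ε := c1 / 2) (by linarith) (by linarith)
  obtain ⟨Λ2, hΛ2, hsq⟩ := sqrt_large r1 (δ := ρ / 2) (by linarith)
  refine ⟨max Λ1 Λ2, hΛ1.trans (le_max_left _ _), fun lam hlam v E S x hx y hy => ?_⟩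
  have g1 : Λ1 ≤ lam := (le_max_left _ _).trans hlam
  have g2 : Λ2 ≤ lam := (le_max_right _ _).trans hlam
  by_contra hcon
  push Not at hcon
  have h1 := hmass lam (hΛ1.trans g1) v E S y hy
  have h2 := hco lam g1 v E S x hx
  have h3 := ms_add S hal hp (measurableSet_ball (x := y) (ε := r1 / √lam)) (measurableSet_ball (x := (inner ℝ e x : ℝ) • e) (ε := ρ / 2))
    (ball_disjoint_ball (by have := hsq lam g2; rw [dist_eq_norm]; linarith))
  have h4 := ms_le S hal hp (ball y (r1 / √lam) ∪ ball ((inner ℝ e x : ℝ) • e) (ρ / 2))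
  have := mul_pos hc1 S.Epos
  linarith

end main
end Conc

namespace Conc
open Topology Set Module Metric

section main
variable {F : Type} [NormedAddCommGroup F] [InnerProductSpace ℝ F] [FiniteDimensional ℝ F]
variable [MeasurableSpace F] [BorelSpace F]
variable {al be lam p E : ℝ} {e : F} {v : F → ℝ}

/-- comparison of the solution with a translated and dilated copy near the inner boundary -/
lemma posA (S : Sol e al be lam p v E) (hal : 0 < al) (hab : al < be) (hlam : 0 < lam) (hp : 1 < p) (he : ‖e‖ = 1) {ρ τ σ ι C : ℝ} (hρ : 0 < ρ)
    (hbe : al + 5 * ρ < be) (hσ1 : 1 ≤ σ) (hσ : σ ^ 2 = (τ + 2 * ρ) / (al + ρ)) (hτ : al ≤ τ) (hι : 0 < ι) (hC0 : 0 ≤ C)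
    (hC : ∀ z : F, gdot (cutf (τ • e) ρ (2 * ρ)) (cutf (τ • e) ρ (2 * ρ)) z ≤ C) :
    E ^ ((p - 1) / 2) * (1 / (2 * (al + 5 * ρ)) * ((σ ^ finrank ℝ F)⁻¹ * ∫ x in DD F al be, (cutf (τ • e) ρ (2 * ρ) x * v x) ^ (p + 1))) ≤
      ((σ ^ finrank ℝ F)⁻¹ * (σ ^ 2 * ((1 + ι) * E + (1 + 1 / ι) * (C * (2 * be * E / lam))))) ^ ((p + 1) / 2) := by
  set η : F → ℝ := cutf (τ • e) ρ (2 * ρ) with hη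
  have hηc : Continuous η := cutf_smooth.continuous
  have hσ0 : 0 < σ := by linarith
  have hc := S.adm.cls.cont
  have hz := S.adm.cls.zero
  have hpc : Continuous fun t : ℝ => t ^ (p + 1) := continuous_rpow_const (by linarith)
  set ep : ℕ → ℝ := fun n => 1 / ((n : ℝ) + 1) with hep
  have hep0 : ∀ n, 0 < ep n := fun n => by simp only [hep]; positivity
  have hepl : Tendsto ep atTop (𝓝 0) := tendsto_one_div_add_atTop_nhds_zero_nat
  set w : ℕ → F → ℝ := fun n x => η x * th (ep n) (v x) with hw
  have hwc : ∀ n, ContDiff ℝ 1 (w n) := fun n => by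
    have := th_contDiff (hep0 n) hc hz (n := 1) (by norm_num) (fun x hx => by exact_mod_cast S.adm.c1 x hx)
    exact cutf_smooth.mul (by exact_mod_cast this)
  have hw0 : ∀ n x, 0 ≤ w n x := fun n x => mul_nonneg (cutf_nonneg x) (th_nonneg (hep0 n) _)
  have hwz : ∀ n x, x ∉ DD F al be → w n x = 0 := fun n x hx => by
    simp only [hw]; rw [hz x hx, th_zero (hep0 n) (hep0 n).le, mul_zero]
  have hwle : ∀ n x, w n x ≤ v x := fun n x => by
    have h1 := th_le (hep0 n) (S.adm.nn x)
    have h2 := mul_le_mul (cutf_le (c := τ • e) (r := ρ) (R := 2 * ρ) x) h1 (th_nonneg (hep0 n) _) zero_le_one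
    simpa using h2
  have hwB : ∀ n x, w n x ≠ 0 → ‖x - τ • e‖ < 2 * ρ := fun n x hx => by
    by_contra hcon
    push Not at hcon
    refine hx ?_
    simp only [hw, hη]
    rw [cutf_zero hρ (by linarith) hcon, zero_mul]
  have hne : ∀ t : ℝ, 0 ≤ t → ‖t • e‖ = t := fun t ht => by rw [norm_smul, he, mul_one, Real.norm_of_nonneg ht]
  have hv2i : IntegrableOn (fun x => v x * v x) (DD F al be) :=
    intg_D (hc.mul hc).continuousOn (bdd_D (hc.mul hc))
  have key : ∀ n, E ^ ((p - 1) / 2) * (1 / (2 * (al + 5 * ρ)) * ((σ ^ finrank ℝ F)⁻¹ * ∫ x in DD F al be, (w n x) ^ (p + 1))) ≤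
      ((σ ^ finrank ℝ F)⁻¹ * (σ ^ 2 * ((1 + ι) * E + (1 + 1 / ι) * (C * (2 * be * E / lam))))) ^ ((p + 1) / 2) := fun n => by
    have hcs : HasCompactSupport (w n) := (th_cs (hep0 n) hc hz).mul_left
    have T := transp S hal hlam hp (hwc n) hcs (hw0 n) (fun A hA z => by
      simp only [hw, hη]; rw [cutf_sym τ A hA, S.adm.cls.sym A hA]) hσ0 τ (al + 3 * ρ) (Vl := 1 / (2 * (al + 5 * ρ))) (Vh := 1 / (2 * (al + ρ)))
      (by positivity) (by positivity) (fun z hz' => by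
        have h1 := hwB n _ hz'
        rw [add_sub_cancel_left, norm_smul, Real.norm_of_nonneg hσ0.le] at h1
        have h2 : ‖z - (al + 3 * ρ) • e‖ < 2 * ρ := by nlinarith [norm_nonneg (z - (al + 3 * ρ) • e)]
        have h3 := hne (al + 3 * ρ) (by positivity)
        have h4 := norm_sub_norm_le z ((al + 3 * ρ) • e)
        have h5 := norm_sub_norm_le ((al + 3 * ρ) • e) z
        rw [norm_sub_rev] at h5
        have h6 : al + ρ < ‖z‖ := by linarith
        have h7 : ‖z‖ < al + 5 * ρ := by linarith
        refine ⟨⟨by linarith, by linarith⟩, ?_, ?_⟩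
        · exact one_div_le_one_div_of_le (by linarith) (by linarith)
        · exact one_div_le_one_div_of_le (by positivity) (by linarith))
    have e1 : ∫ x, w n x ^ (p + 1) = ∫ x in DD F al be, w n x ^ (p + 1) :=
      (setIntegral_eq_integral_of_forall_compl_eq_zero fun x hx => by rw [hwz n x hx, zero_rpow (by linarith)]).symm
    have e2 : ∫ x, w n x * w n x = ∫ x in DD F al be, w n x * w n x :=
      (setIntegral_eq_integral_of_forall_compl_eq_zero fun x hx => by rw [hwz n x hx, zero_mul]).symm
    have e3 : ∫ x, gdot (w n) (w n) x = ∫ x in DD F al be, gdot (w n) (w n) x := by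
      refine (setIntegral_eq_integral_of_forall_compl_eq_zero fun x hx => ?_).symm
      unfold gdot
      refine Finset.sum_eq_zero fun i _ => ?_
      have hev : ∀ᶠ y in 𝓝 x, v y < ep n := hc.continuousAt.eventually_lt continuousAt_const (by rw [hz x hx]; exact hep0 n)
      have : w n =ᶠ[𝓝 x] fun _ => 0 := hev.mono fun y hy => by simp only [hw]; rw [th_zero (hep0 n) hy.le, mul_zero]
      have h0 : pd i (w n) x = 0 := by
        unfold pd
        rw [this.fderiv_eq]
        simp
      rw [h0, zero_mul]
    rw [e1, e2, e3] at T
    refine T.trans (rpow_le_rpow ?_ ?_ (by linarith))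
    · have a1 : 0 ≤ ∫ x in DD F al be, gdot (w n) (w n) x := integral_nonneg fun x => gdot_self_nonneg _ x
      have a2 : 0 ≤ ∫ x in DD F al be, w n x * w n x := integral_nonneg fun x => mul_self_nonneg _
      positivity
    refine mul_le_mul_of_nonneg_left ?_ (by positivity)
    have hgi : IntegrableOn (gdot (w n) (w n)) (DD F al be) := intg_D (gdot_cont (hwc n)).continuousOn (bdd_D (gdot_cont (hwc n)))
    have hwi : IntegrableOn (fun x => w n x * w n x) (DD F al be) :=
      intg_D ((hwc n).continuous.mul (hwc n).continuous).continuousOn (bdd_D ((hwc n).continuous.mul (hwc n).continuous))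
    have hBi := S.adm.bi (lam := lam) hal S.adm
    calc σ ^ 2 * (∫ x in DD F al be, gdot (w n) (w n) x) + lam * (1 / (2 * (al + ρ)) * ∫ x in DD F al be, w n x * w n x)
        = ∫ x in DD F al be, (σ ^ 2 * gdot (w n) (w n) x + lam * (1 / (2 * (al + ρ))) * (w n x * w n x)) := by
          rw [integral_add (hgi.const_mul _) (hwi.const_mul _), integral_const_mul, integral_const_mul]; ring
      _ ≤ ∫ x in DD F al be, σ ^ 2 * ((1 + ι) * (gdot v v x + lam * (VV x * (v x * v x))) + (1 + 1 / ι) * C * (v x * v x)) := by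
          refine setIntegral_mono_on ((hgi.const_mul _).add (hwi.const_mul _)) (((hBi.const_mul (1 + ι)).add (hv2i.const_mul ((1 + 1 / ι) * C))).const_mul _)
            DD_ms fun x hx => ?_
          have hVx := VV_pos (DD_ne hal hx)
          have b1 : 1 / (2 * (al + ρ)) * (w n x * w n x) ≤ σ ^ 2 * (VV x * (v x * v x)) := by
            by_cases hx0 : w n x = 0
            · rw [hx0]
              have := mul_nonneg hVx.le (mul_self_nonneg (v x))
              simp only [mul_zero]; positivity
            have h1 := hwB n x hx0
            have h2 := norm_sub_norm_le x (τ • e)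
            rw [hne τ (by linarith)] at h2
            have hxn : 0 < ‖x‖ := norm_pos_iff.2 (DD_ne hal hx)
            have h3 : 1 / (2 * (al + ρ)) ≤ σ ^ 2 * VV x := by
              rw [hσ]; unfold VV
              rw [div_mul_div_comm, div_le_div_iff₀ (by positivity) (by positivity)]
              have : 0 < al + ρ := by positivity
              nlinarith
            have h4 : w n x * w n x ≤ v x * v x := mul_self_le_mul_self (hw0 n x) (hwle n x)
            calc _ ≤ σ ^ 2 * VV x * (v x * v x) := mul_le_mul h3 h4 (mul_self_nonneg _) (by positivity)
              _ = _ := by ring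
          have b2 : gdot (w n) (w n) x ≤ (1 + ι) * gdot v v x + (1 + 1 / ι) * (v x * v x * gdot η η x) := by
            have hd1 := (S.adm.c1 x hx).differentiableAt (by norm_num)
            have hd2 : DifferentiableAt ℝ η x := (cutf_smooth (c := τ • e)).differentiable (by norm_num) x
            have ht := th_deriv (hep0 n) (v x)
            unfold gdot
            rw [Finset.mul_sum, Finset.mul_sum, Finset.mul_sum, ← Finset.sum_add_distrib]
            refine Finset.sum_le_sum fun i _ => ?_
            have e4 : pd i (w n) x = η x * (thd (ep n) (v x) * pd i v x) + th (ep n) (v x) * pd i η x := by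
              simp only [hw]
              rw [pd_mul (g := fun x => th (ep n) (v x)) hd2 (ht.differentiableAt.comp x hd1), pd_comp ht hd1]
            rw [e4]
            set A := η x * (thd (ep n) (v x) * pd i v x) with hA
            set B := th (ep n) (v x) * pd i η x with hB
            have c1 : A * A ≤ pd i v x * pd i v x := by
              have q1 : η x * thd (ep n) (v x) ≤ 1 := mul_le_one₀ (cutf_le x) (thd_nonneg _) (thd_le _)
              have q0 : 0 ≤ η x * thd (ep n) (v x) := mul_nonneg (cutf_nonneg x) (thd_nonneg _)
              have q2 : (η x * thd (ep n) (v x)) ^ 2 ≤ 1 := pow_le_one₀ q0 q1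
              calc A * A = (η x * thd (ep n) (v x)) ^ 2 * (pd i v x * pd i v x) := by rw [hA]; ring
                _ ≤ _ := mul_le_of_le_one_left (mul_self_nonneg _) q2
            have c2 : B * B ≤ v x * v x * (pd i η x * pd i η x) := by
              have q1 := mul_self_le_mul_self (th_nonneg (hep0 n) (v x)) (th_le (hep0 n) (S.adm.nn x))
              calc B * B = th (ep n) (v x) * th (ep n) (v x) * (pd i η x * pd i η x) := by rw [hB]; ring
                _ ≤ _ := mul_le_mul_of_nonneg_right q1 (mul_self_nonneg _)
            have c3 : (A + B) * (A + B) ≤ (1 + ι) * (A * A) + (1 + 1 / ι) * (B * B) := by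
              have : (1 + ι) * (A * A) + (1 + 1 / ι) * (B * B) - (A + B) * (A + B) = (ι * A - B) ^ 2 / ι := by field_simp; ring
              have : 0 ≤ (ι * A - B) ^ 2 / ι := by positivity
              linarith
            have c4 := mul_le_mul_of_nonneg_left c1 (by linarith : 0 ≤ 1 + ι)
            have c5 := mul_le_mul_of_nonneg_left c2 (by positivity : 0 ≤ 1 + 1 / ι)
            linarith
          have b3 : v x * v x * gdot η η x ≤ v x * v x * C := mul_le_mul_of_nonneg_left (hC x) (mul_self_nonneg _)
          have b4 := mul_le_mul_of_nonneg_left b3 (by positivity : 0 ≤ 1 + 1 / ι)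
          have b5 := mul_le_mul_of_nonneg_left b1 hlam.le
          have b6 : gdot (w n) (w n) x ≤ (1 + ι) * gdot v v x + (1 + 1 / ι) * C * (v x * v x) := by linarith
          have b7 := mul_le_mul_of_nonneg_left b6 (sq_nonneg σ)
          have b8 : 0 ≤ σ ^ 2 * (ι * (lam * (VV x * (v x * v x)))) := by
            have := mul_nonneg hVx.le (mul_self_nonneg (v x))
            positivity
          linarith
      _ = σ ^ 2 * ((1 + ι) * BB al be lam v v + (1 + 1 / ι) * C * ∫ x in DD F al be, v x * v x) := by
          unfold BB
          rw [integral_const_mul, integral_add (hBi.const_mul _) (hv2i.const_mul _), integral_const_mul, integral_const_mul]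
      _ ≤ _ := by
          rw [S.EN]
          refine mul_le_mul_of_nonneg_left ?_ (sq_nonneg σ)
          have := mul_le_mul_of_nonneg_left (S.v2 hal hab hlam) (by positivity : 0 ≤ (1 + 1 / ι) * C)
          linarith
  obtain ⟨M, hM0, hM⟩ := S.adm.cls.bdd
  have hlim : Tendsto (fun n => ∫ x in DD F al be, (w n x) ^ (p + 1)) atTop (𝓝 (∫ x in DD F al be, (η x * v x) ^ (p + 1))) := by
    refine int_dct (C := M ^ (p + 1)) (fun n => (hpc.comp (hwc n).continuous).continuousOn) (fun n x _ => ?_) (fun x _ => ?_)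
    · rw [abs_of_nonneg (rpow_nonneg (hw0 n x) _)]
      exact rpow_le_rpow (hw0 n x) ((hwle n x).trans ((le_abs_self _).trans (hM x))) (by linarith)
    · refine (hpc.tendsto _).comp ?_
      refine Tendsto.const_mul _ (tendsto_of_tendsto_of_tendsto_of_le_of_le (g := fun n => v x - 2 * ep n) (h := fun _ => v x) ?_ tendsto_const_nhds
        (fun n => th_ge (hep0 n) _) (fun n => th_le (hep0 n) (S.adm.nn x)))
      have := (hepl.const_mul 2).const_sub (v x)
      simpa using this
  exact le_of_tendsto (((hlim.const_mul _).const_mul _).const_mul _) (Eventually.of_forall key)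

end main
end Conc

namespace Conc
open Topology Set Module Metric

section main
variable {F : Type} [NormedAddCommGroup F] [InnerProductSpace ℝ F] [FiniteDimensional ℝ F]
variable [MeasurableSpace F] [BorelSpace F]
variable {al be lam p E : ℝ} {e : F} {v : F → ℝ}

lemma rho_choice (hal : 0 < al) (hab : al < be) {G k : ℝ} (hG : 1 < G) : ∃ ρ, 0 < ρ ∧ ρ < al ∧ ρ < 1 ∧ al + 5 * ρ < be ∧
    (1 + 2 * ρ) ^ k < (al - ρ) / (al + 2 * ρ) * ((al + ρ) / (al + 5 * ρ)) * (1 - ρ) * G := by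
  have h1 : ContinuousAt (fun ρ : ℝ => (1 + 2 * ρ) ^ k) 0 := by
    refine ContinuousAt.rpow_const (by fun_prop) (Or.inl (by norm_num))
  have h2 : ContinuousAt (fun ρ : ℝ => (al - ρ) / (al + 2 * ρ) * ((al + ρ) / (al + 5 * ρ)) * (1 - ρ) * G) 0 := by
    have g1 : ContinuousAt (fun ρ : ℝ => (al - ρ) / (al + 2 * ρ)) 0 := ContinuousAt.div (by fun_prop) (by fun_prop) (by simpa using hal.ne')
    have g2 : ContinuousAt (fun ρ : ℝ => (al + ρ) / (al + 5 * ρ)) 0 := ContinuousAt.div (by fun_prop) (by fun_prop) (by simpa using hal.ne')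
    exact ((g1.mul g2).mul (by fun_prop)).mul continuousAt_const
  have h3 : ∀ᶠ ρ in 𝓝 (0 : ℝ), (1 + 2 * ρ) ^ k < (al - ρ) / (al + 2 * ρ) * ((al + ρ) / (al + 5 * ρ)) * (1 - ρ) * G :=
    h1.eventually_lt h2 (by simp [hal.ne']; exact hG)
  have h4 : ∀ᶠ ρ in 𝓝 (0 : ℝ), ρ < min al (min 1 ((be - al) / 5)) := eventually_lt_nhds (by
    have : 0 < (be - al) / 5 := by linarith
    positivity)
  have h7 : ∀ᶠ ρ in 𝓝[>] (0 : ℝ), (0 : ℝ) < ρ := self_mem_nhdsWithin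
  obtain ⟨ρ, ⟨h5, h6⟩, hρ⟩ := (((h3.and h4).filter_mono nhdsWithin_le_nhds).and h7).exists
  have a1 := h6.trans_le (min_le_left _ _)
  have a2 := h6.trans_le ((min_le_right _ _).trans (min_le_left _ _))
  have a3 := h6.trans_le ((min_le_right _ _).trans (min_le_right _ _))
  exact ⟨ρ, hρ, a1, a2, by linarith, h5⟩

set_option maxHeartbeats 800000 in
/-- the peak is close to the inner boundary -/
lemma pos_in (hN3 : 3 ≤ finrank ℝ F) (hal : 0 < al) (hab : al < be) (hp : 1 < p) (hθ : (p - 1) * ((finrank ℝ F : ℝ) / 2) < p + 1) (he : ‖e‖ = 1)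
    {δ : ℝ} (hδ : 0 < δ) : ∃ Λ, 1 ≤ Λ ∧ ∀ lam, Λ ≤ lam → ∀ v E, Sol e al be lam p v E → ∀ x, lam ^ (1 / (p - 1)) / 2 ≤ v x →
      inner ℝ e x < al + δ := by
  set k := (p + 1) / 2 with hk
  set g0 := √(1 + δ / (2 * al)) with hg0
  have hg1 : 1 < g0 := by
    rw [hg0, lt_sqrt (by norm_num)]
    have : 0 < δ / (2 * al) := by positivity
    linarith
  set G := g0 ^ (k - 1) with hG
  have hG1 : 1 < G := one_lt_rpow hg1 (by rw [hk]; linarith)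
  obtain ⟨ρ, hρ, hρa, hρ1, hρb, hbig⟩ := rho_choice (k := k) hal hab hG1
  obtain ⟨C, hC0, hC⟩ := cutf_grad (F := F) hρ (by linarith : ρ < 2 * ρ)
  obtain ⟨Λ1, hΛ1, hco⟩ := conc1 hN3 hal hab hp hθ he hρ hρ
  obtain ⟨Λ2, hΛ2, hli⟩ := lin_large ((1 + 1 / ρ) * (C * (2 * be))) hρ
  refine ⟨max Λ1 Λ2, hΛ1.trans (le_max_left _ _), fun lam hlam v E S x hx => ?_⟩
  have l1 : Λ1 ≤ lam := (le_max_left _ _).trans hlam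
  have l2 : Λ2 ≤ lam := (le_max_right _ _).trans hlam
  have hl0 : 0 < lam := by linarith
  have hE := S.Epos
  by_contra hcon
  push Not at hcon
  set τ : ℝ := inner ℝ e x with hτ
  have hmass := hco lam l1 v E S x hx
  rw [← hτ] at hmass
  have hτ0 : 0 < τ := by linarith
  set σ := √((τ + 2 * ρ) / (al + ρ)) with hσd
  have hσ2 : σ ^ 2 = (τ + 2 * ρ) / (al + ρ) := sq_sqrt (by positivity)
  have hσg : g0 ≤ σ := by
    refine sqrt_le_sqrt ?_
    rw [le_div_iff₀ (by positivity)]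
    have : δ / (2 * al) * (al + ρ) ≤ δ := by
      rw [div_mul_eq_mul_div, div_le_iff₀ (by positivity)]
      nlinarith
    linarith
  have hσ1 : 1 ≤ σ := hg1.le.trans hσg
  have hσ0 : 0 < σ := by linarith
  have A := posA S hal hab hl0 hp he hρ hρb hσ1 hσ2 (by linarith) hρ hC0 (hC (τ • e))
  set η : F → ℝ := cutf (τ • e) ρ (2 * ρ) with hη
  have hηc : Continuous η := cutf_smooth.continuous
  have hpc : Continuous fun z => (η z * v z) ^ (p + 1) :=
    (continuous_rpow_const (by linarith : (0 : ℝ) ≤ p + 1)).comp (hηc.mul S.adm.cls.cont)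
  have hpi : IntegrableOn (fun z => (η z * v z) ^ (p + 1)) (DD F al be) := intg_D hpc.continuousOn (bdd_D hpc)
  have hpn : ∀ z, 0 ≤ (η z * v z) ^ (p + 1) := fun z => rpow_nonneg (mul_nonneg (cutf_nonneg z) (S.adm.nn z)) _
  have hI : 2 * (τ - ρ) * ((1 - ρ) * E) ≤ ∫ z in DD F al be, (η z * v z) ^ (p + 1) := by
    have i1 : ms al be p v (ball (τ • e) ρ) ≤ ∫ z in ball (τ • e) ρ ∩ DD F al be, 1 / (2 * (τ - ρ)) * (η z * v z) ^ (p + 1) := by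
      refine setIntegral_mono_on ((S.pi hal hp).mono_set inter_subset_right) (Integrable.const_mul (hpi.mono_set inter_subset_right) _)
        (measurableSet_ball.inter DD_ms) fun z hz => ?_
      have h1 := hz.1
      rw [mem_ball, dist_eq_norm] at h1
      have h2 : η z = 1 := cutf_one hρ (by linarith) h1.le
      rw [h2, one_mul]
      refine mul_le_mul_of_nonneg_right ?_ (rpow_nonneg (S.adm.nn z) _)
      have h3 := norm_sub_norm_le (τ • e) z
      rw [norm_sub_rev, norm_smul, he, mul_one, Real.norm_of_nonneg hτ0.le] at h3
      exact one_div_le_one_div_of_le (by linarith) (by linarith)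
    have i2 : ∫ z in ball (τ • e) ρ ∩ DD F al be, 1 / (2 * (τ - ρ)) * (η z * v z) ^ (p + 1) ≤
        1 / (2 * (τ - ρ)) * ∫ z in DD F al be, (η z * v z) ^ (p + 1) := by
      rw [integral_const_mul]
      have : 0 < τ - ρ := by linarith
      refine mul_le_mul_of_nonneg_left ?_ (by positivity)
      exact setIntegral_mono_set hpi (Eventually.of_forall hpn) (LE.le.eventuallyLE inter_subset_right)
    have i3 := hmass.trans (i1.trans i2)
    have : 0 < 2 * (τ - ρ) := by linarith
    rw [one_div, ← div_eq_inv_mul, le_div_iff₀ this] at i3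
    linarith
  have hQ : (1 + ρ) * E + (1 + 1 / ρ) * (C * (2 * be * E / lam)) ≤ (1 + 2 * ρ) * E := by
    have h1 := mul_le_mul_of_nonneg_right (hli lam l2) hE.le
    have h2 : (1 + 1 / ρ) * (C * (2 * be * E / lam)) = (1 + 1 / ρ) * (C * (2 * be)) / lam * E := by ring
    rw [h2]; linarith
  have hbe : 0 < be := hal.trans hab
  set q := (σ ^ finrank ℝ F)⁻¹ * σ ^ 2 with hq
  have hq0 : 0 < q := by positivity
  have hB : E ^ (k - 1) * (1 / (2 * (al + 5 * ρ)) * ((σ ^ finrank ℝ F)⁻¹ * (2 * (τ - ρ) * ((1 - ρ) * E)))) ≤ (q * ((1 + 2 * ρ) * E)) ^ k := by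
    have e1 : (p - 1) / 2 = k - 1 := by rw [hk]; ring
    rw [e1] at A
    refine le_trans ?_ (A.trans (rpow_le_rpow (by positivity) ?_ (by linarith)))
    · refine mul_le_mul_of_nonneg_left (mul_le_mul_of_nonneg_left (mul_le_mul_of_nonneg_left hI (by positivity)) (by positivity)) (by positivity)
    · rw [hq, mul_assoc (σ ^ finrank ℝ F)⁻¹]
      exact mul_le_mul_of_nonneg_left (mul_le_mul_of_nonneg_left hQ (by positivity)) (by positivity)
  set g := (al - ρ) / (al + 2 * ρ) * ((al + ρ) / (al + 5 * ρ)) with hg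
  have hgle : g * σ ^ 2 ≤ (τ - ρ) / (al + 5 * ρ) := by
    have h1 : (al - ρ) / (al + 2 * ρ) ≤ (τ - ρ) / (τ + 2 * ρ) := by
      rw [div_le_div_iff₀ (by positivity) (by positivity)]; nlinarith
    have h2 : (τ - ρ) / (τ + 2 * ρ) * ((al + ρ) / (al + 5 * ρ)) * σ ^ 2 = (τ - ρ) / (al + 5 * ρ) := by
      rw [hσ2]; field_simp
    rw [← h2]
    exact mul_le_mul_of_nonneg_right (mul_le_mul_of_nonneg_right h1 (by positivity)) (by positivity)
  have hEk : E ^ k = E ^ (k - 1) * E := by rw [← rpow_add_one hE.ne']; congr 1; ring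
  have hqk : q ^ k = q ^ (k - 1) * q := by rw [← rpow_add_one hq0.ne']; congr 1; ring
  have hD : E ^ k * q * (g * (1 - ρ)) ≤ E ^ k * q * (q ^ (k - 1) * (1 + 2 * ρ) ^ k) := by
    calc E ^ k * q * (g * (1 - ρ)) = E ^ k * (1 - ρ) * (σ ^ finrank ℝ F)⁻¹ * (g * σ ^ 2) := by rw [hq]; ring
      _ ≤ E ^ k * (1 - ρ) * (σ ^ finrank ℝ F)⁻¹ * ((τ - ρ) / (al + 5 * ρ)) := by
          refine mul_le_mul_of_nonneg_left hgle ?_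
          have : 0 < 1 - ρ := by linarith
          positivity
      _ = E ^ (k - 1) * (1 / (2 * (al + 5 * ρ)) * ((σ ^ finrank ℝ F)⁻¹ * (2 * (τ - ρ) * ((1 - ρ) * E)))) := by
          rw [hEk]; field_simp
      _ ≤ _ := hB
      _ = _ := by
          rw [mul_rpow hq0.le (by positivity), mul_rpow (by positivity) hE.le, hqk]; ring
  have hF := le_of_mul_le_mul_left hD (by positivity)
  have hqg : q ≤ g0⁻¹ := by
    have h1 : q ≤ σ⁻¹ := by
      rw [hq, ← div_eq_inv_mul, ← one_div, div_le_div_iff₀ (by positivity) hσ0]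
      have h3 : σ ^ 3 ≤ σ ^ finrank ℝ F := pow_le_pow_right₀ hσ1 hN3
      have h4 : σ ^ 2 * σ = σ ^ 3 := by ring
      rw [one_mul, h4]
      exact h3
    exact h1.trans (inv_anti₀ (by linarith) hσg)
  have hqG : q ^ (k - 1) ≤ G⁻¹ := by
    rw [hG, ← inv_rpow (by linarith)]
    exact rpow_le_rpow hq0.le hqg (by rw [hk]; linarith)
  have hG0 : 0 < G := by linarith
  have h8 : g * (1 - ρ) ≤ G⁻¹ * (1 + 2 * ρ) ^ k := hF.trans (mul_le_mul_of_nonneg_right hqG (by positivity))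
  rw [← div_eq_inv_mul, le_div_iff₀ hG0] at h8
  linarith

/-- high points are close to the inner pole -/
lemma high_near (hN3 : 3 ≤ finrank ℝ F) (hal : 0 < al) (hab : al < be) (hp : 1 < p) (hθ : (p - 1) * ((finrank ℝ F : ℝ) / 2) < p + 1) (he : ‖e‖ = 1)
    {δ : ℝ} (hδ : 0 < δ) : ∃ Λ, 1 ≤ Λ ∧ ∀ lam, Λ ≤ lam → ∀ v E, Sol e al be lam p v E → ∀ x, lam ^ (1 / (p - 1)) / 2 ≤ v x → 0 ≤ (inner ℝ e x : ℝ) →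
      ∀ y, lam ^ (1 / (p - 1)) / 2 ≤ v y → ‖y - al • e‖ < δ := by
  obtain ⟨Λ1, hΛ1, h1⟩ := conc2 hN3 hal hab hp hθ he (ρ := δ / 2) (by linarith)
  obtain ⟨Λ2, hΛ2, h2⟩ := pos_in hN3 hal hab hp hθ he (δ := δ / 2) (by linarith)
  refine ⟨max Λ1 Λ2, hΛ1.trans (le_max_left _ _), fun lam hlam v E S x hx hx0 y hy => ?_⟩
  have l1 : Λ1 ≤ lam := (le_max_left _ _).trans hlam
  have l2 : Λ2 ≤ lam := (le_max_right _ _).trans hlam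
  have a1 := h1 lam l1 v E S x hx x hx
  have a2 := h1 lam l1 v E S x hx y hy
  have a3 := h2 lam l2 v E S x hx
  have hl0 : 0 < lam := by linarith
  have hxD : x ∈ DD F al be := by
    by_contra h
    rw [S.adm.cls.zero x h] at hx
    have : 0 < lam ^ (1 / (p - 1)) := by positivity
    linarith
  have hne : ∀ t : ℝ, ‖t • e‖ = |t| := fun t => by rw [norm_smul, he, mul_one, Real.norm_eq_abs]
  have h3 := norm_sub_norm_le x ((inner ℝ e x : ℝ) • e)
  rw [hne, abs_of_nonneg hx0] at h3
  have h4 := hxD.1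
  have h5 : ‖(inner ℝ e x : ℝ) • e - al • e‖ ≤ δ / 2 := by
    rw [← sub_smul, hne, abs_le]; constructor <;> linarith
  have h6 := norm_sub_le_norm_sub_add_norm_sub y ((inner ℝ e x : ℝ) • e) (al • e)
  linarith

end main
end Conc

namespace Conc
open Topology Set Module Metric

section main
variable {F : Type} [NormedAddCommGroup F] [InnerProductSpace ℝ F] [FiniteDimensional ℝ F]
variable [MeasurableSpace F] [BorelSpace F]
variable {al be lam p E : ℝ} {e : F} {v : F → ℝ}

/-- exponential decay away from high points -/
lemma decay (S : Sol e al be lam p v E) (hal : 0 < al) (hab : al < be) (hlam : 0 < lam) (hp : 1 < p) {x1 : F} {ρ M k : ℝ} (hρ : 0 < ρ) (hk : 0 < k) (hM0 : 0 < M)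
    (hM : ∀ x, v x ≤ M) (hH : ∀ y, ‖y - x1‖ < ρ → v y ≤ lam ^ (1 / (p - 1)) / 2)
    (hkl : 4 * k ^ 2 * ρ ^ 2 + 2 * finrank ℝ F * k ≤ (1 - (1 / 2) ^ (p - 1)) / (2 * be) * lam) : v x1 ≤ M * exp (-(k * ρ ^ 2)) := by
  set θ : ℝ := (1 / 2) ^ (p - 1) with hθ
  have hθ1 : θ < 1 := rpow_lt_one (by norm_num) (by norm_num) (by linarith)
  have hbe : 0 < be := hal.trans hab
  set φ : ℝ → ℝ := fun q => M * exp (k * (q - ρ ^ 2)) with hφ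
  have hd : ∀ q, HasDerivAt φ (k * φ q) q := fun q => by
    have h1 : HasDerivAt (fun q => k * (q - ρ ^ 2)) (k * 1) q := ((hasDerivAt_id' q).sub_const (ρ ^ 2)).const_mul k
    have h2 : HasDerivAt φ (M * (exp (k * (q - ρ ^ 2)) * (k * 1))) q := h1.exp.const_mul M
    refine h2.congr_deriv ?_
    show _ = k * (M * exp (k * (q - ρ ^ 2)))
    ring
  set W : F → ℝ := fun x => φ (‖x - x1‖ ^ 2) with hW
  have hWp : ∀ x, 0 < W x := fun x => by simp only [hW, hφ]; positivity
  have hWl : ∀ x, lap W x = (4 * k ^ 2 * ‖x - x1‖ ^ 2 + 2 * finrank ℝ F * k) * W x := fun x => by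
    have := lap_radial (φ := φ) (φ' := fun q => k * φ q) (φ'' := k * (k * φ (‖x - x1‖ ^ 2))) x1 (Eventually.of_forall hd) ((hd _).const_mul k)
    rw [hW, this]; simp only; ring
  have hWc : ContDiff ℝ 2 W := by
    have h1 : ContDiff ℝ 2 fun x : F => k * (‖x - x1‖ ^ 2 - ρ ^ 2) :=
      contDiff_const.mul (((contDiff_id.sub contDiff_const).norm_sq ℝ).sub contDiff_const)
    exact contDiff_const.mul h1.exp
  have key := wmp (U := ball x1 ρ ∩ DD F al be) (K := closedBall x1 ρ) (w := fun x => v x - W x) (isOpen_ball.inter (DD_open al be))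
    (isCompact_closedBall x1 ρ) (inter_subset_left.trans ball_subset_closedBall) (S.adm.cls.cont.sub hWc.continuous).continuousOn
    (fun x hx _ => (S.c2 x hx.2).sub hWc.contDiffAt) (fun x hx hxU => ?_) (fun x hx hpos => ?_) x1 (mem_closedBall_self hρ.le)
  · have e1 : W x1 = M * exp (-(k * ρ ^ 2)) := by simp only [hW, hφ]; simp
    rw [← e1]; linarith
  · by_cases hxD : x ∈ DD F al be
    · have h1 : ‖x - x1‖ = ρ := by
        rw [mem_closedBall, dist_eq_norm] at hx
        refine le_antisymm hx ?_
        by_contra h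
        exact hxU ⟨by rw [mem_ball, dist_eq_norm]; exact not_le.1 h, hxD⟩
      have : W x = M := by simp only [hW, hφ]; rw [h1]; simp
      rw [this]; linarith [hM x]
    · rw [S.adm.cls.zero x hxD]; linarith [hWp x]
  · have hv := S.pos x hx.2
    have hx1 : ‖x - x1‖ < ρ := by have := hx.1; rwa [mem_ball, dist_eq_norm] at this
    rw [lap_sub (S.c2 x hx.2) hWc.contDiffAt, hWl]
    have h1 := S.eq x hx.2
    have h3 : v x ^ p = v x ^ (p - 1) * v x := by rw [← rpow_add_one hv.ne']; congr 1; ring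
    have h4 : v x ^ (p - 1) ≤ lam * θ := by
      have := rpow_le_rpow hv.le (hH x hx1) (by linarith : 0 ≤ p - 1)
      rw [div_eq_mul_one_div, mul_rpow (by positivity) (by norm_num), ← rpow_mul hlam.le, one_div_mul_cancel (by linarith), rpow_one] at this
      exact this
    have h5 := VV_lo hal hx.2
    have h6 : lap v x = VV x * ((lam - v x ^ (p - 1)) * v x) := by rw [h3] at h1; linarith
    have h7 : (1 - θ) / (2 * be) * lam * v x ≤ lap v x := by
      rw [h6]
      calc (1 - θ) / (2 * be) * lam * v x = 1 / (2 * be) * (lam * (1 - θ) * v x) := by ring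
        _ ≤ VV x * ((lam - v x ^ (p - 1)) * v x) := by
            refine mul_le_mul h5 (mul_le_mul_of_nonneg_right (by linarith) hv.le) ?_ (VV_nonneg x)
            have : 0 < 1 - θ := by linarith
            positivity
    have h8 : 4 * k ^ 2 * ‖x - x1‖ ^ 2 + 2 * finrank ℝ F * k ≤ (1 - θ) / (2 * be) * lam := by
      refine le_trans ?_ hkl
      have : ‖x - x1‖ ^ 2 ≤ ρ ^ 2 := pow_le_pow_left₀ (norm_nonneg _) hx1.le 2
      have := mul_le_mul_of_nonneg_left this (by positivity : 0 ≤ 4 * k ^ 2)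
      linarith
    have h9 := mul_le_mul_of_nonneg_right h8 (hWp x).le
    have hpos' : W x < v x := by linarith
    have hcl : 0 < (1 - θ) / (2 * be) * lam := by
      have : 0 < 1 - θ := by linarith
      positivity
    have := mul_lt_mul_of_pos_left hpos' hcl
    linarith

lemma exp_large (C a : ℝ) {b ε : ℝ} (hb : 0 < b) (hε : 0 < ε) : ∃ Λ, 1 ≤ Λ ∧ ∀ lam, Λ ≤ lam → C * lam ^ a * exp (-(b * √lam)) < ε := by
  have h1 := ((tendsto_rpow_mul_exp_neg_mul_atTop_nhds_zero (2 * a) b hb).comp tendsto_sqrt_atTop).const_mul C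
  rw [mul_zero] at h1
  obtain ⟨Λ, hΛ⟩ := eventually_atTop.1 (h1.eventually_lt_const hε)
  refine ⟨max 1 Λ, le_max_left _ _, fun lam hlam => ?_⟩
  have hl : 1 ≤ lam := (le_max_left _ _).trans hlam
  have h2 := hΛ lam ((le_max_right _ _).trans hlam)
  simp only [Function.comp] at h2
  rw [sqrt_eq_rpow, ← rpow_mul (by linarith), show 1 / 2 * (2 * a) = a by ring, ← sqrt_eq_rpow] at h2
  rw [mul_assoc, ← neg_mul]
  exact h2

/-- concentration at the inner pole -/
theorem conc (hN3 : 3 ≤ finrank ℝ F) (hal : 0 < al) (hab : al < be) (hp : 1 < p) (hθ : (p - 1) * ((finrank ℝ F : ℝ) / 2) < p + 1) (he : ‖e‖ = 1)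
    {δ ε : ℝ} (hδ : 0 < δ) (hε : 0 < ε) : ∃ Λ, 1 ≤ Λ ∧ ∀ lam, Λ ≤ lam → ∀ v E, Sol e al be lam p v E → ∀ x0, x0 ∈ DD F al be → (∀ x, v x ≤ v x0) →
      0 ≤ (inner ℝ e x0 : ℝ) → ∀ z, δ ≤ ‖z - al • e‖ → v z < ε := by
  have hbe : 0 < be := hal.trans hab
  obtain ⟨Λ1, hΛ1, h1⟩ := high_near hN3 hal hab hp hθ he (δ := δ / 2) (by linarith)
  obtain ⟨C, hC, hCM⟩ := M_upper hN3 hal hab hp hθ he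
  set ρ := δ / 2 with hρ
  have hρ0 : 0 < ρ := by linarith
  have hθ1 : ((1 : ℝ) / 2) ^ (p - 1) < 1 := rpow_lt_one (by norm_num) (by norm_num) (by linarith)
  set c := (1 - ((1 : ℝ) / 2) ^ (p - 1)) / (2 * be) with hc
  have hc0 : 0 < c := div_pos (by linarith) (by linarith)
  have hden : 0 < 4 * ρ ^ 2 + 2 * finrank ℝ F := by positivity
  set c' := min 1 (c / (4 * ρ ^ 2 + 2 * finrank ℝ F)) with hc'
  have hc'0 : 0 < c' := lt_min one_pos (div_pos hc0 hden)
  have hc'1 : c' ≤ 1 := min_le_left _ _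
  have hc'2 : c' * (4 * ρ ^ 2 + 2 * finrank ℝ F) ≤ c := by
    rw [← le_div_iff₀ hden]; exact min_le_right _ _
  obtain ⟨Λ2, hΛ2, h2⟩ := exp_large C (1 / (p - 1)) (b := c' * ρ ^ 2) (by positivity) hε
  refine ⟨max Λ1 Λ2, hΛ1.trans (le_max_left _ _), fun lam hlam v E S x0 hx0 hmax hin z hz => ?_⟩
  have l1 : Λ1 ≤ lam := (le_max_left _ _).trans hlam
  have l2 : Λ2 ≤ lam := (le_max_right _ _).trans hlam
  have hl1 : 1 ≤ lam := hΛ1.trans l1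
  have hl0 : 0 < lam := by linarith
  have hlp : 0 < lam ^ (1 / (p - 1)) := by positivity
  have hx0h : lam ^ (1 / (p - 1)) / 2 ≤ v x0 := by linarith [max_lo S hal hp hl0 hx0 hmax]
  have hs1 : 1 ≤ √lam := by rw [one_le_sqrt]; exact hl1
  have hss : √lam * √lam = lam := mul_self_sqrt hl0.le
  have D := decay S hal hab hl0 hp (x1 := z) (ρ := ρ) (M := C * lam ^ (1 / (p - 1))) (k := c' * √lam) hρ0 (by positivity) (by positivity)
    (hCM lam hl1 v E S) (fun y hy => by
      by_contra hcon
      push Not at hcon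
      have h3 := h1 lam l1 v E S x0 hx0h hin y hcon.le
      have h4 := norm_sub_le_norm_sub_add_norm_sub z y (al • e)
      rw [norm_sub_rev z y] at h4
      linarith) (by
      rw [← hc]
      have a1 : (c' * √lam) ^ 2 ≤ c' * lam := by
        rw [mul_pow, sq_sqrt hl0.le]
        exact mul_le_mul_of_nonneg_right (by nlinarith) hl0.le
      have a2 : √lam ≤ lam := by nlinarith
      calc 4 * (c' * √lam) ^ 2 * ρ ^ 2 + 2 * finrank ℝ F * (c' * √lam) ≤ 4 * (c' * lam) * ρ ^ 2 + 2 * finrank ℝ F * (c' * lam) := by gcongr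
        _ = c' * (4 * ρ ^ 2 + 2 * finrank ℝ F) * lam := by ring
        _ ≤ _ := mul_le_mul_of_nonneg_right hc'2 hl0.le)
  have h5 := h2 lam l2
  rw [show c' * √lam * ρ ^ 2 = c' * ρ ^ 2 * √lam by ring] at D
  linarith

/-- the reflected problem is the same problem -/
lemma Sol.neg (S : Sol e al be lam p v E) : Sol (-e) al be lam p v E := by
  have hA : ∀ φ, Adm e al be φ ↔ Adm (-e) al be φ := fun φ => by
    have hs : ∀ A : F ≃ₗᵢ[ℝ] F, A e = e ↔ A (-e) = -e := fun A => by rw [map_neg, neg_inj]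
    constructor
    · exact fun h => ⟨⟨h.cls.cont, h.cls.zero, fun A hA x => h.cls.sym A ((hs A).2 hA) x⟩, h.nn, h.c1, h.gb⟩
    · exact fun h => ⟨⟨h.cls.cont, h.cls.zero, fun A hA x => h.cls.sym A ((hs A).1 hA) x⟩, h.nn, h.c1, h.gb⟩
  exact ⟨(hA v).1 S.adm, S.c2, S.rep, S.eq, S.pos, S.Epos, S.EN, S.EV, fun φ hφ => S.comp φ ((hA φ).2 hφ)⟩

end main
end Conc

namespace Conc
open Topology Set Module Metric


section tr
variable {W : Type*} [NormedAddCommGroup W] [NormedSpace ℝ W]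
variable {Y : Type*} [NormedAddCommGroup Y] [InnerProductSpace ℝ Y]

/-- second directional derivative of a composition with two scalar functions -/
lemma dd_gen {f s t : W → ℝ} {V : ℝ × ℝ → ℝ} {x : W} (hs : ContDiffAt ℝ 2 s x) (ht : ContDiffAt ℝ 2 t x) (hV : ContDiffAt ℝ 2 V (s x, t x))
    (hf : f =ᶠ[𝓝 x] fun y => V (s y, t y)) (d : W) : 
    fderiv ℝ (fun y => fderiv ℝ f y d) x d =
      fderiv ℝ (fun q => fderiv ℝ V q (1, 0)) (s x, t x) (1, 0) * (fderiv ℝ s x d) ^ 2 +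
      (fderiv ℝ (fun q => fderiv ℝ V q (1, 0)) (s x, t x) (0, 1) + fderiv ℝ (fun q => fderiv ℝ V q (0, 1)) (s x, t x) (1, 0)) * (fderiv ℝ s x d * fderiv ℝ t x d) +
      fderiv ℝ (fun q => fderiv ℝ V q (0, 1)) (s x, t x) (0, 1) * (fderiv ℝ t x d) ^ 2 +
      fderiv ℝ V (s x, t x) (1, 0) * fderiv ℝ (fun y => fderiv ℝ s y d) x d +
      fderiv ℝ V (s x, t x) (0, 1) * fderiv ℝ (fun y => fderiv ℝ t y d) x d := by
  have key : ∀ (g : W → ℝ), ContDiffAt ℝ 2 g x → DifferentiableAt ℝ (fun y => fderiv ℝ g y d) x := fun g hg =>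
    ((hg.fderiv_right (m := 1) (by norm_num)).differentiableAt (by norm_num)).clm_apply (differentiableAt_const d)
  have key' : ∀ c : ℝ × ℝ, DifferentiableAt ℝ (fun q => fderiv ℝ V q c) (s x, t x) := fun c =>
    ((hV.fderiv_right (m := 1) (by norm_num)).differentiableAt (by norm_num)).clm_apply (differentiableAt_const c)
  have hst : ContDiffAt ℝ 2 (fun y => (s y, t y)) x := hs.prodMk ht
  have hdec : ∀ (L : ℝ × ℝ →L[ℝ] ℝ) (α β : ℝ), L (α, β) = α * L (1, 0) + β * L (0, 1) := fun L α β => by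
    have : ((α, β) : ℝ × ℝ) = α • ((1 : ℝ), (0 : ℝ)) + β • ((0 : ℝ), (1 : ℝ)) := by simp
    rw [this, map_add, map_smul, map_smul, smul_eq_mul, smul_eq_mul]
  have hev : (fun y => fderiv ℝ f y d) =ᶠ[𝓝 x] fun y => fderiv ℝ V (s y, t y) (1, 0) * fderiv ℝ s y d + fderiv ℝ V (s y, t y) (0, 1) * fderiv ℝ t y d := by
    have e1 := hf.eventuallyEq_nhds
    have e2 := hs.eventually (by simp)
    have e3 := ht.eventually (by simp)
    have e4 := hst.continuousAt.eventually (hV.eventually (by simp))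
    filter_upwards [e1, e2, e3, e4] with y h1 h2 h3 h4
    rw [h1.fderiv_eq]
    have := (h4.differentiableAt (by norm_num)).hasFDerivAt.comp y ((h2.differentiableAt (by norm_num)).hasFDerivAt.prodMk (h3.differentiableAt (by norm_num)).hasFDerivAt)
    have h5 : fderiv ℝ (fun y => V (s y, t y)) y = _ := this.fderiv
    rw [h5]
    simp only [ContinuousLinearMap.comp_apply, ContinuousLinearMap.prod_apply]
    rw [hdec]; ring
  rw [hev.fderiv_eq]
  have hp := (hs.differentiableAt (by norm_num)).hasFDerivAt.prodMk (ht.differentiableAt (by norm_num)).hasFDerivAt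
  have hP := (key' (1, 0)).hasFDerivAt.comp x hp
  have hQ := (key' (0, 1)).hasFDerivAt.comp x hp
  have hfin := (hP.mul (key s hs).hasFDerivAt).add (hQ.mul (key t ht).hasFDerivAt)
  have h5 : fderiv ℝ (fun y => fderiv ℝ V (s y, t y) (1, 0) * fderiv ℝ s y d + fderiv ℝ V (s y, t y) (0, 1) * fderiv ℝ t y d) x = _ := hfin.fderiv
  rw [h5]
  simp only [add_apply, smul_apply, ContinuousLinearMap.comp_apply, ContinuousLinearMap.prod_apply, smul_eq_mul, Function.comp]
  rw [hdec (fderiv ℝ (fun q => fderiv ℝ V q (1, 0)) (s x, t x)), hdec (fderiv ℝ (fun q => fderiv ℝ V q (0, 1)) (s x, t x))]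
  ring

lemma nrm_c2 (A : W →L[ℝ] Y) {x : W} (hx : A x ≠ 0) {n} : ContDiffAt ℝ n (fun y => ‖A y‖) x :=
  (contDiffAt_norm ℝ hx).comp x A.contDiff.contDiffAt

lemma nrm1 (A : W →L[ℝ] Y) {x : W} (hx : A x ≠ 0) (d : W) : fderiv ℝ (fun y => ‖A y‖) x d = inner ℝ (A x) (A d) * ‖A x‖⁻¹ := by
  have h1 : DifferentiableAt ℝ (fun y => ‖A y‖) x := (nrm_c2 A hx (n := 1)).differentiableAt (by norm_num)
  have h2 : fderiv ℝ (fun y => ‖A y‖ ^ 2) x d = 2 * ‖A x‖ * fderiv ℝ (fun y => ‖A y‖) x d := by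
    rw [(h1.hasFDerivAt.pow 2).fderiv]; simp; 
  have h3 : fderiv ℝ (fun y => ‖A y‖ ^ 2) x d = 2 * inner ℝ (A x) (A d) := by
    rw [A.hasFDerivAt.norm_sq.fderiv]; simp
  have h4 : ‖A x‖ ≠ 0 := norm_ne_zero_iff.2 hx
  rw [h3] at h2
  field_simp
  linarith

lemma nrm2 (A : W →L[ℝ] Y) {x : W} (hx : A x ≠ 0) (d : W) : 
    fderiv ℝ (fun y => fderiv ℝ (fun y => ‖A y‖) y d) x d = ‖A d‖ ^ 2 * ‖A x‖⁻¹ - (inner ℝ (A x) (A d)) ^ 2 * (‖A x‖⁻¹) ^ 3 := by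
  have hev : (fun y => fderiv ℝ (fun y => ‖A y‖) y d) =ᶠ[𝓝 x] fun y => inner ℝ (A y) (A d) * ‖A y‖⁻¹ := by
    filter_upwards [A.continuous.continuousAt.eventually_ne hx] with y hy using nrm1 A hy d
  have h4 : ‖A x‖ ≠ 0 := norm_ne_zero_iff.2 hx
  have h1 : DifferentiableAt ℝ (fun y => ‖A y‖) x := (nrm_c2 A hx (n := 1)).differentiableAt (by norm_num)
  have h2 := (hasDerivAt_inv h4).comp_hasFDerivAt x h1.hasFDerivAt
  have h3 := A.hasFDerivAt.inner ℝ (hasFDerivAt_const (A d) x)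
  rw [hev.fderiv_eq]
  have h5 : fderiv ℝ (fun y => inner ℝ (A y) (A d) * ‖A y‖⁻¹) x = _ := (h3.mul h2).fderiv
  rw [h5]
  simp [nrm1 A hx]
  field_simp
  ring

lemma sq1 (A : W →L[ℝ] Y) (x d : W) : fderiv ℝ (fun y => ‖A y‖ ^ 2) x d = 2 * inner ℝ (A x) (A d) := by
  rw [A.hasFDerivAt.norm_sq.fderiv]; simp

lemma sq2 (A : W →L[ℝ] Y) (x d : W) : fderiv ℝ (fun y => fderiv ℝ (fun y => ‖A y‖ ^ 2) y d) x d = 2 * ‖A d‖ ^ 2 := by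
  have : (fun y => fderiv ℝ (fun y => ‖A y‖ ^ 2) y d) = fun y => 2 * inner ℝ (A y) (A d) := funext fun y => sq1 A y d
  rw [this]
  have h3 := (A.hasFDerivAt (x := x)).inner ℝ (hasFDerivAt_const (A d) x)
  rw [(h3.const_mul 2).fderiv]
  simp

lemma mul1 {f g : W → ℝ} {x : W} (hf : ContDiffAt ℝ 2 f x) (hg : ContDiffAt ℝ 2 g x) (d : W) :
    fderiv ℝ (fun y => f y * g y) x d = f x * fderiv ℝ g x d + g x * fderiv ℝ f x d := by
  rw [fderiv_fun_mul (hf.differentiableAt (by norm_num)) (hg.differentiableAt (by norm_num))]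
  simp

lemma mul2 {f g : W → ℝ} {x : W} (hf : ContDiffAt ℝ 2 f x) (hg : ContDiffAt ℝ 2 g x) (d : W) :
    fderiv ℝ (fun y => fderiv ℝ (fun y => f y * g y) y d) x d = f x * fderiv ℝ (fun y => fderiv ℝ g y d) x d + 2 * (fderiv ℝ f x d * fderiv ℝ g x d) +
      g x * fderiv ℝ (fun y => fderiv ℝ f y d) x d := by
  have key : ∀ (g : W → ℝ), ContDiffAt ℝ 2 g x → DifferentiableAt ℝ (fun y => fderiv ℝ g y d) x := fun g hg =>
    ((hg.fderiv_right (m := 1) (by norm_num)).differentiableAt (by norm_num)).clm_apply (differentiableAt_const d)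
  have hev : (fun y => fderiv ℝ (fun y => f y * g y) y d) =ᶠ[𝓝 x] fun y => f y * fderiv ℝ g y d + g y * fderiv ℝ f y d := by
    filter_upwards [hf.eventually (by simp), hg.eventually (by simp)] with y h1 h2 using mul1 h1 h2 d
  have d1 := (hf.differentiableAt (by norm_num)).hasFDerivAt
  have d2 := (hg.differentiableAt (by norm_num)).hasFDerivAt
  rw [hev.fderiv_eq]
  have h5 : fderiv ℝ (fun y => f y * fderiv ℝ g y d + g y * fderiv ℝ f y d) x = _ :=
    ((d1.mul (key g hg).hasFDerivAt).add (d2.mul (key f hf).hasFDerivAt)).fderiv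
  rw [h5]
  simp
  ring

end tr

section main
variable {F : Type} [NormedAddCommGroup F] [InnerProductSpace ℝ F] [FiniteDimensional ℝ F]
variable [MeasurableSpace F] [BorelSpace F]
variable {al be lam p E : ℝ} {e : F} {v : F → ℝ}

lemma V2_c2 {f z : F} {q : ℝ × ℝ} (hv : ContDiffAt ℝ 2 v z) (hq : q.1 • e + q.2 • f = z) : ContDiffAt ℝ 2 (fun q : ℝ × ℝ => v (q.1 • e + q.2 • f)) q := by
  subst hq
  exact ContDiffAt.comp q hv (by fun_prop)

/-- Laplacian of an axially symmetric function -/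
lemma lap_axial (hc : Cls e al be v) (he : ‖e‖ = 1) {f : F} (hf : ‖f‖ = 1) (hef : inner ℝ e f = (0 : ℝ)) {S T : ℝ} (hT : 0 < T)
    (hv : ContDiffAt ℝ 2 v (S • e + T • f)) :
    lap v (S • e + T • f) = 
      fderiv ℝ (fun q => fderiv ℝ (fun q : ℝ × ℝ => v (q.1 • e + q.2 • f)) q (1, 0)) (S, T) (1, 0) +
      fderiv ℝ (fun q => fderiv ℝ (fun q : ℝ × ℝ => v (q.1 • e + q.2 • f)) q (0, 1)) (S, T) (0, 1) +
      fderiv ℝ (fun q : ℝ × ℝ => v (q.1 • e + q.2 • f)) (S, T) (0, 1) * (((finrank ℝ F : ℝ) - 2) / T) := by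
  set V : ℝ × ℝ → ℝ := fun q => v (q.1 • e + q.2 • f) with hV
  set Z := S • e + T • f with hZ
  have hee : inner ℝ e e = (1 : ℝ) := by rw [real_inner_self_eq_norm_sq, he]; norm_num
  have hff : inner ℝ f f = (1 : ℝ) := by rw [real_inner_self_eq_norm_sq, hf]; norm_num
  have hfe : inner ℝ f e = (0 : ℝ) := by rw [real_inner_comm]; exact hef
  let P : F →L[ℝ] F := ContinuousLinearMap.id ℝ F - (innerSL ℝ e).smulRight e
  have hPa : ∀ z, P z = z - (inner ℝ e z : ℝ) • e := fun z => by simp [P]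
  have hPZ : P Z = T • f := by
    rw [hPa, hZ, inner_add_right, inner_smul_right, inner_smul_right, hee, hef]; simp
  have hPn : ∀ z, ‖P z‖ ^ 2 = ‖z‖ ^ 2 - (inner ℝ e z : ℝ) ^ 2 := fun z => by
    rw [hPa, norm_sub_sq_real, inner_smul_right, real_inner_comm, norm_smul, he]
    simp [sq_abs]; ring
  have hPi : ∀ z w, (inner ℝ (P z) (P w) : ℝ) = inner ℝ (P z) w := fun z w => by
    rw [hPa w, inner_sub_right, inner_smul_right]
    have : (inner ℝ (P z) e : ℝ) = 0 := by
      rw [hPa, inner_sub_left, inner_smul_left, hee, real_inner_comm]; simp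
    rw [this]; ring
  have hPZn : ‖P Z‖ = T := by rw [hPZ, norm_smul, hf, Real.norm_of_nonneg hT.le, mul_one]
  have hPZ0 : P Z ≠ 0 := norm_pos_iff.1 (by rw [hPZn]; exact hT)
  have hsZ : (inner ℝ e Z : ℝ) = S := by
    rw [hZ, inner_add_right, inner_smul_right, inner_smul_right, hee, hef]; simp
  have hrep : ∀ z, v z = V (inner ℝ e z, ‖P z‖) := fun z => by
    refine orb hc ?_ ?_
    · rw [inner_add_right, inner_smul_right, inner_smul_right, hee, hef]; simp
    · rw [← sq_eq_sq₀ (norm_nonneg _) (norm_nonneg _), norm_add_sq_real, inner_smul_left, inner_smul_right, hef, norm_smul, norm_smul, he, hf]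
      have := hPn z
      simp [sq_abs]; linarith
  have hs2 : ContDiffAt ℝ 2 (fun z => (inner ℝ e z : ℝ)) Z := (innerSL ℝ e).contDiff.contDiffAt
  have hs1 : ∀ z d, fderiv ℝ (fun z => (inner ℝ e z : ℝ)) z d = inner ℝ e d := fun z d => by
    have : fderiv ℝ (fun z => (inner ℝ e z : ℝ)) z = _ := (innerSL ℝ e).fderiv (x := z)
    rw [this]; simp
  have hss : ∀ d, fderiv ℝ (fun z => fderiv ℝ (fun z => (inner ℝ e z : ℝ)) z d) Z d = 0 := fun d => by
    simp only [hs1]; simp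
  have hVc : ContDiffAt ℝ 2 V (S, T) := V2_c2 hv rfl
  have hVc' : ContDiffAt ℝ 2 V (inner ℝ e Z, ‖P Z‖) := by rw [hsZ, hPZn]; exact hVc
  have main : ∀ i, pd i (pd i v) Z = _ := fun i =>
    dd_gen (f := v) hs2 (nrm_c2 P hPZ0 (n := 2)) hVc' (Eventually.of_forall hrep) (stdOrthonormalBasis ℝ F i)
  set B := stdOrthonormalBasis ℝ F with hB
  have q1 : ∑ i, (inner ℝ e (B i) : ℝ) ^ 2 = 1 := by rw [sum_inner_sq, he]; norm_num
  have q2 : ∑ i, (inner ℝ e (B i) : ℝ) * (inner ℝ (P Z) (B i) * T⁻¹) = 0 := by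
    have h := B.sum_inner_mul_inner e (P Z)
    have h0 : (inner ℝ e (P Z) : ℝ) = 0 := by rw [hPZ, inner_smul_right, hef, mul_zero]
    rw [h0] at h
    calc _ = (∑ i, (inner ℝ e (B i) : ℝ) * inner ℝ (B i) (P Z)) * T⁻¹ := by
          rw [Finset.sum_mul]; exact Finset.sum_congr rfl fun i _ => by rw [real_inner_comm (B i) (P Z)]; ring
      _ = 0 := by rw [h, zero_mul]
  have q3 : ∑ i, (inner ℝ (P Z) (B i) : ℝ) ^ 2 = T ^ 2 := by rw [sum_inner_sq, hPZn]
  have q4 : ∑ i, ‖P (B i)‖ ^ 2 = (finrank ℝ F : ℝ) - 1 := by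
    simp only [hPn, Finset.sum_sub_distrib, q1]
    simp
  unfold lap
  simp only [main, hss, nrm2 P hPZ0]
  simp only [hs1, nrm1 P hPZ0, hPi, hPZn, hsZ, mul_zero, add_zero]
  simp only [Finset.sum_add_distrib, ← Finset.mul_sum, Finset.sum_sub_distrib, ← Finset.sum_mul, mul_pow, q1, q2, q3, q4]
  field_simp
  ring

end main
end Conc

namespace Conc
open Topology Set Module Metric


section trp
variable {m : ℕ}

lemma lapP_axial {u : EuclideanSpace ℝ (Fin m) × EuclideanSpace ℝ (Fin m) → ℝ} {V : ℝ × ℝ → ℝ} {x : EuclideanSpace ℝ (Fin m) × EuclideanSpace ℝ (Fin m)} (h1 : x.1 ≠ 0) (h2 : x.2 ≠ 0)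
    (hu : ∀ y, u y = V ((‖y.1‖ ^ 2 - ‖y.2‖ ^ 2) / 2, ‖y.1‖ * ‖y.2‖)) {S T : ℝ} (hS : (‖x.1‖ ^ 2 - ‖x.2‖ ^ 2) / 2 = S) (hT : ‖x.1‖ * ‖x.2‖ = T) (hV : ContDiffAt ℝ 2 V (S, T)) :
    lapP u x = (‖x.1‖ ^ 2 + ‖x.2‖ ^ 2) * (fderiv ℝ (fun q => fderiv ℝ V q (1, 0)) (S, T) (1, 0) + fderiv ℝ (fun q => fderiv ℝ V q (0, 1)) (S, T) (0, 1) +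
      fderiv ℝ V (S, T) (0, 1) * (((m : ℝ) - 1) / T)) := by
  let A1 : EuclideanSpace ℝ (Fin m) × EuclideanSpace ℝ (Fin m) →L[ℝ] EuclideanSpace ℝ (Fin m) := ContinuousLinearMap.fst ℝ (EuclideanSpace ℝ (Fin m)) (EuclideanSpace ℝ (Fin m))
  let A2 : EuclideanSpace ℝ (Fin m) × EuclideanSpace ℝ (Fin m) →L[ℝ] EuclideanSpace ℝ (Fin m) := ContinuousLinearMap.snd ℝ (EuclideanSpace ℝ (Fin m)) (EuclideanSpace ℝ (Fin m))
  have n1 : ContDiffAt ℝ 2 (fun y : EuclideanSpace ℝ (Fin m) × EuclideanSpace ℝ (Fin m) => ‖y.1‖) x := nrm_c2 A1 h1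
  have n2 : ContDiffAt ℝ 2 (fun y : EuclideanSpace ℝ (Fin m) × EuclideanSpace ℝ (Fin m) => ‖y.2‖) x := nrm_c2 A2 h2
  have hs : ContDiffAt ℝ 2 (fun y : EuclideanSpace ℝ (Fin m) × EuclideanSpace ℝ (Fin m) => (‖y.1‖ ^ 2 - ‖y.2‖ ^ 2) / 2) x := ((n1.pow 2).sub (n2.pow 2)).div_const 2
  have ht := n1.mul n2
  have hs1 : ∀ y d : EuclideanSpace ℝ (Fin m) × EuclideanSpace ℝ (Fin m), fderiv ℝ (fun y : EuclideanSpace ℝ (Fin m) × EuclideanSpace ℝ (Fin m) => (‖y.1‖ ^ 2 - ‖y.2‖ ^ 2) / 2) y d = inner ℝ y.1 d.1 - inner ℝ y.2 d.2 := fun y d => by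
    have := ((A1.hasFDerivAt (x := y)).norm_sq.sub (A2.hasFDerivAt (x := y)).norm_sq).mul_const (1 / 2)
    have e1 : (fun y : EuclideanSpace ℝ (Fin m) × EuclideanSpace ℝ (Fin m) => (‖y.1‖ ^ 2 - ‖y.2‖ ^ 2) / 2) = fun y => (‖A1 y‖ ^ 2 - ‖A2 y‖ ^ 2) * (1 / 2) := by
      funext y; simp [A1, A2]; ring
    have h5 : fderiv ℝ (fun y => (‖A1 y‖ ^ 2 - ‖A2 y‖ ^ 2) * (1 / 2)) y = _ := this.fderiv
    rw [e1, h5]; simp [A1, A2]; ring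
  have hs2 : ∀ d : EuclideanSpace ℝ (Fin m) × EuclideanSpace ℝ (Fin m), fderiv ℝ (fun y => fderiv ℝ (fun y : EuclideanSpace ℝ (Fin m) × EuclideanSpace ℝ (Fin m) => (‖y.1‖ ^ 2 - ‖y.2‖ ^ 2) / 2) y d) x d = ‖d.1‖ ^ 2 - ‖d.2‖ ^ 2 := fun d => by
    simp only [hs1]
    have := ((A1.hasFDerivAt (x := x)).inner ℝ (hasFDerivAt_const d.1 x)).sub ((A2.hasFDerivAt (x := x)).inner ℝ (hasFDerivAt_const d.2 x))
    have h5 : fderiv ℝ (fun y : EuclideanSpace ℝ (Fin m) × EuclideanSpace ℝ (Fin m) => (inner ℝ y.1 d.1 - inner ℝ y.2 d.2 : ℝ)) x = _ := this.fderiv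
    rw [h5]; simp [A1, A2]
  have m1 : ∀ d : EuclideanSpace ℝ (Fin m) × EuclideanSpace ℝ (Fin m), fderiv ℝ (fun y : EuclideanSpace ℝ (Fin m) × EuclideanSpace ℝ (Fin m) => ‖y.1‖) x d = inner ℝ x.1 d.1 * ‖x.1‖⁻¹ := fun d => nrm1 A1 h1 d
  have m2 : ∀ d : EuclideanSpace ℝ (Fin m) × EuclideanSpace ℝ (Fin m), fderiv ℝ (fun y : EuclideanSpace ℝ (Fin m) × EuclideanSpace ℝ (Fin m) => ‖y.2‖) x d = inner ℝ x.2 d.2 * ‖x.2‖⁻¹ := fun d => nrm1 A2 h2 d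
  have l1 : ∀ d : EuclideanSpace ℝ (Fin m) × EuclideanSpace ℝ (Fin m), fderiv ℝ (fun y => fderiv ℝ (fun y : EuclideanSpace ℝ (Fin m) × EuclideanSpace ℝ (Fin m) => ‖y.1‖) y d) x d = ‖d.1‖ ^ 2 * ‖x.1‖⁻¹ - (inner ℝ x.1 d.1) ^ 2 * (‖x.1‖⁻¹) ^ 3 := fun d => nrm2 A1 h1 d
  have l2 : ∀ d : EuclideanSpace ℝ (Fin m) × EuclideanSpace ℝ (Fin m), fderiv ℝ (fun y => fderiv ℝ (fun y : EuclideanSpace ℝ (Fin m) × EuclideanSpace ℝ (Fin m) => ‖y.2‖) y d) x d = ‖d.2‖ ^ 2 * ‖x.2‖⁻¹ - (inner ℝ x.2 d.2) ^ 2 * (‖x.2‖⁻¹) ^ 3 := fun d => nrm2 A2 h2 d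
  have hV' : ContDiffAt ℝ 2 V ((‖x.1‖ ^ 2 - ‖x.2‖ ^ 2) / 2, ‖x.1‖ * ‖x.2‖) := by rw [hS, hT]; exact hV
  have main : ∀ d, fderiv ℝ (fun y => fderiv ℝ u y d) x d = _ := fun d => dd_gen hs ht hV' (Eventually.of_forall hu) d
  have p1 : 0 < ‖x.1‖ := norm_pos_iff.2 h1
  have p2 : 0 < ‖x.2‖ := norm_pos_iff.2 h2
  have q1 : ∑ i, (x.1 i) ^ 2 = ‖x.1‖ ^ 2 := (EuclideanSpace.real_norm_sq_eq _).symm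
  have q2 : ∑ i, (x.2 i) ^ 2 = ‖x.2‖ ^ 2 := (EuclideanSpace.real_norm_sq_eq _).symm
  have i1 : ∀ (w : EuclideanSpace ℝ (Fin m)) (i : Fin m), (inner ℝ w (EuclideanSpace.single i (1 : ℝ)) : ℝ) = w i := fun w i => by
    rw [EuclideanSpace.inner_single_right]; simp
  set r1 := ‖x.1‖ with hr1
  set r2 := ‖x.2‖ with hr2
  set c1 := fderiv ℝ (fun q => fderiv ℝ V q (1, 0)) (S, T) (1, 0)
  set c2 := fderiv ℝ (fun q => fderiv ℝ V q (0, 1)) (S, T) (0, 1)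
  set c3 := fderiv ℝ (fun q => fderiv ℝ V q (1, 0)) (S, T) (0, 1) + fderiv ℝ (fun q => fderiv ℝ V q (0, 1)) (S, T) (1, 0)
  set c4 := fderiv ℝ V (S, T) (1, 0)
  set c5 := fderiv ℝ V (S, T) (0, 1)
  have t1 : ∀ i, fderiv ℝ (fun y => fderiv ℝ u y ((EuclideanSpace.single i (1 : ℝ)), 0)) x ((EuclideanSpace.single i (1 : ℝ)), 0) =
      (c1 + c3 * (r2 * r1⁻¹) + c2 * (r2 * r1⁻¹) ^ 2 - c5 * r2 * r1⁻¹ ^ 3) * (x.1 i) ^ 2 + (c4 + c5 * r2 * r1⁻¹) := fun i => by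
    rw [main, hs2, mul2 n1 n2, mul1 n1 n2, l1, l2, m1, m2, hs1, hS, hT]
    simp only [i1, EuclideanSpace.norm_single, inner_zero_right, norm_zero, ← hr1, ← hr2, norm_one]
    ring
  have t2 : ∀ i, fderiv ℝ (fun y => fderiv ℝ u y (0, (EuclideanSpace.single i (1 : ℝ)))) x (0, (EuclideanSpace.single i (1 : ℝ))) =
      (c1 - c3 * (r1 * r2⁻¹) + c2 * (r1 * r2⁻¹) ^ 2 - c5 * r1 * r2⁻¹ ^ 3) * (x.2 i) ^ 2 + (-c4 + c5 * r1 * r2⁻¹) := fun i => by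
    rw [main, hs2, mul2 n1 n2, mul1 n1 n2, l1, l2, m1, m2, hs1, hS, hT]
    simp only [i1, EuclideanSpace.norm_single, inner_zero_right, norm_zero, ← hr1, ← hr2, norm_one]
    ring
  unfold lapP
  simp only [t1, t2]
  simp only [Finset.sum_add_distrib, ← Finset.mul_sum, q1, q2, Finset.sum_const, Finset.card_univ, Fintype.card_fin, nsmul_eq_mul]
  rw [← hT]
  field_simp
  ring

lemma lapP_cont {u : EuclideanSpace ℝ (Fin m) × EuclideanSpace ℝ (Fin m) → ℝ} {x : EuclideanSpace ℝ (Fin m) × EuclideanSpace ℝ (Fin m)} (hu : ContDiffAt ℝ 2 u x) : ContinuousAt (lapP u) x := by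
  have key : ∀ d : EuclideanSpace ℝ (Fin m) × EuclideanSpace ℝ (Fin m), ContinuousAt (fun y => fderiv ℝ (fun y => fderiv ℝ u y d) y d) x := fun d => by
    have h1 : ContDiffAt ℝ 1 (fun y => fderiv ℝ u y d) x := (hu.fderiv_right (m := 1) (by norm_num)).clm_apply contDiffAt_const
    exact (h1.fderiv_right (m := 0) (by norm_num)).continuousAt.clm_apply continuousAt_const
  unfold lapP
  refine ContinuousAt.add ?_ ?_
  · exact tendsto_finsetSum _ fun i _ => key _
  · exact tendsto_finsetSum _ fun i _ => key _

end trp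

section main
variable {m : ℕ}
variable {F : Type} [NormedAddCommGroup F] [InnerProductSpace ℝ F] [FiniteDimensional ℝ F]
variable [MeasurableSpace F] [BorelSpace F]
variable {al be lam p E : ℝ} {e f : F} {v : F → ℝ}

/-- the reduction map -/
def ZZ (e f : F) (x : EuclideanSpace ℝ (Fin m) × EuclideanSpace ℝ (Fin m)) : F := ((‖x.1‖ ^ 2 - ‖x.2‖ ^ 2) / 2) • e + (‖x.1‖ * ‖x.2‖) • f

lemma nsq (he : ‖e‖ = 1) {w : F} (hw : inner ℝ e w = (0 : ℝ)) (s : ℝ) : ‖s • e + w‖ ^ 2 = s ^ 2 + ‖w‖ ^ 2 := by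
  rw [norm_add_sq_real, inner_smul_left, hw, norm_smul, he]; simp [sq_abs]

lemma isq (he : ‖e‖ = 1) {w : F} (hw : inner ℝ e w = (0 : ℝ)) (s : ℝ) : inner ℝ e (s • e + w) = s := by
  rw [inner_add_right, inner_smul_right, hw, real_inner_self_eq_norm_sq, he]; simp

lemma ZZ_in (he : ‖e‖ = 1) (hef : inner ℝ e f = (0 : ℝ)) (x : EuclideanSpace ℝ (Fin m) × EuclideanSpace ℝ (Fin m)) : inner ℝ e (ZZ e f x) = (‖x.1‖ ^ 2 - ‖x.2‖ ^ 2) / 2 :=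
  isq he (by rw [inner_smul_right, hef, mul_zero]) _

lemma ZZ_norm (he : ‖e‖ = 1) (hf : ‖f‖ = 1) (hef : inner ℝ e f = (0 : ℝ)) (x : EuclideanSpace ℝ (Fin m) × EuclideanSpace ℝ (Fin m)) : ‖ZZ e f x‖ = (‖x.1‖ ^ 2 + ‖x.2‖ ^ 2) / 2 := by
  rw [← sq_eq_sq₀ (norm_nonneg _) (by positivity), ZZ, nsq he (by rw [inner_smul_right, hef, mul_zero]), norm_smul, hf, mul_one, Real.norm_eq_abs, sq_abs]
  ring

lemma ZZ_cont : Continuous (ZZ (m := m) e f) := by unfold ZZ; fun_prop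

lemma exPhi (he : ‖e‖ = 1) (hf : ‖f‖ = 1) (hef : inner ℝ e f = (0 : ℝ)) (L : EuclideanSpace ℝ (Fin m) →ₗᵢ[ℝ] F) (hL : ∀ y, inner ℝ e (L y) = (0 : ℝ)) {x : EuclideanSpace ℝ (Fin m) × EuclideanSpace ℝ (Fin m)} (hx : x ≠ 0) :
    ∃ Φ : EuclideanSpace ℝ (Fin m) × EuclideanSpace ℝ (Fin m) → F, ContDiffAt ℝ 2 Φ x ∧ ∀ y, (inner ℝ e (Φ y) : ℝ) = inner ℝ e (ZZ e f y) ∧ ‖Φ y‖ = ‖ZZ e f y‖ := by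
  have hLc : ContDiff ℝ 2 (fun y => L y) := L.toContinuousLinearMap.contDiff
  have c1 : ContDiff ℝ 2 (fun y : EuclideanSpace ℝ (Fin m) × EuclideanSpace ℝ (Fin m) => ‖y.1‖ ^ 2) := contDiff_fst.norm_sq ℝ
  have c2 : ContDiff ℝ 2 (fun y : EuclideanSpace ℝ (Fin m) × EuclideanSpace ℝ (Fin m) => ‖y.2‖ ^ 2) := contDiff_snd.norm_sq ℝ
  have hs : ContDiff ℝ 2 (fun y : EuclideanSpace ℝ (Fin m) × EuclideanSpace ℝ (Fin m) => ((‖y.1‖ ^ 2 - ‖y.2‖ ^ 2) / 2) • e) := ((c1.sub c2).div_const 2).smul contDiff_const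
  have hz : ∀ (c : ℝ) (y : EuclideanSpace ℝ (Fin m)), inner ℝ e (c • L y) = (0 : ℝ) := fun c y => by rw [inner_smul_right, hL, mul_zero]
  by_cases h1 : x.1 = 0
  · have h2 : x.2 ≠ 0 := fun h => hx (Prod.ext h1 h)
    refine ⟨fun y => ((‖y.1‖ ^ 2 - ‖y.2‖ ^ 2) / 2) • e + ‖y.2‖ • L y.1, hs.contDiffAt.add ((contDiffAt_snd.norm ℝ h2).smul (hLc.comp contDiff_fst).contDiffAt), fun y => ⟨?_, ?_⟩⟩
    · rw [isq he (hz _ _), ZZ_in he hef]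
    · rw [← sq_eq_sq₀ (norm_nonneg _) (norm_nonneg _), nsq he (hz _ _), ZZ_norm he hf hef, norm_smul, L.norm_map, norm_norm]; ring
  · refine ⟨fun y => ((‖y.1‖ ^ 2 - ‖y.2‖ ^ 2) / 2) • e + ‖y.1‖ • L y.2, hs.contDiffAt.add ((contDiffAt_fst.norm ℝ h1).smul (hLc.comp contDiff_snd).contDiffAt), fun y => ⟨?_, ?_⟩⟩
    · rw [isq he (hz _ _), ZZ_in he hef]
    · rw [← sq_eq_sq₀ (norm_nonneg _) (norm_nonneg _), nsq he (hz _ _), ZZ_norm he hf hef, norm_smul, L.norm_map, norm_norm]; ring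

variable {a b : ℝ}

lemma Ann_open : IsOpen (Ann m a b) := by
  have : Continuous (pnorm (m := m)) := by unfold pnorm; fun_prop
  exact (isOpen_lt continuous_const this).inter (isOpen_lt this continuous_const)

lemma Ann_cl : closure (Ann m a b) ⊆ {x | a ≤ pnorm x ∧ pnorm x ≤ b} := by
  have : Continuous (pnorm (m := m)) := by unfold pnorm; fun_prop
  exact closure_minimal (fun x hx => ⟨hx.1.le, hx.2.le⟩) ((isClosed_le continuous_const this).inter (isClosed_le this continuous_const))

lemma pnorm_sq (x : EuclideanSpace ℝ (Fin m) × EuclideanSpace ℝ (Fin m)) : pnorm x ^ 2 = ‖x.1‖ ^ 2 + ‖x.2‖ ^ 2 := Real.sq_sqrt (by positivity)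

lemma pnorm_nn (x : EuclideanSpace ℝ (Fin m) × EuclideanSpace ℝ (Fin m)) : 0 ≤ pnorm x := Real.sqrt_nonneg _

lemma pnorm_ne {x : EuclideanSpace ℝ (Fin m) × EuclideanSpace ℝ (Fin m)} (h : 0 < pnorm x) : x ≠ 0 := by
  rintro rfl
  simp [pnorm] at h

lemma ZZ_DD (he : ‖e‖ = 1) (hf : ‖f‖ = 1) (hef : inner ℝ e f = (0 : ℝ)) (ha : 0 < a) (hab : a < b) (x : EuclideanSpace ℝ (Fin m) × EuclideanSpace ℝ (Fin m)) :
    ZZ e f x ∈ DD F (a ^ 2 / 2) (b ^ 2 / 2) ↔ x ∈ Ann m a b := by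
  have h := pnorm_nn x
  show (_ < ‖ZZ e f x‖ ∧ ‖ZZ e f x‖ < _) ↔ _
  rw [ZZ_norm he hf hef, ← pnorm_sq]
  constructor
  · rintro ⟨h1, h2⟩
    exact ⟨lt_of_pow_lt_pow_left₀ 2 h (by linarith), lt_of_pow_lt_pow_left₀ 2 (ha.trans hab).le (by linarith)⟩
  · rintro ⟨h1, h2⟩
    have := pow_lt_pow_left₀ h1 ha.le two_ne_zero
    have := pow_lt_pow_left₀ h2 h two_ne_zero
    constructor <;> linarith

lemma tr_c2 (S : Sol e (a ^ 2 / 2) (b ^ 2 / 2) lam p v E) (he : ‖e‖ = 1) (hf : ‖f‖ = 1) (hef : inner ℝ e f = (0 : ℝ)) (L : EuclideanSpace ℝ (Fin m) →ₗᵢ[ℝ] F) (hL : ∀ y, inner ℝ e (L y) = (0 : ℝ))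
    (ha : 0 < a) (hab : a < b) {x : EuclideanSpace ℝ (Fin m) × EuclideanSpace ℝ (Fin m)} (hx : x ∈ Ann m a b) : ContDiffAt ℝ 2 (fun x => v (ZZ e f x)) x := by
  obtain ⟨Φ, h1, h2⟩ := exPhi he hf hef L hL (pnorm_ne (ha.trans hx.1))
  have : (fun x => v (ZZ e f x)) = fun x => v (Φ x) := funext fun y => (orb S.adm.cls (h2 y).1 (h2 y).2).symm
  rw [this]
  have hD : Φ x ∈ DD F (a ^ 2 / 2) (b ^ 2 / 2) := by
    have := (ZZ_DD he hf hef ha hab x).2 hx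
    constructor
    · show _ < ‖Φ x‖; rw [(h2 x).2]; exact this.1
    · show ‖Φ x‖ < _; rw [(h2 x).2]; exact this.2
  exact (S.c2 _ hD).comp x h1

lemma tr_c1 (S : Sol e (a ^ 2 / 2) (b ^ 2 / 2) lam p v E) (he : ‖e‖ = 1) (hf : ‖f‖ = 1) (hef : inner ℝ e f = (0 : ℝ)) (L : EuclideanSpace ℝ (Fin m) →ₗᵢ[ℝ] F) (hL : ∀ y, inner ℝ e (L y) = (0 : ℝ))
    (ha : 0 < a) (hab : a < b) : ContDiffOn ℝ 1 (fun x => v (ZZ e f x)) (closure (Ann m a b)) := by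
  intro x hx
  obtain ⟨U, hU, hvU⟩ := S.rep
  have hcl : ∀ y ∈ closure (Ann m a b), a ^ 2 / 2 ≤ ‖ZZ e f y‖ ∧ ‖ZZ e f y‖ ≤ b ^ 2 / 2 := fun y hy => by
    obtain ⟨g1, g2⟩ := Ann_cl hy
    rw [ZZ_norm he hf hef, ← pnorm_sq]
    have := pow_le_pow_left₀ ha.le g1 2
    have := pow_le_pow_left₀ (pnorm_nn y) g2 2
    constructor <;> linarith
  obtain ⟨Φ, h1, h2⟩ := exPhi he hf hef L hL (pnorm_ne (ha.trans_le (Ann_cl hx).1))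
  have h0 : Φ x ≠ 0 := norm_pos_iff.1 (by rw [(h2 x).2]; exact lt_of_lt_of_le (by positivity) (hcl x hx).1)
  have h3 : ContDiffAt ℝ 1 (fun x => U (Φ x)) x := (hU _ h0).comp x (h1.of_le (by norm_num))
  have h4 : ∀ y ∈ closure (Ann m a b), v (ZZ e f y) = U (Φ y) := fun y hy => by
    rw [orb S.adm.cls (h2 y).1.symm (h2 y).2.symm]
    exact hvU _ (by rw [(h2 y).2]; exact hcl y hy)
  exact h3.contDiffWithinAt.congr h4 (h4 x hx)

lemma tr_eq0 (S : Sol e (a ^ 2 / 2) (b ^ 2 / 2) lam p v E) (hN : finrank ℝ F = m + 1) (he : ‖e‖ = 1) (hf : ‖f‖ = 1) (hef : inner ℝ e f = (0 : ℝ)) 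
    (ha : 0 < a) (hab : a < b) {x : EuclideanSpace ℝ (Fin m) × EuclideanSpace ℝ (Fin m)} (hx : x ∈ Ann m a b) (h1 : x.1 ≠ 0) (h2 : x.2 ≠ 0) :
    -lapP (fun x => v (ZZ e f x)) x + lam * v (ZZ e f x) = (v (ZZ e f x)) ^ p := by
  have hD := (ZZ_DD he hf hef ha hab x).2 hx
  have hT : 0 < ‖x.1‖ * ‖x.2‖ := mul_pos (norm_pos_iff.2 h1) (norm_pos_iff.2 h2)
  have hv := S.c2 _ hD
  have hl := lapP_axial (u := fun x => v (ZZ e f x)) (V := fun q : ℝ × ℝ => v (q.1 • e + q.2 • f)) h1 h2 (fun y => rfl) rfl rfl (V2_c2 hv rfl)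
  have hl2 := lap_axial S.adm.cls he hf hef hT hv
  have hN' : (finrank ℝ F : ℝ) - 2 = m - 1 := by rw [hN]; push_cast; ring
  rw [hN'] at hl2
  have hq := S.eq _ hD
  have hn := ZZ_norm he hf hef x
  have hr : 0 < ‖x.1‖ ^ 2 + ‖x.2‖ ^ 2 := by have := norm_pos_iff.2 h1; positivity
  have hVV : VV (ZZ e f x) = 1 / (‖x.1‖ ^ 2 + ‖x.2‖ ^ 2) := by unfold VV; rw [hn]; ring_nf
  rw [hVV] at hq
  have hl3 : lapP (fun x => v (ZZ e f x)) x = (‖x.1‖ ^ 2 + ‖x.2‖ ^ 2) * lap v (ZZ e f x) := by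
    rw [hl]; congr 1; exact hl2.symm
  rw [hl3]
  field_simp at hq
  linarith

lemma tr_eq (S : Sol e (a ^ 2 / 2) (b ^ 2 / 2) lam p v E) (hm : 2 ≤ m) (hp : 1 < p) (hN : finrank ℝ F = m + 1) (he : ‖e‖ = 1) (hf : ‖f‖ = 1) (hef : inner ℝ e f = (0 : ℝ)) 
    (L : EuclideanSpace ℝ (Fin m) →ₗᵢ[ℝ] F) (hL : ∀ y, inner ℝ e (L y) = (0 : ℝ)) (ha : 0 < a) (hab : a < b) {x : EuclideanSpace ℝ (Fin m) × EuclideanSpace ℝ (Fin m)} (hx : x ∈ Ann m a b) :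
    -lapP (fun x => v (ZZ e f x)) x + lam * v (ZZ e f x) = (v (ZZ e f x)) ^ p := by
  have hu : ContinuousAt (fun x => v (ZZ e f x)) x := (S.adm.cls.cont.comp ZZ_cont).continuousAt
  have c1 : ContinuousAt (fun x => -lapP (fun x => v (ZZ e f x)) x + lam * v (ZZ e f x)) x :=
    (lapP_cont (tr_c2 S he hf hef L hL ha hab hx)).neg.add (continuousAt_const.mul hu)
  have c2 : ContinuousAt (fun x => (v (ZZ e f x)) ^ p) x := hu.rpow_const (Or.inr (by linarith))
  have : Nonempty (Fin m) := ⟨⟨0, by omega⟩⟩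
  have : Nontrivial (EuclideanSpace ℝ (Fin m)) := inferInstance
  have hd1 : Dense ({0}ᶜ : Set (EuclideanSpace ℝ (Fin m))) := dense_compl_singleton 0
  have hd : Dense (({0}ᶜ : Set (EuclideanSpace ℝ (Fin m))) ×ˢ ({0}ᶜ : Set (EuclideanSpace ℝ (Fin m)))) := hd1.prod hd1
  have hfr := mem_closure_iff_frequently.1 (hd x)
  refine tendsto_nhds_unique_of_frequently_eq c1 c2 ?_
  refine (hfr.and_eventually (Ann_open.mem_nhds hx)).mono ?_
  rintro y ⟨⟨g1, g2⟩, g3⟩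
  exact tr_eq0 S hN he hf hef ha hab g3 g1 g2

end main
end Conc

namespace Conc
open Topology Set Module Metric


section main
variable {m : ℕ}
variable {F : Type} [NormedAddCommGroup F] [InnerProductSpace ℝ F] [FiniteDimensional ℝ F]
variable [MeasurableSpace F] [BorelSpace F]
variable {al be lam p E a b : ℝ} {e f : F} {v : F → ℝ}

lemma pds_le (hm : 2 ≤ m) (ha : 0 < a) (x : EuclideanSpace ℝ (Fin m) × EuclideanSpace ℝ (Fin m)) :
    pdistSet x {x | x.2 = 0 ∧ ‖x.1‖ = a} ≤ √((‖x.1‖ - a) ^ 2 + ‖x.2‖ ^ 2) := by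
  have hbd : BddBelow {d : ℝ | ∃ w ∈ {x : EuclideanSpace ℝ (Fin m) × EuclideanSpace ℝ (Fin m) | x.2 = 0 ∧ ‖x.1‖ = a}, d = pdist x w} :=
    ⟨0, by rintro d ⟨w, -, rfl⟩; exact Real.sqrt_nonneg _⟩
  have : ∃ w1 : EuclideanSpace ℝ (Fin m), ‖w1‖ = a ∧ ‖x.1 - w1‖ ^ 2 = (‖x.1‖ - a) ^ 2 := by
    by_cases h : x.1 = 0
    · refine ⟨EuclideanSpace.single ⟨0, by omega⟩ a, ?_, ?_⟩
      · simp [abs_of_pos ha]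
      · rw [h]; simp
    · have h0 : ‖x.1‖ ≠ 0 := norm_ne_zero_iff.2 h
      refine ⟨(a / ‖x.1‖) • x.1, ?_, ?_⟩
      · rw [norm_smul, Real.norm_of_nonneg (by positivity)]; field_simp
      · have : x.1 - (a / ‖x.1‖) • x.1 = (1 - a / ‖x.1‖) • x.1 := by rw [sub_smul, one_smul]
        rw [this, norm_smul, mul_pow, Real.norm_eq_abs, sq_abs]; field_simp
  obtain ⟨w1, g1, g2⟩ := this
  refine csInf_le hbd ⟨(w1, 0), ⟨rfl, g1⟩, ?_⟩
  unfold pdist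
  simp only [g2, sub_zero]

lemma pds_ZZ (hm : 2 ≤ m) (ha : 0 < a) (he : ‖e‖ = 1) (hf : ‖f‖ = 1) (hef : inner ℝ e f = (0 : ℝ)) (x : EuclideanSpace ℝ (Fin m) × EuclideanSpace ℝ (Fin m)) {δ : ℝ}
    (hδ0 : 0 < δ) (hδ : δ ≤ pdistSet x {x | x.2 = 0 ∧ ‖x.1‖ = a}) : a * δ / 2 ≤ ‖ZZ e f x - (a ^ 2 / 2) • e‖ := by
  have h1 := hδ.trans (pds_le hm ha x)
  have h2 : δ ^ 2 ≤ (‖x.1‖ - a) ^ 2 + ‖x.2‖ ^ 2 := by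
    rw [← Real.sq_sqrt (show 0 ≤ (‖x.1‖ - a) ^ 2 + ‖x.2‖ ^ 2 by positivity)]
    exact pow_le_pow_left₀ hδ0.le h1 2
  refine (pow_le_pow_iff_left₀ (by positivity) (norm_nonneg _) two_ne_zero).1 ?_
  have h3 : ZZ e f x - (a ^ 2 / 2) • e = ((‖x.1‖ ^ 2 - ‖x.2‖ ^ 2) / 2 - a ^ 2 / 2) • e + (‖x.1‖ * ‖x.2‖) • f := by
    unfold ZZ; rw [sub_smul]; abel
  rw [h3, nsq he (by rw [inner_smul_right, hef, mul_zero]), norm_smul, hf, mul_one, Real.norm_eq_abs, sq_abs]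
  have h4 : ((‖x.1‖ ^ 2 - ‖x.2‖ ^ 2) / 2 - a ^ 2 / 2) ^ 2 + (‖x.1‖ * ‖x.2‖) ^ 2 = ((‖x.1‖ - a) ^ 2 + ‖x.2‖ ^ 2) * ((‖x.1‖ + a) ^ 2 + ‖x.2‖ ^ 2) / 4 := by ring
  rw [h4]
  have h5 : a ^ 2 ≤ (‖x.1‖ + a) ^ 2 + ‖x.2‖ ^ 2 := by nlinarith [norm_nonneg x.1, sq_nonneg ‖x.2‖]
  have := mul_le_mul h2 h5 (by positivity) (by positivity)
  nlinarith

/-- surjectivity of the reduction on invariants -/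
lemma ZZ_surj (hm : 2 ≤ m) (he : ‖e‖ = 1) (hf : ‖f‖ = 1) (hef : inner ℝ e f = (0 : ℝ)) (z : F) :
    ∃ x : EuclideanSpace ℝ (Fin m) × EuclideanSpace ℝ (Fin m), (inner ℝ e (ZZ e f x) : ℝ) = inner ℝ e z ∧ ‖ZZ e f x‖ = ‖z‖ := by
  have h := abs_le.1 (abs_real_inner_le_norm e z)
  rw [he, one_mul] at h
  have q1 := Real.sq_sqrt (show 0 ≤ ‖z‖ + inner ℝ e z by linarith)
  have q2 := Real.sq_sqrt (show 0 ≤ ‖z‖ - inner ℝ e z by linarith)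
  refine ⟨(EuclideanSpace.single ⟨0, by omega⟩ (√(‖z‖ + inner ℝ e z)), EuclideanSpace.single ⟨0, by omega⟩ (√(‖z‖ - inner ℝ e z))), ?_, ?_⟩
  · rw [ZZ_in he hef]; simp [sq_abs]; rw [q1, q2]; ring
  · rw [ZZ_norm he hf hef]; simp [sq_abs]; rw [q1, q2]; ring

lemma exL (hN : finrank ℝ F = m + 1) (he : ‖e‖ = 1) : ∃ L : EuclideanSpace ℝ (Fin m) →ₗᵢ[ℝ] F, ∀ y, inner ℝ e (L y) = (0 : ℝ) := by
  have he0 : e ≠ 0 := norm_ne_zero_iff.1 (by rw [he]; norm_num)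
  have : Fact (finrank ℝ F = m + 1) := ⟨hN⟩
  let R := (OrthonormalBasis.fromOrthogonalSpanSingleton (𝕜 := ℝ) m he0).repr.symm
  refine ⟨(Submodule.subtypeₗᵢ (ℝ ∙ e)ᗮ).comp R.toLinearIsometry, fun y => ?_⟩
  exact Submodule.mem_orthogonal_singleton_iff_inner_right.1 (R y).2

theorem final (m : ℕ) (hm : 2 ≤ m) (a b : ℝ) (ha : 0 < a) (hab : a < b)
    (p : ℝ) (hp : 1 < p) (hp' : p < ((m : ℝ) + 3) / ((m : ℝ) - 1)) :
    ∃ u : ℝ → (EuclideanSpace ℝ (Fin m) × EuclideanSpace ℝ (Fin m) → ℝ),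
      ∀ Γ : Set (EuclideanSpace ℝ (Fin m) × EuclideanSpace ℝ (Fin m)),
        Γ = {x | x.2 = 0 ∧ ‖x.1‖ = a} →
      (∀ lam > (0 : ℝ),
        ContDiffOn ℝ 2 (u lam) (Ann m a b) ∧
        ContDiffOn ℝ 1 (u lam) (closure (Ann m a b)) ∧
        (∀ x ∈ Ann m a b,
          -lapP (u lam) x + lam * u lam x = |u lam x| ^ (p - 1) * u lam x) ∧
        (∀ x ∈ frontier (Ann m a b), u lam x = 0) ∧
        (∀ x ∈ Ann m a b, 0 < u lam x) ∧
        (∀ x ∈ closure (Ann m a b), ∀ x' ∈ closure (Ann m a b),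
          ‖x.1‖ = ‖x'.1‖ → ‖x.2‖ = ‖x'.2‖ → u lam x = u lam x')) ∧
      (∀ δ > (0 : ℝ), ∀ ε > (0 : ℝ), ∃ Λ : ℝ, ∀ lam > Λ, ∀ x ∈ closure (Ann m a b),
        δ ≤ pdistSet x Γ → u lam x < ε) ∧
      (∀ ε > (0 : ℝ), ∃ Λ : ℝ, ∀ lam > Λ, ∀ x ∈ closure (Ann m a b),
        (∀ x' ∈ closure (Ann m a b), u lam x' ≤ u lam x) → pdistSet x Γ < ε) := by
  let F := EuclideanSpace ℝ (Fin (m + 1))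
  have hN : finrank ℝ F = m + 1 := by simp [F]
  have hN3 : 3 ≤ finrank ℝ F := by omega
  have hal : 0 < a ^ 2 / 2 := by positivity
  have habe : a ^ 2 / 2 < b ^ 2 / 2 := by
    have := pow_lt_pow_left₀ hab ha.le two_ne_zero
    linarith
  have hmr : (2 : ℝ) ≤ m := by exact_mod_cast hm
  have hθ : (p - 1) * ((finrank ℝ F : ℝ) / 2) < p + 1 := by
    rw [lt_div_iff₀ (by linarith)] at hp'
    rw [hN]; push_cast; nlinarith
  let e0 : F := EuclideanSpace.single 0 1
  have he0 : ‖e0‖ = 1 := by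
    show ‖(EuclideanSpace.single 0 1 : EuclideanSpace ℝ (Fin (m + 1)))‖ = 1
    rw [EuclideanSpace.norm_single, norm_one]
  obtain ⟨f, -, hf, -, hef0, -, -⟩ := perp2 hN3 he0
  obtain ⟨L, hL0⟩ := exL (m := m) hN he0
  have hex : ∀ lam : ℝ, ∃ (e : F) (v : F → ℝ) (E : ℝ) (x0 : F), (e = e0 ∨ e = -e0) ∧ (0 < lam → Sol e (a ^ 2 / 2) (b ^ 2 / 2) lam p v E ∧
      x0 ∈ DD F (a ^ 2 / 2) (b ^ 2 / 2) ∧ (∀ x, v x ≤ v x0) ∧ 0 ≤ (inner ℝ e x0 : ℝ)) := fun lam => by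
    by_cases hlam : 0 < lam
    · obtain ⟨v, E, S⟩ := sol_exists hN3 hal habe hlam hp hθ e0
      obtain ⟨z, hz⟩ := DD_nonempty (F := F) hN3 hal habe
      obtain ⟨x0, g1, -, g3⟩ := max_pt hN3 hal habe S.adm ⟨z, hz, S.pos z hz⟩
      rcases le_or_gt 0 (inner ℝ e0 x0 : ℝ) with h | h
      · exact ⟨e0, v, E, x0, Or.inl rfl, fun _ => ⟨S, g1, g3, h⟩⟩
      · exact ⟨-e0, v, E, x0, Or.inr rfl, fun _ => ⟨S.neg, g1, g3, by rw [inner_neg_left]; linarith⟩⟩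
    · exact ⟨e0, 0, 0, 0, Or.inl rfl, fun h => absurd h hlam⟩
  choose e v E x0 hee hS using hex
  have he : ∀ lam, ‖e lam‖ = 1 := fun lam => by rcases hee lam with h | h <;> simp only [h, norm_neg, he0]
  have hef : ∀ lam, inner ℝ (e lam) f = (0 : ℝ) := fun lam => by rcases hee lam with h | h <;> simp only [h, inner_neg_left, hef0, neg_zero]
  have hL : ∀ lam y, inner ℝ (e lam) (L y) = (0 : ℝ) := fun lam y => by rcases hee lam with h | h <;> simp only [h, inner_neg_left, hL0, neg_zero]
  refine ⟨fun lam x => v lam (ZZ (e lam) f x), ?_⟩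
  rintro Γ rfl
  have hzero : ∀ lam > 0, ∀ x, x ∉ Ann m a b → v lam (ZZ (e lam) f x) = 0 := fun lam hl x hx =>
    (hS lam hl).1.adm.cls.zero _ (fun h => hx ((ZZ_DD (he lam) hf (hef lam) ha hab x).1 h))
  have hposA : ∀ lam > 0, ∀ x ∈ Ann m a b, 0 < v lam (ZZ (e lam) f x) := fun lam hl x hx =>
    (hS lam hl).1.pos _ ((ZZ_DD (he lam) hf (hef lam) ha hab x).2 hx)
  have part2 : ∀ δ > (0 : ℝ), ∀ ε > (0 : ℝ), ∃ Λ : ℝ, 1 ≤ Λ ∧ ∀ lam > Λ, ∀ x : EuclideanSpace ℝ (Fin m) × EuclideanSpace ℝ (Fin m),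
        δ ≤ pdistSet x {x | x.2 = 0 ∧ ‖x.1‖ = a} → v lam (ZZ (e lam) f x) < ε := by
    intro δ hδ ε hε
    have hδ' : 0 < a * δ / 2 := by positivity
    obtain ⟨Λ1, g1, k1⟩ := conc hN3 hal habe hp hθ he0 hδ' hε
    obtain ⟨Λ2, g2, k2⟩ := conc hN3 hal habe hp hθ (e := -e0) (by rw [norm_neg, he0]) hδ' hε
    refine ⟨max Λ1 Λ2, g1.trans (le_max_left _ _), fun lam hlam x hx => ?_⟩
    have hl1 : Λ1 ≤ lam := (le_max_left _ _).trans hlam.le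
    have hl2 : Λ2 ≤ lam := (le_max_right _ _).trans hlam.le
    obtain ⟨s1, s2, s3, s4⟩ := hS lam (by linarith)
    have hd := pds_ZZ hm ha (he lam) hf (hef lam) x hδ hx
    rcases hee lam with h | h
    · rw [h] at s1 s4 hd ⊢
      exact k1 lam hl1 _ _ s1 _ s2 s3 s4 _ hd
    · rw [h] at s1 s4 hd ⊢
      exact k2 lam hl2 _ _ s1 _ s2 s3 s4 _ hd
  refine ⟨fun lam hl => ⟨?_, ?_, ?_, ?_, hposA lam hl, ?_⟩, ?_, ?_⟩
  · exact fun x hx => (tr_c2 (hS lam hl).1 (he lam) hf (hef lam) L (hL lam) ha hab hx).contDiffWithinAt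
  · exact tr_c1 (hS lam hl).1 (he lam) hf (hef lam) L (hL lam) ha hab
  · intro x hx
    have h1 := tr_eq (hS lam hl).1 hm hp hN (he lam) hf (hef lam) L (hL lam) ha hab hx
    have h2 := hposA lam hl x hx
    show -lapP (fun x => v lam (ZZ (e lam) f x)) x + lam * v lam (ZZ (e lam) f x) = |v lam (ZZ (e lam) f x)| ^ (p - 1) * v lam (ZZ (e lam) f x)
    rw [h1, abs_of_pos h2, ← rpow_add_one h2.ne', sub_add_cancel]
  · intro x hx
    refine hzero lam hl x ?_
    rw [Ann_open.frontier_eq] at hx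
    exact hx.2
  · intro x _ x' _ h1 h2
    show v lam (ZZ (e lam) f x) = v lam (ZZ (e lam) f x')
    unfold ZZ; rw [h1, h2]
  · intro δ hδ ε hε
    obtain ⟨Λ, -, h⟩ := part2 δ hδ ε hε
    exact ⟨Λ, fun lam hl x _ => h lam hl x⟩
  · intro ε hε
    obtain ⟨Λ, hΛ, h⟩ := part2 ε hε 1 one_pos
    refine ⟨Λ, fun lam hl x _ hmax => ?_⟩
    by_contra hcon
    have hlt := h lam hl x (not_lt.1 hcon)
    have hl0 : 0 < lam := by linarith
    obtain ⟨s1, s2, s3, s4⟩ := hS lam hl0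
    obtain ⟨X, g1, g2⟩ := ZZ_surj hm (he lam) hf (hef lam) (x0 lam)
    have hXA : X ∈ Ann m a b := by
      rw [← ZZ_DD (he lam) hf (hef lam) ha hab X]
      constructor
      · show _ < ‖ZZ (e lam) f X‖; rw [g2]; exact s2.1
      · show ‖ZZ (e lam) f X‖ < _; rw [g2]; exact s2.2
    have hX := hmax X (subset_closure hXA)
    have hX' : v lam (ZZ (e lam) f X) = v lam (x0 lam) := orb s1.adm.cls g1 g2
    have hlo := max_lo s1 hal hp hl0 s2 s3
    have h1 : (1 : ℝ) ≤ lam ^ (1 / (p - 1)) := Real.one_le_rpow (by linarith) (by have : 0 < p - 1 := by linarith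
                                                                                  positivity)
    have hX2 : v lam (ZZ (e lam) f X) ≤ v lam (ZZ (e lam) f x) := hX
    linarith

end main
end Conc

/-- for `1 < p < (m+3)/(m−1)` there is a family `(u_λ)` of positive
`O(m)×O(m)`-invariant classical solutions of `−Δu + λu = |u|^{p−1}u` in `A`, `u = 0` on `∂A`,
concentrating as `λ → ∞` on the `(m−1)`-dimensional sphere
`Γ = {(y₁,0) : |y₁| = a}` contained in the inner boundary. -/
theorem stmt_13 (m : ℕ) (hm : 2 ≤ m) (a b : ℝ) (ha : 0 < a) (hab : a < b)
    (p : ℝ) (hp : 1 < p) (hp' : p < ((m : ℝ) + 3) / ((m : ℝ) - 1)) :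
    ∃ u : ℝ → (EuclideanSpace ℝ (Fin m) × EuclideanSpace ℝ (Fin m) → ℝ),
      ∀ Γ : Set (EuclideanSpace ℝ (Fin m) × EuclideanSpace ℝ (Fin m)),
        Γ = {x | x.2 = 0 ∧ ‖x.1‖ = a} →
      (∀ lam > (0 : ℝ),
        ContDiffOn ℝ 2 (u lam) (Ann m a b) ∧
        ContDiffOn ℝ 1 (u lam) (closure (Ann m a b)) ∧
        (∀ x ∈ Ann m a b,
          -lapP (u lam) x + lam * u lam x = |u lam x| ^ (p - 1) * u lam x) ∧
        (∀ x ∈ frontier (Ann m a b), u lam x = 0) ∧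
        (∀ x ∈ Ann m a b, 0 < u lam x) ∧
        (∀ x ∈ closure (Ann m a b), ∀ x' ∈ closure (Ann m a b),
          ‖x.1‖ = ‖x'.1‖ → ‖x.2‖ = ‖x'.2‖ → u lam x = u lam x')) ∧
      (∀ δ > (0 : ℝ), ∀ ε > (0 : ℝ), ∃ Λ : ℝ, ∀ lam > Λ, ∀ x ∈ closure (Ann m a b),
        δ ≤ pdistSet x Γ → u lam x < ε) ∧
      (∀ ε > (0 : ℝ), ∃ Λ : ℝ, ∀ lam > Λ, ∀ x ∈ closure (Ann m a b),
        (∀ x' ∈ closure (Ann m a b), u lam x' ≤ u lam x) → pdistSet x Γ < ε) := by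
  exact Conc.final m hm a b ha hab p hp hp'
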